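/- Let G = (I, J, {A_i}, {B_j}, μ, V) be a nonlocal game and G^orac its oracularisation. If c is a commuting operator correlation for G^orac with w_{G^orac}(c) ≥ 1 − ε, then there exists a tracial correlation c′ for G^orac — i.e. a complex Hilbert space K, a unit vector ξ, and PVMs of orthogonal projections indexed by the questions and answers of G^orac on K with ⟨ξ, x y ξ⟩ = ⟨ξ, y x ξ⟩ for all x, y in the unital *-subalgebra they generate, realizing c′ as c′((a,b),c|(i,j),k) = ⟨ξ, r^{(i,j)}_{(a,b)} r^k_c ξ⟩ — such that w_{G^orac}(c′) ≥ 1 − 177ε^{1/4}. If c is a quantum correlation, then c′ can be chosen finite-dimensional (projections in M_n(ℂ) with a tracial state Tr(σ ·)). -/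

import Mathlib

open scoped Classical ComplexOrder Kronecker Matrix

/-- Bob's answer type in the oracularisation: `A i` for question `inl i`, `B j` for
question `inr j`. -/
@[reducible] def OAns {I J : Type} (A : I → Type) (B : J → Type) : I ⊕ J → Type :=
  Sum.elim A B

instance {I J : Type} (A : I → Type) (B : J → Type)
    [∀ i, Fintype (A i)] [∀ j, Fintype (B j)] : ∀ k, Fintype (OAns A B k)
  | .inl i => inferInstanceAs (Fintype (A i))
  | .inr j => inferInstanceAs (Fintype (B j))

instance {I J : Type} (A : I → Type) (B : J → Type)
    [∀ i, Nonempty (A i)] [∀ j, Nonempty (B j)] : ∀ k, Nonempty (OAns A B k)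
  | .inl i => inferInstanceAs (Nonempty (A i))
  | .inr j => inferInstanceAs (Nonempty (B j))

/-- The winning probability of a correlation in the oracularisation `G^orac` of the
nonlocal game `G = (I, J, A, B, μ, V)`: Alice gets `(i,j)` and answers `(a,b)`; Bob gets
`i` or `j` (each with probability `μ(i,j)/2`) and must answer consistently with Alice,
whose answer must satisfy `V`. -/
noncomputable def oracWin {I J : Type} [Fintype I] [Fintype J]
    {A : I → Type} [∀ i, Fintype (A i)] {B : J → Type} [∀ j, Fintype (B j)]
    (μ : I → J → ℝ) (V : ∀ i j, A i → B j → Prop)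
    (c : ∀ (q : I × J) (k : I ⊕ J), (A q.1 × B q.2) → OAns A B k → ℝ) : ℝ :=
  ∑ i, ∑ j, (μ i j / 2) *
    ∑ a, ∑ b, if V i j a b
      then c (i, j) (Sum.inl i) (a, b) a + c (i, j) (Sum.inr j) (a, b) b
      else 0

section TracialRounding
open scoped InnerProductSpace

section Util
variable {H : Type*} [NormedAddCommGroup H] [InnerProductSpace ℂ H] [CompleteSpace H]

theorem inner_apply_eq_star (x : H →L[ℂ] H) (u w : H) : ⟪x u, w⟫_ℂ = ⟪u, star x w⟫_ℂ :=
  (ContinuousLinearMap.adjoint_inner_right x u w).symm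

theorem inner_apply_of_isSelfAdjoint {x : H →L[ℂ] H} (hx : IsSelfAdjoint x) (u w : H) :
    ⟪x u, w⟫_ℂ = ⟪u, x w⟫_ℂ := by
  rw [inner_apply_eq_star, hx.star_eq]

theorem commute_starProjection_of_invariant (U : Submodule ℂ H) [U.HasOrthogonalProjection]
    (c : H →L[ℂ] H) (h : ∀ v ∈ U, c v ∈ U) (h' : ∀ v ∈ U, star c v ∈ U) :
    Commute c U.starProjection := by
  ext v
  simp only [mul_apply_eq_comp]
  symm
  apply Submodule.eq_starProjection_of_mem_of_inner_eq_zero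
  · exact h _ (Submodule.starProjection_apply_mem _ _)
  · intro w hw
    rw [← map_sub, ← ContinuousLinearMap.adjoint_inner_right]
    exact Submodule.starProjection_inner_eq_zero _ _ (h' w hw)

theorem mapsTo_topologicalClosure {E F : Type*} [NormedAddCommGroup E] [NormedSpace ℂ E]
    [NormedAddCommGroup F] [NormedSpace ℂ F] (c : E →L[ℂ] F) (U : Submodule ℂ E)
    (W : Submodule ℂ F) (h : ∀ v ∈ U, c v ∈ W) :
    ∀ v ∈ U.topologicalClosure, c v ∈ W.topologicalClosure := by
  intro v hv
  exact map_mem_closure c.continuous hv h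

theorem commute_star_of_isSelfAdjoint {R : Type*} [Mul R] [StarMul R] {x y : R}
    (hx : IsSelfAdjoint x) (h : Commute x y) : Commute x (star y) := by
  have := h.star_star
  rwa [hx.star_eq] at this

/-- Projection onto the closed range of a selfadjoint operator. -/
theorem exists_threshold (x : H →L[ℂ] H) (hx : IsSelfAdjoint x) :
    ∃ q : H →L[ℂ] H, IsStarProjection q ∧ (∀ y, Commute x y → Commute q y) ∧
      0 ≤ x * q ∧ x * (1 - q) ≤ 0 := by
  set U : Submodule ℂ H := (LinearMap.range (x⁺ : H →L[ℂ] H).toLinearMap).topologicalClosure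
    with hU
  have : CompleteSpace U := by
    rw [hU]; exact (Submodule.isClosed_topologicalClosure _).completeSpace_coe
  have hcomm : ∀ y, Commute x y → Commute U.starProjection y := by
    intro y hy
    have key : ∀ z, Commute x z → ∀ v ∈ U, z v ∈ U := by
      intro z hz
      apply mapsTo_topologicalClosure
      rintro _ ⟨w, rfl⟩
      have : Commute (x⁺) z := by rw [CFC.posPart_def]; exact hz.cfcₙ_real _
      exact ⟨z w, DFunLike.congr_fun this.eq w⟩
    exact (commute_starProjection_of_invariant U y (key y hy)
      (key _ (commute_star_of_isSelfAdjoint hx hy))).symm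
  have h1 : U.starProjection * x⁺ = x⁺ := by
    ext v
    exact Submodule.starProjection_eq_self_iff.2 (subset_closure ⟨v, rfl⟩)
  have hs : IsStarProjection U.starProjection := isStarProjection_starProjection
  have h1' : x⁺ * U.starProjection = x⁺ := by
    have := congrArg star h1
    rwa [star_mul, hs.isSelfAdjoint.star_eq,
      (IsSelfAdjoint.of_nonneg (CFC.posPart_nonneg x)).star_eq] at this
  have h2 : x⁻ * U.starProjection = 0 := by
    ext v
    have : ∀ w ∈ U, x⁻ w ∈ (⊥ : Submodule ℂ H).topologicalClosure := by
      apply mapsTo_topologicalClosure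
      rintro _ ⟨w, rfl⟩
      exact DFunLike.congr_fun (CFC.negPart_mul_posPart x) w
    simpa [(isClosed_singleton (x := (0:H))).submodule_topologicalClosure_eq (s := ⊥)]
      using this _ (Submodule.starProjection_apply_mem U v)
  have h3 := CFC.posPart_sub_negPart x hx
  have h4 : x * U.starProjection = x⁺ := by
    conv_lhs => rw [← h3]
    rw [sub_mul, h1', h2, sub_zero]
  refine ⟨U.starProjection, hs, hcomm, ?_, ?_⟩
  · rw [h4]; exact CFC.posPart_nonneg x
  · rw [mul_sub, h4, mul_one]
    nth_rewrite 1 [← h3]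
    simpa using CFC.negPart_nonneg x

theorem norm_apply_le_of_form (x : H →L[ℂ] H) (hx : IsSelfAdjoint x) (h : ℝ) (hh : 0 < h)
    (h1 : 0 ≤ (h : ℂ) • 1 + x) (h2 : 0 ≤ (h : ℂ) • 1 - x) (v : H) : ‖x v‖ ≤ h * ‖v‖ := by
  have e1 := ((ContinuousLinearMap.nonneg_iff_isPositive _).1 h2).re_inner_nonneg_left
    (((h : ℂ) • 1 + x) v)
  have e2 := ((ContinuousLinearMap.nonneg_iff_isPositive _).1 h1).re_inner_nonneg_left
    (((h : ℂ) • 1 - x) v)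
  have hs := inner_apply_of_isSelfAdjoint hx
  have hc : (⟪x v, v⟫_ℂ).re = (⟪v, x v⟫_ℂ).re := by rw [hs]
  have n1 : (⟪v, v⟫_ℂ).re = ‖v‖ ^ 2 := by rw [inner_self_eq_norm_sq_to_K]; norm_cast
  have n2 : (⟪x v, x v⟫_ℂ).re = ‖x v‖ ^ 2 := by rw [inner_self_eq_norm_sq_to_K]; norm_cast
  have n3 : (⟪x (x v), v⟫_ℂ).re = ‖x v‖ ^ 2 := by rw [hs, n2]
  have n4 : (⟪x (x v), x v⟫_ℂ).re = (⟪x v, x (x v)⟫_ℂ).re := by rw [hs]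
  simp only [sub_apply, add_apply,
    smul_apply, one_apply_eq_self, map_add, map_sub, map_smul,
    inner_add_left, inner_add_right, inner_sub_left, inner_sub_right, inner_smul_left,
    inner_smul_right, smul_add, smul_sub, RCLike.re_to_complex, Complex.add_re, Complex.sub_re,
    Complex.conj_ofReal, Complex.re_ofReal_mul, n1, n2, n3, hc] at e1 e2
  have : 0 ≤ h * (h^2 * ‖v‖ ^ 2 - ‖x v‖ ^ 2) := by nlinarith
  have := (mul_nonneg_iff_of_pos_left hh).1 this
  refine abs_le_of_sq_le_sq' ?_ (by positivity) |>.2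
  nlinarith

theorem IsStarProjection.mul_of_commute {p q : H →L[ℂ] H} (hp : IsStarProjection p)
    (hq : IsStarProjection q) (h : Commute p q) : IsStarProjection (p * q) :=
  ⟨hp.isIdempotentElem.mul_of_commute h hq.isIdempotentElem, by
    rw [IsSelfAdjoint, star_mul, hp.isSelfAdjoint.star_eq, hq.isSelfAdjoint.star_eq]
    exact h.eq.symm⟩

end Util

section SimpleApprox
variable {H : Type*} [NormedAddCommGroup H] [InnerProductSpace ℂ H] [CompleteSpace H]

theorem mul_proj_nonneg {X p : H →L[ℂ] H} (hX : 0 ≤ X) (hp : IsStarProjection p)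
    (h : Commute X p) : 0 ≤ X * p := by
  have : X * p = star p * X * p := by
    rw [hp.isSelfAdjoint.star_eq, ← h.eq, mul_assoc, hp.isIdempotentElem.eq]
  rw [this]
  exact star_left_conjugate_nonneg hX p

/-- A finite family of spectral projections of `A` on each of which `A` is within `h` of a
scalar. -/
structure SpecFamily (A : H →L[ℂ] H) (h : ℝ) where
  ι : Type
  fin : Fintype ι
  p : ι → H →L[ℂ] H
  a : ι → ℝ
  proj : ∀ i, IsStarProjection (p i)
  ortho : ∀ i j, i ≠ j → p i * p j = 0
  sum : ∑ i, p i = 1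
  le_a : ∀ i, h ≤ a i
  a_le : ∀ i, a i + h ≤ 1
  comm : ∀ i y, Commute A y → Commute (p i) y
  lo : ∀ i, 0 ≤ (A - ((a i - h : ℝ) : ℂ) • 1) * p i
  hi : ∀ i, 0 ≤ (((a i + h : ℝ) : ℂ) • 1 - A) * p i

attribute [instance] SpecFamily.fin

namespace SpecFamily
variable {A : H →L[ℂ] H} {h : ℝ}

theorem commute_A (S : SpecFamily A h) (i : S.ι) : Commute A (S.p i) := (S.comm i A rfl).symm

theorem near (S : SpecFamily A h) (hA : IsSelfAdjoint A) (hh : 0 < h) (i : S.ι) (v : H) :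
    ‖A (S.p i v) - (S.a i : ℂ) • S.p i v‖ ≤ h * ‖S.p i v‖ := by
  have hp := S.proj i
  have hc := S.commute_A i
  set x := (A - (S.a i : ℂ) • 1) * S.p i with hx
  have hxs : IsSelfAdjoint x := by
    rw [isSelfAdjoint_iff, hx, star_mul, hp.isSelfAdjoint.star_eq, star_sub, hA.star_eq, star_smul,
      star_one, RCLike.star_def, Complex.conj_ofReal]
    exact ((hc.sub_left ((Commute.one_left _).smul_left _)).eq).symm
  have hq : (0 : H →L[ℂ] H) ≤ (h : ℂ) • (1 - S.p i) := by
    rw [ContinuousLinearMap.nonneg_iff_isPositive]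
    exact (ContinuousLinearMap.IsPositive.of_isStarProjection hp.one_sub).smul_of_nonneg
      (by exact_mod_cast hh.le)
  have key := norm_apply_le_of_form x hxs h hh ?_ ?_ (S.p i v)
  · have e : x (S.p i v) = A (S.p i v) - (S.a i : ℂ) • S.p i v := by
      have := DFunLike.congr_fun hp.isIdempotentElem.eq v
      simp only [mul_apply_eq_comp] at this
      simp [hx, this]
    rwa [e] at key
  · have := add_nonneg (S.lo i) hq
    convert this using 1
    rw [hx]; push_cast; simp only [sub_mul, smul_mul_assoc, one_mul, smul_sub, sub_smul]; abel
  · have := add_nonneg (S.hi i) hq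
    convert this using 1
    rw [hx]; push_cast; simp only [sub_mul, add_mul, smul_mul_assoc, one_mul, smul_sub, add_smul]; abel

theorem bisect (S : SpecFamily A h) (hA : IsSelfAdjoint A) (hh : 0 < h) :
    Nonempty (SpecFamily A (h / 2)) := by
  obtain ⟨ι, _, p, a, hp, ho, hs, ha, ha', hc, hlo, hhi⟩ := S
  have hAa : ∀ c : ℝ, IsSelfAdjoint (A - (c : ℂ) • 1) := fun c =>
    hA.sub (by simp [isSelfAdjoint_iff, star_smul])
  choose q hq hqc hq0 hq1 using fun i => exists_threshold (A - (a i : ℂ) • 1) (hAa (a i))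
  have hqA : ∀ i y, Commute A y → Commute (q i) y := fun i y hy =>
    hqc i y (hy.sub_left ((Commute.one_left y).smul_left _))
  have hpA : ∀ i, Commute A (p i) := fun i => (hc i A rfl).symm
  have hlin : ∀ (c : ℝ) y, Commute A y → Commute (A - (c : ℂ) • 1) y :=
    fun c y hy => hy.sub_left ((Commute.one_left _).smul_left _)
  have hlin' : ∀ (c : ℝ) y, Commute A y → Commute ((c : ℂ) • 1 - A) y :=
    fun c y hy => ((Commute.one_left _).smul_left _).sub_left hy
  let r : ι × Bool → H →L[ℂ] H := fun x => if x.2 then q x.1 else 1 - q x.1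
  have hr : ∀ x, IsStarProjection (r x) := by
    rintro ⟨i, _ | _⟩
    · exact (hq i).one_sub
    · exact hq i
  have hrA : ∀ x y, Commute A y → Commute (r x) y := by
    rintro ⟨i, _ | _⟩ y hy
    · exact (Commute.one_left y).sub_left (hqA i y hy)
    · exact hqA i y hy
  have hrAA : ∀ x, Commute A (r x) := fun x => (hrA x A rfl).symm
  have hrp : ∀ x i, Commute (r x) (p i) := fun x i => hrA x _ (hpA i)
  refine ⟨⟨ι × Bool, inferInstance, fun x => p x.1 * r x,
    fun x => if x.2 then a x.1 + h / 2 else a x.1 - h / 2, ?_, ?_, ?_, ?_, ?_, ?_, ?_, ?_⟩⟩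
  · intro x
    exact (hp x.1).mul_of_commute (hr x) (hrp x x.1).symm
  · rintro ⟨i, b⟩ ⟨j, c⟩ hne
    have e : p i * r (i, b) * (p j * r (j, c)) = p i * p j * (r (i, b) * r (j, c)) := by
      rw [mul_assoc, ← mul_assoc (r (i, b)), (hrp (i, b) j).eq]; simp only [mul_assoc]
    simp only [e]
    by_cases hij : i = j
    · subst hij
      have : r (i, b) * r (i, c) = 0 := by
        have h2 := (hq i).isIdempotentElem.eq
        cases b <;> cases c <;> simp [r, mul_sub, sub_mul, h2] at hne ⊢
      rw [this, mul_zero]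
    · rw [ho i j hij, zero_mul]
  · rw [Fintype.sum_prod_type, ← hs]
    refine Finset.sum_congr rfl fun i _ => ?_
    simp [r, ← mul_add]
  · rintro ⟨i, _ | _⟩ <;> have := ha i <;> simp <;> linarith
  · rintro ⟨i, _ | _⟩ <;> have := ha' i <;> simp <;> linarith
  · intro x y hy
    exact (hc x.1 y hy).mul_left (hrA x y hy)
  · rintro ⟨i, _ | _⟩
    · have := mul_proj_nonneg (hlo i) (hr (i, false))
        ((hlin _ _ (hrAA _)).mul_left (hrp _ _).symm)
      rw [mul_assoc] at this
      convert this using 4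
      simp; ring
    · have := mul_proj_nonneg (hq0 i) (hp i)
        ((hlin _ _ (hpA _)).mul_left (hrp (i, true) _))
      rw [mul_assoc, show q i * p i = _ from (hrp (i, true) i).eq] at this
      convert this using 4
      simp
  · rintro ⟨i, _ | _⟩
    · have := mul_proj_nonneg (neg_nonneg.2 (hq1 i)) (hp i)
        (((hlin _ _ (hpA _)).mul_left (hrp (i, false) _)).neg_left)
      rw [← neg_mul, neg_sub, mul_assoc, show (1 - q i) * p i = _ from (hrp (i, false) i).eq] at this
      convert this using 4
      simp
    · have := mul_proj_nonneg (hhi i) (hr (i, true))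
        ((hlin' _ _ (hrAA _)).mul_left (hrp _ _).symm)
      rw [mul_assoc] at this
      convert this using 4
      simp; ring

theorem exists_of_nonneg_le_one (A : H →L[ℂ] H) (h0 : 0 ≤ A) (h1 : A ≤ 1) (n : ℕ) :
    Nonempty (SpecFamily A (2⁻¹ ^ (n + 1))) := by
  have hA : IsSelfAdjoint A := .of_nonneg h0
  induction n with
  | zero =>
    refine ⟨⟨Unit, inferInstance, fun _ => 1, fun _ => 2⁻¹, fun _ => ⟨.one, .one _⟩,
      ?_, ?_, ?_, ?_, ?_, ?_, ?_⟩⟩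
    · intro i j h; exact absurd rfl h
    · simp
    · intro i; norm_num
    · intro i; norm_num
    · intro i y _; exact Commute.one_left y
    · intro i; norm_num; exact h0
    · intro i; norm_num; exact h1
  | succ n ih =>
    obtain ⟨S⟩ := ih
    have := S.bisect hA (by positivity)
    rwa [show (2⁻¹ : ℝ) ^ (n + 1) / 2 = 2⁻¹ ^ (n + 1 + 1) by ring] at this

end SpecFamily
end SimpleApprox

section Douglas
variable {H : Type*} [NormedAddCommGroup H] [InnerProductSpace ℂ H] [CompleteSpace H]

/-- Douglas factorisation. -/
theorem exists_douglas_factor (T h : H →L[ℂ] H) (hT : ∀ v, ‖T v‖ ≤ ‖h v‖) :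
    ∃ w : H →L[ℂ] H, w * h = T ∧ (∀ v, ‖w v‖ ≤ ‖v‖) ∧
      (∀ z, (∀ v, ⟪h v, z⟫_ℂ = 0) → w z = 0) ∧
      ∀ c, Commute c T → Commute c h → Commute (star c) h → Commute c w := by
  set R : Submodule ℂ H := (LinearMap.range h.toLinearMap).topologicalClosure with hR
  have hcs : CompleteSpace R := by
    rw [hR]; exact (Submodule.isClosed_topologicalClosure _).completeSpace_coe
  have hmem : ∀ v, h v ∈ R := fun v => subset_closure ⟨v, rfl⟩
  let e : H →L[ℂ] R := h.codRestrict R hmem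
  have hd : DenseRange e := by
    intro x
    rw [Metric.mem_closure_iff]
    intro δ hδ
    have hx : (x : H) ∈ closure (LinearMap.range h.toLinearMap : Set H) := x.2
    rw [Metric.mem_closure_iff] at hx
    obtain ⟨_, ⟨v, rfl⟩, hv⟩ := hx δ hδ
    exact ⟨e v, ⟨v, rfl⟩, hv⟩
  have hb : ∃ C, ∀ v, ‖T.toLinearMap v‖ ≤ C * ‖e.toLinearMap v‖ := ⟨1, fun v => by
    rw [one_mul]; exact hT v⟩
  let w0 : R →L[ℂ] H := T.toLinearMap.extendOfNorm e.toLinearMap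
  have hw0 : ∀ v, w0 (e v) = T v := fun v => LinearMap.extendOfNorm_eq (e := e.toLinearMap) hd hb v
  have hn0 : ∀ x, ‖w0 x‖ ≤ ‖x‖ := by
    intro x
    refine hd.induction_on x ?_ ?_
    · exact isClosed_le (by fun_prop) (by fun_prop)
    · intro v; rw [hw0]; exact hT v
  let w : H →L[ℂ] H := w0 ∘L R.orthogonalProjectionOnto
  have hwh : ∀ v, w (h v) = T v := by
    intro v
    have : R.orthogonalProjectionOnto (h v) = e v :=
      Submodule.orthogonalProjectionOnto_mem_subspace_eq_self (⟨h v, hmem v⟩ : R)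
    simp [w, this, hw0]
  have hwz : ∀ z, (∀ v, ⟪h v, z⟫_ℂ = 0) → w z = 0 := by
    intro z hz
    have hz' : z ∈ Rᗮ := by
      rw [hR, Submodule.orthogonal_closure]
      rintro _ ⟨v, rfl⟩
      exact hz v
    have : R.orthogonalProjectionOnto z = 0 :=
      Submodule.orthogonalProjectionOnto_eq_zero_iff.2 hz'
    simp [w, this]
  refine ⟨w, by ext v; exact hwh v, fun v => ?_, hwz, ?_⟩
  · exact (hn0 _).trans (R.norm_orthogonalProjectionOnto_apply_le v)
  · intro c h1 h2 h3
    ext v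
    simp only [mul_apply_eq_comp]
    have hv : v = R.starProjection v + (v - R.starProjection v) := by abel
    have hperp : ∀ z, (∀ v, ⟪h v, z⟫_ℂ = 0) → c (w z) = w (c z) := by
      intro z hz
      rw [hwz z hz, map_zero, hwz (c z)]
      intro v
      rw [← inner_conj_symm, inner_apply_eq_star, ← inner_conj_symm]
      have : star c (h v) = h (star c v) := DFunLike.congr_fun h3.eq v
      rw [this, hz]; simp
    have hran : ∀ z ∈ R, c (w z) = w (c z) := by
      intro z hz
      have : closure (LinearMap.range h.toLinearMap : Set H) ⊆ {z | c (w z) = w (c z)} := by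
        apply closure_minimal _ (isClosed_eq (by fun_prop) (by fun_prop))
        rintro _ ⟨v, rfl⟩
        change c (w (h v)) = w (c (h v))
        have e1 : c (h v) = h (c v) := DFunLike.congr_fun h2.eq v
        have e2 : c (T v) = T (c v) := DFunLike.congr_fun h1.eq v
        rw [hwh, e1, hwh, e2]
      exact this hz
    rw [hv, map_add, map_add, map_add, map_add, hran _ (Submodule.starProjection_apply_mem _ _),
      hperp]
    intro u
    rw [inner_sub_right, ← Submodule.inner_starProjection_left_eq_right,
      Submodule.starProjection_eq_self_iff.2 (hmem u), sub_self]

end Douglas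

section Compression
variable {H : Type*} [NormedAddCommGroup H] [InnerProductSpace ℂ H] [CompleteSpace H]
variable (S : Submodule ℂ H) [CompleteSpace S]

/-- The compression of an operator to a closed subspace. -/
noncomputable def compress (x : H →L[ℂ] H) : S →L[ℂ] S :=
  S.orthogonalProjectionOnto ∘L x ∘L S.subtypeL

theorem inner_compress (x : H →L[ℂ] H) (u w : S) :
    ⟪u, compress S x w⟫_ℂ = ⟪(u : H), x w⟫_ℂ := by
  rw [Submodule.coe_inner]
  change ⟪(u : H), S.starProjection (x w)⟫_ℂ = _
  rw [← Submodule.inner_starProjection_left_eq_right,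
    Submodule.starProjection_eq_self_iff.2 u.2]

theorem coe_compress {x : H →L[ℂ] H} (hx : ∀ v ∈ S, x v ∈ S) (v : S) :
    (compress S x v : H) = x v := by
  change S.starProjection (x v) = _
  exact Submodule.starProjection_eq_self_iff.2 (hx v v.2)

theorem compress_sum {ι : Type*} (s : Finset ι) (x : ι → H →L[ℂ] H) :
    compress S (∑ i ∈ s, x i) = ∑ i ∈ s, compress S (x i) := by
  ext v; simp [compress]

@[simp] theorem compress_one : compress S (1 : H →L[ℂ] H) = 1 := by
  ext v; rw [coe_compress] <;> simp

theorem star_compress (x : H →L[ℂ] H) : star (compress S x) = compress S (star x) := by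
  refine ContinuousLinearMap.ext fun v => ext_inner_left ℂ fun u => ?_
  rw [← inner_apply_eq_star, inner_compress, ← inner_apply_eq_star, ← inner_conj_symm,
    inner_compress, inner_conj_symm]

theorem compress_mul_left {x : H →L[ℂ] H} (y : H →L[ℂ] H) (hy : ∀ v ∈ S, y v ∈ S) :
    compress S (x * y) = compress S x * compress S y := by
  refine ContinuousLinearMap.ext fun v => ext_inner_left ℂ fun u => ?_
  rw [inner_compress, mul_apply_eq_comp, mul_apply_eq_comp, inner_compress, coe_compress S hy]

theorem compress_mul_right {x : H →L[ℂ] H} (y : H →L[ℂ] H) (hx : ∀ v ∈ S, star x v ∈ S) :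
    compress S (x * y) = compress S x * compress S y := by
  have := compress_mul_left S (x := star y) (star x) hx
  apply star_injective
  rw [star_mul (compress S x), star_compress, star_compress, star_compress, star_mul, this]

theorem compress_nonneg {x : H →L[ℂ] H} (hx : 0 ≤ x) : 0 ≤ compress S x := by
  rw [ContinuousLinearMap.nonneg_iff_isPositive] at hx ⊢
  exact hx.conj_adjoint S.orthogonalProjectionOnto |> fun h => by
    convert h using 1
    simp [compress, Submodule.adjoint_orthogonalProjectionOnto]

end Compression

section Independent
variable {H : Type*} [NormedAddCommGroup H] [InnerProductSpace ℂ H] [CompleteSpace H]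

theorem exists_independent_subspaces {α : Type*} (R : Set (H →L[ℂ] H))
    (hR : ∀ c ∈ R, star c ∈ R) (V : α → Submodule ℂ H) (hVc : ∀ a, IsClosed (V a : Set H))
    (hV : ∀ a, ∀ c ∈ R, ∀ v ∈ V a, c v ∈ V a) (s : Finset α) :
    ∃ V' : α → Submodule ℂ H, (∀ a, V' a ≤ V a) ∧ (∀ a, IsClosed (V' a : Set H)) ∧
      (∀ a, ∀ c ∈ R, ∀ v ∈ V' a, c v ∈ V' a) ∧
      (∀ f : α → H, (∀ a, f a ∈ V' a) → ∑ a ∈ s, f a = 0 → ∀ a ∈ s, f a = 0) ∧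
      (∀ a ∈ s, V a ≤ (⨆ b ∈ s, V' b).topologicalClosure) := by
  induction s using Finset.induction_on with
  | empty => exact ⟨V, fun a => le_rfl, hVc, hV, by simp, by simp⟩
  | insert j s hj ih =>
    obtain ⟨V', h1, h2, h3, h4, h5⟩ := ih
    set W : Submodule ℂ H := ⨆ b ∈ s, V' b with hW
    have hWinv : ∀ c ∈ R, ∀ v ∈ W, c v ∈ W := by
      intro c hc
      have : W ≤ W.comap c.toLinearMap := by
        conv_lhs => rw [hW]
        refine iSup₂_le fun b hb v hv => ?_
        have : V' b ≤ W := le_iSup₂_of_le b hb le_rfl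
        exact this (h3 b c hc v hv)
      exact fun v hv => this hv
    set U : Submodule ℂ H := V j ⊓ W with hU
    have hUinv : ∀ c ∈ R, ∀ v ∈ U, c v ∈ U := fun c hc v hv =>
      ⟨hV j c hc v hv.1, hWinv c hc v hv.2⟩
    set V'' : α → Submodule ℂ H := Function.update V' j (V j ⊓ Uᗮ) with hV''
    have hne : ∀ b ∈ s, V'' b = V' b := fun b hb => by
      have : b ≠ j := fun h => hj (h ▸ hb)
      rw [hV'', Function.update_of_ne this]
    have hjj : V'' j = V j ⊓ Uᗮ := by rw [hV'', Function.update_self]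
    have hsup : (⨆ b ∈ insert j s, V'' b) = (V j ⊓ Uᗮ) ⊔ W := by
      rw [Finset.iSup_insert, hjj, hW]
      congr 1
      exact iSup_congr fun b => iSup_congr fun hb => hne b hb
    refine ⟨V'', ?_, ?_, ?_, ?_, ?_⟩
    · intro a
      by_cases ha : a = j
      · subst ha; rw [hjj]; exact inf_le_left
      · rw [hV'', Function.update_of_ne ha]; exact h1 a
    · intro a
      by_cases ha : a = j
      · subst ha; rw [hjj]; exact (hVc a).inter (Submodule.isClosed_orthogonal _)
      · rw [hV'', Function.update_of_ne ha]; exact h2 a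
    · intro a c hc v hv
      by_cases ha : a = j
      · subst ha
        rw [hjj] at hv ⊢
        refine ⟨hV a c hc v hv.1, fun u hu => ?_⟩
        have := hv.2 (star c u) (hUinv _ (hR c hc) u hu)
        rwa [inner_apply_eq_star, star_star] at this
      · rw [hV'', Function.update_of_ne ha] at hv ⊢; exact h3 a c hc v hv
    · intro f hf hsum
      rw [Finset.sum_insert hj] at hsum
      have hfj := hf j
      rw [hjj] at hfj
      have hfs : ∀ b ∈ s, f b ∈ V' b := fun b hb => hne b hb ▸ hf b
      have hw : ∑ b ∈ s, f b ∈ W := Submodule.sum_mem _ fun b hb =>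
        (le_iSup₂_of_le (f := fun b (_ : b ∈ s) => V' b) b hb le_rfl) (hfs b hb)
      have hfU : f j ∈ U := ⟨hfj.1, by
        rw [eq_neg_of_add_eq_zero_left hsum]; exact W.neg_mem hw⟩
      have hz : f j = 0 := by
        have := hfj.2 _ hfU
        exact inner_self_eq_zero.1 this
      rw [hz, zero_add] at hsum
      intro a ha
      rcases Finset.mem_insert.1 ha with rfl | ha
      · exact hz
      · have := h4 (fun a => if a ∈ s then f a else 0) (fun a => by
          split_ifs with h
          · exact hfs a h
          · exact zero_mem _) (by rw [← hsum]; exact Finset.sum_congr rfl fun b hb => if_pos hb)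
          a ha
        simpa [ha] using this
    · intro a ha
      rw [hsup]
      rcases Finset.mem_insert.1 ha with rfl | ha
      · intro v hv
        have : CompleteSpace U.topologicalClosure :=
          (Submodule.isClosed_topologicalClosure _).completeSpace_coe
        have e1 : U.topologicalClosure.starProjection v ∈ U.topologicalClosure :=
          Submodule.starProjection_apply_mem _ _
        have e2 : U.topologicalClosure ≤ V a :=
          Submodule.topologicalClosure_minimal _ inf_le_left (hVc a)
        have e3 : v - U.topologicalClosure.starProjection v ∈ V a ⊓ Uᗮ := by
          refine ⟨sub_mem hv (e2 e1), ?_⟩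
          rw [← Submodule.orthogonal_closure]
          exact Submodule.sub_starProjection_mem_orthogonal v
        have e4 : U.topologicalClosure ≤ ((V a ⊓ Uᗮ) ⊔ W).topologicalClosure :=
          Submodule.topologicalClosure_mono (inf_le_right.trans le_sup_right)
        have e5 : V a ⊓ Uᗮ ≤ ((V a ⊓ Uᗮ) ⊔ W).topologicalClosure :=
          le_sup_left.trans (Submodule.le_topologicalClosure _)
        have := add_mem (e5 e3) (e4 e1)
        rwa [sub_add_cancel] at this
      · exact (h5 a ha).trans (Submodule.topologicalClosure_mono le_sup_right)

end Independent

section Polar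
variable {H : Type*} [NormedAddCommGroup H] [InnerProductSpace ℂ H] [CompleteSpace H]

theorem mem_centralizer_iff_commute {R : Set (H →L[ℂ] H)} (hR : ∀ c ∈ R, star c ∈ R)
    {x : H →L[ℂ] H} : x ∈ StarSubalgebra.centralizer ℂ R ↔ ∀ c ∈ R, Commute c x := by
  rw [StarSubalgebra.mem_centralizer_iff]
  exact ⟨fun h c hc => (h c hc).1, fun h c hc => ⟨h c hc, h _ (hR c hc)⟩⟩

theorem inner_nonneg_of_nonneg {x : H →L[ℂ] H} (hx : 0 ≤ x) (v : H) : 0 ≤ (⟪v, x v⟫_ℂ).re :=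
  ((ContinuousLinearMap.nonneg_iff_isPositive _).1 hx).re_inner_nonneg_right v

theorem inner_le_of_le {x y : H →L[ℂ] H} (hx : x ≤ y) (v : H) :
    (⟪v, x v⟫_ℂ).re ≤ (⟪v, y v⟫_ℂ).re := by
  have := inner_nonneg_of_nonneg (sub_nonneg.2 hx) v
  simpa [inner_sub_right] using this

theorem norm_sq_apply (x : H →L[ℂ] H) (v : H) : ‖x v‖ ^ 2 = (⟪v, (star x * x) v⟫_ℂ).re := by
  rw [mul_apply_eq_comp, ← inner_apply_eq_star, inner_self_eq_norm_sq_to_K]; norm_cast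

theorem norm_sq_proj {q : H →L[ℂ] H} (hq : IsStarProjection q) (v : H) :
    ‖q v‖ ^ 2 = (⟪v, q v⟫_ℂ).re := by
  rw [norm_sq_apply, hq.isSelfAdjoint.star_eq, hq.isIdempotentElem.eq]

theorem eq_zero_of_vanish (x h : H →L[ℂ] H) (hh : IsSelfAdjoint h) (h1 : x * h = 0)
    (h2 : ∀ z, (∀ v, ⟪h v, z⟫_ℂ = 0) → x z = 0) : x = 0 := by
  have e : h * star x = 0 := by
    have := congrArg star h1
    rwa [star_mul, hh.star_eq, star_zero] at this
  have : star x = 0 := by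
    ext u
    have h3 : x (star x u) = 0 := h2 _ fun v => by
      rw [inner_apply_of_isSelfAdjoint hh, ← mul_apply_eq_comp, e]; simp
    have : ⟪star x u, star x u⟫_ℂ = 0 := by rw [← inner_apply_eq_star, h3, inner_zero_left]
    simpa using this
  simpa using this

/-- Polar decomposition of a tuple of independent projections in a commutant. -/
theorem exists_polar_of_independent {α : Type*} [Fintype α] (R : Set (H →L[ℂ] H))
    (hR : ∀ c ∈ R, star c ∈ R) (q : α → H →L[ℂ] H) (hq : ∀ a, IsStarProjection (q a))
    (hqR : ∀ a, ∀ c ∈ R, Commute c (q a))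
    (hind : ∀ f : α → H, (∀ a, q a (f a) = f a) → ∑ a, f a = 0 → ∀ a, f a = 0) :
    ∃ (h : H →L[ℂ] H) (w : α → H →L[ℂ] H), 0 ≤ h ∧ h * h = ∑ a, q a ∧
      (∀ c ∈ R, Commute c h) ∧ (∀ a, ∀ c ∈ R, Commute c (w a)) ∧
      (∀ a, w a * h = q a) ∧ (∀ a, w a * star (w a) = q a) ∧ (∀ a, q a * w a = w a) ∧
      (∀ a b, a ≠ b → w a * star (w b) = 0) ∧ (∑ a, star (w a) * w a) * h = h := by
  set G : H →L[ℂ] H := ∑ a, q a with hG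
  have hq0 : ∀ a, 0 ≤ q a := fun a => (hq a).nonneg
  have hG0 : 0 ≤ G := Finset.sum_nonneg fun a _ => hq0 a
  set h : H →L[ℂ] H := CFC.sqrt G with hh
  have hh0 : 0 ≤ h := CFC.sqrt_nonneg G
  have hhs : IsSelfAdjoint h := IsSelfAdjoint.of_nonneg hh0
  have hhh : h * h = G := CFC.sqrt_mul_sqrt_self G hG0
  have hGR : ∀ c ∈ R, Commute c G := fun c hc => Commute.sum_right _ _ _ fun a _ => hqR a c hc
  have hhR : ∀ c ∈ R, Commute c h := fun c hc => by
    rw [hh, CFC.sqrt_eq_real_sqrt G hG0]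
    exact ((hGR c hc).symm.cfcₙ_real _).symm
  have hle : ∀ a v, ‖q a v‖ ≤ ‖h v‖ := by
    intro a v
    refine le_of_sq_le_sq ?_ (norm_nonneg _)
    rw [norm_sq_proj (hq a), norm_sq_apply, hhs.star_eq, hhh]
    exact inner_le_of_le (Finset.single_le_sum (fun a _ => hq0 a) (Finset.mem_univ a)) v
  choose w hw1 hw2 hw3 hw4 using fun a => exists_douglas_factor (q a) h (hle a)
  have hwR : ∀ a, ∀ c ∈ R, Commute c (w a) := fun a c hc =>
    hw4 a c (hqR a c hc) (hhR c hc) (hhR _ (hR c hc))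
  have hstar : ∀ a, h * star (w a) = q a := fun a => by
    have := congrArg star (hw1 a)
    rwa [star_mul, hhs.star_eq, (hq a).isSelfAdjoint.star_eq] at this
  have hqw : ∀ a, q a * w a = w a := by
    intro a
    rw [← sub_eq_zero]
    refine eq_zero_of_vanish _ h hhs ?_ ?_
    · rw [sub_mul, mul_assoc, hw1, (hq a).isIdempotentElem.eq, sub_self]
    · intro z hz
      simp [hw3 a z hz]
  set F : H →L[ℂ] H := ∑ a, star (w a) * w a with hF
  have hFs : IsSelfAdjoint F := by
    rw [isSelfAdjoint_iff, hF, star_sum]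
    exact Finset.sum_congr rfl fun a _ => by rw [star_mul, star_star]
  have hhF : h * F * h = h * h := by
    rw [hhh, hF, Finset.mul_sum, Finset.sum_mul, hG]
    refine Finset.sum_congr rfl fun a _ => ?_
    rw [← mul_assoc, hstar, mul_assoc, hw1, (hq a).isIdempotentElem.eq]
  have hhF' : h * F = h := by
    rw [← sub_eq_zero]
    refine eq_zero_of_vanish _ h hhs (by rw [sub_mul, hhF, sub_self]) fun z hz => ?_
    have h1 : F z = 0 := by
      rw [hF, sum_apply]
      exact Finset.sum_eq_zero fun a _ => by rw [mul_apply_eq_comp, hw3 a z hz, map_zero]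
    have h2 : h z = 0 := by
      have := hz (h z)
      rw [inner_apply_of_isSelfAdjoint hhs] at this
      exact inner_self_eq_zero.1 this
    rw [sub_apply, mul_apply_eq_comp, h1, h2]; simp
  have hFh : F * h = h := by
    have := congrArg star hhF'
    rwa [star_mul, hhs.star_eq, hFs.star_eq] at this
  have hww : ∀ a b, w a * star (w b) = if a = b then q a else 0 := by
    intro a b
    refine ContinuousLinearMap.ext fun y => ?_
    have := hind (fun a => w a (star (w b) y) - (if a = b then q a y else 0)) ?_ ?_ a
    · rw [sub_eq_zero] at this
      rw [mul_apply_eq_comp, this]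
      split_ifs <;> simp
    · intro a
      have e1 := DFunLike.congr_fun (hqw a) (star (w b) y)
      have e2 := DFunLike.congr_fun (hq a).isIdempotentElem.eq y
      simp only [mul_apply_eq_comp] at e1 e2
      rw [map_sub, e1]
      split_ifs
      · rw [e2]
      · simp
    · rw [Finset.sum_sub_distrib, Finset.sum_ite_eq' Finset.univ b]
      simp only [Finset.mem_univ, if_true]
      have e1 : ∑ a, w a (star (w b) y) = h (F (star (w b) y)) := by
        rw [hF, sum_apply, map_sum]
        refine Finset.sum_congr rfl fun a _ => ?_
        rw [mul_apply_eq_comp, ← mul_apply_eq_comp h, hstar]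
        exact (DFunLike.congr_fun (hqw a) _).symm
      rw [e1, ← mul_apply_eq_comp, hhF', ← mul_apply_eq_comp, hstar, sub_self]
  exact ⟨h, w, hh0, hhh, hhR, hwR, hw1, fun a => by rw [hww, if_pos rfl], hqw,
    fun a b hab => by rw [hww, if_neg hab], hFh⟩

end Polar

section Rounding
variable {H : Type*} [NormedAddCommGroup H] [InnerProductSpace ℂ H] [CompleteSpace H]

theorem exists_threshold_half (x : H →L[ℂ] H) (h0 : 0 ≤ x) (h1 : x ≤ 1) :
    ∃ q : H →L[ℂ] H, IsStarProjection q ∧ (∀ y, Commute x y → Commute q y) ∧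
      q ≤ x + x ∧ 0 ≤ x - x * x - (q - x) * (q - x) ∧
      q * (1 - x) ≤ (x - x * x) + (x - x * x) ∧ x ≤ (x - x * x) + (x - x * x) + q := by
  have hx : IsSelfAdjoint x := IsSelfAdjoint.of_nonneg h0
  obtain ⟨q, hq, hc, p1, p2⟩ := exists_threshold (x + x - 1) ((hx.add hx).sub (.one _))
  have hcx : ∀ y, Commute x y → Commute q y := fun y hy =>
    hc y ((hy.add_left hy).sub_left (Commute.one_left y))
  have hqx : q * x = x * q := (hcx x rfl).eq
  have hqx' : ∀ z, q * (x * z) = x * (q * z) := fun z => by rw [← mul_assoc, hqx, mul_assoc]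
  have hqq : q * q = q := hq.isIdempotentElem.eq
  have hqq' : ∀ z, q * (q * z) = q * z := fun z => by rw [← mul_assoc, hqq]
  have p2' := neg_nonneg.2 p2
  have c0 : 0 ≤ 1 - x := sub_nonneg.2 h1
  have c1 : Commute ((x + x - 1) * q) (1 - x) := by
    simp only [commute_iff_eq, mul_add, add_mul, mul_sub, sub_mul, mul_one, one_mul, mul_assoc,
      hqx]
    abel
  have c2 : Commute (-((x + x - 1) * (1 - q))) x := by
    simp only [commute_iff_eq, mul_add, add_mul, mul_sub, sub_mul, mul_one, one_mul, mul_assoc,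
      hqx, neg_mul, mul_neg]
  have c3 : Commute (1 - q) x := by simp only [commute_iff_eq, mul_sub, sub_mul, mul_one, one_mul, hqx]
  have c4 : Commute x (1 - x) := (Commute.one_right x).sub_right rfl
  have c5 : Commute ((1 - q) * x) (1 - x) := by
    simp only [commute_iff_eq, mul_sub, sub_mul, mul_one, one_mul, mul_assoc,
      hqx]
    abel
  have c6 : Commute q (1 - x) := by simp only [commute_iff_eq, mul_sub, sub_mul, mul_one, one_mul, hqx]
  have c7 : Commute (q * (1 - x)) x := by
    simp only [commute_iff_eq, mul_sub, sub_mul, mul_one, mul_assoc,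
      hqx]
  have P1 := Commute.mul_nonneg p1 c0 c1
  have P2 := Commute.mul_nonneg p2' h0 c2
  have P3 := Commute.mul_nonneg hq.one_sub.nonneg h0 c3
  have P4 := Commute.mul_nonneg P3 c0 c5
  have P5 := Commute.mul_nonneg hq.nonneg c0 c6
  have P6 := Commute.mul_nonneg P5 h0 c7
  refine ⟨q, hq, hcx, ?_, ?_, ?_, ?_⟩
  · rw [← sub_nonneg]
    convert add_nonneg p1 (add_nonneg P3 P3) using 1
    simp only [add_mul, sub_mul, one_mul, hqx]
    abel
  · convert add_nonneg P1 P2 using 1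
    simp only [add_mul, mul_sub, sub_mul, mul_one, one_mul, mul_assoc, hqx, hqq,
      neg_mul]
    abel
  · rw [← sub_nonneg]
    convert add_nonneg P1 (add_nonneg P4 P4) using 1
    simp only [add_mul, mul_sub, sub_mul, mul_one, one_mul, mul_assoc, hqx]
    abel
  · rw [← sub_nonneg]
    convert add_nonneg P5 (add_nonneg (add_nonneg P6 P6) P2) using 1
    simp only [add_mul, mul_sub, sub_mul, mul_one, one_mul, mul_assoc, hqx,
      neg_mul]
    abel

theorem norm_sq_sum_four_le (a b c d : H) :
    ‖a + b + c + d‖ ^ 2 ≤ 4 * (‖a‖ ^ 2 + ‖b‖ ^ 2 + ‖c‖ ^ 2 + ‖d‖ ^ 2) := by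
  have : ‖a + b + c + d‖ ≤ ‖a‖ + ‖b‖ + ‖c‖ + ‖d‖ := norm_add₄_le
  have h2 := pow_le_pow_left₀ (norm_nonneg _) this 2
  nlinarith [sq_nonneg (‖a‖ - ‖b‖), sq_nonneg (‖a‖ - ‖c‖), sq_nonneg (‖a‖ - ‖d‖),
    sq_nonneg (‖b‖ - ‖c‖), sq_nonneg (‖b‖ - ‖d‖), sq_nonneg (‖c‖ - ‖d‖)]

/-- Rounding of an almost projective measurement in the commutant of `R`, on which the vector
state of `ξ` is tracial. -/
theorem exists_rounding {α : Type*} [Fintype α] [Nonempty α] (R : Set (H →L[ℂ] H))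
    (hR : ∀ c ∈ R, star c ∈ R) (ξ : H) (hξ : ‖ξ‖ = 1)
    (htr : ∀ x y : H →L[ℂ] H, (∀ c ∈ R, Commute c x) → (∀ c ∈ R, Commute c y) →
      ⟪ξ, (x * y) ξ⟫_ℂ = ⟪ξ, (y * x) ξ⟫_ℂ)
    (x : α → H →L[ℂ] H) (hx0 : ∀ a, 0 ≤ x a) (hxR : ∀ a, ∀ c ∈ R, Commute c (x a))
    (hx1 : ∑ a, x a = 1) :
    ∃ r : α → H →L[ℂ] H, (∀ a, IsStarProjection (r a)) ∧ (∀ a, ∀ c ∈ R, Commute c (r a)) ∧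
      ∑ a, r a = 1 ∧ ∑ a, ‖(r a - x a) ξ‖ ^ 2 ≤ 108 * (1 - ∑ a, ‖x a ξ‖ ^ 2) := by
  set τ : (H →L[ℂ] H) →ₗ[ℝ] ℝ :=
    { toFun := fun x => (⟪ξ, x ξ⟫_ℂ).re
      map_add' := fun x y => by simp
      map_smul' := fun r x => by simp [inner_smul_right_eq_smul] } with hτ
  have hτd : ∀ x, τ x = (⟪ξ, x ξ⟫_ℂ).re := fun x => rfl
  have hτ1 : τ 1 = 1 := by
    rw [hτd, one_apply_eq_self, inner_self_eq_norm_sq_to_K, hξ]; simp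
  have hmono : ∀ x y, x ≤ y → τ x ≤ τ y := fun x y h => inner_le_of_le h ξ
  have htr' : ∀ x y : H →L[ℂ] H, (∀ c ∈ R, Commute c x) → (∀ c ∈ R, Commute c y) →
      τ (x * y) = τ (y * x) := fun x y h1 h2 => by
    rw [hτd, htr x y h1 h2, hτd]
  have hpos : ∀ q z : H →L[ℂ] H, IsStarProjection q → (∀ c ∈ R, Commute c q) →
      (∀ c ∈ R, Commute c z) → 0 ≤ z → 0 ≤ τ (q * z) := by
    intro q z hq h1 h2 hz
    have : τ (q * z) = (⟪q ξ, z (q ξ)⟫_ℂ).re := by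
      have e : q * z = q * (q * z) := by rw [← mul_assoc, hq.isIdempotentElem.eq]
      rw [e, htr' q _ h1 (fun c hc => (h1 c hc).mul_right (h2 c hc)),
        hτd, inner_apply_of_isSelfAdjoint hq.isSelfAdjoint]
      simp only [mul_apply_eq_comp]
    rw [this]
    exact inner_nonneg_of_nonneg hz _
  have hnsq : ∀ x : H →L[ℂ] H, ‖x ξ‖ ^ 2 = τ (star x * x) := fun x => norm_sq_apply x ξ
  have hstarR : ∀ x : H →L[ℂ] H, (∀ c ∈ R, Commute c x) → ∀ c ∈ R, Commute c (star x) :=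
    fun x hx c hc => by
      have := (hx _ (hR c hc)).star_star
      rwa [star_star] at this
  have hnstar : ∀ x : H →L[ℂ] H, (∀ c ∈ R, Commute c x) → ‖star x ξ‖ = ‖x ξ‖ := fun x hx => by
    have : ‖star x ξ‖ ^ 2 = ‖x ξ‖ ^ 2 := by
      rw [hnsq, hnsq, star_star, htr' _ _ hx (hstarR x hx)]
    exact (pow_left_inj₀ (norm_nonneg _) (norm_nonneg _) two_ne_zero).1 this
  have hxle : ∀ a, x a ≤ 1 := fun a => by
    rw [← hx1]; exact Finset.single_le_sum (fun a _ => hx0 a) (Finset.mem_univ a)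
  have hxs : ∀ a, star (x a) = x a := fun a => (IsSelfAdjoint.of_nonneg (hx0 a)).star_eq
  choose q hq hqc hq2 hqb hqcc hqd using fun a => exists_threshold_half (x a) (hx0 a) (hxle a)
  have hqR : ∀ a, ∀ c ∈ R, Commute c (q a) := fun a c hc => (hqc a c (hxR a c hc).symm).symm
  set δ : ℝ := 1 - ∑ a, ‖x a ξ‖ ^ 2 with hδ
  have hτx : ∑ a, τ (x a) = 1 := by rw [← map_sum, hx1, hτ1]
  have hδ' : δ = ∑ a, τ (x a - x a * x a) := by
    simp only [hδ, hnsq, hxs, map_sub, Finset.sum_sub_distrib, hτx]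
  -- distance from `q` to `x`
  have D1 : ∑ a, ‖(q a - x a) ξ‖ ^ 2 ≤ δ := by
    rw [hδ']
    refine Finset.sum_le_sum fun a _ => ?_
    rw [hnsq, star_sub, hxs, (hq a).isSelfAdjoint.star_eq]
    exact hmono _ _ (sub_nonneg.1 (hqb a))
  -- trace of `q`
  set θ : ℝ := ∑ a, τ (q a) with hθ
  have hτq0 : ∀ a, 0 ≤ τ (q a) := fun a => inner_nonneg_of_nonneg (hq a).nonneg ξ
  have hθ0 : 0 ≤ θ := Finset.sum_nonneg fun a _ => hτq0 a
  have Tθ : 1 - 2 * δ ≤ θ := by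
    rw [← hτx, hδ', hθ, Finset.mul_sum, ← Finset.sum_sub_distrib]
    refine Finset.sum_le_sum fun a _ => ?_
    have := hmono _ _ (hqd a)
    simp only [map_add] at this
    linarith
  -- overlaps
  set S : ℝ := ∑ a, ∑ b ∈ Finset.univ.erase a, τ (q a * q b) with hS
  have hS0 : 0 ≤ S := Finset.sum_nonneg fun a _ => Finset.sum_nonneg fun b _ =>
    hpos _ _ (hq a) (hqR a) (hqR b) (hq b).nonneg
  have TS : S ≤ 4 * δ := by
    rw [hS, hδ', Finset.mul_sum]
    refine Finset.sum_le_sum fun a _ => ?_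
    have e1 : ∑ b ∈ Finset.univ.erase a, x b = 1 - x a := by
      rw [← hx1, ← Finset.add_sum_erase _ _ (Finset.mem_univ a)]; abel
    have e2 : ∑ b ∈ Finset.univ.erase a, τ (q a * q b) ≤
        ∑ b ∈ Finset.univ.erase a, (τ (q a * x b) + τ (q a * x b)) := by
      refine Finset.sum_le_sum fun b _ => ?_
      have := hpos (q a) (x b + x b - q b) (hq a) (hqR a)
        (fun c hc => ((hxR b c hc).add_right (hxR b c hc)).sub_right (hqR b c hc))
        (sub_nonneg.2 (hq2 b))
      rw [mul_sub, mul_add, map_sub, map_add] at this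
      linarith
    have e4 : ∑ b ∈ Finset.univ.erase a, τ (q a * x b) = τ (q a * (1 - x a)) := by
      rw [← map_sum, ← Finset.mul_sum, e1]
    rw [Finset.sum_add_distrib, e4] at e2
    have e3 := hmono _ _ (hqcc a)
    simp only [map_add] at e3
    linarith
  -- independent subprojections
  set VV : α → Submodule ℂ H := fun a => LinearMap.range (q a).toLinearMap with hVV
  have hmemV : ∀ a v, v ∈ VV a ↔ q a v = v := by
    intro a v
    constructor
    · rintro ⟨u, rfl⟩
      exact DFunLike.congr_fun (hq a).isIdempotentElem.eq u
    · intro h; exact ⟨v, h⟩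
  obtain ⟨V', v1, v2, v3, v4, v5⟩ := exists_independent_subspaces R hR VV
    (fun a => by
      have : (VV a : Set H) = {v | q a v = v} := by ext v; exact hmemV a v
      rw [this]; exact isClosed_eq (by fun_prop) (by fun_prop))
    (fun a c hc v hv => by
      rw [hmemV] at hv ⊢
      have := DFunLike.congr_fun (hqR a c hc).eq v
      simp only [mul_apply_eq_comp, hv] at this
      exact this.symm) Finset.univ
  have hV'c : ∀ a, CompleteSpace (V' a) := fun a => (v2 a).completeSpace_coe
  set q' : α → H →L[ℂ] H := fun a => (V' a).starProjection with hq'd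
  have hq' : ∀ a, IsStarProjection (q' a) := fun a => isStarProjection_starProjection
  have hq'R : ∀ a, ∀ c ∈ R, Commute c (q' a) := fun a c hc =>
    commute_starProjection_of_invariant _ c (v3 a c hc) (v3 a _ (hR c hc))
  have hmem' : ∀ a v, q' a v = v ↔ v ∈ V' a := fun a v => Submodule.starProjection_eq_self_iff
  have hqq' : ∀ a, q a * q' a = q' a := fun a => by
    ext v
    exact (hmemV a _).1 (v1 a (Submodule.starProjection_apply_mem _ v))
  have hq'q : ∀ a, q' a * q a = q' a := fun a => by
    have := congrArg star (hqq' a)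
    rwa [star_mul, (hq a).isSelfAdjoint.star_eq, (hq' a).isSelfAdjoint.star_eq] at this
  have hsubproj : ∀ a, IsStarProjection (q a - q' a) := fun a =>
    (hq' a).sub_of_mul_eq_left (hq a) (hq'q a)
  obtain ⟨h, w, hh0, hhh, hhR, hwR, hwh, hwws, hqw, hww, hFh⟩ := exists_polar_of_independent R hR q'
    hq' hq'R (fun f hf hs a => v4 f (fun a => (hmem' a _).1 (hf a)) hs a (Finset.mem_univ a))
  have hhs : star h = h := (IsSelfAdjoint.of_nonneg hh0).star_eq
  set r0 : α → H →L[ℂ] H := fun a => star (w a) * w a with hr0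
  have hr0R : ∀ a, ∀ c ∈ R, Commute c (r0 a) := fun a c hc =>
    (hstarR _ (hwR a) c hc).mul_right (hwR a c hc)
  have hr0p : ∀ a, IsStarProjection (r0 a) := fun a => by
    refine ⟨?_, ?_⟩
    · change star (w a) * w a * (star (w a) * w a) = star (w a) * w a
      rw [mul_assoc, ← mul_assoc (w a), hwws, hqw]
    · change star (star (w a) * w a) = _
      rw [star_mul, star_star]
  have hr0o : ∀ a b, a ≠ b → r0 a * r0 b = 0 := fun a b hab => by
    change star (w a) * w a * (star (w b) * w b) = 0
    rw [mul_assoc, ← mul_assoc (w a), hww a b hab]; simp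
  set F : H →L[ℂ] H := ∑ a, r0 a with hF
  have hFs : star F = F := by
    rw [hF, star_sum]; exact Finset.sum_congr rfl fun a _ => (hr0p a).isSelfAdjoint.star_eq
  have hr0F : ∀ a, r0 a * F = r0 a := fun a => by
    rw [hF, Finset.mul_sum, Finset.sum_eq_single a]
    · exact (hr0p a).isIdempotentElem.eq
    · exact fun b _ hb => hr0o a b hb.symm
    · simp
  have hFp : IsStarProjection F := by
    refine ⟨?_, hFs⟩
    change F * F = F
    nth_rewrite 1 [hF]
    rw [Finset.sum_mul]
    exact Finset.sum_congr rfl fun a _ => hr0F a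
  have hFR : ∀ c ∈ R, Commute c F := fun c hc => Commute.sum_right _ _ _ fun a _ => hr0R a c hc
  have hhw : ∀ a, h * star (w a) = q' a := fun a => by
    have := congrArg star (hwh a)
    rwa [star_mul, hhs, (hq' a).isSelfAdjoint.star_eq] at this
  have hFq' : ∀ a, F * q' a = q' a := fun a => by rw [← hhw, ← mul_assoc, hFh]
  have hhF : h * F = h := by
    have := congrArg star hFh
    rwa [star_mul, hhs, hFs] at this
  have hFq : ∀ a, F * q a = q a := fun a => by
    have hcl : closure ((⨆ b ∈ Finset.univ, V' b : Submodule ℂ H) : Set H) ⊆ {v | F v = v} := by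
      apply closure_minimal _ (isClosed_eq (by fun_prop) (by fun_prop))
      have : (⨆ b ∈ Finset.univ, V' b : Submodule ℂ H) ≤
          LinearMap.eqLocus F.toLinearMap LinearMap.id := by
        refine iSup₂_le fun b _ v hv => ?_
        have := DFunLike.congr_fun (hFq' b) v
        rw [mul_apply_eq_comp, (hmem' b v).2 hv] at this
        exact this
      exact this
    ext v
    exact hcl (v5 a (Finset.mem_univ a) ⟨v, rfl⟩)
  -- trace of `F`
  have hτF : τ F = ∑ a, τ (q' a) := by
    rw [hF, map_sum]
    refine Finset.sum_congr rfl fun a _ => ?_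
    rw [← hwws a]
    exact htr' _ _ (hstarR _ (hwR a)) (hwR a)
  have hsqQ : ∀ p : α → H →L[ℂ] H, (∀ a, IsStarProjection (p a)) → ‖(∑ a, p a) ξ‖ ^ 2 =
      ∑ a, τ (p a) + ∑ a, ∑ b ∈ Finset.univ.erase a, τ (p a * p b) := by
    intro p hp
    have : star (∑ a, p a) = ∑ a, p a := by
      rw [star_sum]; exact Finset.sum_congr rfl fun a _ => (hp a).isSelfAdjoint.star_eq
    rw [hnsq, this, Finset.sum_mul, map_sum, ← Finset.sum_add_distrib]
    refine Finset.sum_congr rfl fun a _ => ?_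
    rw [Finset.mul_sum, map_sum, ← Finset.add_sum_erase _ _ (Finset.mem_univ a),
      (hp a).isIdempotentElem.eq]
  have hτF0 : 0 ≤ τ F := inner_nonneg_of_nonneg hFp.nonneg ξ
  have hτF1 : τ F ≤ 1 := by
    rw [← hτ1]; exact hmono _ _ (sub_nonneg.1 hFp.one_sub.nonneg)
  have TF : θ - S ≤ τ F := by
    have e1 : θ = (⟪F ξ, (∑ a, q a) ξ⟫_ℂ).re := by
      rw [inner_apply_of_isSelfAdjoint hFs, ← mul_apply_eq_comp, Finset.mul_sum,
        Finset.sum_congr rfl fun a _ => hFq a, ← hτd, map_sum]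
    have e2 : θ ≤ ‖F ξ‖ * ‖(∑ a, q a) ξ‖ := by
      rw [e1]; exact (Complex.re_le_norm _).trans (norm_inner_le_norm _ _)
    have e3 : θ ^ 2 ≤ τ F * (θ + S) := by
      have := pow_le_pow_left₀ hθ0 e2 2
      rwa [mul_pow, norm_sq_proj hFp, ← hτd, hsqQ q hq] at this
    by_contra hcon
    push Not at hcon
    nlinarith
  have D2 : ∑ a, ‖(q' a - q a) ξ‖ ^ 2 ≤ 4 * δ := by
    have : ∑ a, ‖(q' a - q a) ξ‖ ^ 2 = θ - τ F := by
      rw [hθ, hτF, ← Finset.sum_sub_distrib]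
      refine Finset.sum_congr rfl fun a _ => ?_
      rw [← norm_neg, ← neg_apply, neg_sub, norm_sq_proj (hsubproj a), ← hτd, map_sub]
    linarith
  -- polar part
  have hS' : ∑ a, ∑ b ∈ Finset.univ.erase a, τ (q' a * q' b) ≤ 4 * δ := by
    refine le_trans (Finset.sum_le_sum fun a _ => Finset.sum_le_sum fun b _ => ?_) TS
    have f1 := hpos (q' a) (q b - q' b) (hq' a) (hq'R a)
      (fun c hc => (hqR b c hc).sub_right (hq'R b c hc)) (hsubproj b).nonneg
    have f2 := hpos (q b) (q a - q' a) (hq b) (hqR b)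
      (fun c hc => (hqR a c hc).sub_right (hq'R a c hc)) (hsubproj a).nonneg
    rw [mul_sub, map_sub] at f1 f2
    rw [htr' _ _ (hqR b) (hqR a), htr' _ _ (hqR b) (hq'R a)] at f2
    linarith
  have D3 : ∑ a, ‖(w a - q' a) ξ‖ ^ 2 ≤ 4 * δ := by
    set u : H := F (ξ - h ξ) with hu
    have e1 : ∑ a, ‖(w a - q' a) ξ‖ ^ 2 = ‖u‖ ^ 2 := by
      rw [hu, norm_sq_proj hFp, hF, sum_apply, inner_sum, Complex.re_sum]
      refine Finset.sum_congr rfl fun a _ => ?_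
      rw [← norm_sq_apply, map_sub, sub_apply, ← hwh a, mul_apply_eq_comp]
    have e2 : u + h u = F ξ - (∑ a, q' a) ξ := by
      rw [← hhh, hu]
      have a1 := DFunLike.congr_fun hFh ξ
      have a2 := DFunLike.congr_fun hhF ξ
      simp only [mul_apply_eq_comp] at a1 a2
      simp only [map_sub, mul_apply_eq_comp, a1, a2]
      abel
    have e3 : ‖u‖ ^ 2 ≤ ‖u + h u‖ ^ 2 := by
      have hp := inner_nonneg_of_nonneg hh0 u
      rw [@norm_add_sq ℂ]
      have : 0 ≤ ‖h u‖ ^ 2 := sq_nonneg _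
      simp only [RCLike.re_to_complex]
      linarith
    have e4 : ‖F ξ - (∑ a, q' a) ξ‖ ^ 2 = ∑ a, ∑ b ∈ Finset.univ.erase a, τ (q' a * q' b) := by
      rw [@norm_sub_sq ℂ, hsqQ q' hq', norm_sq_proj hFp, ← hτd, hτF]
      have : RCLike.re ⟪F ξ, (∑ a, q' a) ξ⟫_ℂ = ∑ a, τ (q' a) := by
        rw [inner_apply_of_isSelfAdjoint hFs, ← mul_apply_eq_comp, Finset.mul_sum,
          Finset.sum_congr rfl fun a _ => hFq' a, RCLike.re_to_complex, ← hτd, map_sum]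
      rw [this]; ring
    rw [e1]
    rw [e2, e4] at e3
    linarith
  have D4 : ∑ a, ‖(r0 a - q' a) ξ‖ ^ 2 ≤ 16 * δ := by
    have : ∀ a, ‖(r0 a - q' a) ξ‖ ^ 2 ≤ 4 * ‖(w a - q' a) ξ‖ ^ 2 := by
      intro a
      have hcR : ∀ c ∈ R, Commute c (w a - q' a) := fun c hc => (hwR a c hc).sub_right (hq'R a c hc)
      have i1 : (r0 a - q' a) ξ = star (w a) ((w a - q' a) ξ) + star (q' a * (w a - q' a)) ξ := by
        rw [star_mul, (hq' a).isSelfAdjoint.star_eq, star_sub, (hq' a).isSelfAdjoint.star_eq, sub_mul,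
          (hq' a).isIdempotentElem.eq]
        simp [hr0]
      have i2 : ‖star (w a) ((w a - q' a) ξ)‖ ≤ ‖(w a - q' a) ξ‖ := by
        refine le_of_sq_le_sq ?_ (norm_nonneg _)
        rw [norm_sq_apply, star_star, hwws, ← norm_sq_proj (hq' a)]
        exact pow_le_pow_left₀ (norm_nonneg _) (Submodule.norm_starProjection_apply_le _ _) 2
      have i3 : ‖star (q' a * (w a - q' a)) ξ‖ ≤ ‖(w a - q' a) ξ‖ := by
        rw [hnstar _ (fun c hc => (hq'R a c hc).mul_right (hcR c hc)), mul_apply_eq_comp]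
        exact Submodule.norm_starProjection_apply_le _ _
      have i4 : ‖(r0 a - q' a) ξ‖ ≤ 2 * ‖(w a - q' a) ξ‖ := by
        rw [i1]; exact (norm_add_le _ _).trans (by linarith)
      calc _ ≤ (2 * ‖(w a - q' a) ξ‖) ^ 2 := pow_le_pow_left₀ (norm_nonneg _) i4 2
        _ = _ := by ring
    calc _ ≤ ∑ a, 4 * ‖(w a - q' a) ξ‖ ^ 2 := Finset.sum_le_sum fun a _ => this a
      _ ≤ _ := by rw [← Finset.mul_sum]; linarith
  obtain ⟨a0⟩ := ‹Nonempty α›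
  set d : α → H →L[ℂ] H := fun a => if a = a0 then 1 - F else 0 with hd
  have D5 : ∑ a, ‖d a ξ‖ ^ 2 ≤ 6 * δ := by
    rw [Finset.sum_eq_single a0]
    · simp only [hd, if_true]
      rw [norm_sq_proj hFp.one_sub, ← hτd, map_sub, hτ1]
      linarith
    · intro b _ hb; simp [hd, hb]
    · simp
  refine ⟨fun a => r0 a + d a, ?_, ?_, ?_, ?_⟩
  · intro a
    by_cases ha : a = a0
    · simp only [hd, ha, if_true]
      exact (hr0p a0).add hFp.one_sub (by rw [mul_sub, hr0F, mul_one, sub_self])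
    · simp only [hd, ha, if_false, add_zero]; exact hr0p a
  · intro a c hc
    refine (hr0R a c hc).add_right ?_
    by_cases ha : a = a0
    · simp only [hd, ha, if_true]; exact (Commute.one_right c).sub_right (hFR c hc)
    · simp only [hd, ha, if_false]; exact Commute.zero_right c
  · rw [Finset.sum_add_distrib, ← hF]
    simp [hd]
  · calc _ ≤ ∑ a, 4 * (‖d a ξ‖ ^ 2 + ‖(r0 a - q' a) ξ‖ ^ 2 + ‖(q' a - q a) ξ‖ ^ 2 +
          ‖(q a - x a) ξ‖ ^ 2) := by
          refine Finset.sum_le_sum fun a _ => ?_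
          refine le_trans (le_of_eq ?_) (norm_sq_sum_four_le _ _ _ _)
          congr 2
          simp only [add_apply, sub_apply]
          abel
      _ ≤ _ := by
          rw [← Finset.mul_sum, Finset.sum_add_distrib, Finset.sum_add_distrib,
            Finset.sum_add_distrib]
          linarith

end Rounding

section Twins
variable {H : Type*} [NormedAddCommGroup H] [InnerProductSpace ℂ H] [CompleteSpace H]

/-- If `ξ` is cyclic for a family `g` whose members have commuting twins `g'` with
`g i ξ = g' i ξ`, then the vector state of `ξ` is tracial on the commutant of the twins. -/
theorem tracial_of_twins {ι : Type*} (g g' : ι → H →L[ℂ] H) (hg : ∀ i, IsSelfAdjoint (g i))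
    (hg' : ∀ i, IsSelfAdjoint (g' i)) (hc : ∀ i j, Commute (g i) (g' j)) (ξ : H)
    (hξ : ∀ i, g i ξ = g' i ξ)
    (hcyc : ∀ W : Submodule ℂ H, IsClosed (W : Set H) → ξ ∈ W → (∀ i, ∀ v ∈ W, g i v ∈ W) → W = ⊤)
    (x y : H →L[ℂ] H) (hx : ∀ i, Commute (g' i) x) (hy : ∀ i, Commute (g' i) y) :
    ⟪ξ, (x * y) ξ⟫_ℂ = ⟪ξ, (y * x) ξ⟫_ℂ := by
  set T : Set ((H →L[ℂ] H) × (H →L[ℂ] H)) := {p | (∀ i, Commute (g' i) p.1) ∧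
    (∀ z, (∀ i, Commute (g' i) z) → Commute p.2 z) ∧ p.1 ξ = p.2 ξ ∧
      star p.1 ξ = star p.2 ξ} with hT
  have hstar : ∀ z : H →L[ℂ] H, (∀ i, Commute (g' i) z) → ∀ i, Commute (g' i) (star z) :=
    fun z hz i => commute_star_of_isSelfAdjoint (hg' i) (hz i)
  let W0 : Submodule ℂ H :=
    { carrier := {v | ∃ p ∈ T, v = p.2 ξ}
      add_mem' := by
        rintro _ _ ⟨p, hp, rfl⟩ ⟨q, hq, rfl⟩
        refine ⟨p + q, ⟨fun i => (hp.1 i).add_right (hq.1 i),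
          fun z hz => (hp.2.1 z hz).add_left (hq.2.1 z hz), ?_, ?_⟩, ?_⟩
        · simp [hp.2.2.1, hq.2.2.1]
        · simp [hp.2.2.2, hq.2.2.2]
        · simp
      zero_mem' := ⟨0, ⟨fun i => Commute.zero_right _, fun z _ => Commute.zero_left _, by simp,
        by simp⟩, by simp⟩
      smul_mem' := by
        rintro c _ ⟨p, hp, rfl⟩
        refine ⟨c • p, ⟨fun i => (hp.1 i).smul_right c, fun z hz => (hp.2.1 z hz).smul_left c,
          ?_, ?_⟩, ?_⟩
        · simp [hp.2.2.1]
        · simp [hp.2.2.2, star_smul]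
        · simp }
  have hW0 : W0.topologicalClosure = ⊤ := by
    refine hcyc _ (Submodule.isClosed_topologicalClosure _) ?_ ?_
    · exact subset_closure ⟨1, ⟨fun i => Commute.one_right _, fun z _ => Commute.one_left _, by simp,
        by simp⟩, by simp⟩
    · intro i
      apply mapsTo_topologicalClosure
      rintro _ ⟨p, hp, rfl⟩
      have hgi : Commute p.2 (g i) := hp.2.1 _ fun j => (hc i j).symm
      have hgis : Commute (star p.2) (g i) := by
        have := hgi.star_star
        rwa [(hg i).star_eq] at this
      have f1 := DFunLike.congr_fun hgi.eq ξ
      have f2 := DFunLike.congr_fun (hstar _ hp.1 i).eq ξ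
      simp only [mul_apply_eq_comp] at f1 f2
      refine ⟨(g i * p.1, p.2 * g' i), ⟨fun j => (hc i j).symm.mul_right (hp.1 j),
        fun z hz => (hp.2.1 z hz).mul_left (hz i), ?_, ?_⟩, ?_⟩
      · simp only [mul_apply_eq_comp]
        rw [hp.2.2.1, ← f1, hξ]
      · simp only [star_mul, (hg i).star_eq, (hg' i).star_eq, mul_apply_eq_comp]
        rw [hξ, ← f2, hp.2.2.2]
      · simp only [mul_apply_eq_comp]
        rw [← f1, hξ]
  have hle : ∀ z : H →L[ℂ] H, (∀ i, Commute (g' i) z) → ‖star z ξ‖ ≤ ‖z ξ‖ := by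
    intro z hz
    have key : ∀ v : H, ‖⟪star z ξ, v⟫_ℂ‖ ≤ ‖z ξ‖ * ‖v‖ := by
      intro v
      have hv : v ∈ closure (W0 : Set H) := by
        have : v ∈ W0.topologicalClosure := by rw [hW0]; trivial
        exact this
      refine closure_minimal (t := {v | ‖⟪star z ξ, v⟫_ℂ‖ ≤ ‖z ξ‖ * ‖v‖}) ?_
        (isClosed_le (by fun_prop) (by fun_prop)) hv
      rintro _ ⟨p, hp, rfl⟩
      have e := DFunLike.congr_fun (hp.2.1 z hz).eq ξ
      have hn : ‖star p.2 ξ‖ = ‖p.2 ξ‖ := by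
        have hcs : Commute p.2 (star p.1) := hp.2.1 _ (hstar _ hp.1)
        have e := DFunLike.congr_fun hcs.eq ξ
        simp only [mul_apply_eq_comp] at e
        have : ⟪star p.2 ξ, star p.2 ξ⟫_ℂ = ⟪p.2 ξ, p.2 ξ⟫_ℂ := by
          nth_rewrite 2 [← hp.2.2.2]
          rw [inner_apply_eq_star, star_star, e, ← inner_apply_eq_star, hp.2.2.1]
        rw [inner_self_eq_norm_sq_to_K, inner_self_eq_norm_sq_to_K] at this
        have : ‖star p.2 ξ‖ ^ 2 = ‖p.2 ξ‖ ^ 2 := by exact_mod_cast this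
        exact (pow_left_inj₀ (norm_nonneg _) (norm_nonneg _) two_ne_zero).1 this
      simp only [Set.mem_ofPred_eq]
      have : ⟪star z ξ, p.2 ξ⟫_ℂ = ⟪star p.2 ξ, z ξ⟫_ℂ := by
        rw [inner_apply_eq_star, inner_apply_eq_star, star_star, star_star]
        exact congrArg _ e.symm
      rw [this, ← hn, mul_comm]
      exact norm_inner_le_norm _ _
    have := key (star z ξ)
    rw [inner_self_eq_norm_sq_to_K, norm_pow, RCLike.norm_ofReal, abs_norm] at this
    by_contra! hlt
    have := (norm_nonneg _).trans_lt hlt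
    nlinarith
  have heq : ∀ z : H →L[ℂ] H, (∀ i, Commute (g' i) z) → ‖star z ξ‖ ^ 2 = ‖z ξ‖ ^ 2 := by
    intro z hz
    have := hle (star z) (hstar z hz)
    rw [star_star] at this
    rw [le_antisymm (hle z hz) this]
  have hre : ∀ z w : H →L[ℂ] H, (∀ i, Commute (g' i) z) → (∀ i, Commute (g' i) w) →
      (⟪star z ξ, star w ξ⟫_ℂ).re = (⟪w ξ, z ξ⟫_ℂ).re := by
    intro z w hz hw
    have h1 := heq (z + w) fun i => (hz i).add_right (hw i)
    rw [star_add, add_apply, add_apply, @norm_add_sq ℂ, @norm_add_sq ℂ, heq z hz, heq w hw] at h1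
    simp only [RCLike.re_to_complex] at h1
    have h2 : (⟪w ξ, z ξ⟫_ℂ).re = (⟪z ξ, w ξ⟫_ℂ).re := by
      rw [← inner_conj_symm, Complex.conj_re]
    linarith
  have e1 := hre (star x) y (hstar x hx) hy
  have e2 := hre (star x) (Complex.I • y) (hstar x hx) fun i => (hy i).smul_right _
  have f1 : ⟪ξ, (x * y) ξ⟫_ℂ = ⟪star x ξ, y ξ⟫_ℂ := by
    rw [inner_apply_eq_star, star_star, mul_apply_eq_comp]
  have f2 : ⟪ξ, (y * x) ξ⟫_ℂ = ⟪star y ξ, x ξ⟫_ℂ := by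
    rw [inner_apply_eq_star, star_star, mul_apply_eq_comp]
  rw [star_star] at e1 e2
  have s1 := inner_conj_symm (𝕜 := ℂ) (star x ξ) (y ξ)
  have s2 := inner_conj_symm (𝕜 := ℂ) (star y ξ) (x ξ)
  rw [f1, f2, ← s1, ← s2]
  simp only [star_smul, smul_apply, inner_smul_left, inner_smul_right, RCLike.star_def, Complex.conj_I] at e2
  apply Complex.ext
  · simp only [Complex.conj_re]; exact e1.symm
  · simp only [Complex.conj_im]; simp at e2; linarith

end Twins

section RealProjection
variable {H : Type*} [NormedAddCommGroup H] [InnerProductSpace ℂ H] [CompleteSpace H]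

attribute [local instance] InnerProductSpace.complexToReal

/-- The data attached to a real subspace that are used from modular theory: the complex-linear part
`A` and the conjugate-linear part `C` of its real orthogonal projection. -/
structure ModularData (𝓑 M : StarSubalgebra ℂ (H →L[ℂ] H)) (ψ : H) where
  A : H →L[ℂ] H
  C : H →L[ℝ] H
  A_selfAdjoint : IsSelfAdjoint A
  A_nonneg : 0 ≤ A
  A_le_one : A ≤ 1
  C_I : ∀ v, C (Complex.I • v) = -(Complex.I • C v)
  C_symm : ∀ v w, ⟪C v, w⟫_ℂ = ⟪C w, v⟫_ℂ
  sq_add_sq : ∀ v, A (A v) + C (C v) = A v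
  anti : ∀ v, A (C v) + C (A v) = C v
  map_commutant : ∀ m ∈ M, A (m ψ) + C (star m ψ) = m ψ
  map_algebra : ∀ x ∈ 𝓑, C (x ψ) = A (star x ψ)
  eq_of_re : ∀ z ∈ M, IsSelfAdjoint z → ∀ w, (∀ y ∈ M, IsSelfAdjoint y →
    (⟪y ψ, w⟫_ℂ).re = (⟪y ψ, z ψ⟫_ℂ).re) → z ψ = A w + C w

/-- The closed real subspace spanned by the self-adjoint part of `M` applied to `ψ`. -/
noncomputable def selfAdjointSpan (M : StarSubalgebra ℂ (H →L[ℂ] H)) (ψ : H) : Submodule ℝ H :=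
  (Submodule.topologicalClosure
    { carrier := {v | ∃ m ∈ M, IsSelfAdjoint m ∧ v = m ψ}
      add_mem' := by
        rintro _ _ ⟨m, hm, sm, rfl⟩ ⟨n, hn, sn, rfl⟩
        exact ⟨m + n, add_mem hm hn, sm.add sn, by simp⟩
      zero_mem' := ⟨0, zero_mem _, IsSelfAdjoint.zero _, by simp⟩
      smul_mem' := by
        rintro c _ ⟨m, hm, sm, rfl⟩
        refine ⟨(c : ℂ) • m, SMulMemClass.smul_mem _ hm, ?_, by simp⟩
        rw [IsSelfAdjoint, star_smul, sm.star_eq]; simp })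

theorem mem_selfAdjointSpan {M : StarSubalgebra ℂ (H →L[ℂ] H)} {ψ : H} {m : H →L[ℂ] H}
    (hm : m ∈ M) (sm : IsSelfAdjoint m) : m ψ ∈ selfAdjointSpan M ψ :=
  subset_closure ⟨m, hm, sm, rfl⟩

theorem selfAdjointSpan_orthogonal {M : StarSubalgebra ℂ (H →L[ℂ] H)} {ψ w : H}
    (h : ∀ y ∈ M, IsSelfAdjoint y → (⟪y ψ, w⟫_ℂ).re = 0) : ∀ u ∈ selfAdjointSpan M ψ,
    ⟪u, w⟫_ℝ = 0 := by
  intro u hu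
  refine closure_minimal (t := {u | ⟪u, w⟫_ℝ = 0}) ?_ (isClosed_eq (by fun_prop) (by fun_prop)) hu
  rintro _ ⟨m, hm, sm, rfl⟩
  exact h m hm sm

instance (M : StarSubalgebra ℂ (H →L[ℂ] H)) (ψ : H) : CompleteSpace (selfAdjointSpan M ψ) :=
  (Submodule.isClosed_topologicalClosure _).completeSpace_coe

/-- The complex-linear part of a real-linear continuous operator. -/
noncomputable def complexLinearPart (P : H →L[ℝ] H) : H →L[ℂ] H :=
  LinearMap.mkContinuous
    { toFun := fun v => (2⁻¹ : ℝ) • (P v - Complex.I • P (Complex.I • v))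
      map_add' := by intro v w; simp only [smul_add, map_add, smul_sub]; abel
      map_smul' := by
        intro c v
        have hc : ∀ w : H, c • w = c.re • w + c.im • (Complex.I • w) := by
          intro w
          conv_lhs => rw [← Complex.re_add_im c, add_smul, mul_smul]
          simp
        have hI : ∀ w : H, Complex.I • Complex.I • w = -w := by
          intro w; rw [smul_smul, Complex.I_mul_I, neg_one_smul]
        have e1 : P (c • v) = c.re • P v + c.im • P (Complex.I • v) := by
          rw [hc, map_add, map_smul, map_smul]
        have e2 : P (Complex.I • c • v) = c.re • P (Complex.I • v) - c.im • P v := by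
          rw [hc, smul_add, smul_comm Complex.I c.re, smul_comm Complex.I c.im, hI, map_add, map_smul P c.re,
            map_smul P c.im, map_neg, smul_neg, sub_eq_add_neg]
        simp only [RingHom.id_apply]
        rw [e1, e2, hc, smul_comm Complex.I (2⁻¹ : ℝ), smul_sub Complex.I, smul_sub Complex.I, hI,
          smul_comm Complex.I, smul_comm Complex.I]
        module } ‖P‖ (by
    intro v
    have h1 := P.le_opNorm v
    have h2 := P.le_opNorm (Complex.I • v)
    have h3 := norm_sub_le (P v) (Complex.I • P (Complex.I • v))
    simp only [norm_smul, Complex.norm_I, one_mul] at h2 h3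
    change ‖(2⁻¹ : ℝ) • (P v - Complex.I • P (Complex.I • v))‖ ≤ _
    rw [norm_smul]
    norm_num
    linarith)

theorem complexLinearPart_apply (P : H →L[ℝ] H) (v : H) : complexLinearPart P v =
    (2⁻¹ : ℝ) • (P v - Complex.I • P (Complex.I • v)) := rfl

theorem complex_eq_of_re {f g : H → ℂ} (hf : ∀ w, f (Complex.I • w) = Complex.I * f w)
    (hg : ∀ w, g (Complex.I • w) = Complex.I * g w) (h : ∀ w, (f w).re = (g w).re) (w : H) :
    f w = g w := by
  apply Complex.ext (h w)
  have := h (Complex.I • w)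
  rw [hf, hg] at this
  simpa using this

theorem exists_modularData (𝓑 M : StarSubalgebra ℂ (H →L[ℂ] H)) (ψ : H)
    (hc : ∀ x ∈ 𝓑, ∀ m ∈ M, Commute x m) : Nonempty (ModularData 𝓑 M ψ) := by
  set U := selfAdjointSpan M ψ with hU
  set P : H →L[ℝ] H := U.starProjection with hP
  have hPs : ∀ u w : H, (⟪P u, w⟫_ℂ).re = (⟪u, P w⟫_ℂ).re := fun u w =>
    U.inner_starProjection_left_eq_right u w
  have hPP : ∀ u, P (P u) = P u := fun u =>
    Submodule.starProjection_eq_self_iff.2 (U.starProjection_apply_mem u)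
  set A := complexLinearPart P with hA
  set C : H →L[ℝ] H := P - A.restrictScalars ℝ with hC
  have hCv : ∀ v, C v = P v - A v := fun v => rfl
  have hAC : ∀ v, P v = A v + C v := fun v => by rw [hCv]; abel
  have hI : ∀ w : H, Complex.I • Complex.I • w = -w := by
    intro w; rw [smul_smul, Complex.I_mul_I, neg_one_smul]
  have hCI : ∀ v, C (Complex.I • v) = -(Complex.I • C v) := by
    intro v
    rw [hCv, hCv, map_smul A, hA, complexLinearPart_apply, smul_sub Complex.I,
      smul_comm Complex.I (2⁻¹ : ℝ), smul_sub Complex.I, hI]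
    module
  have hre : ∀ v w, (⟪A v, w⟫_ℂ).re = (⟪v, A w⟫_ℂ).re := by
    intro v w
    have h1 := hPs v w
    have h2 := hPs (Complex.I • v) (Complex.I • w)
    have h3 : ∀ u w : H, ⟪(2⁻¹ : ℝ) • u, w⟫_ℂ = 2⁻¹ * ⟪u, w⟫_ℂ := by
      intro u w; rw [← Complex.coe_smul, inner_smul_left, Complex.conj_ofReal]; simp
    have h4 : ∀ u w : H, ⟪u, (2⁻¹ : ℝ) • w⟫_ℂ = 2⁻¹ * ⟪u, w⟫_ℂ := by
      intro u w; rw [← Complex.coe_smul, inner_smul_right]; simp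
    simp only [inner_smul_left, inner_smul_right, Complex.conj_I] at h2
    rw [hA, complexLinearPart_apply, complexLinearPart_apply, h3, h4, inner_sub_left,
      inner_sub_right, inner_smul_left, inner_smul_right, Complex.conj_I]
    simp at h1 h2 ⊢
    linarith
  have hAs : IsSelfAdjoint A := by
    rw [ContinuousLinearMap.isSelfAdjoint_iff_isSymmetric]
    intro v w
    exact complex_eq_of_re (f := fun w => ⟪A v, w⟫_ℂ) (g := fun w => ⟪v, A w⟫_ℂ)
      (fun w => by simp) (fun w => by simp) (hre v) w
  have hCs : ∀ v w, ⟪C v, w⟫_ℂ = ⟪C w, v⟫_ℂ := by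
    intro v w
    refine complex_eq_of_re (f := fun w => ⟪C v, w⟫_ℂ) (g := fun w => ⟪C w, v⟫_ℂ)
      (fun w => by simp) (fun w => by simp [hCI, inner_smul_left]) ?_ w
    intro w
    simp only [hCv, inner_sub_left, Complex.sub_re]
    rw [hPs, hre, ← inner_conj_symm v (P w), ← inner_conj_symm v (A w), Complex.conj_re,
      Complex.conj_re]
  have hAre : ∀ v, (⟪A v, v⟫_ℂ).re = 2⁻¹ * (‖P v‖ ^ 2 + ‖P (Complex.I • v)‖ ^ 2) := by
    intro v
    have h1 : ∀ u, (⟪P u, u⟫_ℂ).re = ‖P u‖ ^ 2 := by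
      intro u
      rw [← hPP, hPs, hPP, inner_self_eq_norm_sq_to_K]
      norm_cast
    have h3 : ∀ u w : H, ⟪(2⁻¹ : ℝ) • u, w⟫_ℂ = 2⁻¹ * ⟪u, w⟫_ℂ := by
      intro u w; rw [← Complex.coe_smul, inner_smul_left, Complex.conj_ofReal]; simp
    rw [← h1, ← h1, hA, complexLinearPart_apply, h3, inner_sub_left, inner_smul_left,
      inner_smul_right, Complex.conj_I]
    simp
  have hPn : ∀ v, ‖P v‖ ≤ ‖v‖ := fun v => U.norm_starProjection_apply_le v
  have hlin : ∀ v, A (A v) + C (C v) = A v ∧ A (C v) + C (A v) = C v := by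
    intro v
    have h1 := hPP v
    have h2 := congrArg (fun u => -(Complex.I • u)) (hPP (Complex.I • v))
    simp only [hAC, map_add, map_smul, hCI, map_neg, smul_add, smul_neg, hI, neg_add, neg_neg]
      at h1 h2
    constructor
    · have : (2 : ℝ) • (A (A v) + C (C v)) = (2 : ℝ) • A v := by
        linear_combination (norm := module) h1 + h2
      exact smul_right_injective _ two_ne_zero this
    · have : (2 : ℝ) • (A (C v) + C (A v)) = (2 : ℝ) • C v := by
        linear_combination (norm := module) h1 - h2
      exact smul_right_injective _ two_ne_zero this
  have hsa : ∀ m ∈ M, IsSelfAdjoint m → A (m ψ) + C (m ψ) = m ψ := by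
    intro m hm sm
    rw [← hAC]
    exact Submodule.starProjection_eq_self_iff.2 (mem_selfAdjointSpan hm sm)
  have hsb : ∀ x ∈ 𝓑, IsSelfAdjoint x → C (x ψ) = A (x ψ) := by
    intro x hx sx
    have : P (Complex.I • x ψ) = 0 := by
      rw [hP, Submodule.starProjection_apply, Submodule.orthogonalProjectionOnto_eq_zero_iff.2]
      · rfl
      · rw [Submodule.mem_orthogonal]
        refine selfAdjointSpan_orthogonal ?_
        intro y hy sy
        have h1 : (⟪y ψ, x ψ⟫_ℂ) = starRingEnd ℂ ⟪y ψ, x ψ⟫_ℂ := by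
          rw [inner_conj_symm, inner_apply_of_isSelfAdjoint sy, inner_apply_of_isSelfAdjoint sx]
          exact congrArg _ (DFunLike.congr_fun (hc x hx y hy).eq ψ).symm
        have h2 := congrArg Complex.im h1
        rw [Complex.conj_im] at h2
        rw [inner_smul_right]
        simp only [Complex.mul_re, Complex.I_re, Complex.I_im]
        linarith
    rw [hCv, hA, complexLinearPart_apply, this, smul_zero, sub_zero]
    module
  have hdec : ∀ m : H →L[ℂ] H, m = (realPart m : H →L[ℂ] H) + Complex.I • (imaginaryPart m : H →L[ℂ] H) :=
    fun m => (realPart_add_I_smul_imaginaryPart m).symm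
  have hdec' : ∀ m : H →L[ℂ] H, star m = (realPart m : H →L[ℂ] H) - Complex.I • (imaginaryPart m : H →L[ℂ] H) := by
    intro m
    conv_lhs => rw [hdec m]
    rw [star_add, star_smul, (realPart m).2.star_eq, (imaginaryPart m).2.star_eq]
    simp [sub_eq_add_neg]
  have hmem : ∀ (S : StarSubalgebra ℂ (H →L[ℂ] H)) (m), m ∈ S → (realPart m : H →L[ℂ] H) ∈ S ∧
      (imaginaryPart m : H →L[ℂ] H) ∈ S := by
    intro S m hm
    have h1 : (realPart m : H →L[ℂ] H) ∈ S := by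
      rw [realPart_apply_coe, ← Complex.coe_smul]
      exact SMulMemClass.smul_mem _ (add_mem hm (star_mem hm))
    refine ⟨h1, ?_⟩
    rw [imaginaryPart_apply_coe, ← Complex.coe_smul (2⁻¹ : ℝ)]
    exact SMulMemClass.smul_mem _ (SMulMemClass.smul_mem _ (sub_mem hm (star_mem hm)))
  refine ⟨⟨A, C, hAs, ?_, ?_, hCI, hCs, fun v => (hlin v).1, fun v => (hlin v).2, ?_, ?_, ?_⟩⟩
  · rw [ContinuousLinearMap.nonneg_iff_isPositive, ContinuousLinearMap.isPositive_def']
    refine ⟨hAs, fun v => ?_⟩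
    rw [ContinuousLinearMap.reApplyInnerSelf_apply]
    have := hAre v
    simp only [RCLike.re_to_complex]
    rw [this]; positivity
  · rw [← sub_nonneg, ContinuousLinearMap.nonneg_iff_isPositive, ContinuousLinearMap.isPositive_def']
    refine ⟨(IsSelfAdjoint.one _).sub hAs, fun v => ?_⟩
    rw [ContinuousLinearMap.reApplyInnerSelf_apply, sub_apply, one_apply_eq_self, inner_sub_left,
      inner_self_eq_norm_sq_to_K]
    have := hAre v
    have h1 := hPn v
    have h2 := hPn (Complex.I • v)
    rw [norm_smul, Complex.norm_I, one_mul] at h2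
    have h3 := norm_nonneg (P v)
    have h4 := norm_nonneg (P (Complex.I • v))
    simp only [map_sub, RCLike.re_to_complex]
    rw [this]
    have h5 : ((‖v‖ : ℂ) ^ 2).re = ‖v‖ ^ 2 := by norm_cast
    change 0 ≤ ((‖v‖ : ℂ) ^ 2).re - _
    rw [h5]
    nlinarith
  · intro m hm
    have h1 := hsa _ (hmem M m hm).1 (realPart m).2
    have h2 := hsa _ (hmem M m hm).2 (imaginaryPart m).2
    rw [hdec' m]
    conv_lhs => enter [1, 2]; rw [hdec m]
    conv_rhs => rw [hdec m]
    simp only [add_apply, sub_apply, smul_apply, map_add, map_sub, map_smul, hCI]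
    linear_combination (norm := module) h1 + Complex.I • h2
  · intro x hx
    have h1 := hsb _ (hmem 𝓑 x hx).1 (realPart x).2
    have h2 := hsb _ (hmem 𝓑 x hx).2 (imaginaryPart x).2
    rw [hdec' x]
    conv_lhs => rw [hdec x]
    simp only [add_apply, sub_apply, smul_apply, map_add, map_sub, map_smul, hCI, h1, h2]
    abel
  · intro z hz sz w hw
    rw [← hAC]
    symm
    apply Submodule.eq_starProjection_of_mem_of_inner_eq_zero (mem_selfAdjointSpan hz sz)
    intro u hu
    rw [real_inner_comm]
    refine selfAdjointSpan_orthogonal ?_ u hu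
    intro y hy sy
    rw [inner_sub_right, Complex.sub_re, hw y hy sy, sub_self]

end RealProjection

section RadonNikodym

/-- A functional dominated by a linear map factors through a continuous functional. -/
theorem exists_dual_of_bound {X E : Type*} [AddCommGroup X] [Module ℂ X] [NormedAddCommGroup E]
    [NormedSpace ℂ E] (Θ : X →ₗ[ℂ] E) (ω : X →ₗ[ℂ] ℂ) (c : ℝ) (h : ∀ x, ‖ω x‖ ≤ c * ‖Θ x‖) :
    ∃ ζ : E →L[ℂ] ℂ, ∀ x, ζ (Θ x) = ω x := by
  obtain ⟨g, hg⟩ := Θ.rangeRestrict.exists_rightInverse_of_surjective Θ.range_rangeRestrict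
  have hg' : ∀ z : LinearMap.range Θ, Θ (g z) = z := fun z =>
    congrArg Subtype.val (LinearMap.congr_fun hg z)
  let f : LinearMap.range Θ →L[ℂ] ℂ := (ω ∘ₗ g).mkContinuous c (by
    intro z
    have := h (g z)
    rwa [hg'] at this)
  obtain ⟨ζ, hζ, -⟩ := exists_extension_norm_eq _ f
  refine ⟨ζ, fun x => ?_⟩
  have h1 := hζ ⟨Θ x, x, rfl⟩
  have h2 : f ⟨Θ x, x, rfl⟩ = ω (g ⟨Θ x, x, rfl⟩) := rfl
  have h3 := h (g ⟨Θ x, x, rfl⟩ - x)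
  rw [map_sub, map_sub, hg', sub_self, norm_zero, mul_zero, norm_le_zero_iff, sub_eq_zero] at h3
  exact h1.trans (h2.trans h3)

variable {H : Type*} [NormedAddCommGroup H] [InnerProductSpace ℂ H] [CompleteSpace H]

theorem eq_of_contraction_norm_eq {u : H →L[ℂ] H} (hu : ∀ v, ‖u v‖ ≤ ‖v‖) {z : H}
    (hz : ‖u z‖ = ‖z‖) : star u (u z) = z := by
  have hs : ‖star u (u z)‖ ≤ ‖u z‖ := by
    have : ‖u‖ ≤ 1 := u.opNorm_le_bound zero_le_one (by simpa using hu)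
    have h2 := (star u).le_opNorm (u z)
    rw [norm_star] at h2
    nlinarith [norm_nonneg (u z)]
  have h1 := @norm_sub_sq ℂ _ _ _ _ (star u (u z)) z
  rw [inner_apply_eq_star, star_star, inner_self_eq_norm_sq_to_K] at h1
  have h3 : RCLike.re (((‖u z‖ : ℝ) : ℂ) ^ 2) = ‖u z‖ ^ 2 := by norm_cast
  simp only [Complex.coe_algebraMap] at h1
  rw [h3, hz] at h1
  rw [hz] at hs
  have : ‖star u (u z) - z‖ ^ 2 ≤ 0 := by nlinarith [norm_nonneg (star u (u z))]
  rw [← sub_eq_zero, ← norm_eq_zero]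
  nlinarith [norm_nonneg (star u (u z) - z)]

theorem commute_sqrt_of_commute {a b : H →L[ℂ] H} (ha : 0 ≤ a) (h : Commute a b) :
    Commute (CFC.sqrt a) b := by
  rw [CFC.sqrt_eq_real_sqrt a ha]
  exact h.cfcₙ_real _

theorem sqrt_apply_norm (y : H →L[ℂ] H) (v : H) : ‖CFC.sqrt (star y * y) v‖ = ‖y v‖ := by
  have h0 : 0 ≤ star y * y := star_mul_self_nonneg y
  have h1 := norm_sq_apply (CFC.sqrt (star y * y)) v
  rw [(CFC.sqrt_nonneg (star y * y)).isSelfAdjoint.star_eq, CFC.sqrt_mul_sqrt_self _ h0,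
    ← norm_sq_apply] at h1
  exact (pow_left_inj₀ (norm_nonneg _) (norm_nonneg _) two_ne_zero).1 h1

/-- Polar decomposition with a square root of the modulus, inside a commutant. -/
theorem exists_polar_sqrt (R : Set (H →L[ℂ] H)) (hR : ∀ c ∈ R, star c ∈ R) (y : H →L[ℂ] H)
    (hy : ∀ c ∈ R, Commute c y) : ∃ u k : H →L[ℂ] H, (∀ v, ‖u v‖ ≤ ‖v‖) ∧ IsSelfAdjoint k ∧
      y = u * (k * k) ∧ star u * y = k * k ∧ (∀ c ∈ R, Commute c u) ∧ ∀ c ∈ R, Commute c k := by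
  set G : H →L[ℂ] H := star y * y with hG
  have hG0 : 0 ≤ G := star_mul_self_nonneg y
  set h : H →L[ℂ] H := CFC.sqrt G with hh
  have hh0 : 0 ≤ h := CFC.sqrt_nonneg G
  have hys : ∀ c ∈ R, Commute c (star y) := fun c hc => by
    have := (hy _ (hR c hc)).star_star
    rwa [star_star] at this
  have hGR : ∀ c ∈ R, Commute c G := fun c hc => (hys c hc).mul_right (hy c hc)
  have hhR : ∀ c ∈ R, Commute c h := fun c hc => (commute_sqrt_of_commute hG0 (hGR c hc).symm).symm
  have hn : ∀ v, ‖h v‖ = ‖y v‖ := sqrt_apply_norm y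
  obtain ⟨u, hu, hu1, -, hu2⟩ := exists_douglas_factor y h fun v => (hn v).ge
  have hkk : CFC.sqrt h * CFC.sqrt h = h := CFC.sqrt_mul_sqrt_self h hh0
  refine ⟨u, CFC.sqrt h, hu1, (CFC.sqrt_nonneg h).isSelfAdjoint, ?_, ?_,
    fun c hc => hu2 c (hy c hc) (hhR c hc) (hhR _ (hR c hc)),
    fun c hc => (commute_sqrt_of_commute hh0 (hhR c hc).symm).symm⟩
  · rw [hkk, hu]
  · rw [hkk]
    ext v
    have e : u (h v) = y v := DFunLike.congr_fun hu v
    rw [mul_apply_eq_comp, ← e]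
    exact eq_of_contraction_norm_eq hu1 (by rw [e, hn])

/-- A Radon–Nikodym theorem for a functional given by the commutant. -/
theorem exists_radon_nikodym {𝓑 M : StarSubalgebra ℂ (H →L[ℂ] H)}
    (hM : ∀ y, y ∈ M ↔ ∀ x ∈ 𝓑, Commute x y) (ψ : H) {x' : H →L[ℂ] H} (hx' : x' ∈ 𝓑) {s : ℝ}
    (hs : 0 < s) : ∃ x ∈ M, ∀ y ∈ M,
      ⟪ψ, y (x' ψ)⟫_ℂ = ⟪ψ, y (x ψ)⟫_ℂ + s * ⟪ψ, x (y ψ)⟫_ℂ := by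
  set N : Submodule ℂ (H →L[ℂ] H) := M.toSubalgebra.toSubmodule with hN
  have hmN : ∀ y, y ∈ N ↔ y ∈ M := fun y => Iff.rfl
  let L : (H →L[ℂ] H) →ₗ[ℂ] ((H →L[ℂ] H) →L[ℂ] ℂ) :=
    { toFun := fun y => (innerSL ℂ ψ ∘L y) ∘L ContinuousLinearMap.apply ℂ H ψ +
        (s : ℂ) • (innerSL ℂ ψ ∘L ContinuousLinearMap.apply ℂ H (y ψ))
      map_add' := fun a b => by ext m; simp; ring
      map_smul' := fun c a => by ext m; simp; ring }
  have hL : ∀ y m, L y m = ⟪ψ, y (m ψ)⟫_ℂ + s * ⟪ψ, m (y ψ)⟫_ℂ := fun y m => by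
    simp [L]
  let Θ : N →ₗ[ℂ] (N →L[ℂ] ℂ) :=
    { toFun := fun y => (L y) ∘L N.subtypeL
      map_add' := fun a b => by ext m; simp
      map_smul' := fun c a => by ext m; simp }
  have hΘ : ∀ y m : N, Θ y m = ⟪ψ, (y : H →L[ℂ] H) ((m : H →L[ℂ] H) ψ)⟫_ℂ +
      s * ⟪ψ, (m : H →L[ℂ] H) ((y : H →L[ℂ] H) ψ)⟫_ℂ := fun y m => hL y m
  let ω : N →ₗ[ℂ] ℂ :=
    { toFun := fun y => ⟪ψ, (y : H →L[ℂ] H) (x' ψ)⟫_ℂ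
      map_add' := fun a b => by simp
      map_smul' := fun c a => by simp }
  have hbound : ∀ y, ‖ω y‖ ≤ (‖x'‖ * (1 + s⁻¹)) * ‖Θ y‖ := by
    rintro ⟨y, hy⟩
    obtain ⟨u, k, hu, hk, hyu, huy, hu2, hk2⟩ := exists_polar_sqrt (𝓑 : Set (H →L[ℂ] H))
      (fun c hc => star_mem hc) y ((hM y).1 hy)
    have hus : star u ∈ M := star_mem ((hM u).2 hu2)
    set α := ‖k (star u ψ)‖ with hα
    set β := ‖k ψ‖ with hβ
    have e1 : Θ ⟨y, hy⟩ ⟨star u, hus⟩ = ((α ^ 2 + s * β ^ 2 : ℝ) : ℂ) := by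
      rw [hΘ]
      change ⟪ψ, y (star u ψ)⟫_ℂ + s * ⟪ψ, star u (y ψ)⟫_ℂ = _
      have h1 : star u (y ψ) = k (k ψ) := DFunLike.congr_fun huy ψ
      have h2 : y (star u ψ) = u (k (k (star u ψ))) := DFunLike.congr_fun hyu _
      rw [h1, h2]
      have h3 : ⟪ψ, u (k (k (star u ψ)))⟫_ℂ = ⟪k (star u ψ), k (star u ψ)⟫_ℂ := by
        rw [inner_apply_of_isSelfAdjoint hk, inner_apply_eq_star, star_star]
      rw [h3, ← inner_apply_of_isSelfAdjoint hk ψ, inner_self_eq_norm_sq_to_K,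
        inner_self_eq_norm_sq_to_K]
      push_cast
      rfl
    have e2 : ‖(⟨star u, hus⟩ : N)‖ ≤ 1 := by
      change ‖star u‖ ≤ 1
      rw [norm_star]
      exact u.opNorm_le_bound zero_le_one (by simpa using hu)
    have e3 : α ^ 2 + s * β ^ 2 ≤ ‖Θ ⟨y, hy⟩‖ := by
      have := (Θ ⟨y, hy⟩).le_opNorm ⟨star u, hus⟩
      rw [e1, Complex.norm_real, Real.norm_of_nonneg (by positivity)] at this
      nlinarith [norm_nonneg (Θ ⟨y, hy⟩)]
    have e4 : ‖ω ⟨y, hy⟩‖ ≤ α * (‖x'‖ * β) := by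
      change ‖⟪ψ, y (x' ψ)⟫_ℂ‖ ≤ _
      have h2 : y (x' ψ) = u (k (k (x' ψ))) := DFunLike.congr_fun hyu _
      have h4 : k (x' ψ) = x' (k ψ) := (DFunLike.congr_fun (hk2 x' hx').eq ψ).symm
      have h3 : ⟪ψ, y (x' ψ)⟫_ℂ = ⟪k (star u ψ), x' (k ψ)⟫_ℂ := by
        rw [h2, inner_apply_of_isSelfAdjoint hk, inner_apply_eq_star, star_star, ← h4]
      rw [h3]
      exact (norm_inner_le_norm _ _).trans
        (mul_le_mul_of_nonneg_left (x'.le_opNorm _) (norm_nonneg _))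
    have e5 : α * β ≤ (1 + s⁻¹) * (α ^ 2 + s * β ^ 2) := by
      have h1 : (1 + s⁻¹) * (α ^ 2 + s * β ^ 2) = α ^ 2 + s * β ^ 2 + s⁻¹ * α ^ 2 + β ^ 2 := by
        field_simp
        ring
      rw [h1]
      have h2 : 0 ≤ s * β ^ 2 := by positivity
      have h3 : 0 ≤ s⁻¹ * α ^ 2 := by positivity
      nlinarith [sq_nonneg (α - β), sq_nonneg α, sq_nonneg β]
    calc ‖ω ⟨y, hy⟩‖ ≤ ‖x'‖ * (α * β) := e4.trans (le_of_eq (by ring))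
      _ ≤ ‖x'‖ * ((1 + s⁻¹) * (α ^ 2 + s * β ^ 2)) := by gcongr
      _ ≤ ‖x'‖ * ((1 + s⁻¹) * ‖Θ ⟨y, hy⟩‖) := by gcongr
      _ = _ := by ring
  obtain ⟨ζ, hζ⟩ := exists_dual_of_bound (E := N →L[ℂ] ℂ) Θ ω _ hbound
  let F : H → H → (N →L[ℂ] ℂ) := fun v w =>
    (innerSL ℂ v ∘L ContinuousLinearMap.apply ℂ H w) ∘L N.subtypeL
  have hF : ∀ v w m, F v w m = ⟪v, (m : H →L[ℂ] H) w⟫_ℂ := fun v w m => rfl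
  have hFn : ∀ v w, ‖F v w‖ ≤ ‖v‖ * ‖w‖ := fun v w => by
    refine ContinuousLinearMap.opNorm_le_bound _ (by positivity) fun m => ?_
    rw [hF]
    calc _ ≤ ‖v‖ * ‖(m : H →L[ℂ] H) w‖ := norm_inner_le_norm _ _
      _ ≤ ‖v‖ * (‖m‖ * ‖w‖) := by gcongr; exact (m : H →L[ℂ] H).le_opNorm w
      _ = _ := by ring
  let S : H →L⋆[ℂ] H →L[ℂ] ℂ := LinearMap.mkContinuous₂
    (LinearMap.mk₂'ₛₗ (starRingEnd ℂ) (RingHom.id ℂ) (fun v w => ζ (F v w))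
      (fun a b w => by rw [← map_add]; congr 1; ext m; simp [hF])
      (fun c a w => by rw [← map_smul]; congr 1; ext m; simp [hF, mul_comm])
      (fun a b w => by rw [← map_add]; congr 1; ext m; simp [hF])
      (fun c a w => by rw [← map_smul]; congr 1; ext m; simp [hF]))
    ‖ζ‖ (fun v w => by
      have := ζ.le_opNorm (F v w)
      calc _ ≤ _ := this
        _ ≤ ‖ζ‖ * (‖v‖ * ‖w‖) := by gcongr; exact hFn v w
        _ = _ := by ring)
  have hS : ∀ v w, S v w = ζ (F v w) := fun v w => rfl
  let x : H →L[ℂ] H := star (InnerProductSpace.continuousLinearMapOfBilin S)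
  have hx : ∀ v w, ⟪v, x w⟫_ℂ = ζ (F v w) := by
    intro v w
    rw [← inner_conj_symm, inner_apply_eq_star, star_star, inner_conj_symm,
      InnerProductSpace.continuousLinearMapOfBilin_apply, hS]
  refine ⟨x, (hM x).2 fun b hb => ?_, fun y hy => ?_⟩
  · ext w
    refine ext_inner_left ℂ fun v => ?_
    change ⟪v, b (x w)⟫_ℂ = ⟪v, x (b w)⟫_ℂ
    rw [← star_star b, ← inner_apply_eq_star, hx, hx, star_star]
    congr 1
    ext ⟨m, hm⟩
    rw [hF, hF, inner_apply_eq_star, star_star]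
    exact congrArg _ (DFunLike.congr_fun ((hM m).1 hm b hb).eq w)
  · have h1 := hζ ⟨y, hy⟩
    have h2 : Θ ⟨y, hy⟩ = F (star y ψ) ψ + (s : ℂ) • F ψ (y ψ) := by
      ext m
      rw [hΘ, add_apply, smul_apply, hF, hF, inner_apply_eq_star, star_star]
      rfl
    rw [h2, map_add, map_smul, ← hx, ← hx, inner_apply_eq_star, star_star] at h1
    exact h1.symm

end RadonNikodym

section DualMap
variable {H : Type*} [NormedAddCommGroup H] [InnerProductSpace ℂ H] [CompleteSpace H]

theorem denseRange_of_selfAdjoint_injective {x : H →L[ℂ] H} (hx : IsSelfAdjoint x)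
    (h : ∀ v, x v = 0 → v = 0) : DenseRange x := by
  have : (LinearMap.range x.toLinearMap).topologicalClosure = ⊤ := by
    rw [Submodule.topologicalClosure_eq_top_iff, Submodule.eq_bot_iff]
    intro v hv
    apply h
    rw [Submodule.mem_orthogonal] at hv
    have := hv (x (x v)) ⟨x v, rfl⟩
    rw [inner_apply_of_isSelfAdjoint hx] at this
    exact inner_self_eq_zero.1 this
  rw [DenseRange, dense_iff_closure_eq]
  have h2 := congrArg (fun W : Submodule ℂ H => (W : Set H)) this
  exact h2

theorem eq_zero_of_dense_inner {s : Set H} (hs : Dense s) {v : H} (h : ∀ w ∈ s, ⟪v, w⟫_ℂ = 0) :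
    v = 0 := by
  have : ∀ w, ⟪v, w⟫_ℂ = 0 := fun w =>
    hs.induction (P := fun w => ⟪v, w⟫_ℂ = 0) h (isClosed_eq (by fun_prop) (by fun_prop)) w
  exact inner_self_eq_zero.1 (this v)

theorem conj_inner_two (u : H) (a b : H →L[ℂ] H) :
    starRingEnd ℂ ⟪u, a (b u)⟫_ℂ = ⟪u, star b (star a u)⟫_ℂ := by
  rw [inner_conj_symm, inner_apply_eq_star, inner_apply_eq_star]

theorem conj_inner_three (u : H) (a b c : H →L[ℂ] H) :
    starRingEnd ℂ ⟪u, a (b (c u))⟫_ℂ = ⟪u, star c (star b (star a u))⟫_ℂ := by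
  rw [inner_conj_symm, inner_apply_eq_star, inner_apply_eq_star, inner_apply_eq_star]

theorem mem_re_im (S : StarSubalgebra ℂ (H →L[ℂ] H)) {m : H →L[ℂ] H} (hm : m ∈ S) :
    ∃ a ∈ S, ∃ b ∈ S, IsSelfAdjoint a ∧ IsSelfAdjoint b ∧ m = a + Complex.I • b := by
  refine ⟨realPart m, ?_, imaginaryPart m, ?_, (realPart m).2, (imaginaryPart m).2,
    (realPart_add_I_smul_imaginaryPart m).symm⟩
  · rw [realPart_apply_coe, ← Complex.coe_smul]
    exact SMulMemClass.smul_mem _ (add_mem hm (star_mem hm))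
  · rw [imaginaryPart_apply_coe, ← Complex.coe_smul (2⁻¹ : ℝ)]
    exact SMulMemClass.smul_mem _ (SMulMemClass.smul_mem _ (sub_mem hm (star_mem hm)))

namespace ModularData
variable {𝓑 M : StarSubalgebra ℂ (H →L[ℂ] H)} {ψ : H} (md : ModularData 𝓑 M ψ)

theorem C_smul (c : ℂ) (v : H) : md.C (c • v) = starRingEnd ℂ c • md.C v := by
  have : c • v = c.re • v + c.im • (Complex.I • v) := by
    conv_lhs => rw [← Complex.re_add_im c, add_smul, mul_smul]
    simp
  rw [this, map_add, map_smul, map_smul, md.C_I]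
  have h2 : starRingEnd ℂ c • md.C v = c.re • md.C v - c.im • (Complex.I • md.C v) := by
    conv_lhs => rw [← Complex.re_add_im c]
    rw [map_add, map_mul, Complex.conj_ofReal, Complex.conj_ofReal, Complex.conj_I, add_smul,
      mul_smul, neg_smul, smul_neg]
    simp [sub_eq_add_neg]
  rw [h2]; module

theorem half : md.A ψ = (2⁻¹ : ℂ) • ψ ∧ md.C ψ = (2⁻¹ : ℂ) • ψ := by
  have h1 := md.map_commutant 1 (one_mem _)
  have h2 := md.map_algebra 1 (one_mem _)
  simp only [star_one, one_apply_eq_self] at h1 h2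
  rw [h2, ← two_smul ℂ] at h1
  have h3 : md.A ψ = (2⁻¹ : ℂ) • ψ := by
    conv_rhs => rw [← h1]
    rw [smul_smul]; norm_num
  exact ⟨h3, h2.trans h3⟩

theorem C_C (v : H) : md.C (md.C v) = (md.A - md.A * md.A) v := by
  have := md.sq_add_sq v
  rw [sub_apply, mul_apply_eq_comp, eq_sub_iff_add_eq, add_comm, this]

theorem inner_C_C (v w : H) : ⟪md.C v, md.C w⟫_ℂ = ⟪(md.A - md.A * md.A) w, v⟫_ℂ := by
  rw [md.C_symm, md.C_C]

theorem C_eq_zero {v : H} (h : (md.A - md.A * md.A) v = 0) : md.C v = 0 := by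
  have := md.inner_C_C v v
  rw [h, inner_zero_left] at this
  exact inner_self_eq_zero.1 this

theorem injective (hBd : Dense {v | ∃ x ∈ 𝓑, v = x ψ}) (hMd : Dense {v | ∃ m ∈ M, v = m ψ})
    {v : H} (h : (md.A - md.A * md.A) v = 0) : v = 0 := by
  have hC := md.C_eq_zero h
  have key1 : ∀ v, md.A v = 0 → md.C v = 0 → v = 0 := by
    intro v hA hC
    refine eq_zero_of_dense_inner hMd ?_
    rintro _ ⟨m, hm, rfl⟩
    rw [← md.map_commutant m hm, inner_add_right, ← inner_apply_of_isSelfAdjoint md.A_selfAdjoint,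
      hA, ← inner_conj_symm v (md.C _), md.C_symm, hC]
    simp
  have key2 : ∀ v, md.A v = v → md.C v = 0 → v = 0 := by
    intro v hA hC
    refine eq_zero_of_dense_inner hBd ?_
    rintro _ ⟨x, hx, rfl⟩
    have h1 := md.map_algebra (star x) (star_mem hx)
    rw [star_star] at h1
    have h2 : ⟪v, x ψ⟫_ℂ = ⟪v, md.A (x ψ)⟫_ℂ := by
      rw [← inner_apply_of_isSelfAdjoint md.A_selfAdjoint, hA]
    rw [h2, ← h1, ← inner_conj_symm v (md.C _), md.C_symm, hC]
    simp
  have hw : md.A v = v := by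
    rw [← sub_eq_zero]
    apply key1
    · rw [map_sub, ← neg_eq_zero, neg_sub]; exact h
    · have := md.anti v
      rw [hC, map_zero, zero_add] at this
      rw [map_sub, this, hC, sub_zero]
  exact key2 v hw hC

theorem exists_selfAdjoint_image (hM : ∀ y, y ∈ M ↔ ∀ x ∈ 𝓑, Commute x y)
    {z' : H →L[ℂ] H} (hz : z' ∈ 𝓑) (sz : IsSelfAdjoint z') :
    ∃ z ∈ M, IsSelfAdjoint z ∧ md.A (z' ψ) = z ψ ∧ md.C (z' ψ) = z ψ ∧
      ∀ w ∈ M, ⟪ψ, w (z' ψ)⟫_ℂ = ⟪ψ, w (z ψ)⟫_ℂ + ⟪ψ, z (w ψ)⟫_ℂ := by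
  obtain ⟨x, hx, hxe⟩ := exists_radon_nikodym hM ψ hz one_pos
  simp only [Complex.ofReal_one, one_mul] at hxe
  have hxs : ∀ w ∈ M, ⟪ψ, w (z' ψ)⟫_ℂ = ⟪ψ, w (star x ψ)⟫_ℂ + ⟪ψ, star x (w ψ)⟫_ℂ := by
    intro w hw
    have h1 := congrArg (starRingEnd ℂ) (hxe (star w) (star_mem hw))
    rw [map_add, conj_inner_two, conj_inner_two, conj_inner_two, star_star, sz.star_eq, add_comm] at h1
    have h2 : z' (w ψ) = w (z' ψ) := DFunLike.congr_fun ((hM w).1 hw z' hz).eq ψ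
    rw [h2] at h1; linear_combination h1
  have hhalf : ∀ u v : H, ⟪u, (2⁻¹ : ℂ) • v⟫_ℂ = 2⁻¹ * ⟪u, v⟫_ℂ := fun u v => inner_smul_right _ _ _
  set z : H →L[ℂ] H := (2⁻¹ : ℂ) • (x + star x) with hzd
  have hzM : z ∈ M := SMulMemClass.smul_mem _ (add_mem hx (star_mem hx))
  have hzs : IsSelfAdjoint z := by
    rw [IsSelfAdjoint, hzd, star_smul, star_add, star_star, add_comm]
    simp
  have hze : ∀ w ∈ M, ⟪ψ, w (z' ψ)⟫_ℂ = ⟪ψ, w (z ψ)⟫_ℂ + ⟪ψ, z (w ψ)⟫_ℂ := by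
    intro w hw
    have h1 := hxe w hw
    have h2 := hxs w hw
    simp only [hzd, smul_apply, add_apply, map_smul, map_add, hhalf, inner_add_right]
    linear_combination (1 / 2 : ℂ) * h1 + (1 / 2 : ℂ) * h2
  have hCA : md.C (z' ψ) = md.A (z' ψ) := by
    rw [md.map_algebra z' hz, sz.star_eq]
  have hzA := md.eq_of_re z hzM hzs ((2⁻¹ : ℂ) • z' ψ) (by
    intro y hy sy
    rw [hhalf, inner_apply_of_isSelfAdjoint sy, hze y hy, inner_apply_of_isSelfAdjoint sy]
    have h1 : ⟪ψ, z (y ψ)⟫_ℂ = starRingEnd ℂ ⟪ψ, y (z ψ)⟫_ℂ := by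
      rw [inner_conj_symm, inner_apply_of_isSelfAdjoint sy, inner_apply_of_isSelfAdjoint hzs]
    rw [h1, Complex.add_conj]
    have : (2 : ℂ)⁻¹ * ((2 * (⟪ψ, y (z ψ)⟫_ℂ).re : ℝ) : ℂ) = ((⟪ψ, y (z ψ)⟫_ℂ).re : ℂ) := by
      push_cast; ring
    rw [this, Complex.ofReal_re])
  rw [map_smul, md.C_smul, hCA] at hzA
  have : md.A (z' ψ) = z ψ := by
    rw [hzA, ← add_smul]
    have : (2⁻¹ + (starRingEnd ℂ) 2⁻¹ : ℂ) = 1 := by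
      rw [map_inv₀, map_ofNat]; norm_num
    rw [this, one_smul]
  exact ⟨z, hzM, hzs, this, hCA.trans this, hze⟩

theorem inner_C_conj (hM : ∀ y, y ∈ M ↔ ∀ x ∈ 𝓑, Commute x y)
    (hBd : Dense {v | ∃ x ∈ 𝓑, v = x ψ}) {x' : H →L[ℂ] H} (hx' : x' ∈ 𝓑) {s : ℝ} (hs : 0 < s) :
    ∃ x ∈ M, ∀ f g, ⟪md.C f, x' (md.C g)⟫_ℂ =
      ⟪g, md.A (x (f - md.A f)) + (s : ℂ) • (x (md.A f) - md.A (x (md.A f)))⟫_ℂ := by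
  obtain ⟨x, hx, hxe⟩ := exists_radon_nikodym hM ψ hx' hs
  refine ⟨x, hx, ?_⟩
  have hsa : ∀ z' ∈ 𝓑, IsSelfAdjoint z' → ∀ y' ∈ 𝓑, IsSelfAdjoint y' →
      ⟪md.C (z' ψ), x' (md.C (y' ψ))⟫_ℂ = ⟪y' ψ, md.A (x (z' ψ - md.A (z' ψ))) +
        (s : ℂ) • (x (md.A (z' ψ)) - md.A (x (md.A (z' ψ))))⟫_ℂ := by
    intro z' hz' sz' y' hy' sy'
    obtain ⟨z, hz, sz, Az, Cz, ez⟩ := md.exists_selfAdjoint_image hM hz' sz'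
    obtain ⟨y, hy, sy, Ay, Cy, ey⟩ := md.exists_selfAdjoint_image hM hy' sy'
    have h1 := ez (y * x) (mul_mem hy hx)
    have h2 := congrArg (starRingEnd ℂ) (ey (z * star x) (mul_mem hz (star_mem hx)))
    have h3 := hxe (z * y) (mul_mem hz hy)
    simp only [mul_apply_eq_comp] at h1 h2 h3
    rw [map_add, conj_inner_three, conj_inner_three, conj_inner_three, star_star, sz.star_eq,
      sy.star_eq, sy'.star_eq] at h2
    have e1 : x' (y ψ) = y (x' ψ) := DFunLike.congr_fun ((hM y).1 hy x' hx').eq ψ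
    have e2 : ∀ u, ⟪y' ψ, md.A u⟫_ℂ = ⟪ψ, y u⟫_ℂ := fun u => by
      rw [← inner_apply_of_isSelfAdjoint md.A_selfAdjoint, Ay, inner_apply_of_isSelfAdjoint sy]
    rw [Az, Cz, Cy, inner_add_right, inner_smul_right, inner_sub_right, e2, e2,
      inner_apply_of_isSelfAdjoint sz, e1, inner_apply_of_isSelfAdjoint sy', map_sub, map_sub,
      inner_sub_right]
    linear_combination h3 - h1 - s * h2
  set D : H → H → ℂ := fun f g => ⟪md.C f, x' (md.C g)⟫_ℂ -
    ⟪g, md.A (x (f - md.A f)) + (s : ℂ) • (x (md.A f) - md.A (x (md.A f)))⟫_ℂ with hD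
  have hD1 : ∀ f f' g, D (f + Complex.I • f') g = D f g + Complex.I * D f' g := by
    intro f f' g
    simp only [hD, map_add, map_smul, md.C_smul, inner_add_left, inner_add_right, inner_smul_left,
      inner_smul_right, map_sub, inner_sub_right, map_neg, neg_neg, Complex.conj_I]
    ring
  have hD2 : ∀ f g g', D f (g + Complex.I • g') = D f g - Complex.I * D f g' := by
    intro f g g'
    simp only [hD, map_add, map_smul, md.C_smul, inner_add_left, inner_add_right, inner_smul_left,
      inner_smul_right, map_sub, inner_sub_right, Complex.conj_I]
    ring
  have hc1 : ∀ g, Continuous fun f => D f g := fun g => by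
    simp only [hD]; fun_prop
  have hc2 : ∀ f, Continuous fun g => D f g := fun f => by
    simp only [hD]; fun_prop
  have hsa' : ∀ z' ∈ 𝓑, IsSelfAdjoint z' → ∀ y' ∈ 𝓑, IsSelfAdjoint y' → D (z' ψ) (y' ψ) = 0 :=
    fun z' h1 h2 y' h3 h4 => sub_eq_zero.2 (hsa z' h1 h2 y' h3 h4)
  have hstep : ∀ y' ∈ 𝓑, IsSelfAdjoint y' → ∀ f, D f (y' ψ) = 0 := by
    intro y' hy' sy' f
    refine hBd.induction (P := fun f => D f (y' ψ) = 0) ?_ (isClosed_eq (hc1 _) continuous_const) f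
    rintro _ ⟨z, hz, rfl⟩
    obtain ⟨a, ha, b, hb, sa, sb, rfl⟩ := mem_re_im 𝓑 hz
    rw [add_apply, smul_apply, hD1, hsa' a ha sa y' hy' sy', hsa' b hb sb y' hy' sy']
    simp
  intro f g
  rw [← sub_eq_zero]
  refine hBd.induction (P := fun g => D f g = 0) ?_ (isClosed_eq (hc2 _) continuous_const) g
  rintro _ ⟨z, hz, rfl⟩
  obtain ⟨a, ha, b, hb, sa, sb, rfl⟩ := mem_re_im 𝓑 hz
  rw [add_apply, smul_apply, hD2, hstep a ha sa, hstep b hb sb]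
  simp

theorem A_sub_sq_nonneg : 0 ≤ md.A - md.A * md.A := by
  rw [ContinuousLinearMap.nonneg_iff_isPositive, ContinuousLinearMap.isPositive_def']
  refine ⟨md.A_selfAdjoint.sub ?_, fun v => ?_⟩
  · rw [IsSelfAdjoint, star_mul, md.A_selfAdjoint.star_eq]
  · rw [ContinuousLinearMap.reApplyInnerSelf_apply, ← md.inner_C_C, inner_self_eq_norm_sq_to_K]
    have : RCLike.re (((‖md.C v‖ : ℝ) : ℂ) ^ 2) = ‖md.C v‖ ^ 2 := by norm_cast
    exact this ▸ sq_nonneg _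

/-- The square root of `A (1 - A)`. -/
noncomputable def T : H →L[ℂ] H := CFC.sqrt (md.A - md.A * md.A)

theorem T_nonneg : 0 ≤ md.T := CFC.sqrt_nonneg _

theorem T_selfAdjoint : IsSelfAdjoint md.T := md.T_nonneg.isSelfAdjoint

theorem T_mul_T : md.T * md.T = md.A - md.A * md.A := CFC.sqrt_mul_sqrt_self _ md.A_sub_sq_nonneg

theorem T_psi : md.T ψ = (2⁻¹ : ℂ) • ψ := by
  have h1 : md.T (md.T ψ) = (4⁻¹ : ℂ) • ψ := by
    have := DFunLike.congr_fun md.T_mul_T ψ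
    rw [mul_apply_eq_comp, sub_apply, mul_apply_eq_comp, md.half.1, map_smul, md.half.1,
      smul_smul, ← sub_smul] at this
    rw [this]; norm_num
  set w := md.T ψ - (2⁻¹ : ℂ) • ψ with hw
  have h2 : md.T w = -((2⁻¹ : ℂ) • w) := by
    rw [hw, map_sub, h1, map_smul, smul_sub, smul_smul]
    norm_num
  have h3 := inner_nonneg_of_nonneg md.T_nonneg w
  rw [h2, inner_neg_right, inner_smul_right, inner_self_eq_norm_sq_to_K] at h3
  have h4 : (-((2⁻¹ : ℂ) * ((‖w‖ : ℝ) : ℂ) ^ 2)).re = -(2⁻¹ * ‖w‖ ^ 2) := by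
    rw [show (-((2⁻¹ : ℂ) * ((‖w‖ : ℝ) : ℂ) ^ 2)) = ((-(2⁻¹ * ‖w‖ ^ 2) : ℝ) : ℂ) by push_cast; ring,
      Complex.ofReal_re]
  have h5 : 0 ≤ -(2⁻¹ * ‖w‖ ^ 2) := h4 ▸ h3
  have h6 : ‖w‖ = 0 := by nlinarith [norm_nonneg w]
  exact sub_eq_zero.1 (norm_eq_zero.1 h6)

theorem denseRange_T (hBd : Dense {v | ∃ x ∈ 𝓑, v = x ψ}) (hMd : Dense {v | ∃ m ∈ M, v = m ψ}) :
    DenseRange md.T := by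
  refine denseRange_of_selfAdjoint_injective md.T_selfAdjoint fun v hv => ?_
  refine md.injective hBd hMd ?_
  rw [← md.T_mul_T, mul_apply_eq_comp, hv, map_zero]

theorem exists_dual_map (hM : ∀ y, y ∈ M ↔ ∀ x ∈ 𝓑, Commute x y)
    (hBd : Dense {v | ∃ x ∈ 𝓑, v = x ψ}) (hMd : Dense {v | ∃ m ∈ M, v = m ψ}) :
    ∃ y : (H →L[ℂ] H) →ₗ[ℂ] (H →L[ℂ] H), y 1 = 1 ∧ (∀ x, 0 ≤ x → 0 ≤ y x) ∧
      (∀ x ∈ 𝓑, md.T (y x ψ) = md.A (x ψ)) ∧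
      ∀ x ∈ 𝓑, ∀ s : ℝ, 0 < s → ∃ z ∈ M, md.T * y x * md.T =
        md.A * z * (1 - md.A) + (s : ℂ) • ((1 - md.A) * z * md.A) := by
  have hT := md.denseRange_T hBd hMd
  let C' : H →ₛₗ[starRingEnd ℂ] H :=
    { toFun := md.C, map_add' := map_add md.C, map_smul' := md.C_smul }
  have hTC : ∀ v, ‖C' v‖ ≤ 1 * ‖md.T.toLinearMap v‖ := by
    intro v
    rw [one_mul]
    refine le_of_sq_le_sq (le_of_eq ?_) (norm_nonneg _)
    change ‖md.C v‖ ^ 2 = ‖md.T v‖ ^ 2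
    rw [norm_sq_apply, md.T_selfAdjoint.star_eq, md.T_mul_T]
    have := congrArg Complex.re (md.inner_C_C v v)
    rw [inner_self_eq_norm_sq_to_K] at this
    have h2 : (((‖md.C v‖ : ℝ) : ℂ) ^ 2).re = ‖md.C v‖ ^ 2 := by norm_cast
    rw [← h2, ← inner_conj_symm v, Complex.conj_re]
    exact this
  set J : H →L⋆[ℂ] H := C'.extendOfNorm md.T.toLinearMap with hJ
  have hJT : ∀ v, J (md.T v) = md.C v := fun v =>
    LinearMap.extendOfNorm_eq (f := C') (e := md.T.toLinearMap) hT ⟨1, hTC⟩ v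
  have hJn : ∀ v, ‖J v‖ ≤ ‖v‖ := fun v => by
    have := LinearMap.norm_extendOfNorm_apply_le (f := C') (e := md.T.toLinearMap) hT 1 hTC v
    rwa [one_mul] at this
  let S : (H →L[ℂ] H) → H →L⋆[ℂ] H →L[ℂ] ℂ := fun x => LinearMap.mkContinuous₂
    (LinearMap.mk₂'ₛₗ (starRingEnd ℂ) (RingHom.id ℂ) (fun u v => ⟪J v, x (J u)⟫_ℂ)
      (fun a b w => by simp)
      (fun c a w => by simp [mul_comm])
      (fun a b w => by simp)
      (fun c a w => by simp [mul_comm]))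
    ‖x‖ (fun u v => by
      calc _ ≤ ‖J v‖ * ‖x (J u)‖ := norm_inner_le_norm _ _
        _ ≤ ‖v‖ * (‖x‖ * ‖u‖) := by
          gcongr
          · exact hJn v
          · exact (x.le_opNorm _).trans (by gcongr; exact hJn u)
        _ = _ := by ring)
  have hS : ∀ x u v, S x u v = ⟪J v, x (J u)⟫_ℂ := fun x u v => rfl
  let Y : (H →L[ℂ] H) → (H →L[ℂ] H) := fun x =>
    star (InnerProductSpace.continuousLinearMapOfBilin (S x))
  have hY : ∀ x u v, ⟪u, Y x v⟫_ℂ = ⟪J v, x (J u)⟫_ℂ := by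
    intro x u v
    rw [← inner_conj_symm, inner_apply_eq_star, star_star, inner_conj_symm,
      InnerProductSpace.continuousLinearMapOfBilin_apply, hS]
  have hext : ∀ a b : H →L[ℂ] H, (∀ u v, ⟪u, a v⟫_ℂ = ⟪u, b v⟫_ℂ) → a = b := fun a b h => by
    ext v; exact ext_inner_left ℂ fun u => h u v
  let y : (H →L[ℂ] H) →ₗ[ℂ] (H →L[ℂ] H) :=
    { toFun := Y
      map_add' := fun a b => hext _ _ fun u v => by
        rw [hY, add_apply, add_apply, inner_add_right, inner_add_right, hY, hY]
      map_smul' := fun c a => hext _ _ fun u v => by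
        rw [hY, RingHom.id_apply, smul_apply, smul_apply, inner_smul_right, inner_smul_right, hY] }
  have hy : ∀ x u v, ⟪u, y x v⟫_ℂ = ⟪J v, x (J u)⟫_ℂ := hY
  have hJψ : J ψ = ψ := by
    have h1 := hJT ((2 : ℂ) • ψ)
    rw [map_smul, md.T_psi, smul_smul, md.C_smul, md.half.2, smul_smul, map_ofNat] at h1
    norm_num at h1
    exact h1
  refine ⟨y, hext _ _ fun u v => ?_, fun x hx => ?_, fun x hx => ?_, fun x hx s hs => ?_⟩
  · rw [hy, one_apply_eq_self, one_apply_eq_self]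
    refine hT.induction (P := fun u => ⟪J v, J u⟫_ℂ = ⟪u, v⟫_ℂ) ?_
      (isClosed_eq (by fun_prop) (by fun_prop)) u
    rintro _ ⟨a, rfl⟩
    refine hT.induction (P := fun v => ⟪J v, J (md.T a)⟫_ℂ = ⟪md.T a, v⟫_ℂ) ?_
      (isClosed_eq (by fun_prop) (by fun_prop)) v
    rintro _ ⟨b, rfl⟩
    rw [hJT, hJT, md.inner_C_C, ← md.T_mul_T, mul_apply_eq_comp,
      inner_apply_of_isSelfAdjoint md.T_selfAdjoint]
  · have hp := (ContinuousLinearMap.nonneg_iff_isPositive _).1 hx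
    have hcomp : ∀ u v, ⟪y x u, v⟫_ℂ = ⟪u, y x v⟫_ℂ := by
      intro u v
      rw [← inner_conj_symm, hy, hy, inner_conj_symm,
        inner_apply_of_isSelfAdjoint hx.isSelfAdjoint]
    rw [ContinuousLinearMap.nonneg_iff_isPositive, ContinuousLinearMap.isPositive_def']
    refine ⟨ContinuousLinearMap.isSelfAdjoint_iff_isSymmetric.2 hcomp, fun v => ?_⟩
    rw [ContinuousLinearMap.reApplyInnerSelf_apply, hcomp, hy]
    exact inner_nonneg_of_nonneg hx (J v)
  · refine ext_inner_left ℂ fun u => ?_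
    rw [← inner_apply_of_isSelfAdjoint md.T_selfAdjoint, hy, hJψ, hJT]
    have h1 := md.map_algebra (star x) (star_mem hx)
    rw [star_star] at h1
    rw [← h1, ← inner_conj_symm u, md.C_symm, inner_conj_symm, inner_apply_eq_star, star_star]
  · obtain ⟨z, hz, he⟩ := md.inner_C_conj hM hBd hx hs
    refine ⟨z, hz, hext _ _ fun u v => ?_⟩
    rw [mul_apply_eq_comp, mul_apply_eq_comp, ← inner_apply_of_isSelfAdjoint md.T_selfAdjoint, hy,
      hJT, hJT, he]
    simp only [add_apply, smul_apply, mul_apply_eq_comp, sub_apply, one_apply_eq_self]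

end ModularData
end DualMap

section Sech
open MeasureTheory Set

theorem integrable_inv_cosh : Integrable fun t : ℝ => (Real.cosh (Real.pi * t))⁻¹ := by
  refine integrable_inv_one_add_sq.mono' (by
    refine Continuous.aestronglyMeasurable ?_
    exact (Real.continuous_cosh.comp (by fun_prop)).inv₀ fun x => (Real.cosh_pos _).ne') ?_
  refine Filter.Eventually.of_forall fun t => ?_
  rw [Real.norm_of_nonneg (inv_nonneg.2 (Real.cosh_pos _).le)]
  refine inv_anti₀ (by positivity) ?_
  have h1 : 1 + (Real.pi * t) ^ 2 / 2 ≤ Real.cosh (Real.pi * t) := by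
    have e : Real.pi * t = 2 * (Real.pi * t / 2) := by ring
    have h2 : (Real.pi * t / 2) ^ 2 ≤ Real.sinh (Real.pi * t / 2) ^ 2 := by
      rw [sq_le_sq, Real.abs_sinh]
      exact Real.self_le_sinh_iff.2 (abs_nonneg _)
    rw [e, Real.cosh_two_mul, Real.cosh_sq]
    nlinarith
  nlinarith [Real.pi_gt_three, sq_nonneg t, mul_nonneg (sq_nonneg t) (by nlinarith [Real.pi_gt_three] : 0 ≤ Real.pi ^ 2 / 2 - 1)]

theorem image_div_one_sub : (fun x : ℝ => x / (1 - x)) '' Ioo 0 1 = Ioi 0 := by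
  ext y
  constructor
  · rintro ⟨x, hx, rfl⟩
    exact div_pos hx.1 (sub_pos.2 hx.2)
  · intro (hy : 0 < y)
    refine ⟨y / (1 + y), ⟨by positivity, ?_⟩, ?_⟩
    · rw [div_lt_one (by positivity)]; linarith
    · have : 1 + y ≠ 0 := by positivity
      field_simp
      simp

theorem injOn_div_one_sub : InjOn (fun x : ℝ => x / (1 - x)) (Ioo 0 1) := by
  intro x hx y hy h
  have h1 : 1 - x ≠ 0 := (sub_pos.2 hx.2).ne'
  have h2 : 1 - y ≠ 0 := (sub_pos.2 hy.2).ne'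
  beta_reduce at h
  rw [div_eq_div_iff h1 h2] at h
  linarith

theorem hasDerivWithinAt_div_one_sub (x : ℝ) (hx : x ∈ Ioo (0 : ℝ) 1) :
    HasDerivWithinAt (fun x : ℝ => x / (1 - x)) (1 / (1 - x) ^ 2) (Ioo 0 1) x := by
  have h1 : 1 - x ≠ 0 := (sub_pos.2 hx.2).ne'
  have := ((hasDerivAt_id x).div ((hasDerivAt_id x).const_sub 1) h1).hasDerivWithinAt (s := Ioo 0 1)
  have e : (1 * (1 - id x) - id x * -1) / (1 - id x) ^ 2 = 1 / (1 - x) ^ 2 := by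
    simp only [id]; ring
  rw [e] at this
  exact this

theorem mellin_kernel_subst (s : ℂ) (x : ℝ) (hx : x ∈ Ioo (0 : ℝ) 1) :
    |1 / (1 - x) ^ 2| • ((((x / (1 - x) : ℝ) : ℂ) ^ (s - 1)) •
      (((1 + x / (1 - x) : ℝ) : ℂ))⁻¹) = (x : ℂ) ^ (s - 1) * (1 - (x : ℂ)) ^ (1 - s - 1) := by
  have h1 : 0 < 1 - x := sub_pos.2 hx.2
  have h1' : (1 - (x : ℂ)) ≠ 0 := by exact_mod_cast h1.ne'
  have e : ((x / (1 - x) : ℝ) : ℂ) ^ (s - 1) = (x : ℂ) ^ (s - 1) * ((1 - x : ℝ) : ℂ) ^ (1 - s) := by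
    rw [div_eq_mul_inv, Complex.ofReal_mul, Complex.mul_cpow_ofReal_nonneg hx.1.le (by positivity),
      Complex.ofReal_inv, Complex.inv_cpow _ _ (by
        rw [Complex.arg_ofReal_of_nonneg h1.le]; exact Real.pi_pos.ne), ← Complex.cpow_neg]
    congr 2; ring
  have e2 : (1 + x / (1 - x) : ℝ) = (1 - x)⁻¹ := by field_simp; ring
  have e3 : (1 - (x : ℂ)) ^ (1 - s - 1) = (1 - (x : ℂ)) ^ (1 - s) * (1 - (x : ℂ))⁻¹ := by
    rw [Complex.cpow_sub _ _ h1', Complex.cpow_one, div_eq_mul_inv]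
  rw [e, e2, e3, abs_of_pos (by positivity), Complex.real_smul, smul_eq_mul]
  push_cast
  field_simp

theorem integral_sech_aux (s : ℂ) : mellin (fun x : ℝ => (((1 + x : ℝ) : ℂ))⁻¹) s
    = Complex.betaIntegral s (1 - s) := by
  rw [mellin, ← image_div_one_sub, integral_image_eq_integral_abs_deriv_smul measurableSet_Ioo
    hasDerivWithinAt_div_one_sub injOn_div_one_sub, Complex.betaIntegral,
    intervalIntegral.integral_of_le zero_le_one, integral_Ioc_eq_integral_Ioo]
  exact setIntegral_congr_fun measurableSet_Ioo fun x hx => mellin_kernel_subst s x hx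

theorem mellin_inv_one_add (y : ℝ) : mellin (fun x : ℝ => (((1 + x : ℝ) : ℂ))⁻¹)
    ((1 / 2 : ℝ) + y * Complex.I) = ((Real.pi / Real.cosh (Real.pi * y) : ℝ) : ℂ) := by
  rw [integral_sech_aux]
  set s : ℂ := (1 / 2 : ℝ) + y * Complex.I with hs
  have h := Complex.Gamma_mul_Gamma_eq_betaIntegral (s := s) (t := 1 - s) (by simp [hs])
    (by simp [hs]; norm_num)
  rw [Complex.Gamma_mul_Gamma_one_sub] at h
  simp only [add_sub_cancel, Complex.Gamma_one, one_mul] at h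
  rw [← h]
  have : (Real.pi : ℂ) * s = Real.pi / 2 + (Real.pi * y : ℝ) * Complex.I := by
    rw [hs]; push_cast; ring
  rw [this, Complex.sin_add, Complex.sin_pi_div_two, Complex.cos_pi_div_two, zero_mul, add_zero,
    one_mul, Complex.cos_mul_I]
  push_cast
  rfl

theorem mellinConvergent_inv_one_add :
    MellinConvergent (fun x : ℝ => (((1 + x : ℝ) : ℂ))⁻¹) ((1 / 2 : ℝ) : ℂ) := by
  rw [MellinConvergent, ← image_div_one_sub, integrableOn_image_iff_integrableOn_abs_deriv_smul
    measurableSet_Ioo hasDerivWithinAt_div_one_sub injOn_div_one_sub]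
  have h := Complex.betaIntegral_convergent (u := ((1 / 2 : ℝ) : ℂ)) (v := 1 - ((1 / 2 : ℝ) : ℂ))
    (by simp) (by simp; norm_num)
  rw [intervalIntegrable_iff_integrableOn_Ioo_of_le zero_le_one] at h
  exact h.congr_fun (fun x hx => (mellin_kernel_subst _ x hx).symm) measurableSet_Ioo

/-- The Fourier transform of the hyperbolic secant. -/
theorem integral_exp_mul_sech (l : ℝ) :
    ∫ t : ℝ, Complex.exp ((t * l : ℝ) * Complex.I) * (((2 * Real.cosh (Real.pi * t))⁻¹ : ℝ) : ℂ)
      = (((2 * Real.cosh (l / 2))⁻¹ : ℝ) : ℂ) := by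
  have key := mellinInv_mellin_eq (1 / 2 : ℝ) (fun x : ℝ => (((1 + x : ℝ) : ℂ))⁻¹)
    (Real.exp_pos (-l)) mellinConvergent_inv_one_add ?_ ?_
  · rw [mellinInv] at key
    have hi : ∀ t : ℝ, ((Real.exp (-l) : ℝ) : ℂ) ^ (-(((1 / 2 : ℝ) : ℂ) + t * Complex.I)) •
        mellin (fun x : ℝ => (((1 + x : ℝ) : ℂ))⁻¹) ((1 / 2 : ℝ) + t * Complex.I)
        = (2 * Real.pi * Real.exp (l / 2) : ℝ) * (Complex.exp ((t * l : ℝ) * Complex.I) *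
          (((2 * Real.cosh (Real.pi * t))⁻¹ : ℝ) : ℂ)) := by
      intro t
      rw [mellin_inv_one_add, Complex.cpow_def_of_ne_zero (by
        exact_mod_cast (Real.exp_pos _).ne'), ← Complex.ofReal_log (Real.exp_pos _).le,
        Real.log_exp]
      have : ((-l : ℝ) : ℂ) * -(((1 / 2 : ℝ) : ℂ) + t * Complex.I)
        = ((l / 2 : ℝ) : ℂ) + ((t * l : ℝ) * Complex.I) := by push_cast; ring
      rw [this, Complex.exp_add, ← Complex.ofReal_exp, smul_eq_mul]
      have hc : (Real.cosh (Real.pi * t) : ℂ) ≠ 0 := by exact_mod_cast (Real.cosh_pos _).ne'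
      push_cast at hc ⊢
      field_simp
    simp_rw [hi] at key
    rw [integral_const_mul, Complex.real_smul] at key
    have h1 : ((2 * Real.cosh (l / 2))⁻¹ : ℝ) = (1 + Real.exp (-l))⁻¹ / Real.exp (l / 2) := by
      rw [Real.cosh_eq, mul_div_cancel₀ _ (two_ne_zero' ℝ), div_eq_mul_inv _ (Real.exp _), ← mul_inv]
      congr 1
      rw [add_mul, ← Real.exp_add, one_mul]
      have : -l + l / 2 = -(l / 2) := by ring
      rw [this]
    rw [h1]
    have hp : (Real.pi : ℂ) ≠ 0 := by exact_mod_cast Real.pi_pos.ne'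
    have he : ((Real.exp (l / 2) : ℝ) : ℂ) ≠ 0 := by exact_mod_cast (Real.exp_pos _).ne'
    rw [Complex.ofReal_div, eq_div_iff he, Complex.ofReal_inv, ← key]
    generalize (∫ t : ℝ, Complex.exp ((t * l : ℝ) * Complex.I) *
      (((2 * Real.cosh (Real.pi * t))⁻¹ : ℝ) : ℂ)) = z
    push_cast
    field_simp
  · rw [Complex.VerticalIntegrable]
    simp_rw [mellin_inv_one_add]
    have := (integrable_inv_cosh.const_mul Real.pi).ofReal (𝕜 := ℂ)
    refine this.congr (Filter.Eventually.of_forall fun t => ?_)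
    simp [div_eq_mul_inv]
  · refine ContinuousAt.inv₀ (by fun_prop) ?_
    have := Real.exp_pos (-l)
    exact_mod_cast (by positivity : (1 + Real.exp (-l)) ≠ 0)

end Sech

section Calculus
open Filter Topology
variable {H : Type*} [NormedAddCommGroup H] [InnerProductSpace ℂ H] [CompleteSpace H]

theorem inner_proj_proj_eq_zero {κ : Type*} (q : κ → H →L[ℂ] H) (hq : ∀ k, IsStarProjection (q k))
    (ho : ∀ i j, i ≠ j → q i * q j = 0) {i j : κ} (hij : i ≠ j) (u v : H) :
    ⟪q i u, q j v⟫_ℂ = 0 := by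
  rw [inner_apply_of_isSelfAdjoint (hq i).isSelfAdjoint, ← mul_apply_eq_comp, ho i j hij]
  simp

theorem norm_sq_sum_smul_proj {κ : Type*} [Fintype κ] (q : κ → H →L[ℂ] H)
    (hq : ∀ k, IsStarProjection (q k)) (ho : ∀ i j, i ≠ j → q i * q j = 0) (g : κ → ℂ) (v : H) :
    ‖∑ k, g k • q k v‖ ^ 2 = ∑ k, ‖g k‖ ^ 2 * ‖q k v‖ ^ 2 := by
  have h : (⟪∑ k, g k • q k v, ∑ k, g k • q k v⟫_ℂ).re = ∑ k, ‖g k‖ ^ 2 * ‖q k v‖ ^ 2 := by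
    rw [sum_inner, Complex.re_sum]
    refine Finset.sum_congr rfl fun k _ => ?_
    rw [inner_sum, Finset.sum_eq_single k]
    · rw [inner_self_eq_norm_sq_to_K, norm_smul, ← mul_pow]
      norm_cast
    · intro j _ hj
      rw [inner_smul_left, inner_smul_right, inner_proj_proj_eq_zero q hq ho (Ne.symm hj)]
      simp
    · simp
  rw [← h, inner_self_eq_norm_sq_to_K]
  norm_cast

theorem norm_sum_smul_proj_le {κ : Type*} [Fintype κ] (q : κ → H →L[ℂ] H)
    (hq : ∀ k, IsStarProjection (q k)) (ho : ∀ i j, i ≠ j → q i * q j = 0) (hs : ∑ k, q k = 1)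
    (g : κ → ℂ) {C : ℝ} (hC : 0 ≤ C) (hg : ∀ k, q k ≠ 0 → ‖g k‖ ≤ C) (v : H) :
    ‖∑ k, g k • q k v‖ ≤ C * ‖v‖ := by
  refine (sq_le_sq₀ (norm_nonneg _) (by positivity)).1 ?_
  have hv : ‖v‖ ^ 2 = ∑ k, ‖q k v‖ ^ 2 := by
    have := norm_sq_sum_smul_proj q hq ho (fun _ => 1) v
    simp only [one_smul, norm_one, one_pow, one_mul] at this
    rw [← this, ← sum_apply, hs, one_apply_eq_self]
  rw [norm_sq_sum_smul_proj q hq ho, mul_pow, hv, Finset.mul_sum]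
  refine Finset.sum_le_sum fun k _ => ?_
  by_cases h0 : q k = 0
  · simp [h0]
  · gcongr
    exact hg k h0

namespace SpecFamily
variable {A : H →L[ℂ] H} {h : ℝ}

/-- The functional calculus of the simple operator attached to a spectral family. -/
noncomputable def fn (S : SpecFamily A h) (g : ℝ → ℂ) : H →L[ℂ] H := ∑ i, g (S.a i) • S.p i

theorem fn_apply (S : SpecFamily A h) (g : ℝ → ℂ) (v : H) :
    S.fn g v = ∑ i, g (S.a i) • S.p i v := by
  simp [fn]

theorem fn_mul (S : SpecFamily A h) (g k : ℝ → ℂ) :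
    S.fn g * S.fn k = S.fn fun a => g a * k a := by
  rw [fn, fn, fn, Finset.sum_mul]
  refine Finset.sum_congr rfl fun i _ => ?_
  rw [Finset.mul_sum, Finset.sum_eq_single i]
  · rw [smul_mul_smul_comm, (S.proj i).isIdempotentElem]
  · intro j _ hj
    rw [smul_mul_smul_comm, S.ortho i j (Ne.symm hj), smul_zero]
  · simp

theorem fn_apply_fn (S : SpecFamily A h) (g k : ℝ → ℂ) (v : H) :
    S.fn g (S.fn k v) = S.fn (fun a => g a * k a) v := by
  rw [← fn_mul, mul_apply_eq_comp]

theorem star_fn (S : SpecFamily A h) (g : ℝ → ℂ) : star (S.fn g) = S.fn fun a => star (g a) := by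
  rw [fn, fn, star_sum]
  refine Finset.sum_congr rfl fun i _ => ?_
  rw [star_smul, (S.proj i).isSelfAdjoint.star_eq]

theorem fn_one (S : SpecFamily A h) : S.fn (fun _ => 1) = 1 := by
  simp [fn, S.sum]

theorem fn_sub (S : SpecFamily A h) (g k : ℝ → ℂ) :
    S.fn g - S.fn k = S.fn fun a => g a - k a := by
  simp [fn, sub_smul, Finset.sum_sub_distrib]

theorem fn_congr (S : SpecFamily A h) {g k : ℝ → ℂ} (hg : ∀ a, h ≤ a → a + h ≤ 1 → g a = k a) :
    S.fn g = S.fn k :=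
  Finset.sum_congr rfl fun i _ => by rw [hg _ (S.le_a i) (S.a_le i)]

theorem commute_fn (S : SpecFamily A h) (g : ℝ → ℂ) {y : H →L[ℂ] H} (hy : Commute A y) :
    Commute (S.fn g) y :=
  Commute.sum_left _ _ _ fun i _ => (S.comm i y hy).smul_left _

theorem norm_fn_le (S : SpecFamily A h) (g : ℝ → ℂ) {C : ℝ} (hC : 0 ≤ C)
    (hg : ∀ a, h ≤ a → a + h ≤ 1 → ‖g a‖ ≤ C) (v : H) : ‖S.fn g v‖ ≤ C * ‖v‖ := by
  rw [fn_apply]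
  exact norm_sum_smul_proj_le S.p S.proj S.ortho S.sum _ hC
    (fun i _ => hg _ (S.le_a i) (S.a_le i)) v

theorem norm_fn_eq (S : SpecFamily A h) (g : ℝ → ℂ)
    (hg : ∀ a, h ≤ a → a + h ≤ 1 → ‖g a‖ = 1) (v : H) : ‖S.fn g v‖ = ‖v‖ := by
  have h1 := norm_sq_sum_smul_proj S.p S.proj S.ortho (fun i => g (S.a i)) v
  have h2 := norm_sq_sum_smul_proj S.p S.proj S.ortho (fun _ => 1) v
  rw [← fn_apply] at h1
  have h3 : ∑ i, (1 : ℂ) • S.p i v = v := by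
    simp_rw [one_smul, ← sum_apply, S.sum, one_apply_eq_self]
  rw [h3] at h2
  rw [← sq_eq_sq₀ (norm_nonneg _) (norm_nonneg _), h1, h2]
  exact Finset.sum_congr rfl fun i _ => by rw [hg _ (S.le_a i) (S.a_le i), norm_one]

theorem norm_sub_fn_id_le (S : SpecFamily A h) (hA : IsSelfAdjoint A) (hh : 0 < h) (v : H) :
    ‖A v - S.fn (fun a => (a : ℂ)) v‖ ≤ h * ‖v‖ := by
  have e : A v - S.fn (fun a => (a : ℂ)) v
      = ∑ i, S.p i (A (S.p i v) - (S.a i : ℂ) • S.p i v) := by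
    have h1 : A v = ∑ i, S.p i (A (S.p i v)) := by
      have : ∀ i, S.p i (A (S.p i v)) = A (S.p i v) := fun i => by
        rw [← mul_apply_eq_comp, ← mul_apply_eq_comp, ← (S.commute_A i).eq, mul_assoc,
          (S.proj i).isIdempotentElem.eq]; rfl
      simp_rw [this, ← map_sum, ← sum_apply, S.sum]; rfl
    rw [h1, fn_apply, ← Finset.sum_sub_distrib]
    refine Finset.sum_congr rfl fun i _ => ?_
    rw [map_sub, map_smul, ← mul_apply_eq_comp (S.p i) (S.p i), (S.proj i).isIdempotentElem.eq]
  have n1 : ∀ w : S.ι → H, ‖∑ i, S.p i (w i)‖ ^ 2 = ∑ i, ‖S.p i (w i)‖ ^ 2 := by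
    intro w
    have h : (⟪∑ i, S.p i (w i), ∑ i, S.p i (w i)⟫_ℂ).re = ∑ i, ‖S.p i (w i)‖ ^ 2 := by
      rw [sum_inner, Complex.re_sum]
      refine Finset.sum_congr rfl fun k _ => ?_
      rw [inner_sum, Finset.sum_eq_single k]
      · rw [inner_self_eq_norm_sq_to_K]; norm_cast
      · intro j _ hj
        exact inner_proj_proj_eq_zero S.p S.proj S.ortho (Ne.symm hj) _ _
      · simp
    rw [← h, inner_self_eq_norm_sq_to_K]; norm_cast
  refine (sq_le_sq₀ (norm_nonneg _) (by positivity)).1 ?_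
  have h2 := n1 fun _ => v
  have h3 : ∑ i, S.p i v = v := by
    rw [← sum_apply, S.sum]; rfl
  rw [h3] at h2
  rw [e, n1, mul_pow, h2, Finset.mul_sum]
  refine Finset.sum_le_sum fun i _ => ?_
  rw [← mul_pow]
  gcongr
  refine le_trans ?_ (S.near hA hh i v)
  have := (S.p i).le_opNorm (A (S.p i v) - (S.a i : ℂ) • S.p i v)
  refine this.trans ?_
  have := IsStarProjection.norm_le (S.p i) (S.proj i)
  exact mul_le_of_le_one_left (norm_nonneg _) this

theorem norm_fn_sub_fn_le {h' : ℝ} (S : SpecFamily A h) (S' : SpecFamily A h')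
    (hA : IsSelfAdjoint A) (hh : 0 < h) (hh' : 0 < h') (g : ℝ → ℂ) {C : ℝ} (hC : 0 ≤ C)
    (hg : ∀ a ∈ Set.Icc (0 : ℝ) 1, ∀ b ∈ Set.Icc (0 : ℝ) 1, |a - b| ≤ h + h' → ‖g a - g b‖ ≤ C)
    (v : H) : ‖S.fn g v - S'.fn g v‖ ≤ C * ‖v‖ := by
  have hc : ∀ i j, Commute (S.p i) (S'.p j) := fun i j => S.comm i _ (S'.commute_A j)
  let q : S.ι × S'.ι → H →L[ℂ] H := fun k => S.p k.1 * S'.p k.2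
  have hq : ∀ k, IsStarProjection (q k) := fun k =>
    (S.proj k.1).mul_of_commute (S'.proj k.2) (hc _ _)
  have ho : ∀ i j, i ≠ j → q i * q j = 0 := by
    rintro ⟨i, i'⟩ ⟨j, j'⟩ hij
    have e : q (i, i') * q (j, j') = (S.p i * S.p j) * (S'.p i' * S'.p j') := by
      simp only [q]
      rw [mul_assoc, ← mul_assoc (S'.p i'), ← (hc j i').eq]
      simp only [mul_assoc]
    rw [e]
    by_cases hi : i = j
    · have : i' ≠ j' := fun h => hij (by rw [hi, h])
      rw [S'.ortho _ _ this, mul_zero]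
    · rw [S.ortho _ _ hi, zero_mul]
  have hs : ∑ k, q k = 1 := by
    simp only [q, Fintype.sum_prod_type]
    simp_rw [← Finset.mul_sum, S'.sum, mul_one, S.sum]
  have e : S.fn g v - S'.fn g v = ∑ k, (g (S.a k.1) - g (S'.a k.2)) • q k v := by
    simp_rw [sub_smul, Finset.sum_sub_distrib]
    congr 1
    · rw [fn_apply, Fintype.sum_prod_type]
      refine Finset.sum_congr rfl fun i _ => ?_
      simp only [q]
      rw [← Finset.smul_sum, ← sum_apply, ← Finset.mul_sum, S'.sum, mul_one]
    · rw [fn_apply, Fintype.sum_prod_type_right]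
      refine Finset.sum_congr rfl fun i _ => ?_
      simp only [q]
      rw [← Finset.smul_sum, ← sum_apply, ← Finset.sum_mul, S.sum, one_mul]
  rw [e]
  refine norm_sum_smul_proj_le q hq ho hs _ hC (fun k hk => ?_) v
  have h0a := S.le_a k.1
  have h0b := S'.le_a k.2
  have h1a := S.a_le k.1
  have h1b := S'.a_le k.2
  refine hg _ ⟨by linarith, by linarith⟩ _ ⟨by linarith, by linarith⟩ ?_
  obtain ⟨w, hw⟩ : ∃ w, q k w ≠ 0 := by
    by_contra! hall
    exact hk (ContinuousLinearMap.ext hall)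
  set u := q k w with hu
  have h1 : S.p k.1 u = u := by
    rw [hu, ← mul_apply_eq_comp]
    simp only [q]
    rw [← mul_assoc, (S.proj k.1).isIdempotentElem.eq]
  have h2 : S'.p k.2 u = u := by
    rw [hu, ← mul_apply_eq_comp]
    simp only [q]
    rw [(hc k.1 k.2).eq, ← mul_assoc, (S'.proj k.2).isIdempotentElem.eq]
  have n1 := S.near hA hh k.1 u
  have n2 := S'.near hA hh' k.2 u
  rw [h1] at n1
  rw [h2] at n2
  have hu0 : 0 < ‖u‖ := norm_pos_iff.2 hw
  refine le_of_mul_le_mul_right ?_ hu0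
  have e2 : ((S.a k.1 - S'.a k.2 : ℝ) : ℂ) • u
      = (A u - (S'.a k.2 : ℂ) • u) - (A u - (S.a k.1 : ℂ) • u) := by
    push_cast; module
  have := congrArg norm e2
  rw [norm_smul, Complex.norm_real, Real.norm_eq_abs] at this
  rw [this]
  refine (norm_sub_le _ _).trans ?_
  linarith

end SpecFamily
end Calculus

section StrongLimits
open Filter Topology
variable {H : Type*} [NormedAddCommGroup H] [InnerProductSpace ℂ H] [CompleteSpace H]

theorem exists_strong_limit (W : ℕ → H →L[ℂ] H) (hb : ∀ n v, ‖W n v‖ ≤ ‖v‖) (B : H →L[ℂ] H)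
    (hB : DenseRange B) (hC : ∀ v, CauchySeq fun n => W n (B v)) :
    ∃ W' : H →L[ℂ] H, ∀ v, Tendsto (fun n => W n v) atTop (𝓝 (W' v)) := by
  have hcs : ∀ v, CauchySeq fun n => W n v := by
    intro v
    rw [Metric.cauchySeq_iff]
    intro δ hδ
    obtain ⟨u, hu⟩ := Metric.denseRange_iff.1 hB v (δ / 3) (by positivity)
    obtain ⟨N, hN⟩ := Metric.cauchySeq_iff.1 (hC u) (δ / 3) (by positivity)
    refine ⟨N, fun m hm n hn => ?_⟩
    have h1 : ∀ k, dist (W k v) (W k (B u)) < δ / 3 := fun k => by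
      rw [dist_eq_norm, ← map_sub]
      exact (hb k _).trans_lt (by rwa [← dist_eq_norm])
    calc dist (W m v) (W n v) ≤ dist (W m v) (W m (B u)) + dist (W m (B u)) (W n (B u))
          + dist (W n (B u)) (W n v) := dist_triangle4 _ _ _ _
      _ < δ / 3 + δ / 3 + δ / 3 := by
        gcongr
        · exact h1 m
        · exact hN m hm n hn
        · rw [dist_comm]; exact h1 n
      _ = δ := by ring
  choose f hf using fun v => cauchySeq_tendsto_of_complete (hcs v)
  exact ⟨continuousLinearMapOfTendsto W (tendsto_pi_nhds.2 hf), hf⟩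

theorem tendsto_apply_of_strong {W : ℕ → H →L[ℂ] H} (hb : ∀ n v, ‖W n v‖ ≤ ‖v‖)
    {x : ℕ → H} {y z : H} (hx : Tendsto x atTop (𝓝 y))
    (hW : Tendsto (fun n => W n y) atTop (𝓝 z)) :
    Tendsto (fun n => W n (x n)) atTop (𝓝 z) := by
  have h0 : Tendsto (fun n => W n (x n - y)) atTop (𝓝 0) := by
    refine squeeze_zero_norm (fun n => hb n _) ?_
    have := (hx.sub_const y).norm
    simpa using this
  have := h0.add hW
  simpa using this

end StrongLimits

section Phase
open Filter Topology

/-- The imaginary power `(a / (1 - a)) ^ (i t)`. -/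
noncomputable def phase (t a : ℝ) : ℂ :=
  Complex.exp ((t * Real.log (a / (1 - a)) : ℝ) * Complex.I)

theorem norm_phase (t a : ℝ) : ‖phase t a‖ = 1 := Complex.norm_exp_ofReal_mul_I _

theorem phase_zero (a : ℝ) : phase 0 a = 1 := by simp [phase]

theorem phase_add (s t a : ℝ) : phase (s + t) a = phase s a * phase t a := by
  rw [phase, phase, phase, ← Complex.exp_add]
  congr 1; push_cast; ring

theorem star_phase (t a : ℝ) : star (phase t a) = phase (-t) a := by
  rw [phase, phase, Complex.star_def, ← Complex.exp_conj]
  congr 1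
  simp

theorem continuous_mul_phase (t : ℝ) :
    Continuous fun a : ℝ => ((a * (1 - a) : ℝ) : ℂ) * phase t a := by
  rw [continuous_iff_continuousAt]
  intro a
  by_cases ha : a / (1 - a) = 0
  · have h0 : a * (1 - a) = 0 := by
      rcases div_eq_zero_iff.1 ha with h | h <;> rw [h] <;> simp
    have h1 : Tendsto (fun a : ℝ => ((a * (1 - a) : ℝ) : ℂ)) (𝓝 a) (𝓝 0) := by
      have : Continuous fun a : ℝ => ((a * (1 - a) : ℝ) : ℂ) := by fun_prop
      have := this.tendsto a
      rwa [h0, Complex.ofReal_zero] at this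
    rw [ContinuousAt, h0, Complex.ofReal_zero, zero_mul]
    refine h1.zero_mul_isBoundedUnder_le ?_
    refine isBoundedUnder_of ⟨1, fun x => ?_⟩
    exact (norm_phase _ _).le
  · refine ContinuousAt.mul (by fun_prop) ?_
    unfold phase
    have h1 : 1 - a ≠ 0 := fun h => ha (by rw [h, div_zero])
    have : ContinuousAt (fun a : ℝ => Real.log (a / (1 - a))) a :=
      (continuousAt_id.div (by fun_prop) h1).log ha
    fun_prop

theorem norm_phase_sub_phase_le (s t a : ℝ) :
    ‖phase t a - phase s a‖ ≤ |t - s| * |Real.log (a / (1 - a))| := by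
  have e : phase t a - phase s a
      = phase s a * (Complex.exp (Complex.I * ((t - s) * Real.log (a / (1 - a)) : ℝ)) - 1) := by
    rw [mul_sub, mul_one, phase, phase, ← Complex.exp_add]
    congr 2; push_cast; ring
  rw [e, norm_mul, norm_phase, one_mul, ← abs_mul, ← Real.norm_eq_abs]
  exact Real.norm_exp_I_mul_ofReal_sub_one_le

theorem abs_mul_log_div_le {a : ℝ} (h0 : 0 < a) (h1 : a < 1) :
    |a * (1 - a)| * |Real.log (a / (1 - a))| ≤ 2 := by
  have h1' : 0 < 1 - a := by linarith
  rw [Real.log_div h0.ne' h1'.ne', ← abs_mul]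
  have n1 := Real.abs_log_mul_self_lt a h0 h1.le
  have n2 := Real.abs_log_mul_self_lt (1 - a) h1' (by linarith)
  have e : a * (1 - a) * (Real.log a - Real.log (1 - a))
      = (1 - a) * (Real.log a * a) - a * (Real.log (1 - a) * (1 - a)) := by ring
  rw [e]
  refine (abs_sub _ _).trans ?_
  rw [abs_mul (1 - a), abs_mul a, abs_of_pos h0, abs_of_pos h1']
  nlinarith [abs_nonneg (Real.log a * a), abs_nonneg (Real.log (1 - a) * (1 - a))]

theorem norm_mul_phase_sub_le (s t : ℝ) {a : ℝ} (h0 : 0 < a) (h1 : a < 1) :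
    ‖((a * (1 - a) : ℝ) : ℂ) * phase t a - ((a * (1 - a) : ℝ) : ℂ) * phase s a‖
      ≤ 2 * |t - s| := by
  rw [← mul_sub, norm_mul, Complex.norm_real, Real.norm_eq_abs]
  calc _ ≤ |a * (1 - a)| * (|t - s| * |Real.log (a / (1 - a))|) := by
        gcongr; exact norm_phase_sub_phase_le s t a
    _ = (|a * (1 - a)| * |Real.log (a / (1 - a))|) * |t - s| := by ring
    _ ≤ 2 * |t - s| := by gcongr; exact abs_mul_log_div_le h0 h1

end Phase

section Flow
open Filter Topology
variable {H : Type*} [NormedAddCommGroup H] [InnerProductSpace ℂ H] [CompleteSpace H]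

/-- A sequence of simple approximations of `A` together with the strong limits of the
corresponding imaginary powers of `A (1 - A)⁻¹`. -/
structure SpectralFlow (A : H →L[ℂ] H) where
  S : ∀ n : ℕ, SpecFamily A (2⁻¹ ^ (n + 1))
  U : ℝ → H →L[ℂ] H
  tendsto_U : ∀ t v, Tendsto (fun n => (S n).fn (phase t) v) atTop (𝓝 (U t v))

theorem tendsto_half_pow_succ : Tendsto (fun n : ℕ => (2⁻¹ : ℝ) ^ (n + 1)) atTop (𝓝 0) :=
  (tendsto_pow_atTop_nhds_zero_of_lt_one (by norm_num) (by norm_num)).comp (tendsto_add_atTop_nat 1)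

theorem SpecFamily.tendsto_fn_id {A : H →L[ℂ] H} (hA : IsSelfAdjoint A)
    (S : ∀ n : ℕ, SpecFamily A (2⁻¹ ^ (n + 1))) (v : H) :
    Tendsto (fun n => (S n).fn (fun a => (a : ℂ)) v) atTop (𝓝 (A v)) := by
  rw [tendsto_iff_norm_sub_tendsto_zero]
  refine squeeze_zero (fun _ => norm_nonneg _) (fun n => ?_)
    (by have := tendsto_half_pow_succ.mul_const ‖v‖; rwa [zero_mul] at this)
  rw [norm_sub_rev]
  exact (S n).norm_sub_fn_id_le hA (by positivity) v

theorem SpecFamily.norm_fn_id_le {A : H →L[ℂ] H} {h : ℝ} (hh : 0 < h) (S : SpecFamily A h)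
    (v : H) : ‖S.fn (fun a => (a : ℂ)) v‖ ≤ ‖v‖ := by
  have := S.norm_fn_le (fun a => (a : ℂ)) zero_le_one (fun a h1 h2 => by
    rw [Complex.norm_real, Real.norm_eq_abs, abs_of_nonneg (by linarith)]; linarith) v
  rwa [one_mul] at this

theorem SpecFamily.tendsto_fn_mul_one_sub {A : H →L[ℂ] H} (hA : IsSelfAdjoint A)
    (S : ∀ n : ℕ, SpecFamily A (2⁻¹ ^ (n + 1))) (v : H) :
    Tendsto (fun n => (S n).fn (fun a => ((a * (1 - a) : ℝ) : ℂ)) v) atTop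
      (𝓝 ((A - A * A) v)) := by
  have h1 := SpecFamily.tendsto_fn_id hA S v
  have h2 := tendsto_apply_of_strong (fun n v => (S n).norm_fn_id_le (by positivity) v) h1
    (SpecFamily.tendsto_fn_id hA S (A v))
  have h3 := h1.sub h2
  refine h3.congr fun n => ?_
  rw [fn_apply_fn, ← sub_apply, fn_sub]
  congr 2
  ext a
  push_cast; ring

theorem SpectralFlow.exists_of_injective {A : H →L[ℂ] H} (h0 : 0 ≤ A) (h1 : A ≤ 1)
    (hd : DenseRange (A - A * A)) : Nonempty (SpectralFlow A) := by
  have hA : IsSelfAdjoint A := .of_nonneg h0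
  let S : ∀ n : ℕ, SpecFamily A (2⁻¹ ^ (n + 1)) :=
    fun n => (SpecFamily.exists_of_nonneg_le_one A h0 h1 n).some
  have hb : ∀ t n v, ‖(S n).fn (phase t) v‖ ≤ ‖v‖ := fun t n v =>
    ((S n).norm_fn_eq _ (fun a _ _ => norm_phase t a) v).le
  have key : ∀ t v, CauchySeq fun n => (S n).fn (phase t) ((A - A * A) v) := by
    intro t v
    let F : ℝ → ℂ := fun a => ((a * (1 - a) : ℝ) : ℂ) * phase t a
    have hF : CauchySeq fun n => (S n).fn F v := by
      rw [Metric.cauchySeq_iff]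
      intro δ hδ
      have hu := (isCompact_Icc (a := (0 : ℝ)) (b := 1)).uniformContinuousOn_of_continuous
        (continuous_mul_phase t).continuousOn
      rw [Metric.uniformContinuousOn_iff] at hu
      obtain ⟨η, hη, hu⟩ := hu (δ / (‖v‖ + 1)) (by positivity)
      obtain ⟨N, hN⟩ := (tendsto_half_pow_succ.eventually_lt_const (half_pos hη)).exists_forall_of_atTop
      refine ⟨N, fun m hm n hn => ?_⟩
      rw [dist_eq_norm]
      refine ((S m).norm_fn_sub_fn_le (S n) hA (by positivity) (by positivity) F
        (C := δ / (‖v‖ + 1)) (by positivity) (fun a ha b hb hab => ?_) v).trans_lt ?_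
      · rw [← dist_eq_norm]
        refine (hu a ha b hb ?_).le
        rw [Real.dist_eq]
        have := hN m hm
        have := hN n hn
        linarith
      · rw [div_mul_eq_mul_div, div_lt_iff₀ (by positivity)]
        nlinarith [norm_nonneg v]
    obtain ⟨z, hz⟩ := cauchySeq_tendsto_of_complete hF
    have hz2 : Tendsto (fun n => (S n).fn (phase t)
        ((A - A * A) v - (S n).fn (fun a => ((a * (1 - a) : ℝ) : ℂ)) v)) atTop (𝓝 0) := by
      refine squeeze_zero_norm (fun n => hb t n _) ?_
      have := ((SpecFamily.tendsto_fn_mul_one_sub hA S v).const_sub ((A - A * A) v)).norm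
      simpa using this
    have := hz2.add hz
    refine Tendsto.cauchySeq (x := 0 + z) (this.congr fun n => ?_)
    rw [map_sub, SpecFamily.fn_apply_fn]
    have : (fun a : ℝ => phase t a * ((a * (1 - a) : ℝ) : ℂ)) = F := by
      ext a; exact mul_comm _ _
    rw [this]
    abel
  choose U hU using fun t => exists_strong_limit (fun n => (S n).fn (phase t)) (hb t) _ hd (key t)
  exact ⟨⟨S, U, hU⟩⟩

namespace SpectralFlow
variable {A : H →L[ℂ] H} (φ : SpectralFlow A)

theorem norm_fn_phase (n : ℕ) (t : ℝ) (v : H) : ‖(φ.S n).fn (phase t) v‖ = ‖v‖ :=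
  (φ.S n).norm_fn_eq _ (fun a _ _ => norm_phase t a) v

theorem norm_U (t : ℝ) (v : H) : ‖φ.U t v‖ = ‖v‖ :=
  tendsto_nhds_unique (φ.tendsto_U t v).norm
    (tendsto_const_nhds.congr fun n => (φ.norm_fn_phase n t v).symm)

theorem U_zero : φ.U 0 = 1 := by
  ext v
  refine tendsto_nhds_unique (φ.tendsto_U 0 v) (tendsto_const_nhds.congr fun n => ?_)
  have : phase 0 = fun _ => 1 := by ext a; exact phase_zero a
  rw [this, SpecFamily.fn_one]

theorem U_add (s t : ℝ) : φ.U (s + t) = φ.U s * φ.U t := by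
  ext v
  refine tendsto_nhds_unique (φ.tendsto_U (s + t) v) ?_
  have := tendsto_apply_of_strong (fun n v => (φ.norm_fn_phase n s v).le) (φ.tendsto_U t v)
    (φ.tendsto_U s (φ.U t v))
  refine this.congr fun n => ?_
  rw [SpecFamily.fn_apply_fn]
  congr 2
  ext a; exact (phase_add s t a).symm

theorem star_U (t : ℝ) : star (φ.U t) = φ.U (-t) := by
  ext v
  refine ext_inner_left ℂ fun u => ?_
  rw [← inner_apply_eq_star]
  refine tendsto_nhds_unique ((φ.tendsto_U t u).inner tendsto_const_nhds)
    ((tendsto_const_nhds.inner (φ.tendsto_U (-t) v)).congr fun n => ?_)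
  rw [inner_apply_eq_star, SpecFamily.star_fn]
  congr 3
  ext a; exact (star_phase t a).symm

theorem commute_U {y : H →L[ℂ] H} (hy : Commute A y) (t : ℝ) : Commute (φ.U t) y := by
  ext v
  refine tendsto_nhds_unique (φ.tendsto_U t (y v)) ?_
  refine ((y.continuous.tendsto _).comp (φ.tendsto_U t v)).congr fun n => ?_
  have := DFunLike.congr_fun ((φ.S n).commute_fn (phase t) hy).eq v
  exact this.symm

theorem U_mul_neg (t : ℝ) : φ.U t * φ.U (-t) = 1 := by
  rw [← U_add, add_neg_cancel, U_zero]

theorem U_neg_mul (t : ℝ) : φ.U (-t) * φ.U t = 1 := by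
  rw [← U_add, neg_add_cancel, U_zero]

theorem continuous_U (hA : IsSelfAdjoint A) (hd : DenseRange (A - A * A)) (v : H) :
    Continuous fun t => φ.U t v := by
  have hb : ∀ u s t, ‖φ.U t ((A - A * A) u) - φ.U s ((A - A * A) u)‖ ≤ 2 * |t - s| * ‖u‖ := by
    intro u s t
    have hlim : ∀ r, Tendsto (fun n => (φ.S n).fn
        (fun a => phase r a * ((a * (1 - a) : ℝ) : ℂ)) u) atTop (𝓝 (φ.U r ((A - A * A) u))) := by
      intro r
      refine (tendsto_apply_of_strong (fun n v => (φ.norm_fn_phase n r v).le)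
        (SpecFamily.tendsto_fn_mul_one_sub hA φ.S u) (φ.tendsto_U r _)).congr fun n => ?_
      rw [SpecFamily.fn_apply_fn]
    refine le_of_tendsto' ((hlim t).sub (hlim s)).norm fun n => ?_
    rw [← sub_apply, SpecFamily.fn_sub]
    refine (φ.S n).norm_fn_le _ (by positivity) (fun a h1 h2 => ?_) u
    have hp : (0 : ℝ) < 2⁻¹ ^ (n + 1) := by positivity
    rw [mul_comm (phase t a), mul_comm (phase s a)]
    exact norm_mul_phase_sub_le s t (by linarith) (by linarith)
  rw [Metric.continuous_iff]
  intro s δ hδ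
  obtain ⟨u, hu⟩ := Metric.denseRange_iff.1 hd v (δ / 3) (by positivity)
  refine ⟨δ / 3 / (2 * (‖u‖ + 1)), by positivity, fun t ht => ?_⟩
  have h1 : ∀ r, dist (φ.U r v) (φ.U r ((A - A * A) u)) < δ / 3 := fun r => by
    rw [dist_eq_norm, ← map_sub, norm_U, ← dist_eq_norm]; exact hu
  have h2 : dist (φ.U t ((A - A * A) u)) (φ.U s ((A - A * A) u)) < δ / 3 := by
    rw [dist_eq_norm]
    refine (hb u s t).trans_lt ?_
    rw [Real.dist_eq, lt_div_iff₀ (by positivity)] at ht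
    nlinarith [abs_nonneg (t - s), norm_nonneg u]
  calc dist (φ.U t v) (φ.U s v) ≤ dist (φ.U t v) (φ.U t ((A - A * A) u))
        + dist (φ.U t ((A - A * A) u)) (φ.U s ((A - A * A) u))
        + dist (φ.U s ((A - A * A) u)) (φ.U s v) := dist_triangle4 _ _ _ _
    _ < δ / 3 + δ / 3 + δ / 3 := by
      gcongr
      · exact h1 t
      · rw [dist_comm]; exact h1 s
    _ = δ := by ring

end SpectralFlow
end Flow

section Sqrt
open Filter Topology
variable {H : Type*} [NormedAddCommGroup H] [InnerProductSpace ℂ H] [CompleteSpace H]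

theorem SpecFamily.fn_nonneg {A : H →L[ℂ] H} {h : ℝ} (hh : 0 < h) (S : SpecFamily A h) {g : ℝ → ℝ}
    (hg : ∀ a, 0 < a → a < 1 → 0 ≤ g a) : 0 ≤ S.fn fun a => (g a : ℂ) := by
  refine Finset.sum_nonneg fun i _ => ?_
  have h1 := S.le_a i
  have h2 := S.a_le i
  have h3 : (0 : ℂ) ≤ (g (S.a i) : ℂ) := by
    exact_mod_cast hg _ (by linarith) (by linarith)
  exact smul_nonneg h3 (S.proj i).nonneg

theorem SpecFamily.tendsto_fn_sqrt {A : H →L[ℂ] H} (hA : IsSelfAdjoint A)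
    (hB : 0 ≤ A - A * A) (S : ∀ n : ℕ, SpecFamily A (2⁻¹ ^ (n + 1))) :
    Tendsto (fun n => (S n).fn (fun a => ((√(a * (1 - a)) : ℝ) : ℂ))) atTop
      (𝓝 (CFC.sqrt (A - A * A))) := by
  have h1 : Tendsto (fun n => (S n).fn (fun a => (a : ℂ))) atTop (𝓝 A) := by
    rw [tendsto_iff_norm_sub_tendsto_zero]
    refine squeeze_zero (fun _ => norm_nonneg _) (fun n => ?_) tendsto_half_pow_succ
    refine ContinuousLinearMap.opNorm_le_bound _ (by positivity) fun v => ?_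
    rw [sub_apply, norm_sub_rev]
    exact (S n).norm_sub_fn_id_le hA (by positivity) v
  have h2 := h1.sub (h1.mul h1)
  have hpos : ∀ n, 0 ≤ (S n).fn (fun a => ((√(a * (1 - a)) : ℝ) : ℂ)) := fun n =>
    (S n).fn_nonneg (by positivity) fun a _ _ => Real.sqrt_nonneg _
  have hsq : ∀ n, (S n).fn (fun a => ((√(a * (1 - a)) : ℝ) : ℂ))
      * (S n).fn (fun a => ((√(a * (1 - a)) : ℝ) : ℂ))
      = (S n).fn (fun a => (a : ℂ)) - (S n).fn (fun a => (a : ℂ)) * (S n).fn (fun a => (a : ℂ)) := by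
    intro n
    have hp : (0 : ℝ) < 2⁻¹ ^ (n + 1) := by positivity
    rw [SpecFamily.fn_mul, SpecFamily.fn_mul, SpecFamily.fn_sub]
    refine (S n).fn_congr fun a h1 h2 => ?_
    have : √(a * (1 - a)) * √(a * (1 - a)) = a - a * a := by
      rw [Real.mul_self_sqrt (mul_nonneg (by linarith) (by linarith))]; ring
    exact_mod_cast this
  have h3 := (CFC.continuousOn_sqrt (A := H →L[ℂ] H)) _ hB
  have h4 : Tendsto (fun n => (S n).fn (fun a => (a : ℂ))
      - (S n).fn (fun a => (a : ℂ)) * (S n).fn (fun a => (a : ℂ))) atTop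
      (𝓝[{a | 0 ≤ a}] (A - A * A)) := by
    refine tendsto_nhdsWithin_iff.2 ⟨h2, Eventually.of_forall fun n => ?_⟩
    rw [← hsq]
    have := star_mul_self_nonneg ((S n).fn (fun a => ((√(a * (1 - a)) : ℝ) : ℂ)))
    rwa [(hpos n).isSelfAdjoint.star_eq] at this
  exact (h3.tendsto.comp h4).congr fun n => CFC.sqrt_unique (hsq n) (hpos n)

end Sqrt

section Kernel
open Filter Topology MeasureTheory

/-- The kernel `e^{-r/2} e^{-itr} / (2 cosh (π t))`. -/
noncomputable def sechKernel (r t : ℝ) : ℂ :=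
  (Real.exp (-r / 2) : ℝ) * Complex.exp (((t * -r : ℝ) : ℂ) * Complex.I) *
    (((2 * Real.cosh (Real.pi * t))⁻¹ : ℝ) : ℂ)

theorem continuous_sech : Continuous fun t : ℝ => (2 * Real.cosh (Real.pi * t))⁻¹ :=
  Continuous.inv₀ (by fun_prop) fun t => by have := Real.cosh_pos (Real.pi * t); positivity

theorem continuous_sechKernel (r : ℝ) : Continuous (sechKernel r) := by
  unfold sechKernel
  have := Complex.continuous_ofReal.comp continuous_sech
  exact Continuous.mul (by fun_prop) this

theorem integrable_sech : Integrable fun t : ℝ => (2 * Real.cosh (Real.pi * t))⁻¹ := by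
  simp_rw [mul_inv]
  exact integrable_inv_cosh.const_mul _

theorem norm_sechKernel (r t : ℝ) :
    ‖sechKernel r t‖ = Real.exp (-r / 2) * (2 * Real.cosh (Real.pi * t))⁻¹ := by
  have := Real.cosh_pos (Real.pi * t)
  rw [sechKernel, norm_mul, norm_mul, Complex.norm_exp_ofReal_mul_I, Complex.norm_real,
    Complex.norm_real, mul_one, Real.norm_of_nonneg (Real.exp_pos _).le,
    Real.norm_of_nonneg (by positivity)]

theorem integrable_sechKernel (r : ℝ) : Integrable (sechKernel r) := by
  refine (integrable_sech.const_mul (Real.exp (-r / 2))).mono'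
    (continuous_sechKernel r).aestronglyMeasurable (Eventually.of_forall fun t => ?_)
  rw [norm_sechKernel]

theorem integrable_sechKernel_mul (r : ℝ) {f : ℝ → ℂ} (hf : Continuous f) {C : ℝ}
    (hC : ∀ t, ‖f t‖ ≤ C) : Integrable fun t => sechKernel r t * f t :=
  (integrable_sechKernel r).mul_bdd hf.aestronglyMeasurable (Eventually.of_forall hC)

theorem tendsto_integral_sechKernel (r : ℝ) {f : ℕ → ℝ → ℂ} {g : ℝ → ℂ}
    (hf : ∀ n, Continuous (f n)) {C : ℝ} (hC : ∀ n t, ‖f n t‖ ≤ C)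
    (h : ∀ t, Tendsto (fun n => f n t) atTop (𝓝 (g t))) :
    Tendsto (fun n => ∫ t, sechKernel r t * f n t) atTop (𝓝 (∫ t, sechKernel r t * g t)) := by
  refine tendsto_integral_of_dominated_convergence (fun t => ‖sechKernel r t‖ * C)
    (fun n => ((continuous_sechKernel r).mul (hf n)).aestronglyMeasurable)
    ((integrable_sechKernel r).norm.mul_const C)
    (fun n => Eventually.of_forall fun t => ?_) (Eventually.of_forall fun t => (h t).const_mul _)
  rw [norm_mul]
  gcongr
  exact hC n t

theorem integral_sechKernel_mul_exp (r δ : ℝ) :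
    ∫ t, sechKernel r t * Complex.exp (((t * δ : ℝ) : ℂ) * Complex.I)
      = ((Real.exp (-r / 2) * (2 * Real.cosh ((δ - r) / 2))⁻¹ : ℝ) : ℂ) := by
  rw [Complex.ofReal_mul, ← integral_exp_mul_sech, ← integral_const_mul]
  congr 1
  ext t
  have : Complex.exp (((t * (δ - r) : ℝ) : ℂ) * Complex.I)
      = Complex.exp (((t * -r : ℝ) : ℂ) * Complex.I) * Complex.exp (((t * δ : ℝ) : ℂ) * Complex.I) := by
    rw [← Complex.exp_add]; congr 1; push_cast; ring
  rw [this, sechKernel]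
  ring

theorem sech_identity (r : ℝ) {a b : ℝ} (ha0 : 0 < a) (ha1 : a < 1) (hb0 : 0 < b) (hb1 : b < 1) :
    Real.exp (-r / 2) * (2 * Real.cosh ((Real.log (a / (1 - a)) - Real.log (b / (1 - b)) - r) / 2))⁻¹
      * (a * (1 - b) + Real.exp r * ((1 - a) * b)) = √(a * (1 - a)) * √(b * (1 - b)) := by
  have ha1' : 0 < 1 - a := by linarith
  have hb1' : 0 < 1 - b := by linarith
  set l := Real.log (a / (1 - a)) with hl
  set m := Real.log (b / (1 - b)) with hm
  have e1 : a = (1 - a) * (Real.exp (l / 2)) ^ 2 := by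
    rw [← Real.exp_nat_mul]; push_cast
    rw [mul_div_cancel₀ _ (two_ne_zero' ℝ), hl, Real.exp_log (by positivity)]; field_simp
  have e2 : b = (1 - b) * (Real.exp (m / 2)) ^ 2 := by
    rw [← Real.exp_nat_mul]; push_cast
    rw [mul_div_cancel₀ _ (two_ne_zero' ℝ), hm, Real.exp_log (by positivity)]; field_simp
  have s1 : √(a * (1 - a)) = (1 - a) * Real.exp (l / 2) := by
    rw [Real.sqrt_eq_iff_mul_self_eq (by positivity) (by positivity)]
    linear_combination (1 - a) * e1
  have s2 : √(b * (1 - b)) = (1 - b) * Real.exp (m / 2) := by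
    rw [Real.sqrt_eq_iff_mul_self_eq (by positivity) (by positivity)]
    linear_combination (1 - b) * e2
  have hr : Real.exp r = Real.exp (r / 2) ^ 2 := by
    rw [← Real.exp_nat_mul]; congr 1; push_cast; ring
  have hr' : Real.exp (-r / 2) = (Real.exp (r / 2))⁻¹ := by
    rw [← Real.exp_neg]; congr 1; ring
  have hc : 2 * Real.cosh ((l - m - r) / 2) = Real.exp (l / 2) / (Real.exp (m / 2) * Real.exp (r / 2))
      + (Real.exp (m / 2) * Real.exp (r / 2)) / Real.exp (l / 2) := by
    rw [Real.cosh_eq, mul_div_cancel₀ _ (two_ne_zero' ℝ), ← Real.exp_add, ← Real.exp_sub,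
      ← Real.exp_sub]
    congr 2 <;> ring
  have q : a * (1 - b) + Real.exp r * ((1 - a) * b) = (1 - a) * (1 - b) *
      (Real.exp (l / 2) ^ 2 + Real.exp (r / 2) ^ 2 * Real.exp (m / 2) ^ 2) := by
    rw [hr]
    linear_combination (1 - b) * e1 + Real.exp (r / 2) ^ 2 * (1 - a) * e2
  rw [s1, s2, q, hr', hc]
  have := Real.exp_pos (l / 2)
  have := Real.exp_pos (m / 2)
  have := Real.exp_pos (r / 2)
  generalize Real.exp (l / 2) = x at *
  generalize Real.exp (m / 2) = y at *
  generalize Real.exp (r / 2) = z at *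
  field_simp

end Kernel

section FlowKernel
open Filter Topology MeasureTheory
variable {H : Type*} [NormedAddCommGroup H] [InnerProductSpace ℂ H] [CompleteSpace H]

theorem SpecFamily.inner_fn_fn {A : H →L[ℂ] H} {h : ℝ} (S : SpecFamily A h) (g k : ℝ → ℂ)
    (z : H →L[ℂ] H) (v w : H) : ⟪S.fn g v, z (S.fn k w)⟫_ℂ
      = ∑ i, ∑ j, star (g (S.a i)) * k (S.a j) * ⟪S.p i v, z (S.p j w)⟫_ℂ := by
  rw [fn_apply, fn_apply, sum_inner]
  refine Finset.sum_congr rfl fun i _ => ?_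
  rw [map_sum, inner_sum]
  refine Finset.sum_congr rfl fun j _ => ?_
  rw [map_smul, inner_smul_left, inner_smul_right, mul_assoc]
  rfl

theorem continuous_phase (a : ℝ) : Continuous fun t => phase t a := by
  unfold phase; fun_prop

theorem SpecFamily.continuous_fn {A : H →L[ℂ] H} {h : ℝ} (S : SpecFamily A h) {g : ℝ → ℝ → ℂ}
    (hg : ∀ a, Continuous fun t => g t a) (v : H) : Continuous fun t => S.fn (g t) v := by
  simp_rw [fn_apply]
  exact continuous_finsetSum _ fun i _ => (hg _).smul continuous_const

theorem SpecFamily.integral_sechKernel {A : H →L[ℂ] H} {h : ℝ} (hh : 0 < h) (S : SpecFamily A h)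
    (r : ℝ) (z : H →L[ℂ] H) (v w : H) :
    ∫ t, sechKernel r t *
      (⟪S.fn (phase (-t)) (S.fn (fun a => (a : ℂ)) v),
          z (S.fn (phase (-t)) (S.fn (fun a => ((1 - a : ℝ) : ℂ)) w))⟫_ℂ
        + (Real.exp r : ℂ) * ⟪S.fn (phase (-t)) (S.fn (fun a => ((1 - a : ℝ) : ℂ)) v),
          z (S.fn (phase (-t)) (S.fn (fun a => (a : ℂ)) w))⟫_ℂ)
      = ⟪S.fn (fun a => ((√(a * (1 - a)) : ℝ) : ℂ)) v,
          z (S.fn (fun a => ((√(a * (1 - a)) : ℝ) : ℂ)) w)⟫_ℂ := by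
  let l : ℝ → ℝ := fun a => Real.log (a / (1 - a))
  have e : ∀ t, sechKernel r t *
      (⟪S.fn (phase (-t)) (S.fn (fun a => (a : ℂ)) v),
          z (S.fn (phase (-t)) (S.fn (fun a => ((1 - a : ℝ) : ℂ)) w))⟫_ℂ
        + (Real.exp r : ℂ) * ⟪S.fn (phase (-t)) (S.fn (fun a => ((1 - a : ℝ) : ℂ)) v),
          z (S.fn (phase (-t)) (S.fn (fun a => (a : ℂ)) w))⟫_ℂ)
      = ∑ i, ∑ j, (((S.a i * (1 - S.a j) + Real.exp r * ((1 - S.a i) * S.a j) : ℝ) : ℂ)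
          * ⟪S.p i v, z (S.p j w)⟫_ℂ) *
          (sechKernel r t * Complex.exp (((t * (l (S.a i) - l (S.a j)) : ℝ) : ℂ) * Complex.I)) := by
    intro t
    have hp : ∀ a b : ℝ, star (phase (-t) a) * phase (-t) b
        = Complex.exp (((t * (l a - l b) : ℝ) : ℂ) * Complex.I) := by
      intro a b
      rw [star_phase, neg_neg, phase, phase, ← Complex.exp_add]
      congr 1; simp only [l]; push_cast; ring
    simp_rw [SpecFamily.fn_apply_fn, SpecFamily.inner_fn_fn, Finset.mul_sum, ← Finset.sum_add_distrib,
      Finset.mul_sum, ← hp]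
    refine Finset.sum_congr rfl fun i _ => Finset.sum_congr rfl fun j _ => ?_
    simp only [star_mul', Complex.star_def, Complex.conj_ofReal]
    push_cast
    ring
  simp_rw [e]
  have hi : ∀ i j, Integrable fun t =>
      (((S.a i * (1 - S.a j) + Real.exp r * ((1 - S.a i) * S.a j) : ℝ) : ℂ)
          * ⟪S.p i v, z (S.p j w)⟫_ℂ) *
          (sechKernel r t * Complex.exp (((t * (l (S.a i) - l (S.a j)) : ℝ) : ℂ) * Complex.I)) := by
    intro i j
    refine (integrable_sechKernel_mul r (by fun_prop) (C := 1) fun t => ?_).const_mul _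
    rw [Complex.norm_exp_ofReal_mul_I]
  rw [integral_finsetSum _ fun i _ => integrable_finsetSum _ fun j _ => hi i j,
    SpecFamily.inner_fn_fn]
  refine Finset.sum_congr rfl fun i _ => ?_
  rw [integral_finsetSum _ fun j _ => hi i j]
  refine Finset.sum_congr rfl fun j _ => ?_
  have hi1 := S.le_a i
  have hi2 := S.a_le i
  have hj1 := S.le_a j
  have hj2 := S.a_le j
  rw [integral_const_mul, integral_sechKernel_mul_exp, Complex.star_def, Complex.conj_ofReal,
    ← Complex.ofReal_mul (√_), ← sech_identity r (a := S.a i) (b := S.a j) (by linarith)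
      (by linarith) (by linarith) (by linarith)]
  push_cast
  ring

namespace SpectralFlow
variable {A : H →L[ℂ] H} (φ : SpectralFlow A)

theorem integral_sechKernel (hA : IsSelfAdjoint A) (hB : 0 ≤ A - A * A) (r : ℝ) (z : H →L[ℂ] H)
    (v w : H) :
    ∫ t, sechKernel r t * (⟪φ.U (-t) (A v), z (φ.U (-t) (w - A w))⟫_ℂ
        + (Real.exp r : ℂ) * ⟪φ.U (-t) (v - A v), z (φ.U (-t) (A w))⟫_ℂ)
      = ⟪CFC.sqrt (A - A * A) v, z (CFC.sqrt (A - A * A) w)⟫_ℂ := by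
  have hid := fun v => SpecFamily.tendsto_fn_id hA φ.S v
  have hb := fun n v => (φ.S n).norm_fn_id_le (by positivity) v
  have hb' : ∀ n v, ‖(φ.S n).fn (fun a => ((1 - a : ℝ) : ℂ)) v‖ ≤ ‖v‖ := fun n v => by
    have hp : (0 : ℝ) < 2⁻¹ ^ (n + 1) := by positivity
    have := (φ.S n).norm_fn_le (fun a => ((1 - a : ℝ) : ℂ)) zero_le_one (fun a h1 h2 => by
      rw [Complex.norm_real, Real.norm_eq_abs, abs_of_nonneg (by linarith)]; linarith) v
    rwa [one_mul] at this
  have hid' : ∀ v, Tendsto (fun n => (φ.S n).fn (fun a => ((1 - a : ℝ) : ℂ)) v) atTop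
      (𝓝 (v - A v)) := fun v => by
    refine ((hid v).const_sub v).congr fun n => ?_
    have : v = (φ.S n).fn (fun _ => 1) v := by rw [SpecFamily.fn_one]; rfl
    nth_rewrite 1 [this]
    rw [← sub_apply, SpecFamily.fn_sub]
    congr 2; ext a; push_cast; rfl
  have hph := fun (n : ℕ) t v => φ.norm_fn_phase n (-t) v
  have hT := SpecFamily.tendsto_fn_sqrt hA hB φ.S
  have hTv : ∀ v, Tendsto (fun n => (φ.S n).fn (fun a => ((√(a * (1 - a)) : ℝ) : ℂ)) v) atTop
      (𝓝 (CFC.sqrt (A - A * A) v)) := fun v =>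
    ((ContinuousLinearMap.apply ℂ H v).continuous.tendsto _).comp hT
  have hU : ∀ t x y, Tendsto x atTop (𝓝 y) →
      Tendsto (fun n => (φ.S n).fn (phase (-t)) (x n)) atTop (𝓝 (φ.U (-t) y)) := fun t x y hx =>
    tendsto_apply_of_strong (fun n v => (hph n t v).le) hx (φ.tendsto_U (-t) y)
  refine tendsto_nhds_unique ?_
    ((hTv v).inner ((z.continuous.tendsto _).comp (hTv w)))
  have hcont : ∀ n u, Continuous fun t => (φ.S n).fn (phase (-t)) u := fun n u =>
    (φ.S n).continuous_fn (g := fun t => phase (-t))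
      (fun a => (continuous_phase a).comp continuous_neg) u
  refine (tendsto_integral_sechKernel r
    (C := ‖v‖ * (‖z‖ * ‖w‖) + Real.exp r * (‖v‖ * (‖z‖ * ‖w‖))) ?_ ?_ ?_).congr
    fun n => (φ.S n).integral_sechKernel (by positivity) r z v w
  · intro n
    exact ((hcont n _).inner (z.continuous.comp (hcont n _))).add
      (continuous_const.mul ((hcont n _).inner (z.continuous.comp (hcont n _))))
  · intro n t
    have hin : ∀ a b : H, ‖a‖ ≤ ‖v‖ → ‖b‖ ≤ ‖w‖ → ‖⟪a, z b⟫_ℂ‖ ≤ ‖v‖ * (‖z‖ * ‖w‖) := by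
      intro a b ha hb
      refine (norm_inner_le_norm _ _).trans ?_
      gcongr
      exact (z.le_opNorm _).trans (by gcongr)
    refine (norm_add_le _ _).trans ?_
    rw [norm_mul, Complex.norm_real, Real.norm_of_nonneg (Real.exp_pos _).le]
    gcongr
    · exact hin _ _ ((hph _ _ _).le.trans (hb _ _)) ((hph _ _ _).le.trans (hb' _ _))
    · exact hin _ _ ((hph _ _ _).le.trans (hb' _ _)) ((hph _ _ _).le.trans (hb _ _))
  · intro t
    exact ((hU t _ _ (hid v)).inner ((z.continuous.tendsto _).comp (hU t _ _ (hid' w)))).add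
      (((hU t _ _ (hid' v)).inner ((z.continuous.tendsto _).comp (hU t _ _ (hid w)))).const_mul _)

theorem integral_sechKernel_of_eq (hA : IsSelfAdjoint A) (hB : 0 ≤ A - A * A)
    (hd : DenseRange (A - A * A)) (hT : DenseRange (CFC.sqrt (A - A * A) : H →L[ℂ] H)) (r : ℝ)
    {y z : H →L[ℂ] H} (hyz : CFC.sqrt (A - A * A) * y * CFC.sqrt (A - A * A)
      = A * z * (1 - A) + (Real.exp r : ℂ) • ((1 - A) * z * A)) (v w : H) :
    ∫ t, sechKernel r t * ⟪φ.U (-t) v, y (φ.U (-t) w)⟫_ℂ = ⟪v, z w⟫_ℂ := by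
  have hTs : IsSelfAdjoint (CFC.sqrt (A - A * A)) := (CFC.sqrt_nonneg _).isSelfAdjoint
  have hTA : Commute A (CFC.sqrt (A - A * A)) := by
    refine (commute_sqrt_of_commute hB ?_).symm
    exact (Commute.refl A).sub_left ((Commute.refl A).mul_left (Commute.refl A))
  have hT1 : ∀ v w, ∫ t, sechKernel r t * ⟪φ.U (-t) (CFC.sqrt (A - A * A) v),
      y (φ.U (-t) (CFC.sqrt (A - A * A) w))⟫_ℂ
      = ⟪CFC.sqrt (A - A * A) v, z (CFC.sqrt (A - A * A) w)⟫_ℂ := by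
    intro v w
    rw [← φ.integral_sechKernel hA hB r z v w]
    congr 1
    ext t
    congr 1
    have hc : ∀ v, φ.U (-t) (CFC.sqrt (A - A * A) v) = CFC.sqrt (A - A * A) (φ.U (-t) v) := fun v =>
      DFunLike.congr_fun (φ.commute_U hTA (-t)).eq v
    have hcA : ∀ v, φ.U (-t) (A v) = A (φ.U (-t) v) := fun v =>
      DFunLike.congr_fun (φ.commute_U (Commute.refl A) (-t)).eq v
    rw [hc, hc, inner_apply_of_isSelfAdjoint hTs]
    have := DFunLike.congr_fun hyz (φ.U (-t) w)
    simp only [mul_apply_eq_comp, add_apply, smul_apply, sub_apply, one_apply_eq_self] at this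
    rw [this]
    simp only [map_sub, hcA, inner_add_right, inner_sub_right, inner_sub_left, inner_smul_right,
      inner_apply_of_isSelfAdjoint hA]
  have hseq : ∀ v, ∃ x : ℕ → H, Tendsto (fun n => CFC.sqrt (A - A * A) (x n)) atTop (𝓝 v) := by
    intro v
    obtain ⟨x, hx, hl⟩ := mem_closure_iff_seq_limit.1 (hT v)
    choose x' hx' using hx
    exact ⟨x', hl.congr fun n => (hx' n).symm⟩
  obtain ⟨x, hx⟩ := hseq v
  obtain ⟨x', hx'⟩ := hseq w
  have hUc : ∀ u, Continuous fun t => φ.U (-t) u := fun u =>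
    (φ.continuous_U hA hd u).comp continuous_neg
  obtain ⟨C, hC⟩ := hx.norm.bddAbove_range
  obtain ⟨C', hC'⟩ := hx'.norm.bddAbove_range
  have hCn : ∀ n, ‖CFC.sqrt (A - A * A) (x n)‖ ≤ C := fun n => hC ⟨n, rfl⟩
  have hCn' : ∀ n, ‖CFC.sqrt (A - A * A) (x' n)‖ ≤ C' := fun n => hC' ⟨n, rfl⟩
  have lim := tendsto_integral_sechKernel r (C := C * (‖y‖ * C'))
    (f := fun n t => ⟪φ.U (-t) (CFC.sqrt (A - A * A) (x n)),
      y (φ.U (-t) (CFC.sqrt (A - A * A) (x' n)))⟫_ℂ)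
    (g := fun t => ⟪φ.U (-t) v, y (φ.U (-t) w)⟫_ℂ)
    (fun n => (hUc _).inner (y.continuous.comp (hUc _)))
    (fun n t => by
      refine (norm_inner_le_norm _ _).trans ?_
      have h0 : 0 ≤ C := (norm_nonneg _).trans (hCn 0)
      gcongr
      · rw [norm_U]; exact hCn n
      · refine (y.le_opNorm _).trans ?_
        gcongr
        rw [norm_U]; exact hCn' n)
    (fun t => (((φ.U (-t)).continuous.tendsto _).comp hx).inner
      ((y.continuous.tendsto _).comp (((φ.U (-t)).continuous.tendsto _).comp hx')))
  refine tendsto_nhds_unique lim ?_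
  simp_rw [hT1]
  exact hx.inner ((z.continuous.tendsto _).comp hx')

/-- Fourier uniqueness against the kernels `sechKernel`. -/
theorem _root_.eq_zero_of_integral_sechKernel {F : ℝ → ℂ} (hF : Continuous F) {C : ℝ}
    (hC : ∀ t, ‖F t‖ ≤ C) (h : ∀ r, ∫ t, sechKernel r t * F t = 0) (t : ℝ) : F t = 0 := by
  let G : ℝ → ℂ := fun t => (((2 * Real.cosh (Real.pi * t))⁻¹ : ℝ) : ℂ) * F t
  have hGc : Continuous G := (Complex.continuous_ofReal.comp continuous_sech).mul hF
  have hG : Integrable G := (integrable_sech.ofReal (𝕜 := ℂ)).mul_bdd hF.aestronglyMeasurable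
    (Eventually.of_forall hC)
  have hG0 : FourierTransform.fourier G = 0 := by
    ext r
    have h1 := h (2 * Real.pi * r)
    have e : ∀ t, sechKernel (2 * Real.pi * r) t * F t
        = (Real.exp (-(2 * Real.pi * r) / 2) : ℝ) *
          (Complex.exp ((↑(-2 * Real.pi * t * r) : ℂ) * Complex.I) • G t) := by
      intro t
      have : (((t * -(2 * Real.pi * r) : ℝ) : ℂ)) = (↑(-2 * Real.pi * t * r) : ℂ) := by
        push_cast; ring
      rw [sechKernel, this, smul_eq_mul]
      simp only [G]
      push_cast
      ring
    simp_rw [e] at h1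
    rw [integral_const_mul] at h1
    have h2 := (mul_eq_zero.1 h1).resolve_left (by exact_mod_cast (Real.exp_pos _).ne')
    rw [Real.fourier_real_eq_integral_exp_smul]
    exact h2
  have := hG.fourierInv_fourier_eq (v := t) (by rw [hG0]; exact integrable_zero _ _ _)
    hGc.continuousAt
  rw [hG0] at this
  have h3 : G t = 0 := by
    rw [← this, Real.fourierInv_eq']
    simp
  refine (mul_eq_zero.1 h3).resolve_left ?_
  have := Real.cosh_pos (Real.pi * t)
  exact_mod_cast (by positivity : (2 * Real.cosh (Real.pi * t))⁻¹ ≠ 0)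

/-- If the relation defining the dual elements holds with `z` in the commutant of `𝓑` for all
parameters, then the whole orbit under the flow lies in the commutant of `𝓑`. -/
theorem commute_flow (hA : IsSelfAdjoint A) (hB : 0 ≤ A - A * A)
    (hd : DenseRange (A - A * A)) (hT : DenseRange (CFC.sqrt (A - A * A) : H →L[ℂ] H))
    {y x : H →L[ℂ] H} (hyz : ∀ s : ℝ, 0 < s → ∃ z, Commute x z ∧
      CFC.sqrt (A - A * A) * y * CFC.sqrt (A - A * A)
        = A * z * (1 - A) + (s : ℂ) • ((1 - A) * z * A)) (t : ℝ) :
    Commute x (φ.U t * y * φ.U (-t)) := by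
  have hUc : ∀ u, Continuous fun t => φ.U (-t) u := fun u =>
    (φ.continuous_U hA hd u).comp continuous_neg
  have hin : ∀ a b t, ‖⟪φ.U (-t) a, y (φ.U (-t) b)⟫_ℂ‖ ≤ ‖a‖ * (‖y‖ * ‖b‖) := by
    intro a b t
    refine (norm_inner_le_norm _ _).trans ?_
    rw [norm_U]
    gcongr
    refine (y.le_opNorm _).trans ?_
    rw [norm_U]
  have hinc : ∀ a b, Continuous fun t => ⟪φ.U (-t) a, y (φ.U (-t) b)⟫_ℂ := fun a b =>
    (hUc a).inner (y.continuous.comp (hUc b))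
  ext w
  refine ext_inner_left ℂ fun v => ?_
  have key := eq_zero_of_integral_sechKernel
    (F := fun t => ⟪φ.U (-t) (star x v), y (φ.U (-t) w)⟫_ℂ - ⟪φ.U (-t) v, y (φ.U (-t) (x w))⟫_ℂ)
    ((hinc _ _).sub (hinc _ _))
    (fun t => (norm_sub_le _ _).trans (add_le_add (hin _ _ t) (hin _ _ t)))
    (fun r => by
      obtain ⟨z, hxz, hz⟩ := hyz (Real.exp r) (Real.exp_pos r)
      simp_rw [mul_sub]
      rw [integral_sub (integrable_sechKernel_mul r (hinc _ _) (hin _ _))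
        (integrable_sechKernel_mul r (hinc _ _) (hin _ _)),
        φ.integral_sechKernel_of_eq hA hB hd hT r hz, φ.integral_sechKernel_of_eq hA hB hd hT r hz,
        inner_apply_eq_star, star_star, ← mul_apply_eq_comp, ← mul_apply_eq_comp, hxz.eq, sub_self])
    t
  have hs : ∀ a b, ⟪φ.U (-t) a, b⟫_ℂ = ⟪a, φ.U t b⟫_ℂ := fun a b => by
    rw [inner_apply_eq_star, star_U, neg_neg]
  rw [hs, hs, sub_eq_zero, inner_apply_eq_star, star_star] at key
  exact key

end SpectralFlow
end FlowKernel

section MulOp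

open Filter Topology MeasureTheory

variable {H : Type*} [NormedAddCommGroup H] [InnerProductSpace ℂ H]

/-- Bounded operator-valued functions on the line that are strongly measurable pointwise. -/
def IsBoundedField (Φ : ℝ → H →L[ℂ] H) : Prop :=
  (∀ v, StronglyMeasurable fun t => Φ t v) ∧ ∃ C, ∀ t, ‖Φ t‖ ≤ C

namespace IsBoundedField

theorem const (x : H →L[ℂ] H) : IsBoundedField fun _ => x :=
  ⟨fun _ => stronglyMeasurable_const, ‖x‖, fun _ => le_rfl⟩

theorem smul_one {g : ℝ → ℂ} (hg : Measurable g) {C : ℝ} (hC : ∀ t, ‖g t‖ ≤ C) :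
    IsBoundedField fun t => g t • (1 : H →L[ℂ] H) := by
  refine ⟨fun v => ?_, C, fun t => ?_⟩
  · simpa using hg.stronglyMeasurable.smul_const v
  · calc _ ≤ ‖g t‖ * ‖(1 : H →L[ℂ] H)‖ := norm_smul_le _ _
      _ ≤ ‖g t‖ * 1 := by
        gcongr
        exact ContinuousLinearMap.norm_id_le
      _ ≤ C := by simpa using hC t

variable {Φ Ψ : ℝ → H →L[ℂ] H}

theorem apply_simpleFunc (hΦ : IsBoundedField Φ) (F : SimpleFunc ℝ H) :
    StronglyMeasurable fun t => Φ t (F t) := by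
  induction F using SimpleFunc.induction with
  | const v hs =>
    rename_i s
    have : (fun t => Φ t ((SimpleFunc.piecewise s hs (SimpleFunc.const ℝ v)
        (SimpleFunc.const ℝ 0)) t)) = s.indicator fun t => Φ t v := by
      ext t
      by_cases h : t ∈ s <;> simp [h]
    rw [this]
    exact (hΦ.1 v).indicator hs
  | add _ hF hG => simpa [Pi.add_def] using hF.add hG

theorem apply_stronglyMeasurable (hΦ : IsBoundedField Φ) {F : ℝ → H} (hF : StronglyMeasurable F) :
    StronglyMeasurable fun t => Φ t (F t) :=
  stronglyMeasurable_of_tendsto atTop (fun n => hΦ.apply_simpleFunc (hF.approx n))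
    (tendsto_pi_nhds.2 fun t => ((Φ t).continuous.tendsto _).comp (hF.tendsto_approx t))

theorem apply_aestronglyMeasurable (hΦ : IsBoundedField Φ) {F : ℝ → H}
    (hF : AEStronglyMeasurable F volume) : AEStronglyMeasurable (fun t => Φ t (F t)) volume :=
  ⟨fun t => Φ t (hF.mk F t), hΦ.apply_stronglyMeasurable hF.stronglyMeasurable_mk, by
    filter_upwards [hF.ae_eq_mk] with t ht
    rw [ht]⟩

theorem memLp (hΦ : IsBoundedField Φ) (F : Lp (α := ℝ) H 2) :
    MemLp (fun t => Φ t (F t)) 2 volume := by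
  obtain ⟨C, hC⟩ := hΦ.2
  refine (Lp.memLp F).of_le_mul (hΦ.apply_aestronglyMeasurable (Lp.aestronglyMeasurable F))
    (c := C) (Eventually.of_forall fun t => ?_)
  exact (Φ t).le_of_opNorm_le (hC t) _

theorem mul (hΦ : IsBoundedField Φ) (hΨ : IsBoundedField Ψ) :
    IsBoundedField fun t => Φ t * Ψ t := by
  obtain ⟨C, hC⟩ := hΦ.2
  obtain ⟨D, hD⟩ := hΨ.2
  refine ⟨fun v => hΦ.apply_stronglyMeasurable (hΨ.1 v), C * D, fun t => ?_⟩
  exact (norm_mul_le _ _).trans (mul_le_mul (hC t) (hD t) (norm_nonneg _)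
    ((norm_nonneg _).trans (hC t)))

theorem add (hΦ : IsBoundedField Φ) (hΨ : IsBoundedField Ψ) :
    IsBoundedField fun t => Φ t + Ψ t := by
  obtain ⟨C, hC⟩ := hΦ.2
  obtain ⟨D, hD⟩ := hΨ.2
  exact ⟨fun v => (hΦ.1 v).add (hΨ.1 v), C + D, fun t =>
    (norm_add_le _ _).trans (add_le_add (hC t) (hD t))⟩

end IsBoundedField

/-- Multiplication by a bounded operator-valued function on `L²(ℝ; H)`. -/
noncomputable def mulOp (Φ : ℝ → H →L[ℂ] H) (hΦ : IsBoundedField Φ) :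
    Lp (α := ℝ) H 2 →L[ℂ] Lp (α := ℝ) H 2 :=
  LinearMap.mkContinuousOfExistsBound
    { toFun := fun F => (hΦ.memLp F).toLp _
      map_add' := fun F G => by
        rw [← MemLp.toLp_add]
        refine MemLp.toLp_congr _ _ ?_
        filter_upwards [Lp.coeFn_add F G] with t ht
        rw [ht, Pi.add_apply, map_add, Pi.add_apply]
      map_smul' := fun c F => by
        simp only [RingHom.id_apply]
        rw [← MemLp.toLp_const_smul]
        refine MemLp.toLp_congr _ _ ?_
        filter_upwards [Lp.coeFn_smul c F] with t ht
        simp [ht] } (by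
      obtain ⟨C, hC⟩ := hΦ.2
      refine ⟨C, fun F => Lp.norm_le_mul_norm_of_ae_le_mul ?_⟩
      filter_upwards [(hΦ.memLp F).coeFn_toLp] with t ht
      simp only [LinearMap.coe_mk, AddHom.coe_mk, ht]
      exact (Φ t).le_of_opNorm_le (hC t) _)

variable {Φ Ψ : ℝ → H →L[ℂ] H}

theorem coeFn_mulOp (hΦ : IsBoundedField Φ) (F : Lp (α := ℝ) H 2) :
    mulOp Φ hΦ F =ᵐ[volume] fun t => Φ t (F t) :=
  (hΦ.memLp F).coeFn_toLp

theorem mulOp_mul (hΦ : IsBoundedField Φ) (hΨ : IsBoundedField Ψ) :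
    mulOp Φ hΦ * mulOp Ψ hΨ = mulOp (fun t => Φ t * Ψ t) (hΦ.mul hΨ) := by
  ext1 F
  refine Lp.ext ?_
  filter_upwards [coeFn_mulOp hΦ (mulOp Ψ hΨ F), coeFn_mulOp hΨ F,
    coeFn_mulOp (hΦ.mul hΨ) F] with t h1 h2 h3
  rw [mul_apply_eq_comp, h1, h2, h3]
  rfl

theorem mulOp_add (hΦ : IsBoundedField Φ) (hΨ : IsBoundedField Ψ) :
    mulOp Φ hΦ + mulOp Ψ hΨ = mulOp (fun t => Φ t + Ψ t) (hΦ.add hΨ) := by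
  ext1 F
  refine Lp.ext ?_
  filter_upwards [Lp.coeFn_add (mulOp Φ hΦ F) (mulOp Ψ hΨ F), coeFn_mulOp hΦ F, coeFn_mulOp hΨ F,
    coeFn_mulOp (hΦ.add hΨ) F] with t h1 h2 h3 h4
  rw [add_apply, h1, h4, Pi.add_apply, h2, h3]
  rfl

theorem mulOp_one : mulOp (fun _ => (1 : H →L[ℂ] H)) (.const 1) = 1 := by
  ext1 F
  refine Lp.ext ?_
  filter_upwards [coeFn_mulOp (.const (1 : H →L[ℂ] H)) F] with t h1
  rw [h1]
  rfl

theorem star_mulOp [CompleteSpace H] (hΦ : IsBoundedField Φ) (hΨ : IsBoundedField Ψ) (h : ∀ t, star (Φ t) = Ψ t) :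
    star (mulOp Φ hΦ) = mulOp Ψ hΨ := by
  rw [ContinuousLinearMap.star_eq_adjoint]
  refine ((ContinuousLinearMap.eq_adjoint_iff _ _).2 fun F G => ?_).symm
  rw [L2.inner_def, L2.inner_def]
  refine integral_congr_ae ?_
  filter_upwards [coeFn_mulOp hΦ G, coeFn_mulOp hΨ F] with t h1 h2
  rw [h1, h2, ← h t, ContinuousLinearMap.star_eq_adjoint, ContinuousLinearMap.adjoint_inner_left]

theorem L2_norm_sq_eq_integral (F : Lp (α := ℝ) H 2) : ‖F‖ ^ 2 = ∫ t, ‖F t‖ ^ 2 := by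
  have h := L2.inner_def (𝕜 := ℂ) F F
  rw [inner_self_eq_norm_sq_to_K] at h
  simp_rw [inner_self_eq_norm_sq_to_K] at h
  have h2 : ∫ t, ((‖F t‖ : ℂ)) ^ 2 = ((∫ t, ‖F t‖ ^ 2 : ℝ) : ℂ) := by
    rw [← integral_complex_ofReal]
    push_cast
    rfl
  refine Complex.ofReal_injective (Eq.trans ?_ (h.trans h2))
  push_cast
  rfl

theorem tendsto_mulOp {Φs : ℕ → ℝ → H →L[ℂ] H} (hs : ∀ n, IsBoundedField (Φs n))
    (hΦ : IsBoundedField Φ) {C : ℝ} (hC : ∀ n t, ‖Φs n t‖ ≤ C)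
    (h : ∀ t v, Tendsto (fun n => Φs n t v) atTop (𝓝 (Φ t v))) (F : Lp (α := ℝ) H 2) :
    Tendsto (fun n => mulOp (Φs n) (hs n) F) atTop (𝓝 (mulOp Φ hΦ F)) := by
  obtain ⟨D, hD⟩ := hΦ.2
  have h1 : ∀ n, ‖mulOp (Φs n) (hs n) F - mulOp Φ hΦ F‖ ^ 2
      = ∫ t, ‖Φs n t (F t) - Φ t (F t)‖ ^ 2 := fun n => by
    rw [L2_norm_sq_eq_integral]
    refine integral_congr_ae ?_
    filter_upwards [Lp.coeFn_sub (mulOp (Φs n) (hs n) F) (mulOp Φ hΦ F), coeFn_mulOp (hs n) F,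
      coeFn_mulOp hΦ F] with t e1 e2 e3
    simp only [e1, Pi.sub_apply, e2, e3]
  have h2 : Tendsto (fun n => ∫ t, ‖Φs n t (F t) - Φ t (F t)‖ ^ 2) atTop
      (𝓝 (∫ _ : ℝ, (0 : ℝ))) := by
    refine tendsto_integral_of_dominated_convergence (fun t => ((C + D) * ‖F t‖) ^ 2)
      (fun n => ?_) ?_ (fun n => Eventually.of_forall fun t => ?_) (Eventually.of_forall fun t => ?_)
    · exact (((hs n).apply_aestronglyMeasurable (Lp.aestronglyMeasurable F)).sub
        (hΦ.apply_aestronglyMeasurable (Lp.aestronglyMeasurable F))).norm.pow 2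
    · simp_rw [mul_pow]
      exact ((memLp_two_iff_integrable_sq_norm (Lp.aestronglyMeasurable F)).1
        (Lp.memLp F)).const_mul _
    · rw [Real.norm_of_nonneg (by positivity)]
      refine pow_le_pow_left₀ (norm_nonneg _) ((norm_sub_le _ _).trans ?_) 2
      rw [add_mul]
      exact add_le_add ((Φs n t).le_of_opNorm_le (hC n t) _) ((Φ t).le_of_opNorm_le (hD t) _)
    · have := ((h t (F t)).sub_const (Φ t (F t))).norm.pow 2
      simpa using this
  rw [integral_zero] at h2
  rw [tendsto_iff_norm_sub_tendsto_zero]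
  have h3 := (h2.congr fun n => (h1 n).symm).sqrt
  simpa using h3

end MulOp

section FourierSide

open Filter Topology MeasureTheory

variable {H : Type*} [NormedAddCommGroup H] [InnerProductSpace ℂ H]

/-- Constant operators acting on `L²(ℝ; H)`. -/
noncomputable def constOp (x : H →L[ℂ] H) : Lp (α := ℝ) H 2 →L[ℂ] Lp (α := ℝ) H 2 :=
  mulOp (fun _ => x) (.const x)

/-- Translation on `L²(ℝ; H)`. -/
noncomputable def shiftOp (l : ℝ) : Lp (α := ℝ) H 2 →L[ℂ] Lp (α := ℝ) H 2 :=
  (Lp.compMeasurePreservingₗᵢ ℂ (fun t : ℝ => t + l)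
    (measurePreserving_add_right volume l)).toContinuousLinearMap

theorem coeFn_shiftOp (l : ℝ) (F : Lp (α := ℝ) H 2) :
    shiftOp l F =ᵐ[volume] fun t => F (t + l) :=
  Lp.coeFn_compMeasurePreserving F (measurePreserving_add_right volume l)

/-- Evaluate an almost everywhere identity at a translated point. -/
theorem ae_comp_add {p : ℝ → Prop} (l : ℝ) (h : ∀ᵐ t, p t) : ∀ᵐ t, p (t + l) :=
  (measurePreserving_add_right volume l).quasiMeasurePreserving.ae h

theorem constOp_apply_ae (x : H →L[ℂ] H) (F : Lp (α := ℝ) H 2) :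
    constOp x F =ᵐ[volume] fun t => x (F t) := coeFn_mulOp _ F

theorem constOp_mul (x y : H →L[ℂ] H) : constOp (x * y) = constOp x * constOp y :=
  (mulOp_mul (.const x) (.const y)).symm

theorem constOp_add (x y : H →L[ℂ] H) : constOp (x + y) = constOp x + constOp y :=
  (mulOp_add (.const x) (.const y)).symm

theorem constOp_one : constOp (1 : H →L[ℂ] H) = 1 := mulOp_one

theorem constOp_smul (c : ℂ) (x : H →L[ℂ] H) : constOp (c • x) = c • constOp x := by
  have h : constOp (c • (1 : H →L[ℂ] H)) = c • 1 := by
    ext1 F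
    refine Lp.ext ?_
    filter_upwards [constOp_apply_ae (c • (1 : H →L[ℂ] H)) F, Lp.coeFn_smul c F] with t h1 h2
    rw [h1]
    exact h2.symm
  rw [← one_mul x, ← smul_mul_assoc, constOp_mul, h, smul_mul_assoc, one_mul, one_mul]

theorem constOp_sum {κ : Type*} (s : Finset κ) (x : κ → H →L[ℂ] H) :
    constOp (∑ i ∈ s, x i) = ∑ i ∈ s, constOp (x i) := by
  have h0 : constOp (0 : H →L[ℂ] H) = 0 := by
    simpa using constOp_smul 0 (0 : H →L[ℂ] H)
  induction s using Finset.induction_on with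
  | empty => simpa using h0
  | insert a s ha ih => rw [Finset.sum_insert ha, Finset.sum_insert ha, constOp_add, ih]

theorem commute_shiftOp_constOp (l : ℝ) (x : H →L[ℂ] H) : Commute (shiftOp l) (constOp x) := by
  ext1 F
  refine Lp.ext ?_
  filter_upwards [coeFn_shiftOp l (constOp x F), constOp_apply_ae x (shiftOp l F),
    coeFn_shiftOp l F, ae_comp_add l (constOp_apply_ae x F)] with t h1 h2 h3 h4
  rw [mul_apply_eq_comp, mul_apply_eq_comp, h1, h2, h3, h4]

theorem shiftOp_mul (l k : ℝ) : shiftOp (H := H) l * shiftOp k = shiftOp (l + k) := by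
  ext1 F
  refine Lp.ext ?_
  filter_upwards [coeFn_shiftOp l (shiftOp k F), ae_comp_add l (coeFn_shiftOp k F),
    coeFn_shiftOp (l + k) F] with t h1 h2 h3
  rw [mul_apply_eq_comp, h1, h2, h3, add_assoc]

theorem shiftOp_zero : shiftOp (H := H) 0 = 1 := by
  ext1 F
  refine Lp.ext ?_
  filter_upwards [coeFn_shiftOp 0 F] with t h1
  rw [h1, add_zero]
  rfl

theorem star_shiftOp [CompleteSpace H] (l : ℝ) : star (shiftOp (H := H) l) = shiftOp (-l) := by
  have h1 : star (shiftOp (H := H) l) * shiftOp l = 1 :=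
    (ContinuousLinearMap.norm_map_iff_adjoint_comp_self _).1
      (Lp.compMeasurePreservingₗᵢ ℂ (fun t : ℝ => t + l)
        (measurePreserving_add_right volume l)).norm_map
  calc star (shiftOp (H := H) l) = star (shiftOp (H := H) l) * (shiftOp l * shiftOp (-l)) := by
        rw [shiftOp_mul, add_neg_cancel, shiftOp_zero, mul_one]
    _ = _ := by rw [← mul_assoc, h1, one_mul]

variable [CompleteSpace H]

theorem star_constOp (x : H →L[ℂ] H) : star (constOp x) = constOp (star x) :=
  star_mulOp _ _ fun _ => rfl

/-- Conjugation by the Fourier transform. -/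
noncomputable def fourierConj :
    (Lp (α := ℝ) H 2 →L[ℂ] Lp (α := ℝ) H 2) ≃⋆ₐ[ℂ] (Lp (α := ℝ) H 2 →L[ℂ] Lp (α := ℝ) H 2) :=
  (Lp.fourierTransformₗᵢ ℝ H).symm.conjStarAlgEquiv

theorem fourierConj_eq_of_schwartz {X Y : Lp (α := ℝ) H 2 →L[ℂ] Lp (α := ℝ) H 2}
    (h : ∀ f : SchwartzMap ℝ H,
      Lp.fourierTransformₗᵢ ℝ H (Y (f.toLp 2)) = X ((FourierTransform.fourier f).toLp 2)) :
    fourierConj X = Y := by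
  have key : ∀ F, Lp.fourierTransformₗᵢ ℝ H (Y F) = X (Lp.fourierTransformₗᵢ ℝ H F) := fun F => by
    refine DenseRange.induction_on
      (p := fun F => Lp.fourierTransformₗᵢ ℝ H (Y F) = X (Lp.fourierTransformₗᵢ ℝ H F))
      (SchwartzMap.denseRange_toLpCLM (p := 2) (F := H) (E := ℝ) (μ := volume)
        ENNReal.ofNat_ne_top) F ?_ fun f => ?_
    · exact isClosed_eq ((Lp.fourierTransformₗᵢ ℝ H).continuous.comp Y.continuous)
        (X.continuous.comp (Lp.fourierTransformₗᵢ ℝ H).continuous)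
    · exact (h f).trans (congrArg X (SchwartzMap.toLp_fourier_eq f).symm)
  ext1 F
  rw [fourierConj, LinearIsometryEquiv.conjStarAlgEquiv_apply_apply,
    LinearIsometryEquiv.symm_symm, ← key, LinearIsometryEquiv.symm_apply_apply]

theorem fourierConj_constOp (x : H →L[ℂ] H) : fourierConj (constOp x) = constOp x := by
  refine fourierConj_eq_of_schwartz fun f => ?_
  have h1 : constOp x (f.toLp 2) = (f.postcompCLM x).toLp 2 := by
    refine Lp.ext ?_
    filter_upwards [constOp_apply_ae x (f.toLp 2), f.coeFn_toLp 2,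
      (f.postcompCLM x).coeFn_toLp 2] with t e1 e2 e3
    rw [e1, e2, e3, SchwartzMap.postcompCLM_apply]
  rw [h1]
  refine (SchwartzMap.toLp_fourier_eq _).trans (Lp.ext ?_)
  filter_upwards [constOp_apply_ae x ((FourierTransform.fourier f).toLp 2),
    (FourierTransform.fourier f).coeFn_toLp 2,
    (FourierTransform.fourier (f.postcompCLM x)).coeFn_toLp 2] with t e1 e2 e3
  rw [e1, e2, e3, SchwartzMap.fourier_coe, SchwartzMap.fourier_coe, Real.fourier_real_eq,
    Real.fourier_real_eq, ← x.integral_comp_comm]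
  · refine integral_congr_ae (Eventually.of_forall fun v => ?_)
    simp only [SchwartzMap.postcompCLM_apply, Circle.smul_def, map_smul]
  · have := (Real.fourierIntegral_convergent_iff (V := ℝ) (μ := volume) (f := f) t).2 f.integrable
    simpa [mul_comm] using this

/-- The modulation function conjugate to translation by `l`. -/
noncomputable def modulation (l t : ℝ) : ℂ := Complex.exp ((2 * Real.pi * t * l : ℝ) * Complex.I)

theorem norm_modulation (l t : ℝ) : ‖modulation l t‖ = 1 := Complex.norm_exp_ofReal_mul_I _

theorem continuous_modulation (l : ℝ) : Continuous (modulation l) := by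
  unfold modulation
  fun_prop

theorem isBoundedField_modulation (l : ℝ) :
    IsBoundedField fun t => modulation l t • (1 : H →L[ℂ] H) :=
  .smul_one (continuous_modulation l).measurable fun t => (norm_modulation l t).le

theorem fourierConj_modulation (l : ℝ) :
    fourierConj (mulOp _ (isBoundedField_modulation (H := H) l)) = shiftOp l := by
  refine fourierConj_eq_of_schwartz fun f => ?_
  have h1 : shiftOp l (f.toLp 2) = (f.compSubConstCLM ℂ (-l)).toLp 2 := by
    refine Lp.ext ?_
    have h0 : ∀ᵐ t, (f.toLp 2 volume) t = f t := f.coeFn_toLp 2 volume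
    filter_upwards [coeFn_shiftOp l (f.toLp 2), ae_comp_add l h0,
      (f.compSubConstCLM ℂ (-l)).coeFn_toLp 2] with t e1 e2 e3
    rw [e1, e2, e3, SchwartzMap.compSubConstCLM_apply, sub_neg_eq_add]
  rw [h1]
  refine (SchwartzMap.toLp_fourier_eq _).trans (Lp.ext ?_)
  filter_upwards [coeFn_mulOp (isBoundedField_modulation (H := H) l)
      ((FourierTransform.fourier f).toLp 2),
    (FourierTransform.fourier f).coeFn_toLp 2,
    (FourierTransform.fourier (f.compSubConstCLM ℂ (-l))).coeFn_toLp 2] with t e1 e2 e3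
  rw [e1, e2, e3, SchwartzMap.fourier_coe, SchwartzMap.fourier_coe]
  have h2 : (f.compSubConstCLM ℂ (-l) : ℝ → H) = (f : ℝ → H) ∘ fun v => v + l := by
    ext v
    simp
  rw [h2]
  have h3 := congrFun (VectorFourier.fourierIntegral_comp_add_right Real.fourierChar volume
    (innerₗ ℝ) (f : ℝ → H) l) t
  refine h3.trans ?_
  rw [Circle.smul_def, Real.fourierChar_apply]
  simp only [smul_apply, one_apply_eq_self, modulation]
  congr 2
  simp
  ring
end FourierSide

section HalfLine

open Filter Topology MeasureTheory

variable {H : Type*} [NormedAddCommGroup H] [InnerProductSpace ℂ H]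

theorem isBoundedField_cut (c : ℝ) :
    IsBoundedField fun t : ℝ => ((Set.Ioi c).indicator (fun _ => (1 : ℂ)) t) • (1 : H →L[ℂ] H) :=
  .smul_one (C := 1) (measurable_const.indicator measurableSet_Ioi) fun t => by
    by_cases h : t ∈ Set.Ioi c <;> simp [h]

/-- Restriction to the half-line `(c, ∞)`, acting on `L²(ℝ; H)`. -/
noncomputable def cutOp (c : ℝ) : Lp (α := ℝ) H 2 →L[ℂ] Lp (α := ℝ) H 2 :=
  mulOp _ (isBoundedField_cut c)

theorem cutOp_apply_ae (c : ℝ) (F : Lp (α := ℝ) H 2) :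
    cutOp c F =ᵐ[volume] fun t => if c < t then F t else 0 := by
  filter_upwards [coeFn_mulOp (isBoundedField_cut (H := H) c) F] with t h
  rw [cutOp, h]
  by_cases hc : c < t <;> simp [hc]

theorem cutOp_mul (c d : ℝ) : cutOp (H := H) c * cutOp d = cutOp (max c d) := by
  ext1 F
  refine Lp.ext ?_
  filter_upwards [cutOp_apply_ae c (cutOp d F), cutOp_apply_ae d F,
    cutOp_apply_ae (max c d) F] with t h1 h2 h3
  rw [mul_apply_eq_comp, h1, h2, h3]
  by_cases hc : c < t <;> by_cases hd : d < t <;> simp [hc, hd]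

theorem commute_cutOp (c d : ℝ) : Commute (cutOp (H := H) c) (cutOp d) := by
  rw [Commute, SemiconjBy, cutOp_mul, cutOp_mul, max_comm]

theorem commute_cutOp_constOp (c : ℝ) (x : H →L[ℂ] H) : Commute (cutOp c) (constOp x) := by
  ext1 F
  refine Lp.ext ?_
  filter_upwards [cutOp_apply_ae c (constOp x F), constOp_apply_ae x (cutOp c F),
    cutOp_apply_ae c F, constOp_apply_ae x F] with t h1 h2 h3 h4
  rw [mul_apply_eq_comp, mul_apply_eq_comp, h1, h2, h3, h4]
  by_cases hc : c < t <;> simp [hc]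

theorem shiftOp_mul_cutOp (l c : ℝ) :
    shiftOp (H := H) l * cutOp c = cutOp (c - l) * shiftOp l := by
  ext1 F
  refine Lp.ext ?_
  filter_upwards [coeFn_shiftOp l (cutOp c F), ae_comp_add l (cutOp_apply_ae c F),
    cutOp_apply_ae (c - l) (shiftOp l F), coeFn_shiftOp l F] with t h1 h2 h3 h4
  rw [mul_apply_eq_comp, mul_apply_eq_comp, h1, h2, h3, h4]
  by_cases hc : c < t + l
  · simp [hc, sub_lt_iff_lt_add]
  · simp [hc, sub_lt_iff_lt_add]

theorem isStarProjection_cutOp [CompleteSpace H] (c : ℝ) : IsStarProjection (cutOp (H := H) c) where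
  isIdempotentElem := by rw [IsIdempotentElem, cutOp_mul, max_self]
  isSelfAdjoint := star_mulOp _ _ fun t => by
    by_cases h : t ∈ Set.Ioi c <;> simp [h]

/-- The function `ω ↦ exp (-ω/2)` on the positive half-line. -/
noncomputable def expProfile (t : ℝ) : ℂ := if 0 < t then (Real.exp (-(t / 2)) : ℂ) else 0

theorem integral_ite_exp (c : ℝ) (hc : 0 ≤ c) :
    Integrable (fun t : ℝ => if c < t then Real.exp (-t) else 0) ∧
      ∫ t : ℝ, (if c < t then Real.exp (-t) else 0) = Real.exp (-c) := by
  have h : (fun t : ℝ => if c < t then Real.exp (-t) else 0)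
      = (Set.Ioi c).indicator fun t => Real.exp (-t) := by
    ext t
    simp [Set.indicator_apply]
  rw [h, integrable_indicator_iff measurableSet_Ioi, integral_indicator measurableSet_Ioi]
  refine ⟨?_, integral_exp_neg_Ioi c⟩
  simpa using exp_neg_integrableOn_Ioi c one_pos

theorem norm_sq_expProfile_smul (t : ℝ) (v : H) :
    ‖expProfile t • v‖ ^ 2 = (if 0 < t then Real.exp (-t) else 0) * ‖v‖ ^ 2 := by
  rw [norm_smul, mul_pow]
  congr 1
  unfold expProfile
  split_ifs
  · rw [Complex.norm_real, Real.norm_of_nonneg (Real.exp_nonneg _), ← Real.exp_nat_mul]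
    congr 1
    push_cast
    ring
  · simp

theorem memLp_expProfile (v : H) : MemLp (fun t => expProfile t • v) 2 (volume : Measure ℝ) := by
  have hm : AEStronglyMeasurable (fun t => expProfile t • v) (volume : Measure ℝ) := by
    refine StronglyMeasurable.aestronglyMeasurable (StronglyMeasurable.smul_const ?_ v)
    refine Measurable.stronglyMeasurable (Measurable.ite measurableSet_Ioi ?_ measurable_const)
    fun_prop
  refine (memLp_two_iff_integrable_sq_norm hm).2 ?_
  simp_rw [norm_sq_expProfile_smul]
  exact (integral_ite_exp 0 le_rfl).1.mul_const _

/-- The embedding `v ↦ (ω ↦ exp (-ω/2) v)` of `H` into `L²((0, ∞); H)`. -/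
noncomputable def expVec : H →ₗ[ℂ] Lp (α := ℝ) H 2 where
  toFun v := (memLp_expProfile v).toLp _
  map_add' v w := by
    rw [← MemLp.toLp_add]
    exact MemLp.toLp_congr _ _ (Eventually.of_forall fun t => smul_add _ _ _)
  map_smul' c v := by
    rw [RingHom.id_apply, ← MemLp.toLp_const_smul]
    exact MemLp.toLp_congr _ _ (Eventually.of_forall fun t => smul_comm _ _ _)

theorem coeFn_expVec (v : H) : expVec v =ᵐ[volume] fun t => expProfile t • v :=
  (memLp_expProfile v).coeFn_toLp

theorem constOp_expVec (x : H →L[ℂ] H) (v : H) : constOp x (expVec v) = expVec (x v) := by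
  refine Lp.ext ?_
  filter_upwards [constOp_apply_ae x (expVec v), coeFn_expVec v, coeFn_expVec (x v)] with t h1 h2 h3
  rw [h1, h2, h3, map_smul]

theorem cutOp_zero_expVec (v : H) : cutOp 0 (expVec v) = expVec v := by
  refine Lp.ext ?_
  filter_upwards [cutOp_apply_ae 0 (expVec v), coeFn_expVec v] with t h1 h2
  rw [h1, h2]
  by_cases h : 0 < t <;> simp [h, expProfile]

theorem norm_sq_cutOp_expVec {c : ℝ} (hc : 0 ≤ c) (v : H) :
    ‖cutOp c (expVec v)‖ ^ 2 = Real.exp (-c) * ‖v‖ ^ 2 := by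
  rw [L2_norm_sq_eq_integral, ← (integral_ite_exp c hc).2, ← integral_mul_const]
  refine integral_congr_ae ?_
  filter_upwards [cutOp_apply_ae c (expVec v), coeFn_expVec v] with t h1 h2
  rw [h1, h2]
  by_cases h : c < t
  · simp only [h, if_true]
    rw [norm_sq_expProfile_smul, if_pos (hc.trans_lt h)]
  · simp [h]

theorem norm_expVec (v : H) : ‖expVec v‖ = ‖v‖ := by
  have h := norm_sq_cutOp_expVec le_rfl v
  rw [cutOp_zero_expVec, neg_zero, Real.exp_zero, one_mul] at h
  exact (sq_eq_sq₀ (norm_nonneg _) (norm_nonneg _)).1 h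

theorem cutOp_shiftOp_expVec (l : ℝ) (v : H) :
    cutOp 0 (shiftOp (-l) (expVec v)) = (Real.exp (l / 2) : ℂ) • cutOp l (expVec v) := by
  refine Lp.ext ?_
  filter_upwards [cutOp_apply_ae 0 (shiftOp (-l) (expVec v)), coeFn_shiftOp (-l) (expVec v),
    ae_comp_add (-l) (coeFn_expVec v), Lp.coeFn_smul (Real.exp (l / 2) : ℂ) (cutOp l (expVec v)),
    cutOp_apply_ae l (expVec v), coeFn_expVec v] with t h1 h2 h3 h4 h5 h6
  rw [h1, h2, h3, h4, Pi.smul_apply, h5, h6]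
  by_cases h : l < t
  · by_cases h' : 0 < t
    · have : 0 < t + -l := by linarith
      simp only [h, h', this, if_true, expProfile, smul_smul, ← Complex.ofReal_mul, ← Real.exp_add]
      congr 3
      ring
    · simp [h, h', expProfile]
  · by_cases h' : 0 < t
    · have : ¬ 0 < t + -l := by linarith
      simp [h, h', this, expProfile]
    · simp [h, h']

theorem norm_sq_sub_cutOp_shiftOp_le [CompleteSpace H] {a : ℝ} (h0 : 0 < a) (h1 : a < 1) (v : H) :
    ‖(1 - cutOp 0) (shiftOp (-Real.log (a / (1 - a))) (expVec v))‖ ^ 2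
      ≤ 2 * |1 - 2 * a| * ‖v‖ ^ 2 := by
  set l := Real.log (a / (1 - a)) with hl
  have ha : 0 < 1 - a := by linarith
  have hel : Real.exp l = a / (1 - a) := Real.exp_log (by positivity)
  set F := shiftOp (-l) (expVec v) with hF
  have hFn : ‖F‖ = ‖v‖ := by
    rw [hF, ← norm_expVec v]
    exact (Lp.compMeasurePreservingₗᵢ ℂ (fun t : ℝ => t + -l)
      (measurePreserving_add_right volume (-l))).norm_map _
  have hpy : ‖(1 - cutOp 0) F‖ ^ 2 = ‖F‖ ^ 2 - ‖cutOp 0 F‖ ^ 2 := by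
    have ho : ⟪cutOp 0 F, (1 - cutOp 0) F⟫_ℂ = 0 := by
      have hp := isStarProjection_cutOp (H := H) 0
      rw [← ContinuousLinearMap.adjoint_inner_right, ← ContinuousLinearMap.star_eq_adjoint,
        hp.isSelfAdjoint.star_eq, ← mul_apply_eq_comp, mul_sub, mul_one,
        hp.isIdempotentElem.eq, sub_self]
      simp
    have := norm_add_sq_eq_norm_sq_add_norm_sq_of_inner_eq_zero _ _ ho
    have h2 : cutOp 0 F + (1 - cutOp 0) F = F := by simp
    rw [h2] at this
    nlinarith
  have hcut : ‖cutOp 0 F‖ ^ 2 = Real.exp l * ‖cutOp l (expVec v)‖ ^ 2 := by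
    rw [hF, cutOp_shiftOp_expVec, norm_smul, mul_pow, Complex.norm_real,
      Real.norm_of_nonneg (Real.exp_nonneg _), ← Real.exp_nat_mul]
    congr 2
    push_cast
    ring
  rw [hpy, hcut, hFn]
  rcases le_total 0 l with h | h
  · rw [norm_sq_cutOp_expVec h, ← mul_assoc, ← Real.exp_add, add_neg_cancel, Real.exp_zero]
    have : (0 : ℝ) ≤ 2 * |1 - 2 * a| * ‖v‖ ^ 2 := by positivity
    linarith
  · have hc : cutOp l (expVec v) = expVec v := by
      rw [← cutOp_zero_expVec v, ← mul_apply_eq_comp, cutOp_mul, max_eq_right h]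
    have hexp : Real.exp l ≤ 1 := Real.exp_le_one_iff.2 h
    rw [hel, div_le_one ha] at hexp
    rw [hc, norm_expVec, hel, abs_of_nonneg (by linarith)]
    have : 1 - a / (1 - a) ≤ 2 * (1 - 2 * a) := by
      rw [sub_le_iff_le_add, ← sub_le_iff_le_add', le_div_iff₀ ha]
      nlinarith
    nlinarith [sq_nonneg ‖v‖]

end HalfLine

namespace SpectralFlow

open Filter Topology MeasureTheory

variable {H : Type*} [NormedAddCommGroup H] [InnerProductSpace ℂ H] [CompleteSpace H]
variable {A : H →L[ℂ] H} (φ : SpectralFlow A)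

theorem U_apply_eigenvector (hA : IsSelfAdjoint A) {a : ℝ} (h0 : 0 < a) (h1 : a < 1) {v : H}
    (hv : A v = (a : ℂ) • v) (t : ℝ) : φ.U t v = phase t a • v := by
  have hcont : ContinuousAt (fun b : ℝ => phase t b) a := by
    unfold phase
    have : ContinuousAt (fun b : ℝ => Real.log (b / (1 - b))) a := by
      refine ContinuousAt.log (by fun_prop (disch := linarith)) ?_
      have : 0 < 1 - a := by linarith
      positivity
    fun_prop
  refine tendsto_nhds_unique (φ.tendsto_U t v) ?_
  rw [tendsto_iff_norm_sub_tendsto_zero]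
  have hsub : ∀ n, ‖(φ.S n).fn (phase t) v - phase t a • v‖
      = ‖(φ.S n).fn (fun b => phase t b - phase t a) v‖ := fun n => by
    rw [← SpecFamily.fn_sub, sub_apply]
    congr 2
    rw [SpecFamily.fn_apply, ← Finset.smul_sum, ← sum_apply, (φ.S n).sum,
      one_apply_eq_self]
  have hid : Tendsto (fun n => ‖(φ.S n).fn (fun b => (b : ℂ) - a) v‖) atTop (𝓝 0) := by
    have h2 := (SpecFamily.tendsto_fn_id hA φ.S v).sub_const ((a : ℂ) • v)
    rw [hv, sub_self] at h2
    have h3 := h2.norm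
    rw [norm_zero] at h3
    refine h3.congr fun n => ?_
    rw [← SpecFamily.fn_sub, sub_apply]
    congr 2
    rw [SpecFamily.fn_apply _ (fun _ => (a : ℂ)), ← Finset.smul_sum,
      ← sum_apply, (φ.S n).sum, one_apply_eq_self]
  rw [Metric.tendsto_atTop]
  intro δ hδ
  obtain ⟨r, hr, hr'⟩ := Metric.continuousAt_iff.1 hcont (δ / (2 * (‖v‖ + 1))) (by positivity)
  have hpt : ∀ b : ℝ, ‖phase t b - phase t a‖
      ≤ δ / (2 * (‖v‖ + 1)) + 2 / r * ‖(b : ℂ) - a‖ := fun b => by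
    have hba : ‖(b : ℂ) - a‖ = |b - a| := by
      rw [← Complex.ofReal_sub, Complex.norm_real, Real.norm_eq_abs]
    rw [hba]
    by_cases hb : |b - a| < r
    · have := hr' (x := b) (by rwa [Real.dist_eq])
      rw [dist_eq_norm] at this
      have : 0 ≤ 2 / r * |b - a| := by positivity
      linarith
    · have h2 : 2 ≤ 2 / r * |b - a| := by
        rw [div_mul_eq_mul_div, le_div_iff₀ hr]
        linarith [not_lt.1 hb]
      have h3 := norm_sub_le (phase t b) (phase t a)
      rw [norm_phase, norm_phase] at h3
      have : 0 ≤ δ / (2 * (‖v‖ + 1)) := by positivity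
      linarith
  have hmain : ∀ n, ‖(φ.S n).fn (fun b => phase t b - phase t a) v‖ ^ 2
      ≤ 2 * (δ / (2 * (‖v‖ + 1)) * ‖v‖) ^ 2
        + 2 * (2 / r * ‖(φ.S n).fn (fun b => (b : ℂ) - a) v‖) ^ 2 := fun n => by
    have e1 := norm_sq_sum_smul_proj (φ.S n).p (φ.S n).proj (φ.S n).ortho (fun _ => 1) v
    simp only [one_smul, norm_one, one_pow, one_mul] at e1
    rw [← sum_apply, (φ.S n).sum, one_apply_eq_self] at e1
    rw [mul_pow, mul_pow, e1, SpecFamily.fn_apply, SpecFamily.fn_apply,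
      norm_sq_sum_smul_proj (φ.S n).p (φ.S n).proj (φ.S n).ortho,
      norm_sq_sum_smul_proj (φ.S n).p (φ.S n).proj (φ.S n).ortho, Finset.mul_sum, Finset.mul_sum,
      Finset.mul_sum, Finset.mul_sum, ← Finset.sum_add_distrib]
    refine Finset.sum_le_sum fun k _ => ?_
    have h2 : ‖phase t ((φ.S n).a k) - phase t a‖ ^ 2
        ≤ 2 * (δ / (2 * (‖v‖ + 1))) ^ 2 + 2 * ((2 / r) ^ 2 * ‖(((φ.S n).a k : ℝ) : ℂ) - a‖ ^ 2) := by
      refine (pow_le_pow_left₀ (norm_nonneg _) (hpt _) 2).trans ?_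
      have := sq_nonneg (δ / (2 * (‖v‖ + 1)) - 2 / r * ‖(((φ.S n).a k : ℝ) : ℂ) - a‖)
      nlinarith
    have := mul_le_mul_of_nonneg_right h2 (sq_nonneg ‖(φ.S n).p k v‖)
    linarith
  have hlim := (((hid.const_mul (2 / r)).pow 2).const_mul 2)
  simp only [mul_zero, ne_eq, OfNat.ofNat_ne_zero, not_false_eq_true, zero_pow] at hlim
  obtain ⟨N, hN⟩ := Metric.tendsto_atTop.1 hlim (δ ^ 2 / 2) (by positivity)
  refine ⟨N, fun n hn => ?_⟩
  rw [Real.dist_eq, sub_zero, abs_of_nonneg (norm_nonneg _), hsub]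
  refine lt_of_pow_lt_pow_left₀ 2 hδ.le ?_
  have h2 := hN n hn
  rw [Real.dist_eq, sub_zero] at h2
  have h3 := (abs_lt.1 h2).2
  have h4 : δ / (2 * (‖v‖ + 1)) * ‖v‖ ≤ δ / 2 := by
    rw [div_mul_eq_mul_div, div_le_iff₀ (by positivity)]
    nlinarith [norm_nonneg v]
  have h5 : (δ / (2 * (‖v‖ + 1)) * ‖v‖) ^ 2 ≤ (δ / 2) ^ 2 :=
    pow_le_pow_left₀ (by positivity) h4 2
  nlinarith [hmain n]

theorem isBoundedField_fn_phase (n : ℕ) (c : ℝ) :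
    IsBoundedField fun t => (φ.S n).fn (phase (c * t)) := by
  refine ⟨fun v => ?_, 1, fun t => ContinuousLinearMap.opNorm_le_bound _ zero_le_one fun v => ?_⟩
  · refine Continuous.stronglyMeasurable ?_
    simp_rw [SpecFamily.fn_apply]
    exact continuous_finsetSum _ fun i _ =>
      ((continuous_phase _).comp (continuous_const.mul continuous_id)).smul continuous_const
  · rw [φ.norm_fn_phase, one_mul]

theorem isBoundedField_U (c : ℝ) : IsBoundedField fun t => φ.U (c * t) := by
  refine ⟨fun v => ?_, 1, fun t => ContinuousLinearMap.opNorm_le_bound _ zero_le_one fun v => ?_⟩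
  · exact stronglyMeasurable_of_tendsto atTop (fun n => (φ.isBoundedField_fn_phase n c).1 v)
      (tendsto_pi_nhds.2 fun t => φ.tendsto_U _ v)
  · rw [φ.norm_U, one_mul]

/-- The unitary on `L²(ℝ; H)` implementing translation by `log (A / (1 - A))`. -/
noncomputable def V : Lp (α := ℝ) H 2 →L[ℂ] Lp (α := ℝ) H 2 :=
  fourierConj (mulOp _ (φ.isBoundedField_U (2 * Real.pi)))

theorem star_V : star φ.V = fourierConj (mulOp _ (φ.isBoundedField_U (-(2 * Real.pi)))) := by
  rw [V, ← map_star]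
  congr 1
  refine star_mulOp _ _ fun t => ?_
  rw [φ.star_U, neg_mul]

theorem star_V_mul_V : star φ.V * φ.V = 1 := by
  rw [star_V, V, ← map_mul, mulOp_mul, ← map_one (fourierConj (H := H)), ← mulOp_one]
  congr 2
  ext1 t
  rw [neg_mul, φ.U_neg_mul]

theorem V_mul_star_V : φ.V * star φ.V = 1 := by
  rw [star_V, V, ← map_mul, mulOp_mul, ← map_one (fourierConj (H := H)), ← mulOp_one]
  congr 2
  ext1 t
  rw [neg_mul, φ.U_mul_neg]

theorem commute_constOp_conj {x y : H →L[ℂ] H} (h : ∀ t, Commute x (φ.U t * y * φ.U (-t))) :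
    Commute (constOp x) (φ.V * constOp y * star φ.V) := by
  rw [star_V, V, ← fourierConj_constOp y, ← fourierConj_constOp x, ← map_mul, ← map_mul]
  refine Commute.map ?_ (fourierConj (H := H))
  rw [Commute, SemiconjBy, constOp, constOp, mulOp_mul, mulOp_mul, mulOp_mul, mulOp_mul]
  congr 1
  ext1 t
  rw [neg_mul]
  exact (h (2 * Real.pi * t)).eq

theorem commute_V_constOp {y : H →L[ℂ] H} (hy : Commute A y) : Commute φ.V (constOp y) := by
  rw [V, ← fourierConj_constOp y]
  refine Commute.map ?_ (fourierConj (H := H))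
  rw [Commute, SemiconjBy, constOp, mulOp_mul, mulOp_mul]
  congr 1
  ext1 t
  exact (φ.commute_U hy _).eq

theorem V_mul_constOp_of_eigen (hA : IsSelfAdjoint A) {a : ℝ} (h0 : 0 < a) (h1 : a < 1)
    {q : H →L[ℂ] H} (hq : A * q = (a : ℂ) • q) :
    φ.V * constOp q = shiftOp (Real.log (a / (1 - a))) * constOp q := by
  rw [V, ← fourierConj_modulation, ← fourierConj_constOp q, ← map_mul, ← map_mul]
  congr 1
  rw [constOp, mulOp_mul, mulOp_mul]
  congr 1
  ext t v
  simp only [mul_apply_eq_comp]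
  rw [φ.U_apply_eigenvector hA h0 h1 (by rw [← mul_apply_eq_comp, hq]; rfl)]
  rfl

/-- The approximating unitaries of `SpectralFlow.V`. -/
noncomputable def Vn (n : ℕ) : Lp (α := ℝ) H 2 →L[ℂ] Lp (α := ℝ) H 2 :=
  ∑ k, constOp ((φ.S n).p k) * shiftOp (Real.log ((φ.S n).a k / (1 - (φ.S n).a k)))

theorem mulOp_sum {κ : Type*} {Φ : κ → ℝ → H →L[ℂ] H} (hΦ : ∀ k, IsBoundedField (Φ k))
    (s : Finset κ) {Ψ : ℝ → H →L[ℂ] H} (hΨ : IsBoundedField Ψ) (h : ∀ t, Ψ t = ∑ k ∈ s, Φ k t) :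
    mulOp Ψ hΨ = ∑ k ∈ s, mulOp (Φ k) (hΦ k) := by
  ext1 F
  refine Lp.ext ?_
  have h2 : ∀ᵐ t, (∑ k ∈ s, mulOp (Φ k) (hΦ k)) F t = ∑ k ∈ s, Φ k t (F t) := by
    clear h
    induction s using Finset.induction_on with
    | empty =>
      simp only [Finset.sum_empty, zero_apply]
      exact Lp.coeFn_zero H 2 volume
    | insert k s hk ih =>
      filter_upwards [ih, coeFn_mulOp (hΦ k) F,
        Lp.coeFn_add (mulOp (Φ k) (hΦ k) F) ((∑ k ∈ s, mulOp (Φ k) (hΦ k)) F)] with t e1 e2 e3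
      rw [Finset.sum_insert hk, Finset.sum_insert hk, add_apply, e3, Pi.add_apply, e1, e2]
  filter_upwards [coeFn_mulOp hΨ F, h2] with t e1 e2
  rw [e1, e2, h, sum_apply]

theorem Vn_eq (n : ℕ) : φ.Vn n = fourierConj (mulOp _ (φ.isBoundedField_fn_phase n (2 * Real.pi))) := by
  rw [Vn, mulOp_sum (fun k => (IsBoundedField.const ((φ.S n).p k)).mul
    (isBoundedField_modulation (H := H) (Real.log ((φ.S n).a k / (1 - (φ.S n).a k)))))
    Finset.univ (φ.isBoundedField_fn_phase n (2 * Real.pi)), map_sum]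
  · refine Finset.sum_congr rfl fun k _ => ?_
    rw [← mulOp_mul (IsBoundedField.const _) (isBoundedField_modulation _), map_mul,
      fourierConj_modulation]
    congr 1
    exact (fourierConj_constOp _).symm
  · intro t
    rw [SpecFamily.fn]
    refine Finset.sum_congr rfl fun k _ => ?_
    rw [mul_smul_comm, mul_one]
    rfl

theorem star_Vn (n : ℕ) :
    star (φ.Vn n) = fourierConj (mulOp _ (φ.isBoundedField_fn_phase n (-(2 * Real.pi)))) := by
  rw [Vn_eq, ← map_star]
  congr 1
  refine star_mulOp _ _ fun t => ?_
  rw [SpecFamily.star_fn, neg_mul]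
  congr 1
  ext1 a
  exact star_phase _ _

theorem star_Vn_eq_sum (n : ℕ) : star (φ.Vn n)
    = ∑ k, constOp ((φ.S n).p k) * shiftOp (-Real.log ((φ.S n).a k / (1 - (φ.S n).a k))) := by
  rw [Vn, star_sum]
  refine Finset.sum_congr rfl fun k _ => ?_
  rw [star_mul, star_shiftOp, star_constOp, ((φ.S n).proj k).isSelfAdjoint.star_eq,
    (commute_shiftOp_constOp _ _).eq]

theorem tendsto_fourierConj {X : ℕ → Lp (α := ℝ) H 2 →L[ℂ] Lp (α := ℝ) H 2}
    {Y : Lp (α := ℝ) H 2 →L[ℂ] Lp (α := ℝ) H 2}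
    (h : ∀ F, Tendsto (fun n => X n F) atTop (𝓝 (Y F))) (F : Lp (α := ℝ) H 2) :
    Tendsto (fun n => fourierConj (X n) F) atTop (𝓝 (fourierConj Y F)) :=
  ((Lp.fourierTransformₗᵢ ℝ H).symm.continuous.tendsto _).comp (h _)

theorem norm_fn_phase_le_one (n : ℕ) (t : ℝ) : ‖(φ.S n).fn (phase t)‖ ≤ 1 :=
  ContinuousLinearMap.opNorm_le_bound _ zero_le_one fun v => by rw [φ.norm_fn_phase, one_mul]

theorem tendsto_fourierConj_fn_phase (c : ℝ) (F : Lp (α := ℝ) H 2) :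
    Tendsto (fun n => fourierConj (mulOp _ (φ.isBoundedField_fn_phase n c)) F) atTop
      (𝓝 (fourierConj (mulOp _ (φ.isBoundedField_U c)) F)) := by
  have h := tendsto_mulOp (fun n => φ.isBoundedField_fn_phase n c) (φ.isBoundedField_U c)
    (C := 1) (fun n t => φ.norm_fn_phase_le_one n _) (fun t v => φ.tendsto_U _ v)
  exact tendsto_fourierConj h F

theorem tendsto_Vn (F : Lp (α := ℝ) H 2) : Tendsto (fun n => φ.Vn n F) atTop (𝓝 (φ.V F)) :=
  (φ.tendsto_fourierConj_fn_phase (2 * Real.pi) F).congr fun n => by rw [Vn_eq]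

theorem tendsto_star_Vn (F : Lp (α := ℝ) H 2) :
    Tendsto (fun n => star (φ.Vn n) F) atTop (𝓝 (star φ.V F)) := by
  rw [star_V]
  exact (φ.tendsto_fourierConj_fn_phase (-(2 * Real.pi)) F).congr fun n => by rw [star_Vn]

theorem star_Vn_mul_Vn (n : ℕ) : star (φ.Vn n) * φ.Vn n = 1 := by
  rw [star_Vn, Vn_eq, ← map_mul, mulOp_mul, ← map_one (fourierConj (H := H)), ← mulOp_one]
  congr 2
  ext1 t
  rw [SpecFamily.fn_mul, ← SpecFamily.fn_one (φ.S n)]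
  congr 1
  ext1 a
  rw [← phase_add, neg_mul, neg_add_cancel, phase_zero]

theorem Vn_mul_star_Vn (n : ℕ) : φ.Vn n * star (φ.Vn n) = 1 := by
  rw [star_Vn, Vn_eq, ← map_mul, mulOp_mul, ← map_one (fourierConj (H := H)), ← mulOp_one]
  congr 2
  ext1 t
  rw [SpecFamily.fn_mul, ← SpecFamily.fn_one (φ.S n)]
  congr 1
  ext1 a
  rw [← phase_add, neg_mul, add_neg_cancel, phase_zero]

end SpectralFlow

namespace SpectralFlow

open Filter Topology MeasureTheory

variable {H : Type*} [NormedAddCommGroup H] [InnerProductSpace ℂ H] [CompleteSpace H]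
variable {A : H →L[ℂ] H} (φ : SpectralFlow A)

theorem exists_eigenprojection (hA : IsSelfAdjoint A) {a : ℝ} {v : H} (hv : A v = (a : ℂ) • v) :
    ∃ q : H →L[ℂ] H, A * q = (a : ℂ) • q ∧ q v = v := by
  refine ⟨(ℂ ∙ v).starProjection, ?_, ?_⟩
  · ext w
    obtain ⟨c, hc⟩ := Submodule.mem_span_singleton.1
      (Submodule.starProjection_apply_mem (ℂ ∙ v) w)
    rw [mul_apply_eq_comp, smul_apply, ← hc, map_smul, hv, smul_comm]
  · exact Submodule.starProjection_eq_self_iff.2 (Submodule.mem_span_singleton_self v)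

theorem V_expVec_of_half (hA : IsSelfAdjoint A) {v : H} (hv : A v = (1 / 2 : ℂ) • v) :
    φ.V (expVec v) = expVec v := by
  have hv' : A v = ((1 / 2 : ℝ) : ℂ) • v := by rw [hv]; norm_num
  obtain ⟨q, hq, hqv⟩ := exists_eigenprojection hA hv'
  have h := φ.V_mul_constOp_of_eigen hA (by norm_num) (by norm_num) hq
  have h0 : Real.log ((1 / 2 : ℝ) / (1 - 1 / 2)) = 0 := by norm_num
  rw [h0, shiftOp_zero, one_mul] at h
  have h2 := congr($h (expVec v))
  rwa [mul_apply_eq_comp, constOp_expVec, hqv] at h2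

theorem norm_V_apply (F : Lp (α := ℝ) H 2) : ‖φ.V F‖ = ‖F‖ := by
  have h : ‖φ.V F‖ ^ 2 = ‖F‖ ^ 2 := by
    have : ⟪φ.V F, φ.V F⟫_ℂ = ⟪F, F⟫_ℂ := by
      rw [inner_apply_eq_star, ← mul_apply_eq_comp, φ.star_V_mul_V, one_apply_eq_self]
    rw [inner_self_eq_norm_sq_to_K, inner_self_eq_norm_sq_to_K] at this
    exact_mod_cast this
  exact (sq_eq_sq₀ (norm_nonneg _) (norm_nonneg _)).1 h

theorem norm_star_V_apply (F : Lp (α := ℝ) H 2) : ‖star φ.V F‖ = ‖F‖ := by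
  rw [← φ.norm_V_apply, ← mul_apply_eq_comp, φ.V_mul_star_V, one_apply_eq_self]

/-- The half-line projection rotated by the flow. -/
noncomputable def rotCut : Lp (α := ℝ) H 2 →L[ℂ] Lp (α := ℝ) H 2 :=
  star φ.V * cutOp 0 * φ.V

/-- The approximations of `SpectralFlow.rotCut`. -/
noncomputable def rotCutApprox (n : ℕ) : Lp (α := ℝ) H 2 →L[ℂ] Lp (α := ℝ) H 2 :=
  star (φ.Vn n) * cutOp 0 * φ.Vn n

theorem constOp_proj_mul_Vn (n : ℕ) (k : (φ.S n).ι) :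
    constOp ((φ.S n).p k) * φ.Vn n = constOp ((φ.S n).p k)
      * shiftOp (Real.log ((φ.S n).a k / (1 - (φ.S n).a k))) := by
  rw [Vn, Finset.mul_sum, Finset.sum_eq_single k]
  · rw [← mul_assoc, ← constOp_mul, ((φ.S n).proj k).isIdempotentElem.eq]
  · intro l _ hl
    rw [← mul_assoc, ← constOp_mul, (φ.S n).ortho k l hl.symm]
    have : constOp (0 : H →L[ℂ] H) = 0 := by
      have := constOp_smul (0 : ℂ) (0 : H →L[ℂ] H)
      rwa [zero_smul, zero_smul] at this
    rw [this, zero_mul]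
  · simp

theorem rotCutApprox_eq (n : ℕ) : φ.rotCutApprox n = ∑ k, constOp ((φ.S n).p k)
    * cutOp (Real.log ((φ.S n).a k / (1 - (φ.S n).a k))) := by
  rw [rotCutApprox, star_Vn_eq_sum, Finset.sum_mul, Finset.sum_mul]
  refine Finset.sum_congr rfl fun k _ => ?_
  set l := Real.log ((φ.S n).a k / (1 - (φ.S n).a k))
  set p := constOp ((φ.S n).p k)
  have e1 : shiftOp (-l) * cutOp (H := H) 0 = cutOp l * shiftOp (-l) := by
    rw [shiftOp_mul_cutOp]; simp
  calc p * shiftOp (-l) * cutOp 0 * φ.Vn n = p * (shiftOp (-l) * cutOp 0) * φ.Vn n := by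
        simp only [mul_assoc]
    _ = (p * cutOp l) * shiftOp (-l) * φ.Vn n := by rw [e1]; simp only [mul_assoc]
    _ = cutOp l * (p * shiftOp (-l)) * φ.Vn n := by
        rw [← (commute_cutOp_constOp l _).eq]; simp only [mul_assoc, p]
    _ = cutOp l * shiftOp (-l) * (p * φ.Vn n) := by
        rw [← (commute_shiftOp_constOp _ _).eq]; simp only [mul_assoc, p]
    _ = cutOp l * (shiftOp (-l) * p) * shiftOp l := by
        rw [φ.constOp_proj_mul_Vn]; simp only [mul_assoc, l, p]
    _ = cutOp l * p * (shiftOp (-l) * shiftOp l) := by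
        rw [(commute_shiftOp_constOp _ _).eq]; simp only [mul_assoc, p]
    _ = p * cutOp l := by
        rw [shiftOp_mul, neg_add_cancel, shiftOp_zero, mul_one, (commute_cutOp_constOp l _).eq]

theorem commute_cutOp_rotCutApprox (c : ℝ) (n : ℕ) :
    Commute (cutOp c) (φ.rotCutApprox n) := by
  rw [rotCutApprox_eq]
  exact Commute.sum_right _ _ _ fun k _ =>
    (commute_cutOp_constOp _ _).mul_right (commute_cutOp _ _)

theorem norm_cutOp_apply_le (c : ℝ) (F : Lp (α := ℝ) H 2) : ‖cutOp c F‖ ≤ ‖F‖ := by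
  have h : ‖cutOp c F‖ ^ 2 + ‖(1 - cutOp c) F‖ ^ 2 = ‖F‖ ^ 2 := by
    have h1 : ⟪cutOp c F, (1 - cutOp c) F⟫_ℂ = 0 := by
      rw [inner_apply_of_isSelfAdjoint (isStarProjection_cutOp (H := H) c).isSelfAdjoint,
        ← mul_apply_eq_comp, (isStarProjection_cutOp (H := H) c).isIdempotentElem.mul_one_sub_self,
        zero_apply, inner_zero_right]
    have h2 := norm_add_sq_eq_norm_sq_add_norm_sq_of_inner_eq_zero _ _ h1
    rw [← add_apply, add_sub_cancel, one_apply_eq_self] at h2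
    rw [sq, sq, sq, h2]
  exact (sq_le_sq₀ (norm_nonneg _) (norm_nonneg _)).1 (by linarith [sq_nonneg ‖(1 - cutOp c) F‖])

theorem norm_star_Vn_apply (n : ℕ) (F : Lp (α := ℝ) H 2) : ‖star (φ.Vn n) F‖ = ‖F‖ := by
  have h : ‖star (φ.Vn n) F‖ ^ 2 = ‖F‖ ^ 2 := by
    have : ⟪star (φ.Vn n) F, star (φ.Vn n) F⟫_ℂ = ⟪F, F⟫_ℂ := by
      rw [inner_apply_eq_star, star_star, ← mul_apply_eq_comp, φ.Vn_mul_star_Vn,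
        one_apply_eq_self]
    rw [inner_self_eq_norm_sq_to_K, inner_self_eq_norm_sq_to_K] at this
    exact_mod_cast this
  exact (sq_eq_sq₀ (norm_nonneg _) (norm_nonneg _)).1 h

theorem norm_Vn_apply (n : ℕ) (F : Lp (α := ℝ) H 2) : ‖φ.Vn n F‖ = ‖F‖ := by
  rw [← φ.norm_star_Vn_apply n, ← mul_apply_eq_comp, φ.star_Vn_mul_Vn, one_apply_eq_self]

theorem norm_rotCutApprox_apply_le (n : ℕ) (F : Lp (α := ℝ) H 2) :
    ‖φ.rotCutApprox n F‖ ≤ ‖F‖ := by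
  rw [rotCutApprox, mul_apply_eq_comp, mul_apply_eq_comp, norm_star_Vn_apply]
  exact (norm_cutOp_apply_le _ _).trans (φ.norm_Vn_apply n F).le

theorem tendsto_rotCutApprox (F : Lp (α := ℝ) H 2) :
    Tendsto (fun n => φ.rotCutApprox n F) atTop (𝓝 (φ.rotCut F)) := by
  refine tendsto_apply_of_strong (W := fun n => star (φ.Vn n))
    (x := fun n => cutOp 0 (φ.Vn n F)) (fun n v => (φ.norm_star_Vn_apply n v).le) ?_
    (φ.tendsto_star_Vn _)
  exact ((cutOp 0).continuous.tendsto _).comp (φ.tendsto_Vn F)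

theorem commute_cutOp_rotCut (c : ℝ) : Commute (cutOp c) φ.rotCut := by
  refine ContinuousLinearMap.ext fun F => ?_
  refine tendsto_nhds_unique (((cutOp c).continuous.tendsto _).comp (φ.tendsto_rotCutApprox F)) ?_
  refine (φ.tendsto_rotCutApprox (cutOp c F)).congr fun n => ?_
  exact congr($((φ.commute_cutOp_rotCutApprox c n).eq) F).symm

theorem commute_star_V_constOp {y : H →L[ℂ] H} (hy : Commute A y) (hA : IsSelfAdjoint A) :
    Commute (star φ.V) (constOp y) := by
  have h : Commute A (star y) := by
    have := hy.star_star
    rwa [hA.star_eq] at this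
  have h2 := (φ.commute_V_constOp h).star_star
  rwa [star_constOp, star_star] at h2

theorem commute_rotCut_constOp {y : H →L[ℂ] H} (hy : Commute A y) (hA : IsSelfAdjoint A) :
    Commute φ.rotCut (constOp y) :=
  ((φ.commute_star_V_constOp hy hA).mul_left (commute_cutOp_constOp _ _)).mul_left
    (φ.commute_V_constOp hy)

theorem cutOp_star_Vn_expVec (n : ℕ) (w : H) :
    cutOp 0 (star (φ.Vn n) (expVec ((φ.S n).fn (fun a => ((√(a * (1 - a)) : ℝ) : ℂ)) w)))
      = φ.rotCutApprox n (expVec ((φ.S n).fn (fun a => (a : ℂ)) w)) := by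
  have hp : ∀ k (g : ℝ → ℂ), (φ.S n).p k ((φ.S n).fn g w) = g ((φ.S n).a k) • (φ.S n).p k w := by
    intro k g
    rw [SpecFamily.fn_apply, map_sum, Finset.sum_eq_single k]
    · rw [map_smul, ← mul_apply_eq_comp, ((φ.S n).proj k).isIdempotentElem.eq]
    · intro l _ hl
      rw [map_smul, ← mul_apply_eq_comp, (φ.S n).ortho k l hl.symm, zero_apply, smul_zero]
    · simp
  rw [rotCutApprox_eq, star_Vn_eq_sum, sum_apply,
    sum_apply, map_sum]
  refine Finset.sum_congr rfl fun k _ => ?_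
  have h0 : 0 < (φ.S n).a k := lt_of_lt_of_le (by positivity) ((φ.S n).le_a k)
  have h1 : (φ.S n).a k < 1 :=
    lt_of_lt_of_le (lt_add_of_pos_right _ (by positivity)) ((φ.S n).a_le k)
  set a := (φ.S n).a k
  have h1' : 0 < 1 - a := by linarith
  rw [← (commute_shiftOp_constOp _ _).eq, ← (commute_cutOp_constOp _ _).eq, mul_apply_eq_comp,
    mul_apply_eq_comp, constOp_expVec, constOp_expVec, hp, hp, map_smul, map_smul, map_smul,
    cutOp_shiftOp_expVec, map_smul, map_smul, smul_smul]
  congr 1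
  rw [← Complex.ofReal_mul]
  congr 1
  have e : Real.exp (Real.log (a / (1 - a)) / 2) = √(a / (1 - a)) := by
    rw [Real.exp_half, Real.exp_log (by positivity)]
  rw [e, ← Real.sqrt_mul (by positivity)]
  have : a * (1 - a) * (a / (1 - a)) = a ^ 2 := by field_simp
  rw [this, Real.sqrt_sq h0.le]

theorem tendsto_expVec {f : ℕ → H} {v : H} (h : Tendsto f atTop (𝓝 v)) :
    Tendsto (fun n => expVec (f n)) atTop (𝓝 (expVec v)) := by
  rw [tendsto_iff_norm_sub_tendsto_zero] at h ⊢
  refine h.congr fun n => ?_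
  rw [← map_sub, norm_expVec]

theorem cutOp_star_V_expVec_sqrt (hA : IsSelfAdjoint A) (hB : 0 ≤ A - A * A) (w : H) :
    cutOp 0 (star φ.V (expVec (CFC.sqrt (A - A * A) w))) = φ.rotCut (expVec (A w)) := by
  have h1 : Tendsto (fun n => (φ.S n).fn (fun a => ((√(a * (1 - a)) : ℝ) : ℂ)) w) atTop
      (𝓝 (CFC.sqrt (A - A * A) w)) :=
    ((ContinuousLinearMap.apply ℂ H w).continuous.tendsto _).comp
      (SpecFamily.tendsto_fn_sqrt hA hB φ.S)
  have h2 := tendsto_apply_of_strong (W := fun n => star (φ.Vn n))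
    (fun n v => (φ.norm_star_Vn_apply n v).le) (tendsto_expVec h1) (φ.tendsto_star_Vn _)
  have h3 := ((cutOp 0).continuous.tendsto _).comp h2
  have h4 := tendsto_apply_of_strong (W := φ.rotCutApprox) φ.norm_rotCutApprox_apply_le
    (tendsto_expVec (SpecFamily.tendsto_fn_id hA φ.S w)) (φ.tendsto_rotCutApprox _)
  exact tendsto_nhds_unique (h3.congr fun n => φ.cutOp_star_Vn_expVec n w) h4

theorem constOp_injective {x : H →L[ℂ] H} (hx : ∀ v, x v = 0 → v = 0) {F : Lp (α := ℝ) H 2}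
    (h : constOp x F = 0) : F = 0 := by
  refine Lp.ext ?_
  filter_upwards [constOp_apply_ae x F, Lp.coeFn_zero H 2 (volume : Measure ℝ),
    (congrArg (fun G : Lp (α := ℝ) H 2 => (G : ℝ → H)) h).eventuallyEq] with t e1 e2 e3
  rw [e2]
  refine hx _ ?_
  rw [← e1]
  exact e3.trans e2

theorem cutOp_star_V_expVec (hA : IsSelfAdjoint A) (hB : 0 ≤ A - A * A)
    (hT : ∀ v, CFC.sqrt (A - A * A) v = 0 → v = 0) {v v' : H}
    (h : CFC.sqrt (A - A * A) v' = A v) :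
    cutOp 0 (star φ.V (expVec v)) = φ.rotCut (expVec v') := by
  set T := CFC.sqrt (A - A * A)
  have hAT : Commute A T :=
    (commute_sqrt_of_commute hB (((Commute.refl A).sub_left
      ((Commute.refl A).mul_left (Commute.refl A))))).symm
  rw [← sub_eq_zero]
  refine constOp_injective hT ?_
  have e1 : constOp T (cutOp 0 (star φ.V (expVec v)))
      = cutOp 0 (star φ.V (expVec (T v))) := by
    rw [← mul_apply_eq_comp, ← (commute_cutOp_constOp _ _).eq, mul_apply_eq_comp,
      ← mul_apply_eq_comp (constOp T), ← (φ.commute_star_V_constOp hAT hA).eq, mul_apply_eq_comp,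
      constOp_expVec]
  have e2 : constOp T (φ.rotCut (expVec v')) = φ.rotCut (expVec (T v')) := by
    rw [← mul_apply_eq_comp, ← (φ.commute_rotCut_constOp hAT hA).eq, mul_apply_eq_comp,
      constOp_expVec]
  rw [map_sub, e1, e2, φ.cutOp_star_V_expVec_sqrt hA hB, h, sub_self]

theorem norm_sq_sub_cutOp_star_Vn_le (n : ℕ) (v : H) :
    ‖(1 - cutOp 0) (star (φ.Vn n) (expVec v))‖ ^ 2
      ≤ 2 * (‖v‖ * ‖v - (2 : ℂ) • (φ.S n).fn (fun a => (a : ℂ)) v‖) := by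
  have hq : ∀ k, IsStarProjection (constOp ((φ.S n).p k)) := fun k =>
    ⟨by rw [IsIdempotentElem, ← constOp_mul, ((φ.S n).proj k).isIdempotentElem.eq],
      by rw [IsSelfAdjoint, star_constOp, ((φ.S n).proj k).isSelfAdjoint.star_eq]⟩
  set X : (φ.S n).ι → Lp (α := ℝ) H 2 := fun k => (1 - cutOp 0)
    (shiftOp (-Real.log ((φ.S n).a k / (1 - (φ.S n).a k))) (expVec ((φ.S n).p k v))) with hX
  have hXq : ∀ k, constOp ((φ.S n).p k) (X k) = X k := fun k => by
    have h1 : Commute (constOp ((φ.S n).p k)) ((1 - cutOp 0) *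
        shiftOp (-Real.log ((φ.S n).a k / (1 - (φ.S n).a k)))) :=
      (((Commute.one_right _).sub_right (commute_cutOp_constOp _ _).symm)).mul_right
        (commute_shiftOp_constOp _ _).symm
    have h2 := congr($(h1.eq) (expVec ((φ.S n).p k v)))
    simp only [mul_apply_eq_comp] at h2
    rw [hX]
    dsimp only
    rw [h2, constOp_expVec, ← mul_apply_eq_comp ((φ.S n).p k), ((φ.S n).proj k).isIdempotentElem.eq]
  have hsum : (1 - cutOp 0) (star (φ.Vn n) (expVec v)) = ∑ k, X k := by
    rw [star_Vn_eq_sum, sum_apply, map_sum]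
    refine Finset.sum_congr rfl fun k _ => ?_
    rw [← (commute_shiftOp_constOp _ _).eq, mul_apply_eq_comp, constOp_expVec]
  have horth : ∀ k l, k ≠ l → ⟪X k, X l⟫_ℂ = 0 := fun k l hkl => by
    rw [← hXq k, ← hXq l, inner_apply_of_isSelfAdjoint (hq k).isSelfAdjoint,
      ← mul_apply_eq_comp, ← constOp_mul, (φ.S n).ortho k l hkl]
    have : constOp (0 : H →L[ℂ] H) = 0 := by
      have := constOp_smul (0 : ℂ) (0 : H →L[ℂ] H)
      rwa [zero_smul, zero_smul] at this
    rw [this, zero_apply, inner_zero_right]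
  have hpyth : ‖∑ k, X k‖ ^ 2 = ∑ k, ‖X k‖ ^ 2 := by
    have : ⟪∑ k, X k, ∑ k, X k⟫_ℂ = ∑ k, ⟪X k, X k⟫_ℂ := by
      rw [sum_inner]
      refine Finset.sum_congr rfl fun k _ => ?_
      rw [inner_sum, Finset.sum_eq_single k (fun l _ hl => horth k l hl.symm) (by simp)]
    simp_rw [inner_self_eq_norm_sq_to_K] at this
    exact_mod_cast this
  rw [hsum, hpyth]
  set f : (φ.S n).ι → ℝ := fun k => |1 - 2 * (φ.S n).a k|
  have hb : ∀ k, ‖X k‖ ^ 2 ≤ 2 * (‖(φ.S n).p k v‖ * (f k * ‖(φ.S n).p k v‖)) := fun k => by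
    have h0 : 0 < (φ.S n).a k := lt_of_lt_of_le (by positivity) ((φ.S n).le_a k)
    have h1 : (φ.S n).a k < 1 :=
      lt_of_lt_of_le (lt_add_of_pos_right _ (by positivity)) ((φ.S n).a_le k)
    refine (norm_sq_sub_cutOp_shiftOp_le h0 h1 _).trans (le_of_eq ?_)
    ring
  refine (Finset.sum_le_sum fun k _ => hb k).trans ?_
  rw [← Finset.mul_sum]
  refine mul_le_mul_of_nonneg_left ?_ zero_le_two
  refine (Real.sum_mul_le_sqrt_mul_sqrt _ _ _).trans (le_of_eq ?_)
  have e1 := norm_sq_sum_smul_proj (φ.S n).p (φ.S n).proj (φ.S n).ortho (fun _ => 1) v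
  simp only [one_smul, norm_one, one_pow, one_mul] at e1
  rw [← sum_apply, (φ.S n).sum, one_apply_eq_self] at e1
  have e2 : v - (2 : ℂ) • (φ.S n).fn (fun a => (a : ℂ)) v
      = ∑ k, (1 - 2 * ((φ.S n).a k : ℂ)) • (φ.S n).p k v := by
    simp_rw [sub_smul, one_smul, mul_smul]
    rw [Finset.sum_sub_distrib, ← sum_apply, (φ.S n).sum, one_apply_eq_self,
      SpecFamily.fn_apply, Finset.smul_sum]
  have e3 : ∑ k, (f k * ‖(φ.S n).p k v‖) ^ 2
      = ‖v - (2 : ℂ) • (φ.S n).fn (fun a => (a : ℂ)) v‖ ^ 2 := by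
    rw [e2, norm_sq_sum_smul_proj _ (φ.S n).proj (φ.S n).ortho]
    refine Finset.sum_congr rfl fun k _ => ?_
    rw [mul_pow]
    congr 2
    change |1 - 2 * (φ.S n).a k| = _
    rw [← Real.norm_eq_abs, ← Complex.norm_real]
    push_cast
    rfl
  rw [← e1, e3, Real.sqrt_sq (norm_nonneg _), Real.sqrt_sq (norm_nonneg _)]

theorem norm_sq_sub_cutOp_star_V_le (hA : IsSelfAdjoint A) (v : H) :
    ‖(1 - cutOp 0) (star φ.V (expVec v))‖ ^ 2 ≤ 2 * (‖v‖ * ‖v - (2 : ℂ) • A v‖) := by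
  have h1 := (((1 - cutOp (H := H) 0).continuous.tendsto _).comp
    (φ.tendsto_star_Vn (expVec v))).norm.pow 2
  have h2 := ((((SpecFamily.tendsto_fn_id hA φ.S v).const_smul (2 : ℂ)).const_sub v).norm.const_mul
    ‖v‖).const_mul 2
  exact le_of_tendsto_of_tendsto' h1 h2 fun n => φ.norm_sq_sub_cutOp_star_Vn_le n v

theorem rotCut_cutOp_expVec_of_eigen (hA : IsSelfAdjoint A) {a : ℝ} (h0 : 0 < a) (h1 : a < 1)
    {v : H} (hv : A v = (a : ℂ) • v) (c : ℝ) :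
    φ.rotCut (cutOp c (expVec v)) = cutOp (max c (Real.log (a / (1 - a)))) (expVec v) := by
  obtain ⟨q, hq, hqv⟩ := exists_eigenprojection hA hv
  have hV := φ.V_mul_constOp_of_eigen hA h0 h1 hq
  set l := Real.log (a / (1 - a))
  have e1 : cutOp (H := H) 0 * shiftOp l = shiftOp l * cutOp l := by
    rw [shiftOp_mul_cutOp, sub_self]
  have e2 : φ.rotCut * constOp q = cutOp l * constOp q := by
    calc φ.rotCut * constOp q = star φ.V * cutOp 0 * (φ.V * constOp q) := by
          rw [rotCut]; simp only [mul_assoc]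
      _ = star φ.V * (cutOp 0 * shiftOp l) * constOp q := by rw [hV]; simp only [mul_assoc]
      _ = star φ.V * (shiftOp l * constOp q) * cutOp l := by
          rw [e1, mul_assoc, mul_assoc, (commute_cutOp_constOp l q).eq]; simp only [mul_assoc]
      _ = (star φ.V * φ.V) * (constOp q * cutOp l) := by rw [← hV]; simp only [mul_assoc]
      _ = cutOp l * constOp q := by rw [φ.star_V_mul_V, one_mul, (commute_cutOp_constOp l q).eq]
  have e3 := congr($e2 (expVec v))
  simp only [mul_apply_eq_comp, constOp_expVec, hqv] at e3
  rw [← mul_apply_eq_comp, ← (φ.commute_cutOp_rotCut c).eq, mul_apply_eq_comp, e3,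
    ← mul_apply_eq_comp, cutOp_mul]

end SpectralFlow

section Cyclic

variable {H : Type*} [NormedAddCommGroup H] [InnerProductSpace ℂ H]

/-- The smallest closed subspace containing `ξ` and invariant under all `g i`. -/
def cyclicSubmodule {κ : Type*} (g : κ → H →L[ℂ] H) (ξ : H) : Submodule ℂ H :=
  sInf {W | IsClosed (W : Set H) ∧ ξ ∈ W ∧ ∀ i, ∀ w ∈ W, g i w ∈ W}

variable {κ : Type*} {g g' : κ → H →L[ℂ] H} {ξ : H}

theorem cyclicSubmodule_le {W : Submodule ℂ H} (h : IsClosed (W : Set H)) (hξ : ξ ∈ W)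
    (hg : ∀ i, ∀ w ∈ W, g i w ∈ W) : cyclicSubmodule g ξ ≤ W :=
  sInf_le ⟨h, hξ, hg⟩

theorem self_mem_cyclicSubmodule : ξ ∈ cyclicSubmodule g ξ :=
  Submodule.mem_sInf.2 fun _ hW => hW.2.1

theorem apply_mem_cyclicSubmodule (i : κ) {w : H} (hw : w ∈ cyclicSubmodule g ξ) :
    g i w ∈ cyclicSubmodule g ξ :=
  Submodule.mem_sInf.2 fun W hW => hW.2.2 i w (Submodule.mem_sInf.1 hw W hW)

theorem isClosed_cyclicSubmodule : IsClosed (cyclicSubmodule g ξ : Set H) := by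
  rw [cyclicSubmodule, Submodule.coe_sInf]
  exact isClosed_biInter fun W hW => hW.1

theorem apply_mem_cyclicSubmodule_of_commute {x : H →L[ℂ] H} (hc : ∀ i, Commute (g i) x)
    (hξ : x ξ ∈ cyclicSubmodule g ξ) {w : H} (hw : w ∈ cyclicSubmodule g ξ) :
    x w ∈ cyclicSubmodule g ξ := by
  have h : cyclicSubmodule g ξ ≤ Submodule.comap (x : H →ₗ[ℂ] H) (cyclicSubmodule g ξ) := by
    refine cyclicSubmodule_le (isClosed_cyclicSubmodule.preimage x.continuous) hξ fun i v hv => ?_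
    change x (g i v) ∈ cyclicSubmodule g ξ
    rw [← mul_apply_eq_comp, ← (hc i).eq, mul_apply_eq_comp]
    exact apply_mem_cyclicSubmodule i hv
  exact h hw

theorem cyclicSubmodule_le_of_twins (hc : ∀ i j, Commute (g i) (g' j)) (hξ : ∀ i, g i ξ = g' i ξ) :
    cyclicSubmodule g ξ ≤ cyclicSubmodule g' ξ :=
  cyclicSubmodule_le isClosed_cyclicSubmodule self_mem_cyclicSubmodule fun i _ hw =>
    apply_mem_cyclicSubmodule_of_commute (fun j => (hc i j).symm)
      (by rw [hξ]; exact apply_mem_cyclicSubmodule i self_mem_cyclicSubmodule) hw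

theorem eq_self_of_mem_cyclicSubmodule {x : H →L[ℂ] H} (hc : ∀ i, Commute (g i) x)
    (hξ : x ξ = ξ) {w : H} (hw : w ∈ cyclicSubmodule g ξ) : x w = w := by
  have h : cyclicSubmodule g ξ ≤ (x - 1).ker := by
    refine cyclicSubmodule_le (x - 1).isClosed_ker (by simp [hξ]) fun i v hv => ?_
    have h1 : (x - 1) v = 0 := hv
    change (x - 1) (g i v) = 0
    rw [← mul_apply_eq_comp, ← ((hc i).sub_right (Commute.one_right _)).eq, mul_apply_eq_comp, h1,
      map_zero]
  have := h hw
  exact sub_eq_zero.1 this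

theorem eq_top_of_compress_cyclicSubmodule [CompleteSpace H] [CompleteSpace (cyclicSubmodule g ξ)]
    {W : Submodule ℂ (cyclicSubmodule g ξ)} (hW : IsClosed (W : Set (cyclicSubmodule g ξ)))
    (hξ : ⟨ξ, self_mem_cyclicSubmodule⟩ ∈ W)
    (hinv : ∀ i, ∀ w ∈ W, compress (cyclicSubmodule g ξ) (g i) w ∈ W) : W = ⊤ := by
  have h : cyclicSubmodule g ξ ≤ W.map (cyclicSubmodule g ξ).subtype := by
    refine cyclicSubmodule_le ?_ ⟨_, hξ, rfl⟩ ?_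
    · exact (isClosed_cyclicSubmodule (g := g) (ξ := ξ)).isClosedEmbedding_subtypeVal.isClosedMap _ hW
    · rintro i _ ⟨w, hw, rfl⟩
      exact ⟨_, hinv i w hw, coe_compress _ (fun _ hv => apply_mem_cyclicSubmodule i hv) w⟩
  rw [eq_top_iff]
  intro v _
  obtain ⟨w, hw, hwv⟩ := h v.2
  rwa [← Subtype.ext hwv]

end Cyclic

section Conjugation

variable {R : Type*} [Monoid R] {V W : R}

theorem commute_conj_of_commute (hVW : V * W = 1) (hWV : W * V = 1) {x y : R}
    (h : Commute x (V * y * W)) : Commute (W * x * V) y := by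
  have h1 : y = W * (V * y * W) * V := by
    calc y = (W * V) * y * (W * V) := by rw [hWV, one_mul, mul_one]
      _ = _ := by simp only [mul_assoc]
  have h2 : ∀ a b : R, W * a * V * (W * b * V) = W * (a * b) * V := fun a b => by
    calc W * a * V * (W * b * V) = W * a * (V * W) * b * V := by simp only [mul_assoc]
      _ = _ := by rw [hVW, mul_one]; simp only [mul_assoc]
  rw [h1, Commute, SemiconjBy, h2, h2, h.eq]

theorem commute_conj_conj (hVW : V * W = 1) (hWV : W * V = 1) {x y : R}
    (h : Commute x y) : Commute (W * x * V) (W * y * V) := by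
  refine commute_conj_of_commute hVW hWV ?_
  have : V * (W * y * V) * W = y := by
    calc V * (W * y * V) * W = (V * W) * y * (V * W) := by simp only [mul_assoc]
      _ = y := by rw [hVW, one_mul, mul_one]
  rwa [this]

end Conjugation

theorem conj_nonneg {L : Type*} [NormedAddCommGroup L] [InnerProductSpace ℂ L] [CompleteSpace L]
    {x e : L →L[ℂ] L} (hx : 0 ≤ x) (he : IsStarProjection e) : 0 ≤ e * x * e := by
  have h := star_left_conjugate_nonneg hx e
  rwa [he.isSelfAdjoint.star_eq] at h

/-- Cutting a rotated family by a projection commuting with its rotation produces commuting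
twins on a cyclic subspace, where the vector state is tracial. -/
theorem exists_tracial_of_rotation {L : Type*} [NormedAddCommGroup L] [InnerProductSpace ℂ L]
    [CompleteSpace L] {κ : Type*} {V e : L →L[ℂ] L} {X Y : κ → L →L[ℂ] L} {ζ : L}
    (hV : star V * V = 1) (hV' : V * star V = 1) (he : IsStarProjection e)
    (hef : Commute e (star V * e * V)) (heX : ∀ k, Commute e (X k)) (heY : ∀ k, Commute e (Y k))
    (hXY : ∀ k l, Commute (X k) (V * Y l * star V)) (hX0 : ∀ k, 0 ≤ X k) (hY0 : ∀ k, 0 ≤ Y k)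
    (hVζ : V ζ = ζ) (heζ : e ζ = ζ)
    (htwin : ∀ k, e (star V (X k ζ)) = (star V * e * V) (Y k ζ)) :
    ∃ (K : Submodule ℂ L) (_ : CompleteSpace K) (ξ : K) (g g' : κ → K →L[ℂ] K),
      ‖ξ‖ = ‖ζ‖ ∧ (∀ k, 0 ≤ g k) ∧ (∀ k, IsSelfAdjoint (g' k)) ∧
      (∀ k l, Commute (g k) (g' l)) ∧
      (∀ a b : K →L[ℂ] K, (∀ k, Commute (g' k) a) → (∀ k, Commute (g' k) b) →
        ⟪ξ, (a * b) ξ⟫_ℂ = ⟪ξ, (b * a) ξ⟫_ℂ) ∧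
      (∀ s : Finset κ, ∑ k ∈ s, X k = 1 → ∑ k ∈ s, g k = 1) ∧
      (∀ k, (g k ξ : L) = e (star V (X k ζ))) ∧
      ∀ K' : Submodule ℂ L, IsClosed (K' : Set L) → ζ ∈ K' →
        (∀ w ∈ K', (star V * e * V) w ∈ K') → (∀ k, ∀ w ∈ K', Y k w ∈ K') → K ≤ K' := by
  have hf : IsStarProjection (star V * e * V) := by
    refine ⟨?_, ?_⟩
    · calc star V * e * V * (star V * e * V) = star V * e * (V * star V) * e * V := by
            simp only [mul_assoc]
        _ = star V * (e * e) * V := by rw [hV', mul_one]; simp only [mul_assoc]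
        _ = _ := by rw [he.isIdempotentElem.eq]
    · rw [IsSelfAdjoint, star_mul, star_mul, star_star, he.isSelfAdjoint.star_eq, mul_assoc]
  have hLf : ∀ k, Commute (star V * X k * V) (star V * e * V) := fun k =>
    commute_conj_conj hV' hV (heX k).symm
  have hLY : ∀ k l, Commute (star V * X k * V) (Y l) := fun k l =>
    commute_conj_of_commute hV' hV (hXY k l)
  have hVζ' : star V ζ = ζ := by
    conv_lhs => rw [← hVζ]
    rw [← mul_apply_eq_comp, hV, one_apply_eq_self]
  have hfζ : (star V * e * V) ζ = ζ := by
    rw [mul_apply_eq_comp, mul_apply_eq_comp, hVζ, heζ, hVζ']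
  have hL0 : ∀ k, 0 ≤ star V * X k * V := fun k => star_left_conjugate_nonneg (hX0 k) V
  have hLsum : ∀ s : Finset κ, ∑ k ∈ s, X k = 1 →
      ∑ k ∈ s, e * (star V * X k * V) * e = e := fun s hs => by
    rw [← Finset.sum_mul, ← Finset.mul_sum, ← Finset.sum_mul, ← Finset.mul_sum, hs, mul_one, hV,
      mul_one, he.isIdempotentElem.eq]
  have hLζ : ∀ k, (e * (star V * X k * V) * e) ζ = e (star V (X k ζ)) := fun k => by
    simp only [mul_apply_eq_comp, heζ, hVζ]
  generalize hfd : star V * e * V = f at *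
  generalize hLd : (fun k => star V * X k * V) = L'
  have hLd' : ∀ k, star V * X k * V = L' k := fun k => congrFun hLd k
  simp only [hLd'] at hLf hLY hL0 hLsum hLζ
  clear hLd hLd' hXY heX hX0 hfd
  have hGG' : ∀ k l, Commute (e * L' k * e) (f * Y l * f) := fun k l => by
    have h1 : Commute e (f * Y l * f) := (hef.mul_right (heY l)).mul_right hef
    have h2 : Commute (L' k) (f * Y l * f) := ((hLf k).mul_right (hLY k l)).mul_right (hLf k)
    exact (h1.mul_left h2).mul_left h1
  have hG0 : ∀ k, 0 ≤ e * L' k * e := fun k => conj_nonneg (hL0 k) he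
  have hG'0 : ∀ k, 0 ≤ f * Y k * f := fun k => conj_nonneg (hY0 k) hf
  have hG'ζ : ∀ k, (e * L' k * e) ζ = (f * Y k * f) ζ := fun k => by
    rw [hLζ, htwin, mul_apply_eq_comp, mul_apply_eq_comp, hfζ]
  have heG : ∀ k, Commute (e * L' k * e) e := fun k => by
    rw [Commute, SemiconjBy, mul_assoc, he.isIdempotentElem.eq, mul_assoc, ← mul_assoc e e,
      he.isIdempotentElem.eq]
  generalize hGd : (fun k => e * L' k * e) = G
  generalize hGd' : (fun k => f * Y k * f) = G'
  have hGk : ∀ k, e * L' k * e = G k := fun k => congrFun hGd k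
  have hGk' : ∀ k, f * Y k * f = G' k := fun k => congrFun hGd' k
  simp only [hGk, hGk'] at hGG' hG0 hG'0 hG'ζ heG hLζ hLsum
  set K := cyclicSubmodule G ζ with hK
  have hKc : CompleteSpace K := isClosed_cyclicSubmodule.completeSpace_coe
  have hGK : ∀ k, ∀ v ∈ K, G k v ∈ K := fun k v hv => apply_mem_cyclicSubmodule k hv
  have hG'K : ∀ k, ∀ v ∈ K, G' k v ∈ K := fun k v hv =>
    apply_mem_cyclicSubmodule_of_commute (fun l => hGG' l k)
      (by rw [← hG'ζ]; exact apply_mem_cyclicSubmodule k self_mem_cyclicSubmodule) hv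
  have heK : ∀ v ∈ K, e v = v := fun v hv => eq_self_of_mem_cyclicSubmodule heG heζ hv
  have hcomm : ∀ k l, Commute (compress K (G k)) (compress K (G' l)) := fun k l => by
    rw [Commute, SemiconjBy, ← compress_mul_left K _ (hG'K l), ← compress_mul_left K _ (hGK k),
      (hGG' k l).eq]
  refine ⟨K, hKc, ⟨ζ, self_mem_cyclicSubmodule⟩, fun k => compress K (G k),
    fun k => compress K (G' k), rfl, fun k => compress_nonneg K (hG0 k),
    fun k => (compress_nonneg K (hG'0 k)).isSelfAdjoint, hcomm, ?_, ?_, ?_, ?_⟩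
  · refine fun a b ha hb => tracial_of_twins (fun k => compress K (G k))
      (fun k => compress K (G' k)) (fun k => (compress_nonneg K (hG0 k)).isSelfAdjoint)
      (fun k => (compress_nonneg K (hG'0 k)).isSelfAdjoint) hcomm _ ?_ ?_ a b ha hb
    · intro k
      refine Subtype.ext ?_
      rw [coe_compress K (hGK k), coe_compress K (hG'K k)]
      exact hG'ζ k
    · exact fun W hW hξ hinv => eq_top_of_compress_cyclicSubmodule hW hξ hinv
  · intro s hs
    rw [← compress_sum, hLsum s hs]
    ext v
    rw [coe_compress K (fun v hv => by rwa [heK v hv]), heK v v.2, one_apply_eq_self]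
  · intro k
    rw [coe_compress K (hGK k)]
    exact hLζ k
  · intro K' hK' hζ hfK hYK
    refine (cyclicSubmodule_le_of_twins hGG' hG'ζ).trans
      (cyclicSubmodule_le hK' hζ fun k w hw => ?_)
    rw [← hGk']
    exact hfK _ (hYK k _ (hfK _ hw))

section

open MeasureTheory

variable {H : Type*} [NormedAddCommGroup H] [InnerProductSpace ℂ H] [CompleteSpace H]

theorem constOp_nonneg {x : H →L[ℂ] H} (hx : 0 ≤ x) : 0 ≤ constOp x := by
  have h1 := CFC.sqrt_mul_sqrt_self x hx
  have h2 := (CFC.sqrt_nonneg x).isSelfAdjoint.star_eq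
  have h3 : constOp x = star (constOp (CFC.sqrt x)) * constOp (CFC.sqrt x) := by
    rw [star_constOp, h2, ← constOp_mul, h1]
  rw [h3]
  exact star_mul_self_nonneg _

theorem eigenvalue_mem_Ioo {A : H →L[ℂ] H} (h0 : 0 ≤ A - A * A)
    (hinj : ∀ v, (A - A * A) v = 0 → v = 0) {a : ℝ} {v : H} (hv : A v = (a : ℂ) • v)
    (hv0 : v ≠ 0) : 0 < a ∧ a < 1 := by
  have h1 : (A - A * A) v = ((a - a * a : ℝ) : ℂ) • v := by
    rw [sub_apply, mul_apply_eq_comp, hv, map_smul, hv, smul_smul, ← sub_smul]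
    push_cast
    rfl
  have h2 : 0 ≤ (⟪v, (A - A * A) v⟫_ℂ).re := inner_nonneg_of_nonneg h0 v
  have h3 : a - a * a ≠ 0 := fun h => hv0 (hinj v (by rw [h1, h]; simp))
  rw [h1, inner_smul_right, inner_self_eq_norm_sq_to_K, Complex.re_ofReal_mul] at h2
  have h4 : 0 < ‖v‖ ^ 2 := by positivity
  have h5 : ((‖v‖ : ℂ) ^ 2).re = ‖v‖ ^ 2 := by norm_cast
  have h6 : 0 ≤ a - a * a := by
    have : 0 ≤ (a - a * a) * ‖v‖ ^ 2 := by rw [← h5]; exact h2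
    exact nonneg_of_mul_nonneg_left this h4
  have h7 : 0 < a - a * a := lt_of_le_of_ne h6 h3.symm
  constructor <;> nlinarith

theorem SpectralFlow.exists_finiteDimensional_invariant [FiniteDimensional ℂ H] {A : H →L[ℂ] H}
    (φ : SpectralFlow A) (hA : IsSelfAdjoint A) (h0 : 0 ≤ A - A * A)
    (hinj : ∀ v, (A - A * A) v = 0 → v = 0) :
    ∃ K : Submodule ℂ (Lp (α := ℝ) H 2 volume), FiniteDimensional ℂ K ∧ (∀ v : H, expVec v ∈ K) ∧
      (∀ w ∈ K, φ.rotCut w ∈ K) ∧ ∀ y : H →L[ℂ] H, ∀ w ∈ K, constOp y w ∈ K := by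
  have hsym : (A : H →ₗ[ℂ] H).IsSymmetric :=
    (ContinuousLinearMap.isSelfAdjoint_iff_isSymmetric).1 hA
  let l : Module.End.Eigenvalues (A : H →ₗ[ℂ] H) → ℝ :=
    fun a => Real.log (RCLike.re (a : ℂ) / (1 - RCLike.re (a : ℂ)))
  let S : Finset ℝ := insert 0 (Finset.univ.image l)
  let K1 : S → Submodule ℂ (Lp (α := ℝ) H 2 volume) := fun c =>
    LinearMap.range ((cutOp (H := H) (c : ℝ)).toLinearMap ∘ₗ expVec)
  have hmem : ∀ c ∈ S, ∀ v : H, cutOp c (expVec v) ∈ ⨆ c, K1 c := fun c hc v =>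
    Submodule.mem_iSup_of_mem (p := K1) (⟨c, hc⟩ : S) ⟨v, rfl⟩
  have hind : ∀ X : Lp (α := ℝ) H 2 volume →L[ℂ] Lp (α := ℝ) H 2 volume,
      (∀ c ∈ S, ∀ v, X (cutOp c (expVec v)) ∈ ⨆ c, K1 c) →
        ∀ w ∈ ⨆ c, K1 c, X w ∈ ⨆ c, K1 c := by
    intro X hX
    have : ⨆ c, K1 c ≤ Submodule.comap (X.toLinearMap)
        (⨆ c, K1 c) := by
      refine iSup_le ?_
      rintro c _ ⟨v, rfl⟩
      exact hX c c.2 v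
    exact this
  refine ⟨⨆ c, K1 c, inferInstance, fun v => ?_, ?_, fun y => ?_⟩
  · rw [← cutOp_zero_expVec v]
    exact hmem 0 (Finset.mem_insert_self _ _) v
  · refine hind _ fun c hc v => ?_
    have hv : v ∈ ⨆ a : Module.End.Eigenvalues (A : H →ₗ[ℂ] H),
        Module.End.eigenspace (A : H →ₗ[ℂ] H) a := by
      have := hsym.orthogonalComplement_iSup_eigenspaces_eq_bot'
      rw [Submodule.orthogonal_eq_bot_iff] at this
      rw [this]
      trivial
    induction hv using Submodule.iSup_induction' with
    | mem a v hv =>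
      by_cases hv0 : v = 0
      · rw [hv0, map_zero, map_zero, map_zero]; exact zero_mem _
      · have h1 : A v = (a : ℂ) • v := Module.End.mem_eigenspace_iff.1 hv
        have h2 : ((RCLike.re (a : ℂ) : ℝ) : ℂ) = a :=
          RCLike.conj_eq_iff_re.1 (hsym.conj_eigenvalue_eq_self a.2)
        rw [← h2] at h1
        obtain ⟨ha0, ha1⟩ := eigenvalue_mem_Ioo h0 hinj h1 hv0
        rw [φ.rotCut_cutOp_expVec_of_eigen hA ha0 ha1 h1]
        refine hmem _ ?_ v
        rcases max_choice c (l a) with h | h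
        · exact h.symm ▸ hc
        · exact h.symm ▸ Finset.mem_insert_of_mem (Finset.mem_image_of_mem l (Finset.mem_univ a))
    | zero => rw [map_zero, map_zero, map_zero]; exact zero_mem _
    | add v w _ _ hv hw => rw [map_add, map_add, map_add]; exact add_mem hv hw
  · refine hind _ fun c hc v => ?_
    rw [← mul_apply_eq_comp, ← (commute_cutOp_constOp c _).eq, mul_apply_eq_comp, constOp_expVec]
    exact hmem c hc _

theorem norm_sq_add_norm_sq_one_sub {L : Type*} [NormedAddCommGroup L] [InnerProductSpace ℂ L]
    [CompleteSpace L] {e : L →L[ℂ] L} (he : IsStarProjection e) (v : L) :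
    ‖e v‖ ^ 2 + ‖(1 - e) v‖ ^ 2 = ‖v‖ ^ 2 := by
  rw [norm_sq_proj he, norm_sq_proj he.one_sub, ← Complex.add_re, ← inner_add_right,
    ← add_apply, add_sub_cancel, one_apply_eq_self, inner_self_eq_norm_sq_to_K]
  norm_cast

/-- An almost tracial vector state on the operators `x k` has a nearby exactly tracial model:
`g k` plays the role of `x k`, and `g' k` is a commuting twin of `g k`. -/
theorem ModularData.exists_tracial_model {𝓑 M : StarSubalgebra ℂ (H →L[ℂ] H)} {ψ : H}
    (md : ModularData 𝓑 M ψ) (hM : ∀ y, y ∈ M ↔ ∀ x ∈ 𝓑, Commute x y)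
    (hBd : Dense {v | ∃ x ∈ 𝓑, v = x ψ}) (hMd : Dense {v | ∃ m ∈ M, v = m ψ})
    {κ : Type*} (x : κ → H →L[ℂ] H) (hx : ∀ k, x k ∈ 𝓑) (hx0 : ∀ k, 0 ≤ x k) :
    ∃ (K : Submodule ℂ (Lp (α := ℝ) H 2)) (_ : CompleteSpace K) (ξ : K) (g g' : κ → K →L[ℂ] K),
      ‖ξ‖ = ‖ψ‖ ∧ (∀ k, 0 ≤ g k) ∧ (∀ k, IsSelfAdjoint (g' k)) ∧
      (∀ k l, Commute (g k) (g' l)) ∧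
      (∀ a b : K →L[ℂ] K, (∀ k, Commute (g' k) a) → (∀ k, Commute (g' k) b) →
        ⟪ξ, (a * b) ξ⟫_ℂ = ⟪ξ, (b * a) ξ⟫_ℂ) ∧
      (∀ s : Finset κ, ∑ k ∈ s, x k = 1 → ∑ k ∈ s, g k = 1) ∧
      (∃ T : H →ₗ[ℂ] Lp (α := ℝ) H 2 volume, (∀ v, ‖T v‖ ≤ ‖v‖) ∧
        ∀ k, K.subtype (g k ξ) = T (x k ψ)) ∧
      (∀ k, ‖x k ψ‖ ^ 2 - 2 * (‖x k ψ‖ * ‖x k ψ - (2 : ℂ) • md.A (x k ψ)‖) ≤ ‖g k ξ‖ ^ 2) ∧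
      (FiniteDimensional ℂ H → FiniteDimensional ℂ K) := by
  have hinj : ∀ v, (md.A - md.A * md.A) v = 0 → v = 0 := fun v h => md.injective hBd hMd h
  have hTinj : ∀ v, md.T v = 0 → v = 0 := fun v h => hinj v (by
    rw [← md.T_mul_T, mul_apply_eq_comp, h, map_zero])
  have hd : DenseRange (md.A - md.A * md.A : H →L[ℂ] H) :=
    denseRange_of_selfAdjoint_injective md.A_sub_sq_nonneg.isSelfAdjoint hinj
  obtain ⟨φ⟩ := SpectralFlow.exists_of_injective md.A_nonneg md.A_le_one hd
  obtain ⟨y, hy1, hy0, hyT, hyz⟩ := md.exists_dual_map hM hBd hMd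
  have hAψ : md.A ψ = (1 / 2 : ℂ) • ψ := by rw [md.half.1, one_div]
  have hXY : ∀ k l, Commute (constOp (x k)) (φ.V * constOp (y (x l)) * star φ.V) := fun k l =>
    φ.commute_constOp_conj (φ.commute_flow md.A_selfAdjoint md.A_sub_sq_nonneg hd
      (md.denseRange_T hBd hMd) fun s hs => by
        obtain ⟨z, hz, h⟩ := hyz (x l) (hx l) s hs
        exact ⟨z, (hM z).1 hz _ (hx k), h⟩)
  have htwin : ∀ k, cutOp 0 (star φ.V (constOp (x k) (expVec ψ)))
      = (star φ.V * cutOp (H := H) 0 * φ.V : Lp (α := ℝ) H 2 →L[ℂ] Lp (α := ℝ) H 2) (constOp (y (x k)) (expVec ψ)) := fun k => by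
    rw [constOp_expVec, constOp_expVec]
    exact φ.cutOp_star_V_expVec md.A_selfAdjoint md.A_sub_sq_nonneg hTinj (hyT _ (hx k))
  obtain ⟨K, hK, ξ, g, g', hξ, hg, hg', hc, htr, hsum, hgξ, hle⟩ :=
    exists_tracial_of_rotation (V := φ.V) (e := cutOp 0) (X := fun k => constOp (x k))
      (Y := fun k => constOp (y (x k))) (ζ := expVec ψ) φ.star_V_mul_V φ.V_mul_star_V
      (isStarProjection_cutOp 0) (φ.commute_cutOp_rotCut 0) (fun k => commute_cutOp_constOp 0 _)
      (fun k => commute_cutOp_constOp 0 _) hXY (fun k => constOp_nonneg (hx0 k))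
      (fun k => constOp_nonneg (hy0 _ (hx0 k))) (φ.V_expVec_of_half md.A_selfAdjoint hAψ)
      (cutOp_zero_expVec ψ) htwin
  simp only [constOp_expVec] at hgξ
  obtain ⟨T, hT⟩ : ∃ T : H →ₗ[ℂ] Lp (α := ℝ) H 2 volume,
      ∀ v, T v = cutOp 0 (star φ.V (expVec v)) :=
    ⟨(cutOp 0).toLinearMap ∘ₗ (star φ.V).toLinearMap ∘ₗ expVec, fun _ => rfl⟩
  refine ⟨K, hK, ξ, g, g', hξ.trans (norm_expVec ψ), hg, hg', hc, htr, fun s hs => ?_, ?_,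
    
    fun k => ?_, fun hfin => ?_⟩
  · exact hsum s (by rw [← constOp_sum, hs, constOp_one])
  · refine ⟨T, fun v => ?_, fun k => by rw [hT]; exact hgξ k⟩
    rw [hT]
    exact (SpectralFlow.norm_cutOp_apply_le 0 _).trans
      ((φ.norm_star_V_apply _).trans (norm_expVec v)).le
  · rw [K.coe_norm, hgξ]
    have h1 := φ.norm_sq_sub_cutOp_star_V_le md.A_selfAdjoint (x k ψ)
    have h3 := norm_sq_add_norm_sq_one_sub (isStarProjection_cutOp (H := H) 0)
      (star φ.V (expVec (x k ψ)))
    rw [φ.norm_star_V_apply, norm_expVec] at h3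
    linarith
  · obtain ⟨K', hK', hJ, hrot, hY⟩ :=
      φ.exists_finiteDimensional_invariant md.A_selfAdjoint md.A_sub_sq_nonneg hinj
    exact Submodule.finiteDimensional_of_le
      (hle K' K'.closed_of_finiteDimensional (hJ ψ) hrot fun k => hY _)

end

section

variable {H : Type*} [NormedAddCommGroup H] [InnerProductSpace ℂ H] [CompleteSpace H]

/-- The orbit of a vector under a star algebra of operators. -/
def StarSubalgebra.orbit (N : StarSubalgebra ℂ (H →L[ℂ] H)) (ψ : H) : Submodule ℂ H where
  carrier := {v | ∃ x ∈ N, v = x ψ}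
  add_mem' := by
    rintro _ _ ⟨x, hx, rfl⟩ ⟨y, hy, rfl⟩
    exact ⟨x + y, add_mem hx hy, rfl⟩
  zero_mem' := ⟨0, zero_mem _, rfl⟩
  smul_mem' := by
    rintro c _ ⟨x, hx, rfl⟩
    exact ⟨c • x, N.smul_mem hx c, rfl⟩

theorem StarSubalgebra.apply_mem_closure_orbit {N : StarSubalgebra ℂ (H →L[ℂ] H)} {ψ : H}
    {x : H →L[ℂ] H} (hx : x ∈ N) :
    ∀ v ∈ (N.orbit ψ).topologicalClosure, x v ∈ (N.orbit ψ).topologicalClosure := by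
  refine mapsTo_topologicalClosure x _ _ ?_
  rintro _ ⟨y, hy, rfl⟩
  exact ⟨x * y, mul_mem hx hy, rfl⟩

theorem exists_commutant {R : Set (H →L[ℂ] H)} (hR : ∀ c ∈ R, star c ∈ R) :
    ∃ N : StarSubalgebra ℂ (H →L[ℂ] H), ∀ x, x ∈ N ↔ ∀ c ∈ R, Commute c x :=
  ⟨_, fun _ => mem_centralizer_iff_commute hR⟩

/-- A vector cyclic for one of two commuting families of operators can be made cyclic and
separating for a pair of mutually commuting algebras without changing the correlation. -/
theorem exists_cyclic_separating_of_cyclic {κ ι : Type*} {P : κ → H →L[ℂ] H}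
    {Q : ι → H →L[ℂ] H} (hP : ∀ k, 0 ≤ P k) (hQ : ∀ l, 0 ≤ Q l)
    (hc : ∀ k l, Commute (P k) (Q l)) {ψ : H}
    (hcyc : ∀ W : Submodule ℂ H, IsClosed (W : Set H) → ψ ∈ W →
      (∀ l, ∀ w ∈ W, Q l w ∈ W) → W = ⊤) :
    ∃ (E : Submodule ℂ H) (_ : CompleteSpace E) (𝓑 M : StarSubalgebra ℂ (E →L[ℂ] E)) (ψ' : E),
      (ψ' : H) = ψ ∧ (∀ y, y ∈ M ↔ ∀ x ∈ 𝓑, Commute x y) ∧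
      Dense {v | ∃ x ∈ 𝓑, v = x ψ'} ∧ Dense {v | ∃ m ∈ M, v = m ψ'} ∧
      (∀ k, compress E (P k) ∈ 𝓑) ∧ (∀ l, compress E (Q l) ∈ M) ∧
      ∀ k l, compress E (P k * Q l) = compress E (P k) * compress E (Q l) := by
  have hQs : ∀ c ∈ Set.range Q, star c ∈ Set.range Q := by
    rintro _ ⟨l, rfl⟩
    exact ⟨l, (hQ l).isSelfAdjoint.star_eq.symm⟩
  obtain ⟨N, hN⟩ : ∃ N : StarSubalgebra ℂ (H →L[ℂ] H), ∀ x, x ∈ N ↔ ∀ l, Commute (Q l) x :=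
    ⟨_, fun x => by rw [mem_centralizer_iff_commute hQs, Set.forall_mem_range]⟩
  obtain ⟨N', hN'⟩ := exists_commutant fun c (hc : c ∈ (N : Set (H →L[ℂ] H))) => star_mem hc
  simp only [SetLike.mem_coe] at hN'
  have hQN : ∀ l, Q l ∈ N' := fun l => (hN' _).2 fun c hc => (((hN c).1 hc) l).symm
  have hPN : ∀ k, P k ∈ N := fun k => (hN _).2 fun l => (hc k l).symm
  have hNd : (N'.orbit ψ).topologicalClosure = ⊤ := by
    refine hcyc _ (Submodule.isClosed_topologicalClosure _)
      (Submodule.le_topologicalClosure _ ⟨1, one_mem _, rfl⟩) fun l =>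
      StarSubalgebra.apply_mem_closure_orbit (hQN l)
  obtain ⟨E, hE⟩ : ∃ E, E = (N.orbit ψ).topologicalClosure := ⟨_, rfl⟩
  have hEc : CompleteSpace E := by
    rw [hE]
    exact (Submodule.isClosed_topologicalClosure _).completeSpace_coe
  have hNE : ∀ x ∈ N, ∀ v ∈ E, x v ∈ E := fun x hx => by
    rw [hE]
    exact StarSubalgebra.apply_mem_closure_orbit hx
  have hψE : ψ ∈ E := by
    rw [hE]
    exact Submodule.le_topologicalClosure _ ⟨1, one_mem _, rfl⟩
  have hmul : ∀ x ∈ N, ∀ y, compress E (x * y) = compress E x * compress E y := fun x hx y => by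
    have h1 : star x ∈ N := star_mem hx
    exact compress_mul_right E y (hNE (star x) h1)
  have hmul' : ∀ x ∈ N, ∀ y, compress E (y * x) = compress E y * compress E x := fun x hx y =>
    compress_mul_left E x (hNE x hx)
  let M0 : Set (E →L[ℂ] E) := {z | ∃ q ∈ N', z = compress E q}
  have hM0 : ∀ c ∈ M0, star c ∈ M0 := by
    rintro _ ⟨q, hq, rfl⟩
    exact ⟨star q, star_mem hq, star_compress E q⟩
  obtain ⟨𝓑, h𝓑⟩ := exists_commutant hM0
  obtain ⟨M, hM⟩ := exists_commutant fun c (hc : c ∈ (𝓑 : Set (E →L[ℂ] E))) => star_mem hc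
  simp only [SetLike.mem_coe] at hM
  have hNB : ∀ x ∈ N, compress E x ∈ 𝓑 := by
    refine fun x hx => (h𝓑 _).2 ?_
    rintro _ ⟨q, hq, rfl⟩
    rw [Commute, SemiconjBy, ← hmul x hx, ← hmul' x hx, ((hN' q).1 hq x hx).eq]
  have hM0M : ∀ q ∈ N', compress E q ∈ M := fun q hq => (hM _).2 fun c hc =>
    ((h𝓑 c).1 hc _ ⟨q, hq, rfl⟩).symm
  refine ⟨E, hEc, 𝓑, M, ⟨ψ, hψE⟩, rfl, hM, ?_, ?_, fun k => hNB _ (hPN k),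
    fun l => hM0M _ (hQN l), fun k l => hmul _ (hPN k) _⟩
  · have h1 : Dense {v : E | ∃ x ∈ N, (v : H) = x ψ} := by
      intro v
      have hv : (v : H) ∈ closure (N.orbit ψ : Set H) := hE.le v.2
      rw [Topology.IsInducing.subtypeVal.closure_eq_preimage_closure_image]
      refine closure_mono ?_ hv
      rintro w ⟨x, hx, rfl⟩
      exact ⟨⟨x ψ, hNE x hx _ hψE⟩, ⟨x, hx, rfl⟩, rfl⟩
    refine h1.mono ?_
    rintro v ⟨x, hx, hv⟩
    exact ⟨compress E x, hNB x hx, Subtype.ext (by rw [hv, coe_compress E (hNE x hx)])⟩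
  · have h1 : Dense (N'.orbit ψ : Set H) := by
      rwa [Submodule.dense_iff_topologicalClosure_eq_top]
    have h2 : DenseRange (E.orthogonalProjectionOnto : H → E) := by
      refine Function.Surjective.denseRange fun v => ⟨v, ?_⟩
      simp
    refine (h2.dense_image E.orthogonalProjectionOnto.continuous h1).mono ?_
    rintro _ ⟨_, ⟨q, hq, rfl⟩, rfl⟩
    exact ⟨compress E q, hM0M q hq, rfl⟩

universe u in
/-- A commuting operator strategy has the same correlation as one given by a pair of mutually
commuting algebras with a cyclic and separating vector. -/
theorem exists_cyclic_separating {H : Type u} [NormedAddCommGroup H] [InnerProductSpace ℂ H]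
    [CompleteSpace H] {κ ι : Type*} {P : κ → H →L[ℂ] H}
    {Q : ι → H →L[ℂ] H} (hP : ∀ k, 0 ≤ P k) (hQ : ∀ l, 0 ≤ Q l)
    (hc : ∀ k l, Commute (P k) (Q l)) (ψ : H) :
    ∃ (E : Type u) (_ : NormedAddCommGroup E) (_ : InnerProductSpace ℂ E) (_ : CompleteSpace E)
      (𝓑 M : StarSubalgebra ℂ (E →L[ℂ] E)) (ψ' : E) (P' : κ → E →L[ℂ] E) (Q' : ι → E →L[ℂ] E),
      ‖ψ'‖ = ‖ψ‖ ∧ (∀ y, y ∈ M ↔ ∀ x ∈ 𝓑, Commute x y) ∧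
      Dense {v | ∃ x ∈ 𝓑, v = x ψ'} ∧ Dense {v | ∃ m ∈ M, v = m ψ'} ∧
      (∀ k, P' k ∈ 𝓑) ∧ (∀ l, Q' l ∈ M) ∧ (∀ k, 0 ≤ P' k) ∧ (∀ l, 0 ≤ Q' l) ∧
      (∀ s : Finset κ, ∑ k ∈ s, P k = 1 → ∑ k ∈ s, P' k = 1) ∧
      (∀ s : Finset ι, ∑ k ∈ s, Q k = 1 → ∑ k ∈ s, Q' k = 1) ∧
      (∀ k l, ⟪ψ', (P' k * Q' l) ψ'⟫_ℂ = ⟪ψ, (P k * Q l) ψ⟫_ℂ) ∧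
      (FiniteDimensional ℂ H → FiniteDimensional ℂ E) := by
  let S := cyclicSubmodule Q ψ
  have hS : CompleteSpace S := isClosed_cyclicSubmodule.completeSpace_coe
  have hQS : ∀ l, ∀ v ∈ S, Q l v ∈ S := fun l v hv => apply_mem_cyclicSubmodule l hv
  have hm : ∀ k l, compress S (P k * Q l) = compress S (P k) * compress S (Q l) := fun k l =>
    compress_mul_left S _ (hQS l)
  obtain ⟨E, hE, 𝓑, M, ψ', hψ, hM, hBd, hMd, hPB, hQM, hmul⟩ :=
    exists_cyclic_separating_of_cyclic (P := fun k => compress S (P k))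
      (Q := fun l => compress S (Q l)) (ψ := ⟨ψ, self_mem_cyclicSubmodule⟩)
      (fun k => compress_nonneg S (hP k)) (fun l => compress_nonneg S (hQ l)) (fun k l => by
        rw [Commute, SemiconjBy, ← hm, (hc k l).eq]
        exact compress_mul_right S _ fun v hv => by
          rw [(hQ l).isSelfAdjoint.star_eq]; exact hQS l v hv)
      fun W hW hψ hinv => eq_top_of_compress_cyclicSubmodule hW hψ hinv
  refine ⟨E, inferInstance, inferInstance, hE, 𝓑, M, ψ', fun k => compress E (compress S (P k)),
    fun l => compress E (compress S (Q l)), ?_, hM, hBd, hMd, hPB, hQM,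
    fun k => compress_nonneg E (compress_nonneg S (hP k)),
    fun l => compress_nonneg E (compress_nonneg S (hQ l)), fun s hs => ?_, fun s hs => ?_,
    fun k l => ?_, fun hfin => ?_⟩
  · rw [E.coe_norm, hψ]
    rfl
  · rw [← compress_sum, ← compress_sum, hs, compress_one, compress_one]
  · rw [← compress_sum, ← compress_sum, hs, compress_one, compress_one]
  · rw [← hmul, inner_compress, hψ, ← hm, inner_compress]
  · have : FiniteDimensional ℂ S := FiniteDimensional.finiteDimensional_submodule S
    exact FiniteDimensional.finiteDimensional_submodule E

end

section VectorState
variable {H : Type*} [NormedAddCommGroup H] [InnerProductSpace ℂ H] [CompleteSpace H]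

/-- The real part of the vector functional `x ↦ ⟪ψ, x ψ⟫`. -/
noncomputable def vectorState (ψ : H) : (H →L[ℂ] H) →ₗ[ℝ] ℝ where
  toFun x := (⟪ψ, x ψ⟫_ℂ).re
  map_add' x y := by simp
  map_smul' r x := by simp [inner_smul_right_eq_smul]

theorem vectorState_apply (ψ : H) (x : H →L[ℂ] H) : vectorState ψ x = (⟪ψ, x ψ⟫_ℂ).re := rfl

theorem vectorState_one {ψ : H} (hψ : ‖ψ‖ = 1) : vectorState ψ 1 = 1 := by
  rw [vectorState_apply, one_apply_eq_self, inner_self_eq_norm_sq_to_K, hψ]; simp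

theorem vectorState_nonneg (ψ : H) {x : H →L[ℂ] H} (hx : 0 ≤ x) : 0 ≤ vectorState ψ x :=
  inner_nonneg_of_nonneg hx ψ

theorem norm_sq_apply_eq_vectorState (ψ : H) {x : H →L[ℂ] H} (hx : IsSelfAdjoint x) :
    ‖x ψ‖ ^ 2 = vectorState ψ (x * x) := by
  rw [norm_sq_apply, hx.star_eq, vectorState_apply]

theorem norm_sq_apply_le_vectorState (ψ : H) {x : H →L[ℂ] H} (h0 : 0 ≤ x) (h1 : x ≤ 1) :
    ‖x ψ‖ ^ 2 ≤ vectorState ψ x := by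
  rw [norm_sq_apply_eq_vectorState ψ h0.isSelfAdjoint, ← sub_nonneg, ← map_sub]
  refine vectorState_nonneg ψ ?_
  have : x - x * x = x * (1 - x) := by noncomm_ring
  rw [this]
  exact Commute.mul_nonneg h0 (sub_nonneg.2 h1) ((Commute.one_right x).sub_right (Commute.refl x))

theorem le_one_of_sum_eq_one {α : Type*} [Fintype α] {x : α → H →L[ℂ] H} (h0 : ∀ a, 0 ≤ x a)
    (h1 : ∑ a, x a = 1) (a : α) : x a ≤ 1 :=
  h1 ▸ Finset.single_le_sum (fun a _ => h0 a) (Finset.mem_univ a)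

theorem sum_vectorState_eq_one {α : Type*} [Fintype α] {ψ : H} (hψ : ‖ψ‖ = 1) {x : α → H →L[ℂ] H}
    (h1 : ∑ a, x a = 1) : ∑ a, vectorState ψ (x a) = 1 := by
  rw [← map_sum, h1, vectorState_one hψ]

theorem sum_norm_sq_apply_le {α : Type*} [Fintype α] {x : α → H →L[ℂ] H} (h0 : ∀ a, 0 ≤ x a)
    (h1 : ∑ a, x a = 1) (v : H) : ∑ a, ‖x a v‖ ^ 2 ≤ ‖v‖ ^ 2 :=
  calc ∑ a, ‖x a v‖ ^ 2 ≤ ∑ a, vectorState v (x a) :=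
        Finset.sum_le_sum fun a _ =>
          norm_sq_apply_le_vectorState v (h0 a) (le_one_of_sum_eq_one h0 h1 a)
    _ = ‖v‖ ^ 2 := by
        rw [← map_sum, h1, vectorState_apply, one_apply_eq_self, inner_self_eq_norm_sq_to_K]
        norm_cast

theorem norm_sub_sq_re (x y : H) : ‖x - y‖ ^ 2 = ‖x‖ ^ 2 + ‖y‖ ^ 2 - 2 * (⟪x, y⟫_ℂ).re := by
  have := norm_sub_sq (𝕜 := ℂ) x y
  rw [RCLike.re_eq_complex_re] at this
  linarith

/-- If two effects `S` and `T` commute with the positive operator `P`, and are both almost implied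
by `P`, then `P` almost implies their product. -/
theorem vectorState_mul_mul_ge (ψ : H) {P S T : H →L[ℂ] H} (hP : 0 ≤ P) (hS0 : 0 ≤ S) (hS1 : S ≤ 1)
    (hT0 : 0 ≤ T) (hT1 : T ≤ 1) (hPS : Commute P S) (hPT : Commute P T) :
    vectorState ψ P - 3 / 2 * (vectorState ψ (P * (1 - S)) + vectorState ψ (P * (1 - T)))
      ≤ (⟪P ψ, (T * S) ψ⟫_ℂ).re := by
  have key : ∀ U : H →L[ℂ] H, 0 ≤ U → U ≤ 1 → Commute P U →
      vectorState ψ ((1 - U) * P * (1 - U)) ≤ vectorState ψ (P * (1 - U)) := by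
    intro U h0 h1 hc
    rw [← sub_nonneg, ← map_sub]
    refine vectorState_nonneg ψ ?_
    have e : P * (1 - U) - (1 - U) * P * (1 - U) = P * (U * (1 - U)) := by
      have := hc.eq
      calc _ = U * P * (1 - U) := by noncomm_ring
        _ = _ := by rw [← this, mul_assoc]
    rw [e]
    have hU : Commute U (1 - U) := (Commute.one_right U).sub_right (Commute.refl U)
    exact Commute.mul_nonneg hP (Commute.mul_nonneg h0 (sub_nonneg.2 h1) hU)
      (hc.mul_right ((Commute.one_right P).sub_right hc))
  have hS' : IsSelfAdjoint (1 - S) := (sub_nonneg.2 hS1).isSelfAdjoint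
  have hT' : IsSelfAdjoint (1 - T) := (sub_nonneg.2 hT1).isSelfAdjoint
  have hpos : 0 ≤ vectorState ψ (((1 - T) + (1 - S)) * P * ((1 - T) + (1 - S))) := by
    rw [vectorState_apply, mul_assoc, mul_apply_eq_comp, ← (hT'.add hS').star_eq,
      ← inner_apply_eq_star, (hT'.add hS').star_eq, mul_apply_eq_comp]
    exact inner_nonneg_of_nonneg hP _
  have hsymm : vectorState ψ ((1 - S) * P * (1 - T)) = vectorState ψ ((1 - T) * P * (1 - S)) := by
    have e : (1 - S) * P * (1 - T) = star ((1 - T) * P * (1 - S)) := by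
      rw [star_mul, star_mul, hS'.star_eq, hT'.star_eq, hP.isSelfAdjoint.star_eq, mul_assoc]
    rw [e, vectorState_apply, ← inner_apply_eq_star, vectorState_apply, ← inner_conj_symm,
      Complex.conj_re]
  have e1 : (⟪P ψ, (T * S) ψ⟫_ℂ).re = vectorState ψ (P * (T * S)) := by
    rw [vectorState_apply, mul_apply_eq_comp P, inner_apply_of_isSelfAdjoint hP.isSelfAdjoint]
  have e2 : P * (T * S) = P - P * (1 - S) - P * (1 - T) + (1 - T) * P * (1 - S) := by
    have h : (1 - T) * P = P * (1 - T) :=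
      ((Commute.one_right P).sub_right hPT).eq.symm
    rw [h]
    noncomm_ring
  have e3 : ((1 - T) + (1 - S)) * P * ((1 - T) + (1 - S))
      = (1 - T) * P * (1 - T) + (1 - S) * P * (1 - S)
        + ((1 - T) * P * (1 - S) + (1 - S) * P * (1 - T)) := by noncomm_ring
  rw [e3, map_add, map_add, map_add, hsymm] at hpos
  rw [e1, e2, map_add, map_sub, map_sub]
  linarith [key S hS0 hS1 hPS, key T hT0 hT1 hPT]

theorem sum_norm_sub_mul_sq_le {α β : Type*} [Fintype α] [Fintype β] {ψ : H} (hψ : ‖ψ‖ = 1)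
    {P : α × β → H →L[ℂ] H} {S : α → H →L[ℂ] H} {T : β → H →L[ℂ] H}
    (hP0 : ∀ x, 0 ≤ P x) (hP1 : ∑ x, P x = 1) (hS0 : ∀ a, 0 ≤ S a) (hS1 : ∑ a, S a = 1)
    (hT0 : ∀ b, 0 ≤ T b) (hT1 : ∑ b, T b = 1)
    (hPS : ∀ x a, Commute (P x) (S a)) (hPT : ∀ x b, Commute (P x) (T b)) :
    ∑ x, ‖P x ψ - (T x.2 * S x.1) ψ‖ ^ 2 ≤ ∑ x, ‖P x ψ‖ ^ 2 - 1 +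
      3 * ∑ x, (vectorState ψ (P x * (1 - S x.1)) + vectorState ψ (P x * (1 - T x.2))) := by
  have h1 : ∑ x : α × β, ‖(T x.2 * S x.1) ψ‖ ^ 2 ≤ 1 := by
    rw [Fintype.sum_prod_type]
    calc _ ≤ ∑ a, ‖S a ψ‖ ^ 2 := Finset.sum_le_sum fun a _ => by
          simp only [mul_apply_eq_comp]
          exact sum_norm_sq_apply_le hT0 hT1 _
      _ ≤ ‖ψ‖ ^ 2 := sum_norm_sq_apply_le hS0 hS1 ψ
      _ = 1 := by rw [hψ]; norm_num
  have h3 := Finset.sum_le_sum fun (x : α × β) (_ : x ∈ Finset.univ) =>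
    vectorState_mul_mul_ge ψ (hP0 x) (hS0 x.1) (le_one_of_sum_eq_one hS0 hS1 _) (hT0 x.2)
      (le_one_of_sum_eq_one hT0 hT1 _) (hPS x x.1) (hPT x x.2)
  rw [Finset.sum_sub_distrib, sum_vectorState_eq_one hψ hP1, ← Finset.mul_sum] at h3
  calc _ = ∑ x, ‖P x ψ‖ ^ 2 + ∑ x : α × β, ‖(T x.2 * S x.1) ψ‖ ^ 2
        - 2 * ∑ x : α × β, (⟪P x ψ, (T x.2 * S x.1) ψ⟫_ℂ).re := by
        rw [Finset.mul_sum, ← Finset.sum_add_distrib, ← Finset.sum_sub_distrib]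
        exact Finset.sum_congr rfl fun x _ => norm_sub_sq_re _ _
    _ ≤ _ := by linarith

theorem sum_norm_sub_apply_sq_le {α : Type*} [Fintype α] {ψ : H} (hψ : ‖ψ‖ = 1)
    {P S : α → H →L[ℂ] H} (hP0 : ∀ a, 0 ≤ P a) (hP1 : ∑ a, P a = 1) (hS0 : ∀ a, 0 ≤ S a)
    (hS1 : ∑ a, S a = 1) :
    ∑ a, ‖P a ψ - S a ψ‖ ^ 2 ≤ 2 * ∑ a, vectorState ψ (P a * (1 - S a)) := by
  have h1 := sum_norm_sq_apply_le hP0 hP1 ψ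
  have h2 := sum_norm_sq_apply_le hS0 hS1 ψ
  rw [hψ, one_pow] at h1 h2
  have h3 : ∀ a, vectorState ψ (P a * (1 - S a))
      = vectorState ψ (P a) - (⟪P a ψ, S a ψ⟫_ℂ).re := fun a => by
    rw [mul_sub, mul_one, map_sub, vectorState_apply ψ (P a * S a), mul_apply_eq_comp,
      inner_apply_of_isSelfAdjoint (hP0 a).isSelfAdjoint]
  simp only [h3, norm_sub_sq_re]
  rw [Finset.sum_sub_distrib, Finset.sum_sub_distrib, Finset.sum_add_distrib,
    sum_vectorState_eq_one hψ hP1, ← Finset.mul_sum]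
  linarith

/-- The losing probability of commuting measurements `P`, `S`, `T` in the consistency test
subject to the winning condition `W`. -/
noncomputable def testLoss {α β : Type*} [Fintype α] [Fintype β] (ψ : H) (W : α → β → Prop)
    (P : α × β → H →L[ℂ] H) (S : α → H →L[ℂ] H) (T : β → H →L[ℂ] H) : ℝ :=
  1 - ∑ a, ∑ b, if W a b then
    (vectorState ψ (P (a, b) * S a) + vectorState ψ (P (a, b) * T b)) / 2 else 0

/-- Consequences of a small losing probability in the consistency test. -/
theorem testLoss_estimates {α β : Type*} [Fintype α] [Fintype β] {ψ : H} (hψ : ‖ψ‖ = 1)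
    {P : α × β → H →L[ℂ] H} {S : α → H →L[ℂ] H} {T : β → H →L[ℂ] H} (W : α → β → Prop)
    (hP0 : ∀ x, 0 ≤ P x) (hP1 : ∑ x, P x = 1) (hS0 : ∀ a, 0 ≤ S a) (hS1 : ∑ a, S a = 1)
    (hT0 : ∀ b, 0 ≤ T b) (hT1 : ∑ b, T b = 1)
    (hPS : ∀ x a, Commute (P x) (S a)) (hPT : ∀ x b, Commute (P x) (T b)) :
    0 ≤ testLoss ψ W P S T ∧ testLoss ψ W P S T ≤ 1 ∧
    (∑ x : α × β, if W x.1 x.2 then 0 else ‖P x ψ‖ ^ 2) ≤ testLoss ψ W P S T ∧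
    ∑ a, ‖(∑ b, P (a, b)) ψ - S a ψ‖ ^ 2 ≤ 4 * testLoss ψ W P S T ∧
    ∑ b, ‖(∑ a, P (a, b)) ψ - T b ψ‖ ^ 2 ≤ 4 * testLoss ψ W P S T ∧
    ∑ x, ‖P x ψ - (T x.2 * S x.1) ψ‖ ^ 2 ≤ 6 * testLoss ψ W P S T ∧
    ∑ x, ‖P x ψ - (S x.1 * T x.2) ψ‖ ^ 2 ≤ 6 * testLoss ψ W P S T ∧
    1 - 6 * testLoss ψ W P S T ≤ ∑ x, ‖P x ψ‖ ^ 2 ∧ ∑ x, ‖P x ψ‖ ^ 2 ≤ 1 := by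
  have hS := fun a => le_one_of_sum_eq_one hS0 hS1 a
  have hT := fun b => le_one_of_sum_eq_one hT0 hT1 b
  set p : α × β → ℝ := fun x => vectorState ψ (P x) with hp
  set s : α × β → ℝ := fun x => vectorState ψ (P x * (1 - S x.1)) with hs
  set t : α × β → ℝ := fun x => vectorState ψ (P x * (1 - T x.2)) with ht
  set l : α × β → ℝ := fun x => p x - if W x.1 x.2 then
    (vectorState ψ (P x * S x.1) + vectorState ψ (P x * T x.2)) / 2 else 0 with hl
  have hpsum : ∑ x, p x = 1 := sum_vectorState_eq_one hψ hP1
  have hlsum : ∑ x, l x = testLoss ψ W P S T := by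
    rw [hl, Finset.sum_sub_distrib, hpsum, testLoss, Fintype.sum_prod_type]
  have hPS0 : ∀ x a, 0 ≤ vectorState ψ (P x * S a) := fun x a =>
    vectorState_nonneg ψ (Commute.mul_nonneg (hP0 x) (hS0 a) (hPS x a))
  have hPT0 : ∀ x b, 0 ≤ vectorState ψ (P x * T b) := fun x b =>
    vectorState_nonneg ψ (Commute.mul_nonneg (hP0 x) (hT0 b) (hPT x b))
  have hs0 : ∀ x, 0 ≤ s x := fun x => vectorState_nonneg ψ (Commute.mul_nonneg (hP0 x)
    (sub_nonneg.2 (hS _)) ((Commute.one_right _).sub_right (hPS x _)))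
  have ht0 : ∀ x, 0 ≤ t x := fun x => vectorState_nonneg ψ (Commute.mul_nonneg (hP0 x)
    (sub_nonneg.2 (hT _)) ((Commute.one_right _).sub_right (hPT x _)))
  have hs1 : ∀ x, s x = p x - vectorState ψ (P x * S x.1) := fun x => by
    simp only [hs, hp]; rw [mul_sub, mul_one, map_sub]
  have ht1 : ∀ x, t x = p x - vectorState ψ (P x * T x.2) := fun x => by
    simp only [ht, hp]; rw [mul_sub, mul_one, map_sub]
  have hlW : ∀ x, W x.1 x.2 → l x = (s x + t x) / 2 := fun x h => by
    rw [hl, hs1, ht1]; simp only [h, if_true]; ring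
  have hlW' : ∀ x, ¬ W x.1 x.2 → l x = p x := fun x h => by
    rw [hl]; simp only [h, if_false, sub_zero]
  have hp0 : ∀ x, 0 ≤ p x := fun x => vectorState_nonneg ψ (hP0 x)
  have hst : ∀ x, 0 ≤ l x ∧ l x ≤ p x ∧ s x ≤ 2 * l x ∧ t x ≤ 2 * l x ∧ s x + t x ≤ 2 * l x := by
    intro x
    by_cases h : W x.1 x.2
    · rw [hlW x h]
      refine ⟨?_, ?_, ?_, ?_, ?_⟩ <;> linarith [hs0 x, ht0 x, hs1 x, ht1 x, hPS0 x x.1, hPT0 x x.2]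
    · rw [hlW' x h]
      refine ⟨?_, ?_, ?_, ?_, ?_⟩ <;>
        linarith [hs0 x, ht0 x, hs1 x, ht1 x, hPS0 x x.1, hPT0 x x.2, hp0 x]
  have hst4 : ∑ x, (s x + t x) ≤ 2 * testLoss ψ W P S T := by
    rw [← hlsum, Finset.mul_sum]
    exact Finset.sum_le_sum fun x _ => (hst x).2.2.2.2
  have h1 := sum_norm_sq_apply_le hP0 hP1 ψ
  rw [hψ, one_pow] at h1
  have hTS := sum_norm_sub_mul_sq_le hψ hP0 hP1 hS0 hS1 hT0 hT1 hPS hPT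
  have hST : ∑ x : α × β, ‖P x ψ - (S x.1 * T x.2) ψ‖ ^ 2
      ≤ ∑ x, ‖P x ψ‖ ^ 2 - 1 + 3 * ∑ x, (s x + t x) := by
    have := sum_norm_sub_mul_sq_le (P := fun y : β × α => P y.swap) hψ (fun x => hP0 _)
      (by rw [← hP1]; exact (Equiv.prodComm β α).sum_comp P) hT0 hT1 hS0 hS1 (fun x b => hPT _ b)
      (fun x a => hPS _ a)
    rw [← (Equiv.prodComm β α).sum_comp, ← (Equiv.prodComm β α).sum_comp,
      ← (Equiv.prodComm β α).sum_comp (fun x => s x + t x)]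
    refine this.trans_eq ?_
    congr 2
    exact Finset.sum_congr rfl fun x _ => add_comm _ _
  refine ⟨?_, ?_, ?_, ?_, ?_, ?_, ?_, ?_, h1⟩
  · rw [← hlsum]; exact Finset.sum_nonneg fun x _ => (hst x).1
  · rw [← hlsum, ← hpsum]; exact Finset.sum_le_sum fun x _ => (hst x).2.1
  · rw [← hlsum]
    refine Finset.sum_le_sum fun x _ => ?_
    split_ifs with h
    · exact (hst x).1
    · rw [hlW' x h]
      exact norm_sq_apply_le_vectorState ψ (hP0 x) (le_one_of_sum_eq_one hP0 hP1 x)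
  · have h := sum_norm_sub_apply_sq_le hψ (P := fun a => ∑ b, P (a, b))
      (fun a => Finset.sum_nonneg fun b _ => hP0 _)
      (by rw [← hP1, Fintype.sum_prod_type]) hS0 hS1
    have e : ∑ a, vectorState ψ ((∑ b, P (a, b)) * (1 - S a)) = ∑ x, s x := by
      rw [Fintype.sum_prod_type]
      simp only [Finset.sum_mul, map_sum, hs]
    have h' : ∑ x, s x ≤ ∑ x, 2 * l x := Finset.sum_le_sum fun x _ => (hst x).2.2.1
    rw [← Finset.mul_sum, hlsum] at h'
    linarith
  · have h := sum_norm_sub_apply_sq_le hψ (P := fun b => ∑ a, P (a, b))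
      (fun a => Finset.sum_nonneg fun b _ => hP0 _)
      (by rw [← hP1, Fintype.sum_prod_type_right]) hT0 hT1
    have e : ∑ b, vectorState ψ ((∑ a, P (a, b)) * (1 - T b)) = ∑ x, t x := by
      rw [Fintype.sum_prod_type_right]
      simp only [Finset.sum_mul, map_sum, ht]
    have h' : ∑ x, t x ≤ ∑ x, 2 * l x := Finset.sum_le_sum fun x _ => (hst x).2.2.2.1
    rw [← Finset.mul_sum, hlsum] at h'
    linarith
  · linarith
  · linarith
  · have : 0 ≤ ∑ x : α × β, ‖P x ψ - (T x.2 * S x.1) ψ‖ ^ 2 :=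
      Finset.sum_nonneg fun x _ => sq_nonneg _
    linarith

end VectorState

section ModularEstimate
variable {H : Type*} [NormedAddCommGroup H] [InnerProductSpace ℂ H] [CompleteSpace H]
  {𝓑 M : StarSubalgebra ℂ (H →L[ℂ] H)} {ψ : H} (md : ModularData 𝓑 M ψ)

theorem norm_apply_le_of_le_one {x : H →L[ℂ] H} (h0 : 0 ≤ x) (h1 : x ≤ 1) (v : H) :
    ‖x v‖ ≤ ‖v‖ := by
  refine (sq_le_sq₀ (norm_nonneg _) (norm_nonneg _)).1
    ((norm_sq_apply_le_vectorState v h0 h1).trans ?_)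
  have h2 := inner_le_of_le h1 v
  have h3 : (⟪v, (1 : H →L[ℂ] H) v⟫_ℂ).re = ‖v‖ ^ 2 := by
    rw [one_apply_eq_self, inner_self_eq_norm_sq_to_K]; norm_cast
  rw [vectorState_apply]
  linarith

namespace ModularData

theorem norm_C_le (v : H) : ‖md.C v‖ ≤ ‖v‖ := by
  have h1 : (⟪md.C v, md.C v⟫_ℂ).re = ‖md.C v‖ ^ 2 := by
    rw [inner_self_eq_norm_sq_to_K]; norm_cast
  have h0 : 0 ≤ md.A * md.A := by
    have := star_mul_self_nonneg md.A
    rwa [md.A_selfAdjoint.star_eq] at this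
  have h2 : md.A - md.A * md.A ≤ 1 := (sub_le_self _ h0).trans md.A_le_one
  have h3 := norm_apply_le_of_le_one md.A_sub_sq_nonneg h2 v
  rw [md.inner_C_C] at h1
  have h4 := (Complex.re_le_norm _).trans (norm_inner_le_norm (𝕜 := ℂ) ((md.A - md.A * md.A) v) v)
  refine (sq_le_sq₀ (norm_nonneg _) (norm_nonneg _)).1 ?_
  nlinarith [norm_nonneg v]

theorem norm_sub_two_smul_sq_le {x m : H →L[ℂ] H} (hx : x ∈ 𝓑) (hxs : IsSelfAdjoint x)
    (hm : m ∈ M) : ‖x ψ - (2 : ℂ) • md.A (x ψ)‖ ^ 2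
      ≤ 2 * ‖x ψ - m ψ‖ ^ 2 + 2 * ‖x ψ - star m ψ‖ ^ 2 := by
  have h1 := md.map_commutant m hm
  have h2 := md.map_algebra x hx
  rw [hxs.star_eq] at h2
  have e : x ψ - (2 : ℂ) • md.A (x ψ)
      = (1 - md.A) (x ψ - m ψ) - md.C (x ψ - star m ψ) := by
    rw [sub_apply, one_apply_eq_self, map_sub, map_sub, h2]
    linear_combination (norm := module) -h1
  have h3 := norm_sub_le ((1 - md.A) (x ψ - m ψ)) (md.C (x ψ - star m ψ))
  have h4 := norm_apply_le_of_le_one (sub_nonneg.2 md.A_le_one) (sub_le_self _ md.A_nonneg)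
    (x ψ - m ψ)
  have h5 := md.norm_C_le (x ψ - star m ψ)
  rw [← e] at h3
  calc _ ≤ (‖x ψ - m ψ‖ + ‖x ψ - star m ψ‖) ^ 2 :=
        pow_le_pow_left₀ (norm_nonneg _) (by linarith) 2
    _ ≤ _ := by nlinarith [sq_nonneg (‖x ψ - m ψ‖ - ‖x ψ - star m ψ‖)]

theorem one_sub_sum_norm_sq_le {α β : Type*} [Fintype α] [Fintype β] (hψ : ‖ψ‖ = 1)
    {P : α × β → H →L[ℂ] H} {S : α → H →L[ℂ] H} {T : β → H →L[ℂ] H} (W : α → β → Prop)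
    (hP0 : ∀ x, 0 ≤ P x) (hP1 : ∑ x, P x = 1) (hS0 : ∀ a, 0 ≤ S a) (hS1 : ∑ a, S a = 1)
    (hT0 : ∀ b, 0 ≤ T b) (hT1 : ∑ b, T b = 1)
    (hPS : ∀ x a, Commute (P x) (S a)) (hPT : ∀ x b, Commute (P x) (T b))
    (hPB : ∀ x, P x ∈ 𝓑) (hSM : ∀ a, S a ∈ M) (hTM : ∀ b, T b ∈ M) :
    1 - 16 * √(testLoss ψ W P S T) ≤
      ∑ x, (‖P x ψ‖ ^ 2 - 2 * (‖P x ψ‖ * ‖P x ψ - (2 : ℂ) • md.A (P x ψ)‖)) := by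
  obtain ⟨hl0, hl1, -, -, -, h6, h7, h8, h9⟩ :=
    testLoss_estimates hψ W hP0 hP1 hS0 hS1 hT0 hT1 hPS hPT
  have hA : ∑ x, ‖P x ψ - (2 : ℂ) • md.A (P x ψ)‖ ^ 2 ≤ 24 * testLoss ψ W P S T := by
    calc _ ≤ ∑ x : α × β, (2 * ‖P x ψ - (T x.2 * S x.1) ψ‖ ^ 2
            + 2 * ‖P x ψ - (S x.1 * T x.2) ψ‖ ^ 2) := Finset.sum_le_sum fun x _ => by
          have := md.norm_sub_two_smul_sq_le (hPB x) (hP0 x).isSelfAdjoint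
            (mul_mem (hTM x.2) (hSM x.1))
          rwa [star_mul, (hS0 _).isSelfAdjoint.star_eq, (hT0 _).isSelfAdjoint.star_eq] at this
      _ ≤ _ := by rw [Finset.sum_add_distrib, ← Finset.mul_sum, ← Finset.mul_sum]; linarith
  have hcs := Real.sum_mul_le_sqrt_mul_sqrt Finset.univ (fun x => ‖P x ψ‖)
    (fun x => ‖P x ψ - (2 : ℂ) • md.A (P x ψ)‖)
  have h10 : √(∑ x, ‖P x ψ‖ ^ 2) ≤ 1 := Real.sqrt_le_one.2 h9
  have h11 : √(∑ x, ‖P x ψ - (2 : ℂ) • md.A (P x ψ)‖ ^ 2) ≤ 5 * √(testLoss ψ W P S T) := by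
    rw [show (5 : ℝ) = √25 by rw [show (25 : ℝ) = 5 ^ 2 by norm_num]; simp,
      ← Real.sqrt_mul (by norm_num)]
    exact Real.sqrt_le_sqrt (by linarith)
  have h12 : testLoss ψ W P S T ≤ √(testLoss ψ W P S T) := Real.le_sqrt_of_sq_le (by nlinarith)
  have h13 : √(∑ x, ‖P x ψ‖ ^ 2) * √(∑ x, ‖P x ψ - (2 : ℂ) • md.A (P x ψ)‖ ^ 2)
      ≤ 1 * (5 * √(testLoss ψ W P S T)) := by gcongr
  rw [Finset.sum_sub_distrib, ← Finset.mul_sum]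
  linarith

end ModularData

end ModularEstimate

section TracialEstimate
variable {H : Type*} [NormedAddCommGroup H] [InnerProductSpace ℂ H] [CompleteSpace H]
  {R : Set (H →L[ℂ] H)} {ξ : H}

theorem vectorState_proj_mul_nonneg
    (htr : ∀ x y : H →L[ℂ] H, (∀ c ∈ R, Commute c x) → (∀ c ∈ R, Commute c y) →
      ⟪ξ, (x * y) ξ⟫_ℂ = ⟪ξ, (y * x) ξ⟫_ℂ) {r g : H →L[ℂ] H} (hr : IsStarProjection r)
    (hrR : ∀ c ∈ R, Commute c r) (hg : 0 ≤ g) (hgR : ∀ c ∈ R, Commute c g) :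
    0 ≤ vectorState ξ (r * g) := by
  have h := htr r (r * g) hrR fun c hc => (hrR c hc).mul_right (hgR c hc)
  rw [← mul_assoc, hr.isIdempotentElem.eq] at h
  rw [vectorState_apply, h, mul_assoc, mul_apply_eq_comp, ← hr.isSelfAdjoint.star_eq,
    ← inner_apply_eq_star, hr.isSelfAdjoint.star_eq, mul_apply_eq_comp]
  exact inner_nonneg_of_nonneg hg _

theorem inner_apply_apply_re {x y : H →L[ℂ] H} (hx : IsSelfAdjoint x) (ξ : H) :
    (⟪x ξ, y ξ⟫_ℂ).re = vectorState ξ (x * y) := by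
  rw [vectorState_apply, mul_apply_eq_comp, inner_apply_of_isSelfAdjoint hx]

theorem sum_proj {α : Type*} [Fintype α] {r : α → H →L[ℂ] H} (hr : ∀ a, IsStarProjection (r a))
    (hr1 : ∑ a, r a = 1) (hξ : ‖ξ‖ = 1) : ∑ a, ‖r a ξ‖ ^ 2 = 1 := by
  rw [← sum_vectorState_eq_one hξ hr1]
  exact Finset.sum_congr rfl fun a _ => norm_sq_proj (hr a) ξ

/-- Coarse graining does not spoil the approximation of a measurement by a projective one. -/
theorem sum_norm_marginal_sub_sq_le {α β : Type*} [Fintype α] [Fintype β] (hξ : ‖ξ‖ = 1)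
    (htr : ∀ x y : H →L[ℂ] H, (∀ c ∈ R, Commute c x) → (∀ c ∈ R, Commute c y) →
      ⟪ξ, (x * y) ξ⟫_ℂ = ⟪ξ, (y * x) ξ⟫_ℂ) {r g : α × β → H →L[ℂ] H}
    (hr : ∀ x, IsStarProjection (r x)) (hrR : ∀ x, ∀ c ∈ R, Commute c (r x)) (hr1 : ∑ x, r x = 1)
    (hg0 : ∀ x, 0 ≤ g x) (hgR : ∀ x, ∀ c ∈ R, Commute c (g x)) (hg1 : ∑ x, g x = 1) :
    ∑ a, ‖(∑ b, r (a, b)) ξ - (∑ b, g (a, b)) ξ‖ ^ 2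
      ≤ ∑ x, ‖(r x - g x) ξ‖ ^ 2 + (1 - ∑ x, ‖g x ξ‖ ^ 2) := by
  have e1 : ∀ x, ‖(r x - g x) ξ‖ ^ 2
      = ‖r x ξ‖ ^ 2 + ‖g x ξ‖ ^ 2 - 2 * vectorState ξ (r x * g x) := fun x => by
    rw [sub_apply, norm_sub_sq_re, inner_apply_apply_re (hr x).isSelfAdjoint]
  have hr1' : ∑ a, ∑ b, r (a, b) = 1 := by rw [← hr1, Fintype.sum_prod_type]
  have hg1' : ∑ a, ∑ b, g (a, b) = 1 := by rw [← hg1, Fintype.sum_prod_type]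
  have hr0 : ∀ a, 0 ≤ ∑ b, r (a, b) := fun a => Finset.sum_nonneg fun b _ => (hr _).nonneg
  have h2 : ∑ a, ‖(∑ b, r (a, b)) ξ‖ ^ 2 ≤ 1 := by
    simpa [hξ] using sum_norm_sq_apply_le hr0 hr1' ξ
  have h3 : ∑ a, ‖(∑ b, g (a, b)) ξ‖ ^ 2 ≤ 1 := by
    simpa [hξ] using sum_norm_sq_apply_le (fun a => Finset.sum_nonneg fun b _ => hg0 _) hg1' ξ
  have h4 : ∑ x, vectorState ξ (r x * g x)
      ≤ ∑ a, vectorState ξ ((∑ b, r (a, b)) * ∑ b, g (a, b)) := by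
    rw [Fintype.sum_prod_type]
    refine Finset.sum_le_sum fun a _ => ?_
    rw [Finset.sum_mul, map_sum]
    refine Finset.sum_le_sum fun b _ => ?_
    rw [Finset.mul_sum, map_sum]
    exact Finset.single_le_sum (f := fun b' => vectorState ξ (r (a, b) * g (a, b')))
      (fun b' _ => vectorState_proj_mul_nonneg htr (hr _) (hrR _) (hg0 _) (hgR _))
      (Finset.mem_univ b)
  simp only [e1, norm_sub_sq_re, inner_apply_apply_re (hr0 _).isSelfAdjoint]
  rw [Finset.sum_sub_distrib, Finset.sum_sub_distrib, Finset.sum_add_distrib,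
    Finset.sum_add_distrib, sum_proj hr hr1 hξ, ← Finset.mul_sum, ← Finset.mul_sum]
  linarith

theorem sum_norm_marginal_sub_sq_le' {α β : Type*} [Fintype α] [Fintype β] (hξ : ‖ξ‖ = 1)
    (htr : ∀ x y : H →L[ℂ] H, (∀ c ∈ R, Commute c x) → (∀ c ∈ R, Commute c y) →
      ⟪ξ, (x * y) ξ⟫_ℂ = ⟪ξ, (y * x) ξ⟫_ℂ) {r g : α × β → H →L[ℂ] H}
    (hr : ∀ x, IsStarProjection (r x)) (hrR : ∀ x, ∀ c ∈ R, Commute c (r x)) (hr1 : ∑ x, r x = 1)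
    (hg0 : ∀ x, 0 ≤ g x) (hgR : ∀ x, ∀ c ∈ R, Commute c (g x)) (hg1 : ∑ x, g x = 1) :
    ∑ b, ‖(∑ a, r (a, b)) ξ - (∑ a, g (a, b)) ξ‖ ^ 2
      ≤ ∑ x, ‖(r x - g x) ξ‖ ^ 2 + (1 - ∑ x, ‖g x ξ‖ ^ 2) := by
  have := sum_norm_marginal_sub_sq_le (r := fun y : β × α => r y.swap)
    (g := fun y : β × α => g y.swap) hξ htr (fun x => hr _) (fun x => hrR _)
    (((Equiv.prodComm β α).sum_comp r).trans hr1) (fun x => hg0 _) (fun x => hgR _)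
    (((Equiv.prodComm β α).sum_comp g).trans hg1)
  rwa [← (Equiv.prodComm β α).sum_comp, ← (Equiv.prodComm β α).sum_comp (fun x => ‖g x ξ‖ ^ 2)]

theorem mul_eq_zero_of_sum_eq_one {α : Type*} [Fintype α] {r : α → H →L[ℂ] H}
    (hr : ∀ a, IsStarProjection (r a)) (hr1 : ∑ a, r a = 1) {a b : α} (hab : a ≠ b) :
    r a * r b = 0 := by
  ext v
  have h1 : r b (r b v) = r b v := by
    rw [← mul_apply_eq_comp, (hr b).isIdempotentElem.eq]
  have h2 : ∑ a, ‖r a (r b v)‖ ^ 2 = ‖r b v‖ ^ 2 := by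
    have : ∀ a, ‖r a (r b v)‖ ^ 2 = vectorState (r b v) (r a) := fun a => norm_sq_proj (hr a) _
    simp only [this]
    rw [← map_sum, hr1, vectorState_apply, one_apply_eq_self, inner_self_eq_norm_sq_to_K]
    norm_cast
  have h3 : ‖r a (r b v)‖ ^ 2 + ‖r b (r b v)‖ ^ 2 ≤ ∑ a, ‖r a (r b v)‖ ^ 2 := by
    rw [← Finset.sum_pair (f := fun a => ‖r a (r b v)‖ ^ 2) hab]
    exact Finset.sum_le_sum_of_subset_of_nonneg (Finset.subset_univ _) fun _ _ _ => sq_nonneg _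
  rw [h1, h2] at h3
  have h4 : ‖r a (r b v)‖ ^ 2 = 0 := le_antisymm (by linarith) (sq_nonneg _)
  simpa using h4

/-- Sums of distinct members of a projective measurement are projections. -/
theorem isStarProjection_sum_of_sum_eq_one {α γ : Type*} [Fintype α] [Fintype γ]
    {r : α → H →L[ℂ] H} (hr : ∀ a, IsStarProjection (r a)) (hr1 : ∑ a, r a = 1) {f : γ → α}
    (hf : Function.Injective f) : IsStarProjection (∑ c, r (f c)) := by
  refine ⟨?_, isSelfAdjoint_sum _ fun c _ => (hr _).isSelfAdjoint⟩
  rw [IsIdempotentElem, Finset.sum_mul]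
  refine Finset.sum_congr rfl fun c _ => ?_
  rw [Finset.mul_sum, Finset.sum_eq_single c
    (fun d _ hd => mul_eq_zero_of_sum_eq_one hr hr1 (hf.ne hd.symm)) (by simp)]
  exact (hr _).isIdempotentElem.eq

theorem sum_vectorState_marginal_mul {α β : Type*} [Fintype α] [Fintype β] (hξ : ‖ξ‖ = 1)
    {r : α × β → H →L[ℂ] H} {s : α → H →L[ℂ] H}
    (hr : ∀ a, IsStarProjection (∑ b, r (a, b))) (hr1 : ∑ x, r x = 1)
    (hs : ∀ a, IsStarProjection (s a)) (hs1 : ∑ a, s a = 1) :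
    ∑ a, ∑ b, vectorState ξ (r (a, b) * s a)
      = 1 - (∑ a, ‖(∑ b, r (a, b)) ξ - s a ξ‖ ^ 2) / 2 := by
  have h1 := sum_proj hr (by rw [← hr1, Fintype.sum_prod_type]) hξ
  have h2 := sum_proj hs hs1 hξ
  simp only [norm_sub_sq_re, inner_apply_apply_re (hr _).isSelfAdjoint]
  rw [Finset.sum_sub_distrib, Finset.sum_add_distrib, h1, h2, ← Finset.mul_sum]
  simp only [Finset.sum_mul, map_sum]
  ring

theorem testLoss_le_of_tracial {α β : Type*} [Fintype α] [Fintype β] (hξ : ‖ξ‖ = 1)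
    (htr : ∀ x y : H →L[ℂ] H, (∀ c ∈ R, Commute c x) → (∀ c ∈ R, Commute c y) →
      ⟪ξ, (x * y) ξ⟫_ℂ = ⟪ξ, (y * x) ξ⟫_ℂ) (W : α → β → Prop) {r : α × β → H →L[ℂ] H}
    {s : α → H →L[ℂ] H} {t : β → H →L[ℂ] H}
    (hr : ∀ x, IsStarProjection (r x)) (hrR : ∀ x, ∀ c ∈ R, Commute c (r x)) (hr1 : ∑ x, r x = 1)
    (hs : ∀ x, IsStarProjection (s x)) (hsR : ∀ x, ∀ c ∈ R, Commute c (s x)) (hs1 : ∑ x, s x = 1)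
    (ht : ∀ x, IsStarProjection (t x)) (htR : ∀ x, ∀ c ∈ R, Commute c (t x)) (ht1 : ∑ x, t x = 1) :
    testLoss ξ W r s t ≤ (∑ a, ‖(∑ b, r (a, b)) ξ - s a ξ‖ ^ 2) / 4
      + (∑ b, ‖(∑ a, r (a, b)) ξ - t b ξ‖ ^ 2) / 4
      + ∑ x : α × β, if W x.1 x.2 then 0 else ‖r x ξ‖ ^ 2 := by
  have h1 := sum_vectorState_marginal_mul hξ (r := r) (s := s)
    (fun a => isStarProjection_sum_of_sum_eq_one hr hr1 (Prod.mk_right_injective a)) hr1 hs hs1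
  have h2 := sum_vectorState_marginal_mul hξ (r := fun y : β × α => r y.swap) (s := t)
    (fun b => isStarProjection_sum_of_sum_eq_one hr hr1 (Prod.mk_left_injective b)) (((Equiv.prodComm β α).sum_comp r).trans hr1) ht ht1
  simp only [Prod.swap_prod_mk] at h2
  rw [Finset.sum_comm] at h2
  have key : ∀ p q : H →L[ℂ] H, IsStarProjection p → IsStarProjection q → (∀ c ∈ R, Commute c p) →
      (∀ c ∈ R, Commute c q) → vectorState ξ (p * q) ≤ ‖p ξ‖ ^ 2 := by
    intro p q hp hq hpR hqR
    have := vectorState_proj_mul_nonneg htr hp hpR hq.one_sub.nonneg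
      fun c hc => (Commute.one_right c).sub_right (hqR c hc)
    rw [mul_sub, mul_one, map_sub] at this
    rw [norm_sq_proj hp, ← vectorState_apply]
    linarith
  have h3 : ∑ a, ∑ b, (vectorState ξ (r (a, b) * s a) + vectorState ξ (r (a, b) * t b)) / 2
      ≤ ∑ a, ∑ b, ((if W a b then
          (vectorState ξ (r (a, b) * s a) + vectorState ξ (r (a, b) * t b)) / 2 else 0)
        + if W a b then 0 else ‖r (a, b) ξ‖ ^ 2) := by
    refine Finset.sum_le_sum fun a _ => Finset.sum_le_sum fun b _ => ?_
    split_ifs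
    · simp
    · linarith [key _ _ (hr (a, b)) (hs a) (hrR _) (hsR _),
        key _ _ (hr (a, b)) (ht b) (hrR _) (htR _)]
  simp only [Finset.sum_add_distrib, ← Finset.sum_div] at h3
  rw [h1, h2] at h3
  rw [testLoss, Fintype.sum_prod_type]
  linarith

end TracialEstimate

section TracialRounding

/-- Almost tracial measurements have nearby projective measurements in an exactly tracial model. -/
theorem exists_tracial_rounding.{u} {H : Type u} [NormedAddCommGroup H] [InnerProductSpace ℂ H]
    [CompleteSpace H] {𝓑 M : StarSubalgebra ℂ (H →L[ℂ] H)} {ψ : H} (hψ : ‖ψ‖ = 1)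
    (md : ModularData 𝓑 M ψ) (hM : ∀ y, y ∈ M ↔ ∀ x ∈ 𝓑, Commute x y)
    (hBd : Dense {v | ∃ x ∈ 𝓑, v = x ψ}) (hMd : Dense {v | ∃ m ∈ M, v = m ψ})
    {Θ : Type} {Ω : Θ → Type} [∀ q, Fintype (Ω q)] [∀ q, Nonempty (Ω q)]
    (x : ∀ q, Ω q → H →L[ℂ] H) (hx : ∀ q y, x q y ∈ 𝓑) (hx0 : ∀ q y, 0 ≤ x q y)
    (hx1 : ∀ q, ∑ y, x q y = 1) :
    ∃ (K : Type u) (_ : NormedAddCommGroup K) (_ : InnerProductSpace ℂ K) (_ : CompleteSpace K)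
      (ξ : K) (R : Set (K →L[ℂ] K)) (g r : ∀ q, Ω q → K →L[ℂ] K), ‖ξ‖ = 1 ∧
      (∀ c ∈ R, star c ∈ R) ∧
      (∀ a b : K →L[ℂ] K, (∀ c ∈ R, Commute c a) → (∀ c ∈ R, Commute c b) →
        ⟪ξ, (a * b) ξ⟫_ℂ = ⟪ξ, (b * a) ξ⟫_ℂ) ∧
      (∀ q y, 0 ≤ g q y) ∧ (∀ q y, ∀ c ∈ R, Commute c (g q y)) ∧ (∀ q, ∑ y, g q y = 1) ∧
      (∀ {γ γ' : Type} [Fintype γ] [Fintype γ'] (q q' : Θ) (f : γ → Ω q) (f' : γ' → Ω q'),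
        ‖(∑ z, g q (f z)) ξ - (∑ z, g q' (f' z)) ξ‖
          ≤ ‖(∑ z, x q (f z)) ψ - (∑ z, x q' (f' z)) ψ‖) ∧
      (∀ q, ∑ y, (‖x q y ψ‖ ^ 2 - 2 * (‖x q y ψ‖ * ‖x q y ψ - (2 : ℂ) • md.A (x q y ψ)‖))
        ≤ ∑ y, ‖g q y ξ‖ ^ 2) ∧
      (∀ q y, IsStarProjection (r q y)) ∧ (∀ q y, ∀ c ∈ R, Commute c (r q y)) ∧
      (∀ q, ∑ y, r q y = 1) ∧
      (∀ q, ∑ y, ‖(r q y - g q y) ξ‖ ^ 2 ≤ 108 * (1 - ∑ y, ‖g q y ξ‖ ^ 2)) ∧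
      (FiniteDimensional ℂ H → FiniteDimensional ℂ K) := by
  obtain ⟨K, hK, ξ, g, g', hξ, hg0, hg's, hgg', htr, hsum, ⟨T, hT, hgT⟩, hle, hfin⟩ :=
    md.exists_tracial_model hM hBd hMd (fun k : Σ q, Ω q => x k.1 k.2) (fun k => hx _ _)
      (fun k => hx0 _ _)
  have hR : ∀ c ∈ Set.range g', star c ∈ Set.range g' := by
    rintro _ ⟨k, rfl⟩
    exact ⟨k, (hg's k).star_eq.symm⟩
  have htr' : ∀ a b : K →L[ℂ] K, (∀ c ∈ Set.range g', Commute c a) →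
      (∀ c ∈ Set.range g', Commute c b) → ⟪ξ, (a * b) ξ⟫_ℂ = ⟪ξ, (b * a) ξ⟫_ℂ := fun a b ha hb =>
    htr a b (fun k => ha _ ⟨k, rfl⟩) (fun k => hb _ ⟨k, rfl⟩)
  have hgR : ∀ k, ∀ c ∈ Set.range g', Commute c (g k) := by
    rintro k _ ⟨l, rfl⟩
    exact (hgg' k l).symm
  have hg1 : ∀ q, ∑ y, g ⟨q, y⟩ = 1 := fun q => by
    have h := hsum (Finset.univ.map (Function.Embedding.sigmaMk q))
    simp only [Finset.sum_map, Function.Embedding.sigmaMk_apply] at h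
    exact h (hx1 q)
  rw [hψ] at hξ
  choose r hr1 hr2 hr3 hr4 using fun q => exists_rounding (Set.range g') hR ξ hξ htr'
    (fun y => g ⟨q, y⟩) (fun y => hg0 _) (fun y => hgR _) (hg1 q)
  refine ⟨K, inferInstance, inferInstance, hK, ξ, Set.range g', fun q y => g ⟨q, y⟩, r, hξ, hR, htr',
    fun q y => hg0 _, fun q y => hgR _, hg1, fun {γ γ'} _ _ q q' f f' => ?_,
    fun q => Finset.sum_le_sum fun y _ => hle ⟨q, y⟩, hr1, hr2, hr3, hr4, hfin⟩
  have h1 : K.subtype ((∑ z, g ⟨q, f z⟩) ξ - (∑ z, g ⟨q', f' z⟩) ξ)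
      = T ((∑ z, x q (f z)) ψ - (∑ z, x q' (f' z)) ψ) := by
    simp only [sum_apply, map_sub, map_sum, hgT]
  rw [K.coe_norm, ← Submodule.subtype_apply, h1]
  exact hT _

end TracialRounding

section NearTracial

theorem sum_norm_sub_sq_le_of_le {E α : Type*} [NormedAddCommGroup E] [Fintype α] {u v p q : α → E}
    {m d : ℝ} (hu : ∑ a, ‖u a - p a‖ ^ 2 ≤ d) (hm : ∑ a, ‖p a - q a‖ ^ 2 ≤ m)
    (hv : ∑ a, ‖v a - q a‖ ^ 2 ≤ d) : ∑ a, ‖u a - v a‖ ^ 2 ≤ 3 * (2 * d + m) := by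
  have h : ∀ a, ‖u a - v a‖ ^ 2
      ≤ 3 * (‖u a - p a‖ ^ 2 + ‖p a - q a‖ ^ 2 + ‖v a - q a‖ ^ 2) := fun a => by
    have h1 : ‖u a - v a‖ ≤ ‖u a - p a‖ + ‖p a - q a‖ + ‖v a - q a‖ := by
      have e : u a - v a = (u a - p a) + (p a - q a) - (v a - q a) := by abel
      rw [e]
      exact (norm_sub_le _ _).trans (by gcongr; exact norm_add_le _ _)
    have h2 := pow_le_pow_left₀ (norm_nonneg _) h1 2
    nlinarith [sq_nonneg (‖u a - p a‖ - ‖p a - q a‖), sq_nonneg (‖u a - p a‖ - ‖v a - q a‖),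
      sq_nonneg (‖p a - q a‖ - ‖v a - q a‖)]
  refine (Finset.sum_le_sum fun a _ => h a).trans ?_
  rw [← Finset.mul_sum, Finset.sum_add_distrib, Finset.sum_add_distrib]
  linarith

theorem sum_norm_sub_sq_le_of_common {E α : Type*} [SeminormedAddCommGroup E] [Fintype α]
    {p q s : α → E} {l l' : ℝ} (hp : ∑ a, ‖p a - s a‖ ^ 2 ≤ l) (hq : ∑ a, ‖q a - s a‖ ^ 2 ≤ l') :
    ∑ a, ‖p a - q a‖ ^ 2 ≤ 2 * (l + l') := by
  have h : ∀ a, ‖p a - q a‖ ^ 2 ≤ 2 * (‖p a - s a‖ ^ 2 + ‖q a - s a‖ ^ 2) := fun a => by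
    have h1 : ‖p a - q a‖ ≤ ‖p a - s a‖ + ‖q a - s a‖ := by
      rw [← sub_sub_sub_cancel_right (p a) (q a) (s a)]
      exact norm_sub_le _ _
    have h2 := pow_le_pow_left₀ (norm_nonneg _) h1 2
    nlinarith [sq_nonneg (‖p a - s a‖ - ‖q a - s a‖)]
  refine (Finset.sum_le_sum fun a _ => h a).trans ?_
  rw [← Finset.mul_sum, Finset.sum_add_distrib]
  linarith

/-- A commuting strategy for the consistency tests has a nearby projective tracial strategy. -/
theorem exists_near_tracial {I J : Type} [Finite I] [Finite J] [Nonempty I] [Nonempty J]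
    {A : I → Type} [∀ i, Fintype (A i)] [∀ i, Nonempty (A i)]
    {B : J → Type} [∀ j, Fintype (B j)] [∀ j, Nonempty (B j)] (V : ∀ i j, A i → B j → Prop)
    {H : Type} [NormedAddCommGroup H] [InnerProductSpace ℂ H] [CompleteSpace H]
    (P : ∀ q : I × J, (A q.1 × B q.2) → H →L[ℂ] H) (Q : ∀ k : I ⊕ J, OAns A B k → H →L[ℂ] H)
    (hP : ∀ q y, 0 ≤ P q y) (hP1 : ∀ q, ∑ y, P q y = 1)
    (hQ : ∀ k o, 0 ≤ Q k o) (hQ1 : ∀ k, ∑ o, Q k o = 1)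
    (hc : ∀ q y k o, Commute (P q y) (Q k o)) {ψ : H} (hψ : ‖ψ‖ = 1) :
    ∃ (K : Type) (_ : NormedAddCommGroup K) (_ : InnerProductSpace ℂ K) (_ : CompleteSpace K)
      (ξ : K) (R : Set (K →L[ℂ] K)) (r : ∀ q : I × J, (A q.1 × B q.2) → K →L[ℂ] K)
      (s : ∀ k : I ⊕ J, OAns A B k → K →L[ℂ] K), ‖ξ‖ = 1 ∧ (∀ c ∈ R, star c ∈ R) ∧
      (∀ a b : K →L[ℂ] K, (∀ c ∈ R, Commute c a) → (∀ c ∈ R, Commute c b) →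
        ⟪ξ, (a * b) ξ⟫_ℂ = ⟪ξ, (b * a) ξ⟫_ℂ) ∧
      (∀ q y, IsStarProjection (r q y)) ∧ (∀ q y, ∀ c ∈ R, Commute c (r q y)) ∧
      (∀ q, ∑ y, r q y = 1) ∧
      (∀ k o, IsStarProjection (s k o)) ∧ (∀ k o, ∀ c ∈ R, Commute c (s k o)) ∧
      (∀ k, ∑ o, s k o = 1) ∧
      (∀ i j, testLoss ξ (V i j) (r (i, j)) (s (.inl i)) (s (.inr j))
        ≤ 8714 * √(testLoss ψ (V i j) (P (i, j)) (Q (.inl i)) (Q (.inr j)))) ∧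
      (FiniteDimensional ℂ H → FiniteDimensional ℂ K) := by
  obtain ⟨E, _, _, _, 𝓑, M, ψ', P', Q', hψ', hM, hBd, hMd, hPB, hQM, hP0', hQ0', hP1', hQ1', hPQ,
    hfin⟩ := exists_cyclic_separating (P := fun k : Σ q : I × J, A q.1 × B q.2 => P k.1 k.2)
      (Q := fun k : Σ k, OAns A B k => Q k.1 k.2) (fun k => hP _ _) (fun k => hQ _ _)
      (fun k l => hc _ _ _ _) ψ
  rw [hψ] at hψ'
  obtain ⟨md⟩ := exists_modularData 𝓑 M ψ' fun x hx m hm => (hM m).1 hm x hx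
  have hP1'' : ∀ q, ∑ y, P' ⟨q, y⟩ = 1 := fun q => by
    have h := hP1' (Finset.univ.map (Function.Embedding.sigmaMk q))
    simp only [Finset.sum_map, Function.Embedding.sigmaMk_apply] at h
    exact h (hP1 q)
  have hQ1'' : ∀ k, ∑ o, Q' ⟨k, o⟩ = 1 := fun q => by
    have h := hQ1' (Finset.univ.map (Function.Embedding.sigmaMk q))
    simp only [Finset.sum_map, Function.Embedding.sigmaMk_apply] at h
    exact h (hQ1 q)
  have hcPQ : ∀ k l, Commute (P' k) (Q' l) := fun k l => (hM _).1 (hQM l) _ (hPB k)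
  obtain ⟨K, _, _, _, ξ, R, g, r, hξ, hR, htr, hg0, hgR, hg1, hcontr, hle, hr, hrR, hr1, hround,
    hfin'⟩ := exists_tracial_rounding hψ' md hM hBd hMd (Ω := fun q : I × J => A q.1 × B q.2)
      (fun q y => P' ⟨q, y⟩) (fun q y => hPB _) (fun q y => hP0' _) hP1''
  obtain ⟨l, hl⟩ : ∃ l : I → J → ℝ, ∀ i j,
      l i j = testLoss ψ (V i j) (P (i, j)) (Q (.inl i)) (Q (.inr j)) := ⟨_, fun _ _ => rfl⟩
  have hl' : ∀ i j, l i j = testLoss ψ' (V i j) (fun y => P' ⟨(i, j), y⟩)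
      (fun a => Q' ⟨.inl i, a⟩) (fun b => Q' ⟨.inr j, b⟩) := fun i j => by
    simp only [hl, testLoss, vectorState_apply, hPQ]
  have hest := fun i j => testLoss_estimates hψ' (V i j) (P := fun y => P' ⟨(i, j), y⟩)
    (S := fun a => Q' ⟨.inl i, a⟩) (T := fun b => Q' ⟨.inr j, b⟩) (fun y => hP0' _)
    (hP1'' (i, j)) (fun a => hQ0' _) (hQ1'' (.inl i)) (fun b => hQ0' _) (hQ1'' (.inr j))
    (fun y a => hcPQ _ _) (fun y b => hcPQ _ _)
  simp only [← hl'] at hest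
  have hδ : ∀ i j, 1 - ∑ y, ‖g (i, j) y ξ‖ ^ 2 ≤ 16 * √(l i j) := fun i j => by
    have h1 := md.one_sub_sum_norm_sq_le hψ' (V i j) (P := fun y => P' ⟨(i, j), y⟩)
      (S := fun a => Q' ⟨.inl i, a⟩) (T := fun b => Q' ⟨.inr j, b⟩) (fun y => hP0' _)
      (hP1'' (i, j)) (fun a => hQ0' _) (hQ1'' (.inl i)) (fun b => hQ0' _) (hQ1'' (.inr j))
      (fun y a => hcPQ _ _) (fun y b => hcPQ _ _) (fun y => hPB _) (fun a => hQM _) (fun b => hQM _)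
    rw [← hl'] at h1
    linarith [hle (i, j)]
  choose jm hjm using fun i => Finite.exists_min (l i)
  choose im him using fun j => Finite.exists_min fun i => l i j
  have hmargA : ∀ i j, ∑ a, ‖(∑ b, r (i, j) (a, b)) ξ - (∑ b, g (i, j) (a, b)) ξ‖ ^ 2
      ≤ 1744 * √(l i j) := fun i j => by
    have h1 := sum_norm_marginal_sub_sq_le hξ htr (hr (i, j)) (hrR _) (hr1 _) (hg0 _) (hgR _)
      (hg1 _)
    linarith [hround (i, j), hδ i j]
  have hmargB : ∀ i j, ∑ b, ‖(∑ a, r (i, j) (a, b)) ξ - (∑ a, g (i, j) (a, b)) ξ‖ ^ 2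
      ≤ 1744 * √(l i j) := fun i j => by
    have h1 := sum_norm_marginal_sub_sq_le' hξ htr (hr (i, j)) (hrR _) (hr1 _) (hg0 _) (hgR _)
      (hg1 _)
    linarith [hround (i, j), hδ i j]
  have hle_sqrt : ∀ i j, l i j ≤ √(l i j) := fun i j =>
    Real.le_sqrt_of_sq_le (by nlinarith [(hest i j).1, (hest i j).2.1])
  have hDA : ∀ i j, ∑ a, ‖(∑ b, r (i, j) (a, b)) ξ - (∑ b, r (i, jm i) (a, b)) ξ‖ ^ 2
      ≤ 10512 * √(l i j) := fun i j => by
    have h1 := sum_norm_sub_sq_le_of_common (hest i j).2.2.2.1 (hest i (jm i)).2.2.2.1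
    have h2 : ∑ a, ‖(∑ b, g (i, j) (a, b)) ξ - (∑ b, g (i, jm i) (a, b)) ξ‖ ^ 2
        ≤ 2 * (4 * l i j + 4 * l i (jm i)) :=
      (Finset.sum_le_sum fun a _ => pow_le_pow_left₀ (norm_nonneg _)
        (hcontr (i, j) (i, jm i) (fun b => (a, b)) fun b => (a, b)) 2).trans h1
    have h3 := sum_norm_sub_sq_le_of_le (hmargA i j) h2 ((hmargA i (jm i)).trans
      (mul_le_mul_of_nonneg_left (Real.sqrt_le_sqrt (hjm i j)) (by norm_num)))
    linarith [hjm i j, hle_sqrt i j]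
  have hDB : ∀ i j, ∑ b, ‖(∑ a, r (i, j) (a, b)) ξ - (∑ a, r (im j, j) (a, b)) ξ‖ ^ 2
      ≤ 10512 * √(l i j) := fun i j => by
    have h1 := sum_norm_sub_sq_le_of_common (hest i j).2.2.2.2.1 (hest (im j) j).2.2.2.2.1
    have h2 : ∑ b, ‖(∑ a, g (i, j) (a, b)) ξ - (∑ a, g (im j, j) (a, b)) ξ‖ ^ 2
        ≤ 2 * (4 * l i j + 4 * l (im j) j) :=
      (Finset.sum_le_sum fun b _ => pow_le_pow_left₀ (norm_nonneg _)
        (hcontr (i, j) (im j, j) (fun a => (a, b)) fun a => (a, b)) 2).trans h1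
    have h3 := sum_norm_sub_sq_le_of_le (hmargB i j) h2 ((hmargB (im j) j).trans
      (mul_le_mul_of_nonneg_left (Real.sqrt_le_sqrt (him j i)) (by norm_num)))
    linarith [him j i, hle_sqrt i j]
  have hW : ∀ i j, (∑ y : A i × B j, if V i j y.1 y.2 then 0 else ‖r (i, j) y ξ‖ ^ 2)
      ≤ 3458 * √(l i j) := fun i j => by
    have h1 : ∀ y : A i × B j, (if V i j y.1 y.2 then 0 else ‖r (i, j) y ξ‖ ^ 2)
        ≤ 2 * ‖(r (i, j) y - g (i, j) y) ξ‖ ^ 2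
          + 2 * (if V i j y.1 y.2 then 0 else ‖P' ⟨(i, j), y⟩ ψ'‖ ^ 2) := fun y => by
      split_ifs
      · positivity
      · have h2 := hcontr (i, j) (i, j) (fun _ : Unit => y) (fun z : Empty => z.elim)
        simp only [Finset.univ_unique, Finset.sum_const, Finset.card_singleton, one_smul,
          Finset.univ_eq_empty, Finset.sum_empty, zero_apply, sub_zero] at h2
        have h3 : ‖r (i, j) y ξ‖ ≤ ‖(r (i, j) y - g (i, j) y) ξ‖ + ‖P' ⟨(i, j), y⟩ ψ'‖ := by
          have := norm_add_le ((r (i, j) y - g (i, j) y) ξ) (g (i, j) y ξ)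
          rw [sub_apply, sub_add_cancel] at this
          rw [sub_apply]
          linarith
        have h4 := pow_le_pow_left₀ (norm_nonneg _) h3 2
        nlinarith [sq_nonneg (‖(r (i, j) y - g (i, j) y) ξ‖ - ‖P' ⟨(i, j), y⟩ ψ'‖)]
    have h2 := Finset.sum_le_sum fun y (_ : y ∈ Finset.univ) => h1 y
    rw [Finset.sum_add_distrib, ← Finset.mul_sum, ← Finset.mul_sum] at h2
    linarith [hround (i, j), hδ i j, (hest i j).2.2.1, hle_sqrt i j]
  have hmA : ∀ i j a, IsStarProjection (∑ b, r (i, j) (a, b)) := fun i j a =>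
    isStarProjection_sum_of_sum_eq_one (hr (i, j)) (hr1 _) (Prod.mk_right_injective a)
  have hmB : ∀ i j b, IsStarProjection (∑ a, r (i, j) (a, b)) := fun i j b =>
    isStarProjection_sum_of_sum_eq_one (hr (i, j)) (hr1 _) (Prod.mk_left_injective b)
  obtain ⟨s, hsA, hsB⟩ : ∃ s : ∀ k : I ⊕ J, OAns A B k → K →L[ℂ] K,
      (∀ i, s (.inl i) = fun a => ∑ b, r (i, jm i) (a, b)) ∧
      (∀ j, s (.inr j) = fun b => ∑ a, r (im j, j) (a, b)) :=
    ⟨fun k => match k with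
      | .inl i => fun a => ∑ b, r (i, jm i) (a, b)
      | .inr j => fun b => ∑ a, r (im j, j) (a, b), fun _ => rfl, fun _ => rfl⟩
  have hs : ∀ k o, IsStarProjection (s k o) := by
    rintro (i | j) o
    · rw [hsA]; exact hmA _ _ _
    · rw [hsB]; exact hmB _ _ _
  have hsR : ∀ k o, ∀ c ∈ R, Commute c (s k o) := by
    rintro (i | j) o c hc
    · rw [hsA]; exact Commute.sum_right _ _ _ fun b _ => hrR _ _ c hc
    · rw [hsB]; exact Commute.sum_right _ _ _ fun b _ => hrR _ _ c hc
  have hs1 : ∀ k, ∑ o, s k o = 1 := by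
    rintro (i | j)
    · rw [hsA, ← hr1 (i, jm i), Fintype.sum_prod_type]; rfl
    · rw [hsB, ← hr1 (im j, j), Fintype.sum_prod_type_right]; rfl
  refine ⟨K, _, _, _, ξ, R, r, s, hξ, hR, htr, hr, hrR, hr1, hs, hsR, hs1, fun i j => ?_,
    fun h => hfin' (hfin h)⟩
  rw [← hl]
  have h1 := testLoss_le_of_tracial hξ htr (V i j) (hr (i, j)) (hrR (i, j)) (hr1 (i, j))
    (hs (.inl i)) (hsR (.inl i)) (hs1 (.inl i)) (hs (.inr j)) (hsR (.inr j)) (hs1 (.inr j))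
  have h2 := hDA i j
  have h3 := hDB i j
  rw [hsA, hsB] at h1
  rw [hsA, hsB]
  linarith [hW i j]

end NearTracial

section OracWin

theorem sum_mul_le_of_le_sqrt {I J : Type*} [Fintype I] [Fintype J] {μ l L : I → J → ℝ} {ε : ℝ}
    (hμ0 : ∀ i j, 0 ≤ μ i j) (hμ1 : ∑ i, ∑ j, μ i j = 1) (hl : ∀ i j, 0 ≤ l i j)
    (hL : ∀ i j, L i j ≤ 8714 * √(l i j)) (hL1 : ∑ i, ∑ j, μ i j * L i j ≤ 1)
    (hε : ∑ i, ∑ j, μ i j * l i j ≤ ε) :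
    ∑ i, ∑ j, μ i j * L i j ≤ 177 * ε ^ ((1 : ℝ) / 4) := by
  have hε0 : 0 ≤ ε := le_trans
    (Finset.sum_nonneg fun i _ => Finset.sum_nonneg fun j _ => mul_nonneg (hμ0 i j) (hl i j)) hε
  have hroot : ε ^ ((1 : ℝ) / 4) = √(√ε) := by
    rw [Real.sqrt_eq_rpow, Real.sqrt_eq_rpow, ← Real.rpow_mul hε0]; norm_num
  have hcs : ∑ x : I × J, μ x.1 x.2 * √(l x.1 x.2) ≤ √ε := by
    have h := Real.sum_mul_le_sqrt_mul_sqrt Finset.univ (fun x : I × J => √(μ x.1 x.2))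
      fun x => √(μ x.1 x.2 * l x.1 x.2)
    simp only [Real.sq_sqrt (hμ0 _ _), Real.sq_sqrt (mul_nonneg (hμ0 _ _) (hl _ _)),
      Fintype.sum_prod_type, hμ1, Real.sqrt_one, one_mul] at h
    rw [Fintype.sum_prod_type]
    refine le_trans (le_of_eq ?_) (h.trans (Real.sqrt_le_sqrt hε))
    refine Finset.sum_congr rfl fun i _ => Finset.sum_congr rfl fun j _ => ?_
    rw [Real.sqrt_mul (hμ0 i j), ← mul_assoc, Real.mul_self_sqrt (hμ0 i j)]
  have hle : ∑ i, ∑ j, μ i j * L i j ≤ 8714 * √ε := by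
    rw [Fintype.sum_prod_type] at hcs
    refine le_trans ?_ (mul_le_mul_of_nonneg_left hcs (by norm_num))
    simp only [Finset.mul_sum]
    refine Finset.sum_le_sum fun i _ => Finset.sum_le_sum fun j _ => ?_
    calc μ i j * L i j ≤ μ i j * (8714 * √(l i j)) := mul_le_mul_of_nonneg_left (hL i j) (hμ0 i j)
      _ = _ := by ring
  rw [hroot]
  rcases le_total (∑ i, ∑ j, μ i j * L i j) 0 with h0 | h0
  · exact h0.trans (by positivity)
  · refine abs_le_of_sq_le_sq' ?_ (by positivity) |>.2
    rw [mul_pow, Real.sq_sqrt (Real.sqrt_nonneg _)]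
    nlinarith [Real.sqrt_nonneg ε]

variable {I J : Type} [Fintype I] [Fintype J] {A : I → Type} [∀ i, Fintype (A i)] {B : J → Type}
  [∀ j, Fintype (B j)] {μ : I → J → ℝ} (V : ∀ i j, A i → B j → Prop)

theorem one_sub_oracWin_eq {H : Type*} [NormedAddCommGroup H] [InnerProductSpace ℂ H]
    [CompleteSpace H] (ψ : H) (hμ1 : ∑ i, ∑ j, μ i j = 1)
    (P : ∀ q : I × J, (A q.1 × B q.2) → H →L[ℂ] H) (Q : ∀ k : I ⊕ J, OAns A B k → H →L[ℂ] H)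
    {c : ∀ (q : I × J) (k : I ⊕ J), (A q.1 × B q.2) → OAns A B k → ℝ}
    (hc : ∀ q k ab o, c q k ab o = vectorState ψ (P q ab * Q k o)) :
    1 - oracWin μ V c = ∑ i, ∑ j, μ i j *
      testLoss ψ (V i j) (P (i, j)) (Q (.inl i)) (Q (.inr j)) := by
  simp only [testLoss, oracWin, mul_sub, mul_one, Finset.sum_sub_distrib, hμ1]
  congr 1
  refine Finset.sum_congr rfl fun i _ => Finset.sum_congr rfl fun j _ => ?_
  rw [div_mul_eq_mul_div, mul_div_assoc]
  congr 1
  simp only [Finset.sum_div]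
  refine Finset.sum_congr rfl fun a _ => Finset.sum_congr rfl fun b _ => ?_
  split_ifs
  · exact congrArg₂ (fun x y => (x + y) / 2) (hc (i, j) (.inl i) (a, b) a)
      (hc (i, j) (.inr j) (a, b) b)
  · exact zero_div _

theorem oracWin_nonneg (hμ0 : ∀ i j, 0 ≤ μ i j)
    {c : ∀ (q : I × J) (k : I ⊕ J), (A q.1 × B q.2) → OAns A B k → ℝ}
    (hc : ∀ q k ab o, 0 ≤ c q k ab o) : 0 ≤ oracWin μ V c := by
  refine Finset.sum_nonneg fun i _ => Finset.sum_nonneg fun j _ =>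
    mul_nonneg (div_nonneg (hμ0 i j) zero_le_two) (Finset.sum_nonneg fun a _ =>
      Finset.sum_nonneg fun b _ => ?_)
  split_ifs
  · exact add_nonneg (hc _ _ _ _) (hc _ _ _ _)
  · exact le_rfl

/-- An almost perfect commuting operator strategy for the oracularisation is close to a tracial
one; the latter is finite-dimensional when the former is. -/
theorem exists_tracial_correlation [Nonempty I] [Nonempty J] [∀ i, Nonempty (A i)]
    [∀ j, Nonempty (B j)] (hμ0 : ∀ i j, 0 ≤ μ i j)
    (hμ1 : ∑ i, ∑ j, μ i j = 1)
    {H : Type} [NormedAddCommGroup H] [InnerProductSpace ℂ H] [CompleteSpace H]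
    {P : ∀ q : I × J, (A q.1 × B q.2) → H →L[ℂ] H} {Q : ∀ k : I ⊕ J, OAns A B k → H →L[ℂ] H}
    (hP : ∀ q ab, 0 ≤ P q ab) (hP1 : ∀ q, ∑ ab, P q ab = 1)
    (hQ : ∀ k o, 0 ≤ Q k o) (hQ1 : ∀ k, ∑ o, Q k o = 1)
    (hcomm : ∀ q ab k o, Commute (P q ab) (Q k o)) {ψ : H} (hψ : ‖ψ‖ = 1)
    {c : ∀ (q : I × J) (k : I ⊕ J), (A q.1 × B q.2) → OAns A B k → ℝ}
    (hc : ∀ q k ab o, (c q k ab o : ℂ) = ⟪ψ, (P q ab * Q k o) ψ⟫_ℂ) {ε : ℝ}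
    (hw : 1 - ε ≤ oracWin μ V c) :
    ∃ (K : Type) (_ : NormedAddCommGroup K) (_ : InnerProductSpace ℂ K)
      (_ : CompleteSpace K) (ξ : K)
      (r : ∀ q : I × J, (A q.1 × B q.2) → K →L[ℂ] K) (s : ∀ k : I ⊕ J, OAns A B k → K →L[ℂ] K)
      (c' : ∀ (q : I × J) (k : I ⊕ J), (A q.1 × B q.2) → OAns A B k → ℝ),
      ‖ξ‖ = 1 ∧ (∀ q ab, IsStarProjection (r q ab)) ∧ (∀ q, ∑ ab, r q ab = 1) ∧
      (∀ k o, IsStarProjection (s k o)) ∧ (∀ k, ∑ o, s k o = 1) ∧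
      (∀ x y : K →L[ℂ] K,
        x ∈ StarAlgebra.adjoin ℂ ({T | ∃ q ab, T = r q ab} ∪ {T | ∃ k o, T = s k o}) →
        y ∈ StarAlgebra.adjoin ℂ ({T | ∃ q ab, T = r q ab} ∪ {T | ∃ k o, T = s k o}) →
        ⟪ξ, (x * y) ξ⟫_ℂ = ⟪ξ, (y * x) ξ⟫_ℂ) ∧
      (∀ q k ab o, (c' q k ab o : ℂ) = ⟪ξ, (r q ab * s k o) ξ⟫_ℂ) ∧
      1 - 177 * ε ^ ((1 : ℝ) / 4) ≤ oracWin μ V c' ∧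
      (FiniteDimensional ℂ H → FiniteDimensional ℂ K) := by
  obtain ⟨K, _, _, _, ξ, R, r, s, hξ, hR, htr, hr, hrR, hr1, hs, hsR, hs1, hloss, hfin⟩ :=
    exists_near_tracial V P Q hP hP1 hQ hQ1 hcomm hψ
  have hadj : StarAlgebra.adjoin ℂ ({T | ∃ q ab, T = r q ab} ∪ {T | ∃ k o, T = s k o})
      ≤ StarSubalgebra.centralizer ℂ R := by
    refine StarAlgebra.adjoin_le ?_
    rintro T (⟨q, ab, rfl⟩ | ⟨k, o, rfl⟩)
    · exact (mem_centralizer_iff_commute hR).2 (hrR q ab)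
    · exact (mem_centralizer_iff_commute hR).2 (hsR k o)
  have hest := fun i j => testLoss_estimates hψ (V i j) (hP (i, j)) (hP1 (i, j)) (hQ (.inl i))
    (hQ1 (.inl i)) (hQ (.inr j)) (hQ1 (.inr j)) (fun y a => hcomm (i, j) y (.inl i) a)
    (fun y b => hcomm (i, j) y (.inr j) b)
  have hcre : ∀ q k ab o, c q k ab o = vectorState ψ (P q ab * Q k o) := fun q k ab o => by
    rw [vectorState_apply, ← hc, Complex.ofReal_re]
  refine ⟨K, _, _, _, ξ, r, s, fun q k ab o => vectorState ξ (r q ab * s k o), hξ, hr, hr1, hs, hs1,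
    fun x y hx hy => htr x y ((mem_centralizer_iff_commute hR).1 (hadj hx))
      ((mem_centralizer_iff_commute hR).1 (hadj hy)), fun q k ab o => ?_, ?_, hfin⟩
  · refine Complex.conj_eq_iff_re.1 ?_
    rw [inner_conj_symm, inner_apply_eq_star, star_mul, (hr q ab).isSelfAdjoint.star_eq,
      (hs k o).isSelfAdjoint.star_eq]
    exact htr _ _ (hsR k o) (hrR q ab)
  · have h := one_sub_oracWin_eq V ξ hμ1 r s
      (c := fun q k ab o => vectorState ξ (r q ab * s k o)) fun _ _ _ _ => rfl
    have h0 := oracWin_nonneg V hμ0 (c := fun q k ab o => vectorState ξ (r q ab * s k o))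
      fun q k ab o => vectorState_proj_mul_nonneg htr (hr q ab) (hrR q ab) (hs k o).nonneg (hsR k o)
    have h' := one_sub_oracWin_eq V ψ hμ1 P Q hcre
    have := sum_mul_le_of_le_sqrt (ε := ε) hμ0 hμ1 (fun i j => (hest i j).1) hloss (by linarith)
      (by linarith)
    linarith

end OracWin

section MatrixModel
variable {n : Type*} [Fintype n] [DecidableEq n]

/-- Positive semidefinite matrices act as positive operators. -/
theorem toEuclideanCLM_nonneg {M : Matrix n n ℂ} (hM : M.PosSemidef) :
    0 ≤ Matrix.toEuclideanCLM (n := n) (𝕜 := ℂ) M := by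
  rw [ContinuousLinearMap.nonneg_iff_isPositive]
  exact (LinearMap.isPositive_toContinuousLinearMap_iff _).2
    (Matrix.isPositive_toEuclideanLin_iff.2 hM)

theorem inner_toEuclideanCLM_eq_dotProduct (M : Matrix n n ℂ) (v : EuclideanSpace ℂ n) :
    ⟪v, Matrix.toEuclideanCLM (n := n) (𝕜 := ℂ) M v⟫_ℂ = star v.ofLp ⬝ᵥ M *ᵥ v.ofLp := by
  rw [EuclideanSpace.inner_eq_star_dotProduct, Matrix.ofLp_toEuclideanCLM, dotProduct_comm]

theorem trace_vecMulVec_star_mul (v : EuclideanSpace ℂ n) (M : Matrix n n ℂ) :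
    (Matrix.vecMulVec v.ofLp (star v.ofLp) * M).trace
      = ⟪v, Matrix.toEuclideanCLM (n := n) (𝕜 := ℂ) M v⟫_ℂ := by
  rw [Matrix.trace_mul_comm, Matrix.mul_vecMulVec, Matrix.trace_vecMulVec, dotProduct_comm,
    inner_toEuclideanCLM_eq_dotProduct]

/-- A vector state on a finite-dimensional Hilbert space is a density matrix state. -/
theorem exists_matrix_model {K : Type*} [NormedAddCommGroup K] [InnerProductSpace ℂ K]
    [CompleteSpace K] [FiniteDimensional ℂ K] {ξ : K} (hξ : ‖ξ‖ = 1) :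
    ∃ (n : ℕ) (Φ : (K →L[ℂ] K) ≃⋆ₐ[ℂ] Matrix (Fin n) (Fin n) ℂ) (σ : Matrix (Fin n) (Fin n) ℂ),
      1 ≤ n ∧ σ.PosSemidef ∧ σ.trace = 1 ∧ ∀ x, (σ * Φ x).trace = ⟪ξ, x ξ⟫_ℂ := by
  set e := (stdOrthonormalBasis ℂ K).repr
  set Φ := e.conjStarAlgEquiv.trans Matrix.toEuclideanCLM.symm
  have hΦ : ∀ x, (Matrix.vecMulVec (e ξ).ofLp (star (e ξ).ofLp) * Φ x).trace = ⟪ξ, x ξ⟫_ℂ :=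
    fun x => by
      rw [trace_vecMulVec_star_mul]
      simp only [Φ, StarAlgEquiv.trans_apply, StarAlgEquiv.apply_symm_apply,
        LinearIsometryEquiv.conjStarAlgEquiv_apply_apply, LinearIsometryEquiv.symm_apply_apply,
        LinearIsometryEquiv.inner_map_map]
  have htr : (Matrix.vecMulVec (e ξ).ofLp (star (e ξ).ofLp)).trace = 1 := by
    have h := hΦ 1
    rw [map_one, mul_one, one_apply_eq_self, inner_self_eq_norm_sq_to_K, hξ] at h
    simpa using h
  have : Nontrivial K := ⟨ξ, 0, fun h => by simp [h] at hξ⟩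
  exact ⟨_, Φ, _, Module.finrank_pos, Matrix.posSemidef_vecMulVec_self_star _, htr, hΦ⟩

/-- The operators of a finite-dimensional tensor product strategy, as a commuting operator
strategy. -/
theorem exists_commuting_of_kronecker {X Y : Type*} {α : X → Type*} {β : Y → Type*}
    [∀ x, Fintype (α x)] [∀ y, Fintype (β y)] {a b : ℕ}
    {P : ∀ x, α x → Matrix (Fin a) (Fin a) ℂ} {Q : ∀ y, β y → Matrix (Fin b) (Fin b) ℂ}
    {φ : Fin a × Fin b → ℂ} (hP : ∀ x i, (P x i).PosSemidef) (hP1 : ∀ x, ∑ i, P x i = 1)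
    (hQ : ∀ y j, (Q y j).PosSemidef) (hQ1 : ∀ y, ∑ j, Q y j = 1) (hφ : star φ ⬝ᵥ φ = 1) :
    ∃ (P' : ∀ x, α x → EuclideanSpace ℂ (Fin a × Fin b) →L[ℂ] EuclideanSpace ℂ (Fin a × Fin b))
      (Q' : ∀ y, β y → EuclideanSpace ℂ (Fin a × Fin b) →L[ℂ] EuclideanSpace ℂ (Fin a × Fin b))
      (ψ : EuclideanSpace ℂ (Fin a × Fin b)), ‖ψ‖ = 1 ∧ (∀ x i, 0 ≤ P' x i) ∧
      (∀ x, ∑ i, P' x i = 1) ∧ (∀ y j, 0 ≤ Q' y j) ∧ (∀ y, ∑ j, Q' y j = 1) ∧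
      (∀ x i y j, Commute (P' x i) (Q' y j)) ∧
      ∀ x i y j, ⟪ψ, (P' x i * Q' y j) ψ⟫_ℂ = star φ ⬝ᵥ ((P x i ⊗ₖ Q y j) *ᵥ φ) := by
  set Φ := Matrix.toEuclideanCLM (n := Fin a × Fin b) (𝕜 := ℂ)
  have hmul : ∀ x i y j, Φ (P x i ⊗ₖ 1) * Φ (1 ⊗ₖ Q y j) = Φ (P x i ⊗ₖ Q y j) := fun x i y j => by
    rw [← map_mul, ← Matrix.mul_kronecker_mul, one_mul, mul_one]
  refine ⟨fun x i => Φ (P x i ⊗ₖ 1), fun y j => Φ (1 ⊗ₖ Q y j), WithLp.toLp 2 φ, ?_,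
    fun x i => toEuclideanCLM_nonneg ((hP x i).kronecker Matrix.PosSemidef.one), fun x => ?_,
    fun y j => toEuclideanCLM_nonneg (Matrix.PosSemidef.one.kronecker (hQ y j)), fun y => ?_,
    fun x i y j => ?_, fun x i y j => ?_⟩
  · have h := inner_toEuclideanCLM_eq_dotProduct (1 : Matrix (Fin a × Fin b) (Fin a × Fin b) ℂ)
      (WithLp.toLp 2 φ)
    rw [map_one, one_apply_eq_self, inner_self_eq_norm_sq_to_K, Matrix.one_mulVec, hφ] at h
    have h' : ‖(WithLp.toLp 2 φ : EuclideanSpace ℂ (Fin a × Fin b))‖ ^ 2 = 1 :=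
      Complex.ofReal_injective (by rw [Complex.ofReal_pow]; exact h)
    rwa [pow_eq_one_iff_of_nonneg (norm_nonneg _) two_ne_zero] at h'
  · rw [← map_sum, ← map_one Φ, ← Matrix.one_kronecker_one, ← hP1 x]
    congr 1
    ext i j
    simp [Matrix.sum_apply, Finset.sum_mul]
  · rw [← map_sum, ← map_one Φ, ← Matrix.one_kronecker_one, ← hQ1 y]
    congr 1
    ext i j
    simp [Matrix.sum_apply, Finset.mul_sum]
  · simp only [Commute, SemiconjBy]
    rw [hmul, ← map_mul, ← Matrix.mul_kronecker_mul, one_mul, mul_one]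
  · rw [hmul, inner_toEuclideanCLM_eq_dotProduct]

end MatrixModel

end TracialRounding

/-- If `c` is a commuting operator correlation for the oracularisation
`G^orac` with `w(c) ≥ 1 - ε`, then there is a tracial correlation `c'` for `G^orac`
with `w(c') ≥ 1 - 177 ε^{1/4}`; and if moreover `c` is a quantum correlation, then `c'`
can be chosen finite-dimensional. -/
theorem oracularisation_almost_perfect_strategy_near_tracial
    {I J : Type} [Fintype I] [Fintype J] [Nonempty I] [Nonempty J]
    {A : I → Type} [∀ i, Fintype (A i)] [∀ i, Nonempty (A i)]
    {B : J → Type} [∀ j, Fintype (B j)] [∀ j, Nonempty (B j)]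
    (μ : I → J → ℝ) (hμ0 : ∀ i j, 0 ≤ μ i j) (hμ1 : ∑ i, ∑ j, μ i j = 1)
    (V : ∀ i j, A i → B j → Prop)
    -- `c` is a commuting operator correlation for `G^orac`
    {H : Type} [NormedAddCommGroup H] [InnerProductSpace ℂ H] [CompleteSpace H]
    (P : ∀ q : I × J, (A q.1 × B q.2) → H →L[ℂ] H)
    (Q : ∀ k : I ⊕ J, OAns A B k → H →L[ℂ] H)
    (hP : ∀ q ab, (P q ab).IsPositive) (hPsum : ∀ q, ∑ ab, P q ab = 1)
    (hQ : ∀ k o, (Q k o).IsPositive) (hQsum : ∀ k, ∑ o, Q k o = 1)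
    (hcomm : ∀ q k ab o, P q ab * Q k o = Q k o * P q ab)
    (ψ : H) (hψ : ‖ψ‖ = 1)
    (c : ∀ (q : I × J) (k : I ⊕ J), (A q.1 × B q.2) → OAns A B k → ℝ)
    (hc : ∀ q k ab o, (c q k ab o : ℂ) = @inner ℂ H _ ψ ((P q ab * Q k o) ψ))
    (ε : ℝ)
    (hw : 1 - ε ≤ oracWin μ V c) :
    -- there is a tracial correlation `c'` winning with probability `≥ 1 - 177 ε^{1/4}`
    (∃ (K : Type) (_ : NormedAddCommGroup K) (_ : InnerProductSpace ℂ K)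
      (_ : CompleteSpace K) (ξ : K)
      (r : ∀ q : I × J, (A q.1 × B q.2) → K →L[ℂ] K)
      (s : ∀ k : I ⊕ J, OAns A B k → K →L[ℂ] K)
      (c' : ∀ (q : I × J) (k : I ⊕ J), (A q.1 × B q.2) → OAns A B k → ℝ),
      ‖ξ‖ = 1 ∧
      (∀ q ab, IsSelfAdjoint (r q ab) ∧ r q ab * r q ab = r q ab) ∧
      (∀ q, ∑ ab, r q ab = 1) ∧
      (∀ k o, IsSelfAdjoint (s k o) ∧ s k o * s k o = s k o) ∧
      (∀ k, ∑ o, s k o = 1) ∧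
      (∀ x y : K →L[ℂ] K,
        x ∈ StarAlgebra.adjoin ℂ
          ({T | ∃ q ab, T = r q ab} ∪ {T | ∃ k o, T = s k o}) →
        y ∈ StarAlgebra.adjoin ℂ
          ({T | ∃ q ab, T = r q ab} ∪ {T | ∃ k o, T = s k o}) →
        @inner ℂ K _ ξ ((x * y) ξ) = @inner ℂ K _ ξ ((y * x) ξ)) ∧
      (∀ q k ab o, (c' q k ab o : ℂ) = @inner ℂ K _ ξ ((r q ab * s k o) ξ)) ∧
      1 - 177 * ε ^ ((1 : ℝ)/4) ≤ oracWin μ V c') ∧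
    -- if moreover `c` is a quantum correlation, `c'` can be chosen finite-dimensional
    ((∃ (dA dB : ℕ)
        (Pm : ∀ q : I × J, (A q.1 × B q.2) → Matrix (Fin dA) (Fin dA) ℂ)
        (Qm : ∀ k : I ⊕ J, OAns A B k → Matrix (Fin dB) (Fin dB) ℂ)
        (φ : Fin dA × Fin dB → ℂ),
        (∀ q ab, (Pm q ab).PosSemidef) ∧ (∀ q, ∑ ab, Pm q ab = 1) ∧
        (∀ k o, (Qm k o).PosSemidef) ∧ (∀ k, ∑ o, Qm k o = 1) ∧
        star φ ⬝ᵥ φ = 1 ∧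
        (∀ q k ab o, (c q k ab o : ℂ) = star φ ⬝ᵥ ((Pm q ab ⊗ₖ Qm k o) *ᵥ φ))) →
      ∃ (n : ℕ) (r : ∀ q : I × J, (A q.1 × B q.2) → Matrix (Fin n) (Fin n) ℂ)
        (s : ∀ k : I ⊕ J, OAns A B k → Matrix (Fin n) (Fin n) ℂ)
        (σ : Matrix (Fin n) (Fin n) ℂ)
        (c' : ∀ (q : I × J) (k : I ⊕ J), (A q.1 × B q.2) → OAns A B k → ℝ),
        1 ≤ n ∧
        (∀ q ab, (r q ab).IsHermitian ∧ r q ab * r q ab = r q ab) ∧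
        (∀ q, ∑ ab, r q ab = 1) ∧
        (∀ k o, (s k o).IsHermitian ∧ s k o * s k o = s k o) ∧
        (∀ k, ∑ o, s k o = 1) ∧
        σ.PosSemidef ∧ σ.trace = 1 ∧
        (∀ x y : Matrix (Fin n) (Fin n) ℂ,
          x ∈ StarAlgebra.adjoin ℂ
            ({M | ∃ q ab, M = r q ab} ∪ {M | ∃ k o, M = s k o}) →
          y ∈ StarAlgebra.adjoin ℂ
            ({M | ∃ q ab, M = r q ab} ∪ {M | ∃ k o, M = s k o}) →
          (σ * (x * y)).trace = (σ * (y * x)).trace) ∧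
        (∀ q k ab o, (c' q k ab o : ℂ) = (σ * (r q ab * s k o)).trace) ∧
        1 - 177 * ε ^ ((1 : ℝ)/4) ≤ oracWin μ V c') := by
  refine ⟨?_, ?_⟩
  · obtain ⟨K, _, _, _, ξ, r, s, c', hξ, hr, hr1, hs, hs1, htr, hc', hwin, -⟩ :=
      exists_tracial_correlation V hμ0 hμ1
        (fun q ab => (ContinuousLinearMap.nonneg_iff_isPositive _).2 (hP q ab)) hPsum
        (fun k o => (ContinuousLinearMap.nonneg_iff_isPositive _).2 (hQ k o)) hQsum
        (fun q ab k o => hcomm q k ab o) hψ hc hw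
    exact ⟨K, _, _, _, ξ, r, s, c', hξ,
      fun q ab => ⟨(hr q ab).isSelfAdjoint, (hr q ab).isIdempotentElem⟩, hr1,
      fun k o => ⟨(hs k o).isSelfAdjoint, (hs k o).isIdempotentElem⟩, hs1, htr, hc', hwin⟩
  · rintro ⟨dA, dB, Pm, Qm, φ, hPm, hPm1, hQm, hQm1, hφ, hcm⟩
    obtain ⟨P', Q', ψ', hψ', hP', hP1', hQ', hQ1', hcomm', hc'⟩ :=
      exists_commuting_of_kronecker hPm hPm1 hQm hQm1 hφ
    obtain ⟨K, _, _, _, ξ, r, s, d, hξ, hr, hr1, hs, hs1, htr, hd, hwin, hfin⟩ :=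
      exists_tracial_correlation V hμ0 hμ1 hP' hP1' hQ' hQ1' hcomm' hψ'
        (fun q k ab o => (hcm q k ab o).trans (hc' q ab k o).symm) hw
    have := hfin inferInstance
    obtain ⟨n, Φ, σ, hn, hσ, hσ1, hΦ⟩ := exists_matrix_model hξ
    have hproj : ∀ p : K →L[ℂ] K, IsStarProjection p →
        (Φ p).IsHermitian ∧ Φ p * Φ p = Φ p := fun p hp =>
      ⟨hp.isSelfAdjoint.map Φ, by rw [← map_mul, hp.isIdempotentElem.eq]⟩
    have hadj : StarAlgebra.adjoin ℂ
          ({M | ∃ q ab, M = Φ (r q ab)} ∪ {M | ∃ k o, M = Φ (s k o)})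
        ≤ (StarAlgebra.adjoin ℂ ({T | ∃ q ab, T = r q ab} ∪ {T | ∃ k o, T = s k o})).comap
          (Φ.symm : Matrix (Fin n) (Fin n) ℂ →⋆ₐ[ℂ] K →L[ℂ] K) := by
      refine StarAlgebra.adjoin_le ?_
      rintro _ (⟨q, ab, rfl⟩ | ⟨k, o, rfl⟩) <;> refine StarAlgebra.subset_adjoin ℂ _ ?_
      · exact .inl ⟨q, ab, Φ.symm_apply_apply _⟩
      · exact .inr ⟨k, o, Φ.symm_apply_apply _⟩
    refine ⟨n, fun q ab => Φ (r q ab), fun k o => Φ (s k o), σ, d, hn, fun q ab => hproj _ (hr q ab),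
      fun q => by rw [← map_sum, hr1, map_one], fun k o => hproj _ (hs k o),
      fun k => by rw [← map_sum, hs1, map_one], hσ, hσ1, fun x y hx hy => ?_,
      fun q k ab o => by rw [← map_mul Φ, hΦ, hd], hwin⟩
    obtain ⟨x, rfl⟩ : ∃ z, Φ z = x := ⟨_, Φ.apply_symm_apply x⟩
    obtain ⟨y, rfl⟩ : ∃ z, Φ z = y := ⟨_, Φ.apply_symm_apply y⟩
    have hx' := hadj hx
    have hy' := hadj hy
    rw [StarSubalgebra.mem_comap] at hx' hy'
    rw [← map_mul Φ, ← map_mul Φ, hΦ, hΦ]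
    exact htr x y (by simpa using hx') (by simpa using hy')
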